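/- Let m be a nonnegative weak solution of the Fokker–Planck equation with drift A and initial datum m₀, and suppose E ≤ K and ‖m‖_{L^{p₀}(Q)} ≤ K for some K > 0, where p₀ ∈ (1, (N+2)/(N+2−γ')) if γ' < N+2 and p₀ ∈ (1,∞) if γ' ≥ N+2. Let r satisfy r ∈ (1, (N+2)/(N+3−γ')) if γ' < N+2, and r ∈ (1, γ') if γ' ≥ N+2. Then there exists C > 0, depending only on K, r, T, N, γ' and ‖∇m₀‖_{L^∞(T^N)}, such that: m ∈ L^r(Q) with ‖m‖_{L^r(Q)} ≤ C; m admits a weak spatial gradient ∇m ∈ L^r(Q;ℝ^N) with ‖∇m‖_{L^r(Q)} ≤ C; and |∫_Q m ∂_t φ dx dt| ≤ C ‖∇φ‖_{L^{r'}(Q)} for every smooth φ : T^N × [0,T] → ℝ with φ(·,0) = φ(·,T) = 0. Consequently ‖m‖_{L^p(Q)} ≤ C' for every p < (N+2)/(N+2−γ') if γ' < N+2, and for every p < ∞ if γ' ≥ N+2, with C' depending on the same quantities and on p. -/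

import Mathlib

open MeasureTheory Set Filter Topology

noncomputable section

/-- Points of `ℝ^N`.  `ℤ^N`-periodic functions on `RN N` model functions on the
flat torus `T^N`. -/
abbrev RN (N : ℕ) := Fin N → ℝ

/-- The Euclidean norm on `ℝ^N`. -/
def euclNorm {N : ℕ} (p : RN N) : ℝ := Real.sqrt (∑ i, p i ^ 2)

/-- The Euclidean inner product on `ℝ^N`. -/
def dotp {N : ℕ} (p q : RN N) : ℝ := ∑ i, p i * q i

/-- `ℤ^N`-periodicity: such functions are exactly the functions on the flat torus `T^N`. -/
def ZPeriodic {N : ℕ} {β : Type*} (u : RN N → β) : Prop :=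
  ∀ (x : RN N) (z : Fin N → ℤ), u (fun i => x i + (z i : ℝ)) = u x

/-- Partial derivative in the `i`-th coordinate direction. -/
def pd {N : ℕ} (i : Fin N) (u : RN N → ℝ) (x : RN N) : ℝ := fderiv ℝ u x (Pi.single i 1)

/-- Spatial gradient. -/
def grad {N : ℕ} (u : RN N → ℝ) (x : RN N) : RN N := fun i => pd i u x

/-- Divergence of a vector field. -/
def dive {N : ℕ} (w : RN N → RN N) (x : RN N) : ℝ := ∑ i, pd i (fun y => w y i) x

/-- Laplacian. -/
def lap {N : ℕ} (u : RN N → ℝ) (x : RN N) : ℝ := ∑ i, pd i (pd i u) x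

/-- The unit cube, a fundamental domain for the torus `T^N` (of total measure `1`,
so that the measure on the torus is the normalized one). -/
def cube (N : ℕ) : Set (RN N) := Set.Icc 0 1

/-- The space-time cylinder `Q = T^N × (0,T)`. -/
def QQ (N : ℕ) (T : ℝ) : Set (RN N × ℝ) := cube N ×ˢ Ioo 0 T

/-- Integral over `Q = T^N × (0,T)`. -/
def intQ (N : ℕ) (T : ℝ) (f : RN N → ℝ → ℝ) : ℝ := ∫ q in QQ N T, f q.1 q.2

/-- Smooth space-periodic test functions on `T^N × [0,T]`. -/
def IsTest (N : ℕ) (φ : RN N → ℝ → ℝ) : Prop :=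
  ContDiff ℝ (⊤ : ℕ∞) (fun q : RN N × ℝ => φ q.1 q.2) ∧ ∀ t, ZPeriodic fun x => φ x t

/-- The Legendre transform `L(q) = sup_p (p·q - H(p))`. -/
def Leg {N : ℕ} (H : RN N → ℝ) (q : RN N) : ℝ := sSup ((fun p => dotp p q - H p) '' Set.univ)

/-- `m L(-w/m)`, with the convention that it vanishes when `m ≤ 0` (recall that in `K`
one has `w = 0` a.e. on `{m = 0}`). -/
def mLag {N : ℕ} (L : RN N → ℝ) (mv : ℝ) (wv : RN N) : ℝ :=
  if 0 < mv then mv * L ((-mv⁻¹) • wv) else 0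

/-- `|w|^{γ'} m^{1-γ'}`, with the convention that it vanishes when `m ≤ 0`. -/
def kinQ {N : ℕ} (γ' : ℝ) (mv : ℝ) (wv : RN N) : ℝ :=
  if 0 < mv then euclNorm wv ^ γ' * mv ^ (1 - γ') else 0

/-- `F(x,m) = ∫_0^m f(x,σ) dσ`. -/
def Fint {N : ℕ} (f : RN N → ℝ → ℝ) (x : RN N) (mv : ℝ) : ℝ := ∫ σ in (0:ℝ)..mv, f x σ

/-- The convexifying term `G(x,t,m)`, as a function of `m̄(x,t)` (argument `mb`) and `m`. -/
def Gcvx (c_f α mb mv : ℝ) : ℝ :=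
  ((c_f + 1) / (α * (α + 1))) * ((mv + 1) ^ (α + 1) - (mb + 1) ^ (α + 1))
    - ((c_f + 1) / α) * (mb + 1) ^ α * (mv - mb)

/-- `g = ∂_m G`, as a function of `m̄(x,t)` (argument `mb`) and `m`. -/
def gcvx (c_f α mb mv : ℝ) : ℝ := ((c_f + 1) / α) * ((mv + 1) ^ α - (mb + 1) ^ α)

/-- The penalised Lagrangian `L_η(q) = L(q) + (η/(N+3)) |q|^{N+3}`. -/
def Lpen {N : ℕ} (L : RN N → ℝ) (η : ℝ) (q : RN N) : ℝ :=
  L q + (η / ((N : ℝ) + 3)) * euclNorm q ^ ((N : ℝ) + 3)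

/-- The penalised Hamiltonian `H_η`, the Legendre transform of `L_η`. -/
def Hpen {N : ℕ} (L : RN N → ℝ) (η : ℝ) : RN N → ℝ := Leg (Lpen L η)

/-- `g` is the weak spatial gradient of `m` on `Q`. -/
def HasWeakGradQ (N : ℕ) (T : ℝ) (m : RN N → ℝ → ℝ) (g : RN N → ℝ → RN N) : Prop :=
  ∀ Φ : RN N → ℝ → RN N, ContDiff ℝ (⊤ : ℕ∞) (fun q : RN N × ℝ => Φ q.1 q.2) →
    (∀ t, ZPeriodic fun x => Φ x t) →
    intQ N T (fun x t => m x t * dive (fun y => Φ y t) x)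
      = -intQ N T (fun x t => dotp (g x t) (Φ x t))

/-- `m` is `θ`-Hölder continuous on `T^N × [0,T]` with constant `C`. -/
def HolderOnQ (N : ℕ) (T C θ : ℝ) (m : RN N → ℝ → ℝ) : Prop :=
  ∀ x t x' t', t ∈ Icc (0:ℝ) T → t' ∈ Icc (0:ℝ) T →
    |m x t - m x' t'| ≤
      C * Real.sqrt (euclNorm (fun i => x i - x' i) ^ 2 + (t - t') ^ 2) ^ θ

/-- Membership in the constraint set `K`: `(m,w) ∈ L^{α+1}(Q) × L¹(Q;ℝ^N)`, `m ≥ 0`,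
`|w|^{γ'} m^{1-γ'} ∈ L¹(Q)`, together with the weak Fokker–Planck constraint
(with initial datum `m₀`); the field `traceId` states that `m(·,T)` is the time-`T`
trace of `m` determined by the constraint. -/
structure MemK (N : ℕ) (T α γ' : ℝ) (m₀ : RN N → ℝ)
    (m : RN N → ℝ → ℝ) (w : RN N → ℝ → RN N) : Prop where
  per_m : ∀ t, ZPeriodic fun x => m x t
  per_w : ∀ t, ZPeriodic fun x => w x t
  nonneg : ∀ x t, 0 ≤ m x t
  lp_m : IntegrableOn (fun q : RN N × ℝ => m q.1 q.2 ^ (α + 1)) (QQ N T)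
  l1_w : IntegrableOn (fun q : RN N × ℝ => w q.1 q.2) (QQ N T)
  vanish : ∀ᵐ q ∂(volume.restrict (QQ N T)), m q.1 q.2 = 0 → w q.1 q.2 = 0
  kin_int : IntegrableOn (fun q : RN N × ℝ => kinQ γ' (m q.1 q.2) (w q.1 q.2)) (QQ N T)
  traceInt : IntegrableOn (fun x => m x T) (cube N)
  fp : ∀ φ : RN N → ℝ → ℝ, IsTest N φ → (∀ x, φ x T = 0) →
    intQ N T (fun x t => m x t * deriv (φ x) t + dotp (w x t) (grad (fun y => φ y t) x)
        + m x t * lap (fun y => φ y t) x)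
      + (∫ x in cube N, m₀ x * φ x 0) = 0
  traceId : ∀ φ : RN N → ℝ → ℝ, IsTest N φ →
    intQ N T (fun x t => m x t * deriv (φ x) t + dotp (w x t) (grad (fun y => φ y t) x)
        + m x t * lap (fun y => φ y t) x)
      + (∫ x in cube N, m₀ x * φ x 0) - (∫ x in cube N, m x T * φ x T) = 0

/-- The energy functional `E` on `K`, with Lagrangian `L` and coupling antiderivative `F`. -/
def energyF (N : ℕ) (T : ℝ) (L : RN N → ℝ) (F : RN N → ℝ → ℝ) (uT : RN N → ℝ)
    (m : RN N → ℝ → ℝ) (w : RN N → ℝ → RN N) : ℝ :=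
  intQ N T (fun x t => mLag L (m x t) (w x t) - F x (m x t)) + ∫ x in cube N, uT x * m x T

/-- `(m,w)` belongs to `K` and minimises the energy over `K`. -/
def MinimisesE (N : ℕ) (T α γ' : ℝ) (m₀ : RN N → ℝ) (L : RN N → ℝ) (F : RN N → ℝ → ℝ)
    (uT : RN N → ℝ) (m : RN N → ℝ → ℝ) (w : RN N → ℝ → RN N) : Prop :=
  MemK N T α γ' m₀ m w ∧
    ∀ m' w', MemK N T α γ' m₀ m' w' → energyF N T L F uT m w ≤ energyF N T L F uT m' w'

/-- Classical solution of the MFG system `-∂_t u - Δu + H(∇u) = fc(x,t,m)`,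
`∂_t m - Δm - div(∇H(∇u) m) = 0`, `m(·,0) = m₀`, `u(·,T) = u_T`:
`u, m` are continuous on `T^N × [0,T]` together with `∂_t u, ∂_t m` and all first and
second space derivatives, and the equations hold pointwise. -/
structure ClassicalSol (N : ℕ) (T : ℝ) (H : RN N → ℝ) (fc : RN N → ℝ → ℝ → ℝ)
    (m₀ uT : RN N → ℝ) (u m : RN N → ℝ → ℝ) : Prop where
  per_u : ∀ t, ZPeriodic fun x => u x t
  per_m : ∀ t, ZPeriodic fun x => m x t
  cont_u : ContinuousOn (fun q : RN N × ℝ => u q.1 q.2) ((Set.univ : Set (RN N)) ×ˢ Icc 0 T)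
  cont_m : ContinuousOn (fun q : RN N × ℝ => m q.1 q.2) ((Set.univ : Set (RN N)) ×ˢ Icc 0 T)
  cont_ut : ContinuousOn (fun q : RN N × ℝ => deriv (u q.1) q.2)
    ((Set.univ : Set (RN N)) ×ˢ Icc 0 T)
  cont_mt : ContinuousOn (fun q : RN N × ℝ => deriv (m q.1) q.2)
    ((Set.univ : Set (RN N)) ×ˢ Icc 0 T)
  cont_du : ∀ i, ContinuousOn (fun q : RN N × ℝ => pd i (fun y => u y q.2) q.1)
    ((Set.univ : Set (RN N)) ×ˢ Icc 0 T)
  cont_dm : ∀ i, ContinuousOn (fun q : RN N × ℝ => pd i (fun y => m y q.2) q.1)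
    ((Set.univ : Set (RN N)) ×ˢ Icc 0 T)
  cont_ddu : ∀ i j, ContinuousOn (fun q : RN N × ℝ => pd i (pd j fun y => u y q.2) q.1)
    ((Set.univ : Set (RN N)) ×ˢ Icc 0 T)
  cont_ddm : ∀ i j, ContinuousOn (fun q : RN N × ℝ => pd i (pd j fun y => m y q.2) q.1)
    ((Set.univ : Set (RN N)) ×ˢ Icc 0 T)
  tdiff_u : ∀ x, ∀ t ∈ Ioo 0 T, DifferentiableAt ℝ (u x) t
  tdiff_m : ∀ x, ∀ t ∈ Ioo 0 T, DifferentiableAt ℝ (m x) t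
  xdiff_u : ∀ t ∈ Icc 0 T,
    Differentiable ℝ (fun y => u y t) ∧ ∀ i, Differentiable ℝ (pd i fun y => u y t)
  xdiff_m : ∀ t ∈ Icc 0 T,
    Differentiable ℝ (fun y => m y t) ∧ ∀ i, Differentiable ℝ (pd i fun y => m y t)
  hjb : ∀ x, ∀ t ∈ Ioo 0 T,
    -deriv (u x) t - lap (fun y => u y t) x + H (grad (fun y => u y t) x) = fc x t (m x t)
  fkp : ∀ x, ∀ t ∈ Ioo 0 T,
    deriv (m x) t - lap (fun y => m y t) x
      - dive (fun y => m y t • grad H (grad (fun z => u z t) y)) x = 0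
  init : ∀ x, m x 0 = m₀ x
  final : ∀ x, u x T = uT x

/-- Weak solution `(u,m)` (with weak spatial gradient `Du` of `u`) of the MFG system
`-∂_t u - Δu + H(∇u) = fc(x,t,m)`, `∂_t m - Δm - div(∇H(∇u) m) = 0`, `m(·,0) = m₀`,
`u(·,T) = u_T`, in the sense of Definition 3.1 of the paper. -/
structure WeakSol (N : ℕ) (T γ α : ℝ) (H : RN N → ℝ) (fc : RN N → ℝ → ℝ → ℝ)
    (m₀ uT : RN N → ℝ) (u m : RN N → ℝ → ℝ) (Du : RN N → ℝ → RN N) : Prop where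
  per_u : ∀ t, ZPeriodic fun x => u x t
  per_m : ∀ t, ZPeriodic fun x => m x t
  per_Du : ∀ t, ZPeriodic fun x => Du x t
  nonneg_m : ∀ x t, 0 ≤ m x t
  lp_m : IntegrableOn (fun q : RN N × ℝ => m q.1 q.2 ^ (α + 1)) (QQ N T)
  lq_u_sup : α < γ / N → ∃ C, ∀ᵐ q ∂(volume.restrict (QQ N T)), |u q.1 q.2| ≤ C
  lq_u_int : γ / N < α →
    IntegrableOn (fun q : RN N × ℝ =>
      |u q.1 q.2| ^ (γ * (α + 1) * (1 + (N : ℝ)) / (α * N - γ))) (QQ N T)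
  weak_grad : HasWeakGradQ N T u Du
  lγ_Du : IntegrableOn (fun q : RN N × ℝ => euclNorm (Du q.1 q.2) ^ γ) (QQ N T)
  int_mL : IntegrableOn (fun q : RN N × ℝ =>
      m q.1 q.2 * Leg H (grad H (Du q.1 q.2))) (QQ N T)
  int_mDH : IntegrableOn (fun q : RN N × ℝ => m q.1 q.2 • grad H (Du q.1 q.2)) (QQ N T)
  hjb : ∀ φ : RN N → ℝ → ℝ, IsTest N φ → (∀ x t, 0 ≤ φ x t) →
    (∃ ε > (0:ℝ), ∀ x, ∀ t ≤ ε, φ x t = 0) →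
    intQ N T (fun x t => u x t * deriv (φ x) t - u x t * lap (fun y => φ y t) x
        + (H (Du x t) - fc x t (m x t)) * φ x t)
      ≤ ∫ x in cube N, uT x * φ x T
  fkp : ∀ φ : RN N → ℝ → ℝ, IsTest N φ → (∀ x, φ x T = 0) →
    intQ N T (fun x t => m x t * deriv (φ x) t
        - dotp (m x t • grad H (Du x t)) (grad (fun y => φ y t) x)
        + m x t * lap (fun y => φ y t) x)
      + (∫ x in cube N, m₀ x * φ x 0) = 0
  energy_id : intQ N T (fun x t =>
        m x t * (-(fc x t (m x t)) + Leg H (grad H (Du x t))))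
      + (∫ x in cube N, (m x T * uT x - m₀ x * u x 0)) = 0

/-- Nonnegative weak solution of the Fokker–Planck equation
`∂_t m - Δm + div(A m) = 0` in `Q`, `m(·,0) = m₀`, with finite energy
`E = ∫_Q |A|^{γ'} m < ∞`. -/
structure FPSol (N : ℕ) (T γ' : ℝ) (m₀ : RN N → ℝ) (m : RN N → ℝ → ℝ)
    (A : RN N → ℝ → RN N) : Prop where
  per_m : ∀ t, ZPeriodic fun x => m x t
  per_A : ∀ t, ZPeriodic fun x => A x t
  nonneg : ∀ x t, 0 ≤ m x t
  int_m : IntegrableOn (fun q : RN N × ℝ => m q.1 q.2) (QQ N T)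
  int_E : IntegrableOn (fun q : RN N × ℝ => euclNorm (A q.1 q.2) ^ γ' * m q.1 q.2) (QQ N T)
  weak : ∀ φ : RN N → ℝ → ℝ, IsTest N φ → (∀ x, φ x T = 0) →
    intQ N T (fun x t => m x t * (deriv (φ x) t + lap (fun y => φ y t) x
        + dotp (A x t) (grad (fun y => φ y t) x)))
      + (∫ x in cube N, m₀ x * φ x 0) = 0

/-- Conditions on the initial datum of the Fokker–Planck equation: a periodic (i.e.
defined on the torus) Lipschitz probability density, with `‖∇m₀‖_∞ ≤ K₀`. -/
def FPData (N : ℕ) (K₀ : ℝ) (m₀ : RN N → ℝ) : Prop :=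
  ZPeriodic m₀ ∧ (∀ x, 0 ≤ m₀ x) ∧ (∫ x in cube N, m₀ x) = 1 ∧
    Differentiable ℝ m₀ ∧ ∀ x, euclNorm (grad m₀ x) ≤ K₀

section

/-- Space-time. -/
abbrev XT (N : ℕ) := RN N × ℝ

/-- The lattice embedding `ℤ^N → ℝ^N × ℝ`. -/
def latHom (N : ℕ) : (Fin N → ℤ) →+ XT N where
  toFun z := (fun i => (z i : ℝ), 0)
  map_zero' := by ext <;> simp
  map_add' a b := by ext <;> simp

/-- Space-periodicity of functions on space-time. -/
def PerQ {N : ℕ} {β : Type*} (g : XT N → β) : Prop :=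
  ∀ (q : XT N) (z : Fin N → ℤ), g (q + latHom N z) = g q

/-- A half-open fundamental strip. -/
def strip (N : ℕ) : Set (XT N) := {q | ∀ i, q.1 i ∈ Ico (0:ℝ) 1}

variable {N : ℕ}

lemma strip_eq : strip N = (Set.univ.pi fun _ => Ico (0:ℝ) 1) ×ˢ univ := by
  ext q; simp [strip]

lemma measurableSet_strip : MeasurableSet (strip N) := by
  rw [strip_eq]
  exact (MeasurableSet.univ_pi fun _ => measurableSet_Ico).prod MeasurableSet.univ

instance : (volume : Measure (XT N)).IsAddHaarMeasure :=
  inferInstanceAs ((volume : Measure (RN N)).prod (volume : Measure ℝ)).IsAddHaarMeasure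

lemma vadd_range (g : (latHom N).range) (q : XT N) : g +ᵥ q = (g : XT N) + q := rfl

lemma existsUnique_lattice (u q : XT N) :
    ∃! g : (latHom N).range, (g +ᵥ q) + u ∈ strip N := by
  refine ⟨⟨latHom N (fun i => -⌊q.1 i + u.1 i⌋), _, rfl⟩, ?_, ?_⟩
  · intro i
    change ((-⌊q.1 i + u.1 i⌋ : ℤ) : ℝ) + q.1 i + u.1 i ∈ Ico (0:ℝ) 1
    have h1 := Int.floor_le (q.1 i + u.1 i)
    have h2 := Int.lt_floor_add_one (q.1 i + u.1 i)
    push_cast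
    constructor <;> linarith
  · rintro ⟨_, z, rfl⟩ h
    congr 2
    ext i
    have hi : (z i : ℝ) + q.1 i + u.1 i ∈ Ico (0:ℝ) 1 := h i
    rw [mem_Ico] at hi
    have : ⌊q.1 i + u.1 i⌋ = -z i := by
      rw [Int.floor_eq_iff]; push_cast; constructor <;> linarith
    omega

lemma isAddFundamentalDomain_strip (u : XT N) :
    IsAddFundamentalDomain (latHom N).range ((fun q => q + u) ⁻¹' strip N) volume :=
  IsAddFundamentalDomain.mk'
    ((measurableSet_strip.preimage (measurable_id.add_const u)).nullMeasurableSet)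
    (fun q => existsUnique_lattice u q)

instance : Countable (latHom N).range := by
  have : Countable (Fin N → ℤ) := inferInstance
  exact (countable_range (latHom N)).to_subtype

instance : VAddInvariantMeasure (latHom N).range (XT N) volume := by
  constructor
  intro c s _
  exact measure_preimage_add volume (c : XT N) s

lemma PerQ.vadd {β : Type*} {g : XT N → β} (hg : PerQ g) (k : (latHom N).range) (q : XT N) :
    g (k +ᵥ q) = g q := by
  obtain ⟨_, z, rfl⟩ := k
  rw [vadd_range, add_comm]
  exact hg q z

lemma PerQ.lintegral_shift {g : XT N → ENNReal} (hg : PerQ g) (u : XT N) :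
    ∫⁻ q in strip N, g (q + u) = ∫⁻ q in strip N, g q := by
  have h0 : (fun q : XT N => q + 0) ⁻¹' strip N = strip N := by ext; simp
  have h1 := (isAddFundamentalDomain_strip (N := N) (-u)).setLIntegral_eq
    (isAddFundamentalDomain_strip (N := N) 0) g hg.vadd
  rw [h0] at h1
  rw [← h1]
  have hmp := (measurePreserving_add_right (volume : Measure (XT N)) u)
  rw [← hmp.setLIntegral_comp_preimage_emb (MeasurableEquiv.addRight u).measurableEmbedding g,
    ← preimage_comp]
  simp [Function.comp_def]

lemma PerQ.integral_shift {F : Type*} [NormedAddCommGroup F] [NormedSpace ℝ F]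
    {g : XT N → F} (hg : PerQ g) (u : XT N) :
    ∫ q in strip N, g (q + u) = ∫ q in strip N, g q := by
  have h0 : (fun q : XT N => q + 0) ⁻¹' strip N = strip N := by ext; simp
  have h1 := (isAddFundamentalDomain_strip (N := N) (-u)).setIntegral_eq
    (isAddFundamentalDomain_strip (N := N) 0) (f := g) hg.vadd
  rw [h0] at h1
  rw [← h1]
  have hmp := (measurePreserving_add_right (volume : Measure (XT N)) u)
  rw [← hmp.setIntegral_preimage_emb (MeasurableEquiv.addRight u).measurableEmbedding g,
    ← preimage_comp]
  simp [Function.comp_def]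

lemma lintegral_unfold_swap {F : XT N → XT N → ENNReal} (hF : Measurable (Function.uncurry F))
    (hper : ∀ x z k, F (x + latHom N k) (z + latHom N k) = F x z) :
    ∫⁻ x in strip N, ∫⁻ z, F x z = ∫⁻ z in strip N, ∫⁻ x, F x z := by
  have e1 : ∀ x, ∫⁻ z, F x z = ∫⁻ y, F x (x - y) := fun x =>
    (lintegral_sub_left_eq_self (fun z => F x z) x).symm
  have e2 : ∀ z, ∫⁻ x, F x z = ∫⁻ y, F (z + y) z := fun z =>
    (lintegral_add_left_eq_self (fun x => F x z) z).symm
  have m1 : Measurable (Function.uncurry fun x y : XT N => F x (x - y)) :=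
    hF.comp (measurable_fst.prodMk (measurable_fst.sub measurable_snd))
  have m2 : Measurable (Function.uncurry fun z y : XT N => F (z + y) z) :=
    hF.comp ((measurable_fst.add measurable_snd).prodMk measurable_fst)
  simp_rw [e1, e2]
  rw [lintegral_lintegral_swap m1.aemeasurable, lintegral_lintegral_swap m2.aemeasurable]
  congr 1
  ext y
  have : PerQ (fun x => F x (x - y)) := by
    intro q k
    have := hper q (q - y) k
    simp only [← this]; congr 1; abel
  rw [← this.lintegral_shift y]
  simp

lemma lintegral_eq_tsum_strip (g : XT N → ENNReal) :
    ∫⁻ q, g q = ∑' k : (latHom N).range, ∫⁻ q in strip N, g ((k : XT N) + q) := by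
  have h0 : (fun q : XT N => q + 0) ⁻¹' strip N = strip N := by ext; simp
  have := (isAddFundamentalDomain_strip (N := N) 0).lintegral_eq_tsum'' g
  rw [h0] at this
  exact this

lemma QQ_ae_eq (T : ℝ) : (QQ N T : Set (XT N)) =ᵐ[volume] (strip N ∩ {q | q.2 ∈ Ioo 0 T} : Set (XT N)) := by
  have h1 : (strip N ∩ {q | q.2 ∈ Ioo 0 T} : Set (XT N)) = (Set.univ.pi fun _ => Ico (0:ℝ) 1) ×ˢ Ioo 0 T := by
    ext q; simp [strip]
  have h2 : (QQ N T : Set (XT N)) = (Set.univ.pi fun _ => Icc (0:ℝ) 1) ×ˢ Ioo 0 T := by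
    ext q; simp [QQ, cube, Pi.le_def]
  rw [h1, h2]
  refine Measure.set_prod_ae_eq ?_ (ae_eq_refl _)
  refine (Measure.univ_pi_Ico_ae_eq_Icc (f := fun _ => (0:ℝ)) (g := fun _ => 1)).trans ?_ |>.symm
  rw [pi_univ_Icc]
  rfl

/-- Smooth space-periodic functions supported in times `|t| ≤ R`. -/
structure SPc {F : Type*} [NormedAddCommGroup F] [NormedSpace ℝ F] (f : XT N → F) (R : ℝ) :
    Prop where
  smooth : ContDiff ℝ (⊤ : ℕ∞) f
  per : PerQ f
  supp : ∀ q : XT N, R < |q.2| → f q = 0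

/-- Bounded measurable space-periodic functions supported in times `|t| ≤ R`. -/
structure BPc (f : XT N → ℝ) (M R : ℝ) : Prop where
  meas : Measurable f
  per : PerQ f
  bdd : ∀ q, |f q| ≤ M
  supp : ∀ q : XT N, R < |q.2| → f q = 0

lemma exists_latHom_add_mem (q : XT N) : ∃ z : Fin N → ℤ, q + latHom N z ∈ strip N := by
  obtain ⟨⟨_, z, rfl⟩, hz, _⟩ := existsUnique_lattice (0 : XT N) q
  refine ⟨z, ?_⟩
  rw [vadd_range, add_zero, add_comm] at hz
  exact hz

lemma latHom_snd (z : Fin N → ℤ) : (latHom N z).2 = 0 := rfl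

/-- The part of the strip with times `|t| ≤ R`. -/
def slab (N : ℕ) (R : ℝ) : Set (XT N) := strip N ∩ {q | |q.2| ≤ R}

lemma measurableSet_slab (R : ℝ) : MeasurableSet (slab N R) :=
  measurableSet_strip.inter (measurableSet_le (measurable_snd.abs) measurable_const)

lemma slab_subset (R : ℝ) : slab N R ⊆ (Icc (fun _ => 0) (fun _ => 1)) ×ˢ Icc (-R) R := by
  rintro q ⟨h1, h2⟩
  exact ⟨⟨fun i => (h1 i).1, fun i => (h1 i).2.le⟩, abs_le.1 h2⟩

lemma volume_slab_lt_top (R : ℝ) : volume (slab N R) < ⊤ :=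
  lt_of_le_of_lt (measure_mono (slab_subset R)) (isCompact_Icc.prod isCompact_Icc).measure_lt_top

lemma volume_slab (R : ℝ) : volume (slab N R) = ENNReal.ofReal (2 * R) := by
  have : slab N R = (Set.univ.pi fun _ => Ico (0:ℝ) 1) ×ˢ Icc (-R) R := by
    ext q; simp [slab, strip, abs_le]
  rw [this, Measure.volume_eq_prod, Measure.prod_prod, Real.volume_pi_Ico, Real.volume_Icc]
  simp [two_mul]

instance (R : ℝ) : IsFiniteMeasure ((volume : Measure (XT N)).restrict (slab N R)) :=
  ⟨by simpa using volume_slab_lt_top R⟩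

section
variable {F : Type*} [NormedAddCommGroup F] [NormedSpace ℝ F] {f : XT N → F} {R : ℝ}

lemma setLIntegral_strip_eq_slab {g : XT N → ENNReal} (h : ∀ q : XT N, R < |q.2| → g q = 0) :
    ∫⁻ q in strip N, g q = ∫⁻ q in slab N R, g q := by
  rw [slab, inter_comm, ← Measure.restrict_restrict (measurableSet_le (measurable_snd.abs) measurable_const),
    ← lintegral_indicator (measurableSet_le (measurable_snd.abs) measurable_const)]
  congr 1
  ext q
  by_cases hq : |q.2| ≤ R
  · rw [indicator_of_mem]; exact hq
  · rw [indicator_of_notMem, h q (not_le.1 hq)]; exact hq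

lemma SPc.exists_bound (hf : SPc f R) : ∃ C, 0 ≤ C ∧ ∀ q, ‖f q‖ ≤ C := by
  obtain ⟨C, hC⟩ := ((isCompact_Icc (a := fun _ : Fin N => (0:ℝ)) (b := fun _ => 1)).prod
    (isCompact_Icc (a := -R) (b := R))).exists_bound_of_continuousOn hf.smooth.continuous.continuousOn
  refine ⟨max C 0, le_max_right _ _, fun q => ?_⟩
  by_cases hq : |q.2| ≤ R
  · obtain ⟨z, hz⟩ := exists_latHom_add_mem q
    rw [← hf.per q z]
    refine le_max_of_le_left (hC _ (slab_subset R ⟨hz, ?_⟩))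
    simpa [latHom_snd] using hq
  · rw [hf.supp q (not_le.1 hq)]; simp

lemma SPc.fderivMap (hf : SPc f R) : SPc (fderiv ℝ f) R where
  smooth := hf.smooth.fderiv_right (m := (⊤ : ℕ∞)) (by norm_cast)
  per q z := by
    have : f = fun x => f (x + latHom N z) := funext fun x => (hf.per x z).symm
    conv_rhs => rw [this]
    rw [fderiv_comp_add_right]
  supp q hq := by
    have : f =ᶠ[𝓝 q] fun _ => 0 := by
      filter_upwards [(isOpen_lt continuous_const (continuous_snd.abs)).mem_nhds hq] with x hx
      exact hf.supp x hx
    rw [this.fderiv_eq]; simp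

lemma SPc.clm_comp {G : Type*} [NormedAddCommGroup G] [NormedSpace ℝ G] (L : F →L[ℝ] G)
    (hf : SPc f R) : SPc (fun q => L (f q)) R where
  smooth := L.contDiff.comp hf.smooth
  per q z := by simp only [hf.per q z]
  supp q hq := by simp only [hf.supp q hq, map_zero]

lemma SPc.dir (hf : SPc f R) (v : XT N) : SPc (fun q => fderiv ℝ f q v) R :=
  hf.fderivMap.clm_comp (ContinuousLinearMap.apply ℝ F v)

lemma SPc.mul {f g : XT N → ℝ} (hf : SPc f R) (hg : PerQ g) (hg' : ContDiff ℝ (⊤ : ℕ∞) g) :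
    SPc (fun q => f q * g q) R where
  smooth := hf.smooth.mul hg'
  per q z := by simp only [hf.per q z, hg q z]
  supp q hq := by simp only [hf.supp q hq, zero_mul]

lemma SPc.sub {g : XT N → F} (hf : SPc f R) (hg : SPc g R) : SPc (fun q => f q - g q) R where
  smooth := hf.smooth.sub hg.smooth
  per q z := by simp only [hf.per q z, hg.per q z]
  supp q hq := by simp only [hf.supp q hq, hg.supp q hq, sub_zero]

lemma SPc.sum {ι : Type*} {s : Finset ι} {g : ι → XT N → F} (hg : ∀ i ∈ s, SPc (g i) R) :
    SPc (fun q => ∑ i ∈ s, g i q) R where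
  smooth := ContDiff.sum fun i hi => (hg i hi).smooth
  per q z := Finset.sum_congr rfl fun i hi => (hg i hi).per q z
  supp q hq := Finset.sum_eq_zero fun i hi => (hg i hi).supp q hq

lemma SPc.mono {R' : ℝ} (hf : SPc f R) (h : R ≤ R') : SPc f R' :=
  ⟨hf.smooth, hf.per, fun q hq => hf.supp q (h.trans_lt hq)⟩

lemma SPc.integrableOn (hf : SPc f R) : IntegrableOn f (strip N) := by
  obtain ⟨C, -, hC⟩ := hf.exists_bound
  have : IntegrableOn f (slab N R) :=
    (integrable_const C).mono' hf.smooth.continuous.aestronglyMeasurable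
      (Eventually.of_forall hC)
  exact this.of_forall_sdiff_eq_zero measurableSet_strip fun q hq =>
    hf.supp q (not_le.1 fun h => hq.2 ⟨hq.1, h⟩)

/-- Integrals of directional derivatives over a period vanish. -/
lemma SPc.integral_dir [CompleteSpace F] (hf : SPc f R) (v : XT N) :
    ∫ q in strip N, fderiv ℝ f q v = 0 := by
  obtain ⟨C, hC0, hC⟩ := (hf.dir v).exists_bound
  set R' := R + |v.2|
  have key : ∀ ε : ℝ, |ε| < 1 → ∫ q in slab N R', f (q + ε • v) = ∫ q in strip N, f q := by
    intro ε hε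
    rw [← hf.per.integral_shift (ε • v)]
    refine Eq.symm <| setIntegral_eq_of_subset_of_forall_sdiff_eq_zero measurableSet_strip inter_subset_left ?_
    intro q hq
    refine hf.supp _ ?_
    have h1 : R' < |q.2| := not_le.1 fun h => hq.2 ⟨hq.1, h⟩
    have h2 : |ε * v.2| ≤ |v.2| := by
      rw [abs_mul]; exact mul_le_of_le_one_left (abs_nonneg _) hε.le
    have h3 : |q.2| ≤ |q.2 + ε * v.2| + |ε * v.2| := by
      have := abs_sub (q.2 + ε * v.2) (ε * v.2); simpa using this
    change R < |q.2 + ε * v.2|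
    simp only [R'] at h1
    linarith
  have hd : ∀ (q : XT N) (ε : ℝ),
      HasDerivAt (fun ε : ℝ => f (q + ε • v)) (fderiv ℝ f (q + ε • v) v) ε := by
    intro q ε
    have h1 := (hf.smooth.differentiable (by simp)).differentiableAt (x := q + ε • v) |>.hasFDerivAt
    have h2 : HasDerivAt (fun ε : ℝ => q + ε • v) v ε := by
      simpa using ((hasDerivAt_id ε).smul_const v).const_add q
    exact h1.comp_hasDerivAt ε h2
  have main := (hasDerivAt_integral_of_dominated_loc_of_deriv_le
    (μ := volume.restrict (slab N R')) (F := fun (ε : ℝ) q => f (q + ε • v))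
    (F' := fun (ε : ℝ) q => fderiv ℝ f (q + ε • v) v) (x₀ := 0) (bound := fun _ => C)
    (s := Metric.ball 0 1)
    (Metric.ball_mem_nhds 0 one_pos)
    (Eventually.of_forall fun ε => (hf.smooth.continuous.comp
      (continuous_id.add continuous_const)).aestronglyMeasurable)
    (by simp only [zero_smul, add_zero]
        exact hf.integrableOn.mono_set (s := slab N R') inter_subset_left)
    (by simpa using (hf.dir v).smooth.continuous.aestronglyMeasurable)
    (Eventually.of_forall fun q ε _ => hC _) (integrable_const C)
    (Eventually.of_forall fun q ε _ => hd q ε)).2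
  have h0 : HasDerivAt (fun ε : ℝ => ∫ q in slab N R', f (q + ε • v)) 0 0 := by
    refine (hasDerivAt_const (0:ℝ) (∫ q in strip N, f q)).congr_of_eventuallyEq ?_
    filter_upwards [Metric.ball_mem_nhds (0:ℝ) one_pos] with ε hε
    exact key ε (by simpa using hε)
  have := main.unique h0
  simp only [zero_smul, add_zero] at this
  rw [← this]
  refine setIntegral_eq_of_subset_of_forall_sdiff_eq_zero measurableSet_strip inter_subset_left ?_
  intro q hq
  refine (hf.dir v).supp _ ?_
  have h1 : R' < |q.2| := not_le.1 fun h => hq.2 ⟨hq.1, h⟩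
  exact lt_of_le_of_lt (le_add_of_nonneg_right (abs_nonneg _)) h1

section
variable {Ω : Type*} [MeasurableSpace Ω] {ν : Measure Ω} {d : Ω → XT N}

/-- Average of translates of `f` along displacements `d`. -/
def Av (ν : Measure Ω) (d : Ω → XT N) (f : XT N → F) (q : XT N) : F := ∫ ω, f (q - d ω) ∂ν

lemma SPc.integrable_translate [IsFiniteMeasure ν] (hd : Measurable d) (hf : SPc f R) (q : XT N) :
    Integrable (fun ω => f (q - d ω)) ν := by
  obtain ⟨C, hC0, hC⟩ := hf.exists_bound
  exact (integrable_const C).mono' (hf.smooth.continuous.comp_aestronglyMeasurable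
    (measurable_const.sub hd).aestronglyMeasurable) (Eventually.of_forall fun ω => hC _)

lemma SPc.hasFDerivAt_Av [IsFiniteMeasure ν] (hd : Measurable d) (hf : SPc f R)
    (q : XT N) : HasFDerivAt (Av ν d f) (Av ν d (fderiv ℝ f) q) q := by
  obtain ⟨C, hC0, hC⟩ := hf.fderivMap.exists_bound
  refine hasFDerivAt_integral_of_dominated_of_fderiv_le (s := univ) (bound := fun _ => C) univ_mem
    (Eventually.of_forall fun x => (hf.integrable_translate hd x).1) (hf.integrable_translate hd q)
    (hf.fderivMap.integrable_translate hd q).1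
    (Eventually.of_forall fun ω x _ => hC _) (integrable_const C)
    (F' := fun x ω => fderiv ℝ f (x - d ω)) (Eventually.of_forall fun ω x _ => ?_)
  exact (hasFDerivAt_comp_sub (d ω)).2
    ((hf.smooth.differentiable (by simp)) (x - d ω)).hasFDerivAt

lemma SPc.fderiv_Av [IsFiniteMeasure ν] (hd : Measurable d) (hf : SPc f R) :
    fderiv ℝ (Av ν d f) = Av ν d (fderiv ℝ f) :=
  funext fun q => (hf.hasFDerivAt_Av hd q).fderiv

end
end

lemma SPc.contDiff_Av_nat {Ω : Type*} [MeasurableSpace Ω] {ν : Measure Ω} {d : Ω → XT N}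
    [IsFiniteMeasure ν] (hd : Measurable d) (n : ℕ) :
    ∀ {F : Type} [NormedAddCommGroup F] [NormedSpace ℝ F] {f : XT N → F} {R : ℝ},
    SPc f R → ContDiff ℝ n (Av ν d f) := by
  induction n with
  | zero =>
    intro F _ _ f R hf
    exact contDiff_zero.2 (continuous_iff_continuousAt.2
      fun q => (hf.hasFDerivAt_Av hd q).continuousAt)
  | succ n ih =>
    intro F _ _ f R hf
    rw [Nat.cast_succ, contDiff_succ_iff_fderiv]
    refine ⟨fun q => (hf.hasFDerivAt_Av hd q).differentiableAt, by simp, ?_⟩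
    rw [hf.fderiv_Av hd]
    exact ih hf.fderivMap

section
variable {F : Type} [NormedAddCommGroup F] [NormedSpace ℝ F] {f : XT N → F} {R : ℝ}
  {Ω : Type*} [MeasurableSpace Ω] {ν : Measure Ω} {d : Ω → XT N}

lemma SPc.av [IsFiniteMeasure ν] (hd : Measurable d) {D : ℝ} (hD : ∀ᵐ ω ∂ν, |(d ω).2| ≤ D)
    (hf : SPc f R) : SPc (Av ν d f) (R + D) where
  smooth := contDiff_infty.2 fun n => hf.contDiff_Av_nat hd n
  per q z := by
    refine integral_congr_ae (Eventually.of_forall fun ω => ?_)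
    simp only
    rw [add_sub_right_comm, hf.per]
  supp q hq := by
    refine integral_eq_zero_of_ae ?_
    filter_upwards [hD] with ω hω
    refine hf.supp _ ?_
    have h3 : |q.2| ≤ |q.2 - (d ω).2| + |(d ω).2| := by
      have := abs_add_le (q.2 - (d ω).2) ((d ω).2); simpa using this
    change R < |q.2 - (d ω).2|
    linarith

lemma SPc.fderiv_Av_apply [CompleteSpace F] [IsFiniteMeasure ν] (hd : Measurable d) (hf : SPc f R) (q v : XT N) :
    fderiv ℝ (Av ν d f) q v = Av ν d (fun x => fderiv ℝ f x v) q := by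
  rw [hf.fderiv_Av hd]
  exact ContinuousLinearMap.integral_apply (hf.fderivMap.integrable_translate hd q) v

end

lemma BPc.integrableOn {f : XT N → ℝ} {M R : ℝ} (hf : BPc f M R) : IntegrableOn f (strip N) := by
  have : IntegrableOn f (slab N R) :=
    (integrable_const M).mono' hf.meas.aestronglyMeasurable (Eventually.of_forall hf.bdd)
  exact this.of_forall_sdiff_eq_zero measurableSet_strip fun q hq =>
    hf.supp q (not_le.1 fun h => hq.2 ⟨hq.1, h⟩)

lemma SPc.integral_mul_dir {f g : XT N → ℝ} {R : ℝ} (hf : SPc f R) (hg : PerQ g)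
    (hg' : ContDiff ℝ (⊤ : ℕ∞) g) (v : XT N) :
    ∫ q in strip N, f q * fderiv ℝ g q v = - ∫ q in strip N, fderiv ℝ f q v * g q := by
  have h := (hf.mul hg hg').integral_dir v
  have hgd : SPc (fun q => f q * fderiv ℝ g q v) R := by
    refine hf.mul (fun q z => ?_) ?_
    · have : g = fun x => g (x + latHom N z) := funext fun x => (hg x z).symm
      conv_rhs => rw [this]
      rw [fderiv_comp_add_right]
    · exact (hg'.fderiv_right (m := (⊤ : ℕ∞)) (by norm_cast)).clm_apply contDiff_const
  have e : ∀ q, fderiv ℝ (fun q => f q * g q) q v = f q * fderiv ℝ g q v + fderiv ℝ f q v * g q := by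
    intro q
    rw [fderiv_fun_mul (hf.smooth.differentiable (by simp) q) (hg'.differentiable (by simp) q)]
    simp [mul_comm]
  simp_rw [e] at h
  rw [integral_add hgd.integrableOn ((hf.dir v).mul hg hg').integrableOn] at h
  linarith

lemma BPc.locallyIntegrable {f : XT N → ℝ} {M R : ℝ} (hf : BPc f M R) :
    LocallyIntegrable f volume := by
  rw [locallyIntegrable_iff]
  intro k hk
  have : IsFiniteMeasure (volume.restrict k) := ⟨by simpa using hk.measure_lt_top⟩
  exact (integrable_const M).mono' hf.meas.aestronglyMeasurable (Eventually.of_forall hf.bdd)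

/-- Mollification of bounded periodic functions. -/
lemma BPc.exists_approx {f : XT N → ℝ} {M R : ℝ} (hf : BPc f M R) {ε : ℝ} (hε : 0 < ε) :
    ∃ fn : ℕ → XT N → ℝ, (∀ n, SPc (fn n) (R + ε)) ∧ (∀ n q, |fn n q| ≤ M) ∧
      (∀ a b, (∀ q, q.2 ∉ Icc a b → f q = 0) → ∀ n q, q.2 ∉ Icc (a - ε) (b + ε) → fn n q = 0) ∧
      ∀ᵐ q, Tendsto (fun n => fn n q) atTop (𝓝 (f q)) := by
  let φ : ℕ → ContDiffBump (0 : XT N) := fun n =>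
    ⟨ε / (n + 1) / 2, ε / (n + 1), by positivity, half_lt_self (by positivity)⟩
  have hout : ∀ n, (φ n).rOut ≤ ε := fun n => div_le_self hε.le (by simp)
  let fn : ℕ → XT N → ℝ := fun n =>
    MeasureTheory.convolution ((φ n).normed volume) f (ContinuousLinearMap.lsmul ℝ ℝ) volume
  have hfn : ∀ n q, fn n q = ∫ t, (φ n).normed volume t * f (q - t) := fun n q => rfl
  have hzero : ∀ a b, (∀ q, q.2 ∉ Icc a b → f q = 0) →
      ∀ n q, q.2 ∉ Icc (a - ε) (b + ε) → fn n q = 0 := by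
    intro a b hab n q hq
    rw [hfn]
    refine integral_eq_zero_of_ae (Eventually.of_forall fun t => ?_)
    by_cases ht : t ∈ Metric.ball (0 : XT N) (φ n).rOut
    · have h1 : |t.2| ≤ ε := by
        have h2 : ‖t.2‖ ≤ ‖t‖ := norm_snd_le t
        rw [mem_ball_zero_iff] at ht
        rw [← Real.norm_eq_abs]; linarith [hout n]
      have := hab (q - t) fun h => hq (by
        have h3 : (q - t).2 = q.2 - t.2 := rfl
        rw [h3] at h
        have := abs_le.1 h1
        exact ⟨by linarith [h.1], by linarith [h.2]⟩)
      simp [this]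
    · have : t ∉ Function.support ((φ n).normed volume) := by
        rwa [(φ n).support_normed_eq]
      simp [Function.notMem_support.1 this]
  refine ⟨fn, fun n => ⟨?_, ?_, ?_⟩, ?_, hzero, ?_⟩
  · exact ((φ n).hasCompactSupport_normed).contDiff_convolution_left _
      ((φ n).contDiff_normed) hf.locallyIntegrable
  · intro q z
    rw [hfn, hfn]
    congr 1; ext t
    rw [add_sub_right_comm, hf.per]
  · intro q hq
    refine hzero (-R) R (fun x hx => hf.supp x ?_) n q ?_
    · contrapose! hx; exact abs_le.1 hx
    · intro h
      have : |q.2| ≤ R + ε := abs_le.2 ⟨by linarith [h.1], h.2⟩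
      linarith
  · intro n q
    rw [hfn, ← Real.norm_eq_abs]
    refine (norm_integral_le_of_norm_le (((φ n).integrable_normed).mul_const M)
      (Eventually.of_forall fun t => ?_)).trans ?_
    · rw [norm_mul, Real.norm_of_nonneg ((φ n).nonneg_normed t)]
      exact mul_le_mul_of_nonneg_left (hf.bdd _) ((φ n).nonneg_normed t)
    · rw [integral_mul_const, (φ n).integral_normed, one_mul]
  · refine ContDiffBump.ae_convolution_tendsto_right_of_locallyIntegrable (K := 2) ?_
      (Eventually.of_forall fun n => ?_) hf.locallyIntegrable
    · have := (tendsto_one_div_add_atTop_nhds_zero_nat (𝕜 := ℝ)).const_mul ε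
      simpa [φ, div_eq_mul_inv] using this
    · simp only [φ]; linarith

lemma SPc.bpc {f : XT N → ℝ} {M R : ℝ} (hf : SPc f R) (hM : ∀ q, |f q| ≤ M) : BPc f M R :=
  ⟨hf.smooth.continuous.measurable, hf.per, hM, hf.supp⟩

/-- Convolution with an integrable kernel. -/
def cvk (κ f : XT N → ℝ) (q : XT N) : ℝ := ∫ u, κ u * f (q - u)

section
variable {κ f : XT N → ℝ} {M R : ℝ}

lemma BPc.integrable_cvk (hκ : Integrable κ) (hf : BPc f M R) (q : XT N) :
    Integrable (fun u => κ u * f (q - u)) :=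
  hκ.mul_bdd (c := M) (hf.meas.comp (measurable_const.sub measurable_id)).aestronglyMeasurable
    (Eventually.of_forall fun _ => hf.bdd _)

lemma BPc.measurable_cvk (hκ' : Measurable κ) (hf : BPc f M R) : Measurable (cvk κ f) := by
  have : StronglyMeasurable (Function.uncurry fun (q u : XT N) => κ u * f (q - u)) :=
    ((hκ'.comp measurable_snd).mul (hf.meas.comp
      (measurable_fst.sub measurable_snd))).stronglyMeasurable
  exact (this.integral_prod_right (ν := volume)).measurable

lemma BPc.per_cvk (hf : BPc f M R) : PerQ (cvk κ f) := by
  intro q z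
  unfold cvk
  congr 1; ext u
  rw [add_sub_right_comm, hf.per]

lemma BPc.abs_cvk_le (hκ : Integrable κ) (hf : BPc f M R) (q : XT N) :
    |cvk κ f q| ≤ M * ∫ u, |κ u| := by
  rw [← Real.norm_eq_abs]
  refine (norm_integral_le_of_norm_le (hκ.abs.const_mul M)
      (Eventually.of_forall fun t => ?_)).trans ?_
  · rw [norm_mul, mul_comm, Real.norm_eq_abs, Real.norm_eq_abs]
    exact mul_le_mul_of_nonneg_right (hf.bdd _) (abs_nonneg _)
  · rw [integral_const_mul]

/-- Pointwise convergence of convolutions. -/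
lemma tendsto_cvk (hκ : Integrable κ) {fn : ℕ → XT N → ℝ} (hfm : ∀ n, Measurable (fn n))
    (hb : ∀ n q, |fn n q| ≤ M)
    (hlim : ∀ᵐ q, Tendsto (fun n => fn n q) atTop (𝓝 (f q))) (q : XT N) :
    Tendsto (fun n => cvk κ (fn n) q) atTop (𝓝 (cvk κ f q)) := by
  refine tendsto_integral_of_dominated_convergence (fun u => |κ u| * M) (fun n => ?_)
    (hκ.abs.mul_const M) (fun n => Eventually.of_forall fun u => ?_) ?_
  · exact hκ.1.mul ((hfm n).comp (measurable_const.sub measurable_id)).aestronglyMeasurable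
  · rw [norm_mul]
    exact mul_le_mul_of_nonneg_left (hb _ _) (abs_nonneg _)
  · have hmp : MeasurePreserving (fun u : XT N => q - u) volume volume :=
      Measure.measurePreserving_sub_left volume q
    filter_upwards [hmp.quasiMeasurePreserving.ae hlim] with u hu
    exact hu.const_mul _

/-- Fatou closure of `L^r`–`L^q` bounds for convolution operators. -/
lemma cvk_bound_of_approx (hκ : Integrable κ) {fn : ℕ → XT N → ℝ} {R' : ℝ} {r q : ℝ}
    (hr : 0 < r) (hq : 0 < q) {C : ENNReal} (hC : C ≠ ⊤) {D : Set (XT N)}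
    (hfn : ∀ n, BPc (fn n) M R')
    (hlim : ∀ᵐ q, Tendsto (fun n => fn n q) atTop (𝓝 (f q)))
    (hκ' : Measurable κ)
    (hb : ∀ n, ∫⁻ x in D, ‖cvk κ (fn n) x‖ₑ ^ r ≤ C * (∫⁻ x in strip N, ‖fn n x‖ₑ ^ q) ^ (r / q)) :
    ∫⁻ x in D, ‖cvk κ f x‖ₑ ^ r ≤ C * (∫⁻ x in strip N, ‖f x‖ₑ ^ q) ^ (r / q) := by
  have hcont : ∀ {p : ℝ}, 0 < p → ∀ {a : ℕ → ℝ} {b : ℝ}, Tendsto a atTop (𝓝 b) →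
      Tendsto (fun n => ‖a n‖ₑ ^ p) atTop (𝓝 (‖b‖ₑ ^ p)) := by
    intro p hp a b h
    exact (ENNReal.continuous_rpow_const.tendsto _).comp (h.enorm)
  have h1 : ∫⁻ x in D, ‖cvk κ f x‖ₑ ^ r ≤ liminf (fun n => ∫⁻ x in D, ‖cvk κ (fn n) x‖ₑ ^ r) atTop := by
    refine le_trans (le_of_eq ?_) (lintegral_liminf_le fun n =>
      (((hfn n).measurable_cvk hκ').enorm.pow_const r))
    congr 1; ext x
    exact (hcont hr (tendsto_cvk hκ (fun n => (hfn n).meas) (fun n => (hfn n).bdd)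
      hlim x)).liminf_eq.symm
  have h2 : Tendsto (fun n => ∫⁻ x in strip N, ‖fn n x‖ₑ ^ q) atTop
      (𝓝 (∫⁻ x in strip N, ‖f x‖ₑ ^ q)) := by
    refine tendsto_lintegral_of_dominated_convergence
      ((slab N R').indicator fun _ => ENNReal.ofReal M ^ q)
      (fun n => (hfn n).meas.enorm.pow_const q) (fun n => ?_) ?_ ?_
    · filter_upwards [ae_restrict_mem measurableSet_strip] with x hx
      by_cases h : |x.2| ≤ R'
      · rw [indicator_of_mem (show x ∈ slab N R' from ⟨hx, h⟩)]
        gcongr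
        rw [← ofReal_norm]
        exact ENNReal.ofReal_le_ofReal ((hfn n).bdd x)
      · rw [(hfn n).supp x (not_le.1 h)]
        simp [hq]
    · rw [lintegral_indicator (measurableSet_slab _), lintegral_const]
      refine ENNReal.mul_ne_top (by simp [hq.le]) ?_
      rw [Measure.restrict_apply_univ]
      exact ((Measure.restrict_apply_le _ _).trans_lt (volume_slab_lt_top _)).ne
    · filter_upwards [ae_restrict_of_ae hlim] with x hx
      exact hcont hq hx
  have h3 : Tendsto (fun n => C * (∫⁻ x in strip N, ‖fn n x‖ₑ ^ q) ^ (r / q)) atTop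
      (𝓝 (C * (∫⁻ x in strip N, ‖f x‖ₑ ^ q) ^ (r / q))) :=
    ENNReal.Tendsto.const_mul ((ENNReal.continuous_rpow_const.tendsto _).comp h2) (Or.inr hC)
  rw [← h3.liminf_eq]
  exact h1.trans (liminf_le_liminf (Eventually.of_forall hb))

end

/-- The corner of the parabolic dyadic box of generation `n` containing `q`. -/
def cor (n : ℕ) (q : XT N) : XT N :=
  (fun i => (⌊(2:ℝ) ^ n * q.1 i⌋ : ℝ) / 2 ^ n, (⌊(4:ℝ) ^ n * q.2⌋ : ℝ) / 4 ^ n)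

lemma cor_eq_iff {n : ℕ} {z w : XT N} : cor n z = cor n w ↔
    (∀ i, ⌊(2:ℝ) ^ n * z.1 i⌋ = ⌊(2:ℝ) ^ n * w.1 i⌋) ∧ ⌊(4:ℝ) ^ n * z.2⌋ = ⌊(4:ℝ) ^ n * w.2⌋ := by
  simp [cor, Prod.ext_iff, funext_iff, div_left_inj']

lemma measurable_cor (n : ℕ) : Measurable (cor (N := N) n) := by
  refine Measurable.prodMk (measurable_pi_lambda _ fun i => ?_) ?_
  · exact ((measurable_from_top (f := fun k : ℤ => (k : ℝ))).comp
      (Int.measurable_floor.comp ((measurable_pi_apply i).comp measurable_fst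
        |>.const_mul _))).div_const _
  · exact ((measurable_from_top (f := fun k : ℤ => (k : ℝ))).comp
      (Int.measurable_floor.comp (measurable_snd.const_mul _))).div_const _

lemma floor_pow_succ_eq {b : ℕ} (hb : 0 < b) {n : ℕ} {x y : ℝ}
    (h : ⌊(b:ℝ) ^ (n + 1) * x⌋ = ⌊(b:ℝ) ^ (n + 1) * y⌋) : ⌊(b:ℝ) ^ n * x⌋ = ⌊(b:ℝ) ^ n * y⌋ := by
  have e : ∀ x : ℝ, ⌊(b:ℝ) ^ n * x⌋ = ⌊(b:ℝ) ^ (n + 1) * x⌋ / (b:ℤ) := by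
    intro x
    rw [← Int.floor_div_natCast]
    congr 1
    field_simp
    ring
  rw [e, e, h]

lemma cor_succ {n : ℕ} {z w : XT N} (h : cor (n + 1) z = cor (n + 1) w) : cor n z = cor n w := by
  rw [cor_eq_iff] at h ⊢
  refine ⟨fun i => ?_, ?_⟩
  · exact floor_pow_succ_eq (b := 2) two_pos (by exact_mod_cast h.1 i)
  · exact floor_pow_succ_eq (b := 4) four_pos (by exact_mod_cast h.2)

lemma cor_mono {i j : ℕ} (hij : i ≤ j) {z w : XT N} (h : cor j z = cor j w) :
    cor i z = cor i w := by
  induction j, hij using Nat.le_induction with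
  | base => exact h
  | succ k hk ih => exact ih (cor_succ h)

lemma cor_add_latHom (n : ℕ) (q : XT N) (k : Fin N → ℤ) :
    cor n (q + latHom N k) = cor n q + latHom N k := by
  have : ∀ i, ⌊(2:ℝ) ^ n * (q.1 i + k i)⌋ = ⌊(2:ℝ) ^ n * q.1 i⌋ + 2 ^ n * k i := by
    intro i
    rw [mul_add, show (2:ℝ) ^ n * (k i : ℝ) = ((2 ^ n * k i : ℤ) : ℝ) by push_cast; ring,
      Int.floor_add_intCast]
  ext i
  · change (⌊(2:ℝ) ^ n * (q.1 i + k i)⌋ : ℝ) / 2 ^ n = (⌊(2:ℝ) ^ n * q.1 i⌋ : ℝ) / 2 ^ n + k i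
    rw [this]; push_cast; field_simp
  · change (⌊(4:ℝ) ^ n * (q.2 + 0)⌋ : ℝ) / 4 ^ n = (⌊(4:ℝ) ^ n * q.2⌋ : ℝ) / 4 ^ n + 0
    simp

lemma floor_mul_div_mem {c x : ℝ} (hc : 0 < c) : 0 ≤ x - ⌊c * x⌋ / c ∧ x - ⌊c * x⌋ / c ≤ c⁻¹ := by
  have h1 := Int.floor_le (c * x)
  have h2 := Int.lt_floor_add_one (c * x)
  constructor
  · rw [sub_nonneg, div_le_iff₀ hc]; linarith
  · rw [inv_eq_one_div, sub_le_iff_le_add, ← add_div, le_div_iff₀ hc]; linarith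

lemma sub_cor_fst (n : ℕ) (q : XT N) (i : Fin N) :
    0 ≤ (q - cor n q).1 i ∧ (q - cor n q).1 i ≤ ((2:ℝ) ^ n)⁻¹ :=
  floor_mul_div_mem (by positivity)

lemma sub_cor_snd (n : ℕ) (q : XT N) :
    0 ≤ (q - cor n q).2 ∧ (q - cor n q).2 ≤ ((4:ℝ) ^ n)⁻¹ :=
  floor_mul_div_mem (by positivity)

/-- Inverse volume of the boxes of generation `n`. -/
def bdens (N n : ℕ) : ℝ := (2 ^ n) ^ N * 4 ^ n

lemma bdens_pos (n : ℕ) : 0 < bdens N n := by unfold bdens; positivity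

lemma bdens_succ (n : ℕ) : bdens N (n + 1) = 2 ^ (N + 2) * bdens N n := by
  unfold bdens
  rw [pow_succ (2:ℝ) n, mul_pow, pow_succ (4:ℝ) n, pow_add]; ring

lemma measurableSet_box (n : ℕ) (z : XT N) : MeasurableSet {w | cor n z = cor n w} :=
  measurableSet_eq_fun measurable_const (measurable_cor n)

lemma volume_box (n : ℕ) (z : XT N) :
    volume {w : XT N | cor n z = cor n w} = ENNReal.ofReal (bdens N n)⁻¹ := by
  have e : {w : XT N | cor n z = cor n w} =
      (Set.univ.pi fun i => Ico (⌊(2:ℝ) ^ n * z.1 i⌋ / 2 ^ n : ℝ) ((⌊(2:ℝ) ^ n * z.1 i⌋ + 1) / 2 ^ n)) ×ˢ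
        Ico (⌊(4:ℝ) ^ n * z.2⌋ / 4 ^ n : ℝ) ((⌊(4:ℝ) ^ n * z.2⌋ + 1) / 4 ^ n) := by
    have key : ∀ (c x : ℝ) (k : ℤ), 0 < c → (k = ⌊c * x⌋ ↔ x ∈ Ico (k / c : ℝ) ((k + 1) / c)) := by
      intro c x k hc
      rw [eq_comm, Int.floor_eq_iff, mem_Ico, div_le_iff₀ hc, lt_div_iff₀ hc, mul_comm x]
    ext w
    simp only [mem_ofPred_eq, cor_eq_iff, mem_prod, Set.mem_pi, mem_univ, true_implies]
    rw [key _ _ _ (by positivity)]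
    simp_rw [key ((2:ℝ) ^ n) _ _ (by positivity)]
  rw [e, Measure.volume_eq_prod, Measure.prod_prod, Real.volume_pi_Ico, Real.volume_Ico]
  have e1 : ∀ (c : ℝ) (k : ℤ), ((k + 1) / c - k / c : ℝ) = c⁻¹ := fun c k => by
    rw [← sub_div]; simp
  simp_rw [e1]
  rw [Finset.prod_const, Finset.card_univ, Fintype.card_fin, ← ENNReal.ofReal_pow (by positivity),
    ← ENNReal.ofReal_mul (by positivity)]
  congr 1
  unfold bdens
  rw [mul_inv, inv_pow]

open Classical in
/-- The averaging kernel of generation `n`. -/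
def pk (n : ℕ) (z w : XT N) : ℝ := if cor n z = cor n w then bdens N n else 0

lemma pk_nonneg (n : ℕ) (z w : XT N) : 0 ≤ pk n z w := by
  unfold pk; split_ifs; exacts [(bdens_pos n).le, le_rfl]

lemma pk_symm (n : ℕ) (z w : XT N) : pk n z w = pk n w z := by
  unfold pk; simp only [eq_comm]

lemma pk_congr {n : ℕ} {z z' : XT N} (h : cor n z = cor n z') (w : XT N) : pk n z w = pk n z' w := by
  unfold pk; rw [h]

lemma measurable_pk (n : ℕ) : Measurable (Function.uncurry (pk (N := N) n)) := by
  refine Measurable.ite ?_ measurable_const measurable_const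
  exact measurableSet_eq_fun ((measurable_cor n).comp measurable_fst)
    ((measurable_cor n).comp measurable_snd)

lemma measurable_pk_right (n : ℕ) (z : XT N) : Measurable fun w => pk n z w :=
  (measurable_pk n).of_uncurry_left

lemma pk_latHom (n : ℕ) (z w : XT N) (k : Fin N → ℤ) :
    pk n (z + latHom N k) (w + latHom N k) = pk n z w := by
  unfold pk; simp only [cor_add_latHom, add_left_inj]

lemma pk_succ_le (n : ℕ) (z w : XT N) : pk (n + 1) z w ≤ 2 ^ (N + 2) * pk n z w := by
  by_cases h : cor (n + 1) z = cor (n + 1) w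
  · simp [pk, h, cor_succ h, bdens_succ]
  · simp only [pk, h, if_false]
    exact mul_nonneg (by positivity) (pk_nonneg n z w)

lemma lintegral_pk (n : ℕ) (z : XT N) : ∫⁻ w, ENNReal.ofReal (pk n z w) = 1 := by
  have e : (fun w => ENNReal.ofReal (pk n z w)) =
      {w | cor n z = cor n w}.indicator fun _ => ENNReal.ofReal (bdens N n) := by
    ext w
    by_cases h : cor n z = cor n w
    · rw [indicator_of_mem (by exact h)]; simp [pk, h]
    · rw [indicator_of_notMem (by exact h)]; simp [pk, h]
  rw [e, lintegral_indicator_const (measurableSet_box n z), volume_box, 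
    ← ENNReal.ofReal_mul (bdens_pos n).le, mul_inv_cancel₀ (bdens_pos n).ne', ENNReal.ofReal_one]

/-- Dyadic averages of `|f|`. -/
def avAbs (f : XT N → ℝ) (n : ℕ) (z : XT N) : ENNReal := ∫⁻ w, ENNReal.ofReal (pk n z w) * ‖f w‖ₑ

/-- Dyadic averages of `f`. -/
def avR (f : XT N → ℝ) (n : ℕ) (z : XT N) : ℝ := ∫ w, pk n z w * f w

section
variable {f : XT N → ℝ}

lemma measurable_avAbs (hf : Measurable f) (n : ℕ) : Measurable (avAbs f n) := by
  refine Measurable.lintegral_prod_right' (f := fun p : XT N × XT N =>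
    ENNReal.ofReal (pk n p.1 p.2) * ‖f p.2‖ₑ) ?_
  exact (measurable_pk n).ennreal_ofReal.mul (hf.comp measurable_snd).enorm

lemma measurable_avR (hf : Measurable f) (n : ℕ) : Measurable (avR f n) := by
  have : StronglyMeasurable (Function.uncurry fun (q u : XT N) => pk n q u * f u) :=
    ((measurable_pk n).mul (hf.comp measurable_snd)).stronglyMeasurable
  exact (this.integral_prod_right (ν := volume)).measurable

lemma enorm_avR_le (n : ℕ) (z : XT N) : ‖avR f n z‖ₑ ≤ avAbs f n z := by
  refine (enorm_integral_le_lintegral_enorm _).trans (le_of_eq ?_)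
  unfold avAbs
  congr 1; ext w
  rw [enorm_mul, ← ofReal_norm, Real.norm_of_nonneg (pk_nonneg n z w)]

lemma avAbs_congr {n : ℕ} {z w : XT N} (h : cor n z = cor n w) : avAbs f n z = avAbs f n w := by
  unfold avAbs; simp_rw [pk_congr h]

lemma avR_congr {n : ℕ} {z w : XT N} (h : cor n z = cor n w) : avR f n z = avR f n w := by
  unfold avR; simp_rw [pk_congr h]

lemma avAbs_succ_le (n : ℕ) (z : XT N) : avAbs f (n + 1) z ≤ 2 ^ (N + 2) * avAbs f n z := by
  unfold avAbs
  rw [← lintegral_const_mul' _ _ (by finiteness)]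
  refine lintegral_mono fun w => ?_
  rw [← mul_assoc]
  gcongr
  refine (ENNReal.ofReal_le_ofReal (pk_succ_le n z w)).trans (le_of_eq ?_)
  rw [ENNReal.ofReal_mul (by positivity), ENNReal.ofReal_pow (by norm_num)]; simp

lemma per_avAbs (hf : PerQ f) (n : ℕ) : PerQ (avAbs f n) := by
  intro q k
  unfold avAbs
  rw [← lintegral_add_right_eq_self _ (latHom N k)]
  simp_rw [pk_latHom, hf _ k]

lemma per_avR (hf : PerQ f) (n : ℕ) : PerQ (avR f n) := by
  intro q k
  unfold avR
  rw [← integral_add_right_eq_self _ (latHom N k)]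
  simp_rw [pk_latHom, hf _ k]

lemma avAbs_le_of_bdd {M : ENNReal} (hM : ∀ q, ‖f q‖ₑ ≤ M) (n : ℕ) (z : XT N) : avAbs f n z ≤ M := by
  calc avAbs f n z ≤ ∫⁻ w, ENNReal.ofReal (pk n z w) * M := by
        unfold avAbs; gcongr with w; exact hM w
    _ = M := by
      rw [lintegral_mul_const _ (measurable_pk_right n z).ennreal_ofReal, lintegral_pk, one_mul]

lemma avAbs_of_const {n : ℕ} (hf : ∀ q, f (cor n q) = f q) (z : XT N) : avAbs f n z = ‖f z‖ₑ := by
  calc avAbs f n z = ∫⁻ w, ENNReal.ofReal (pk n z w) * ‖f z‖ₑ := by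
        unfold avAbs
        congr 1; ext w
        by_cases h : cor n z = cor n w
        · rw [← hf w, ← h, hf]
        · simp [pk, h]
    _ = _ := by
      rw [lintegral_mul_const _ (measurable_pk_right n z).ennreal_ofReal, lintegral_pk, one_mul]

lemma avAbs_zero_le (hf : PerQ f) (z : XT N) : avAbs f 0 z ≤ ∫⁻ w in strip N, ‖f w‖ₑ := by
  set k : Fin N → ℤ := fun i => -⌊z.1 i⌋
  have hmp := measurePreserving_add_right (volume : Measure (XT N)) (latHom N k)
  calc avAbs f 0 z ≤ ∫⁻ w in (fun w => w + latHom N k) ⁻¹' strip N, ‖f (w + latHom N k)‖ₑ := by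
        rw [← lintegral_indicator (measurableSet_strip.preimage hmp.measurable)]
        refine lintegral_mono fun w => ?_
        by_cases h : cor 0 z = cor 0 w
        · have hw : w ∈ (fun w => w + latHom N k) ⁻¹' strip N := by
            intro i
            have h1 := (cor_eq_iff.1 h).1 i
            simp only [pow_zero, one_mul] at h1
            change w.1 i + ((-⌊z.1 i⌋ : ℤ) : ℝ) ∈ Ico (0:ℝ) 1
            rw [h1]; push_cast
            exact ⟨by linarith [Int.floor_le (w.1 i)], by linarith [Int.lt_floor_add_one (w.1 i)]⟩
          rw [indicator_of_mem hw, hf]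
          simp [pk, h, bdens]
        · simp [pk, h]
    _ = _ := by
      rw [hmp.setLIntegral_comp_preimage_emb (MeasurableEquiv.addRight _).measurableEmbedding
        (fun w => ‖f w‖ₑ)]

/-- Averaging preserves integrals over saturated sets. -/
lemma lintegral_indicator_avAbs (hf : Measurable f) (hper : PerQ f) {n : ℕ} {P : Set (XT N)}
    (hP : MeasurableSet P) (hPper : ∀ q k, q + latHom N k ∈ P ↔ q ∈ P)
    (hsat : ∀ z w, cor n z = cor n w → (z ∈ P ↔ w ∈ P)) :
    ∫⁻ z in strip N, P.indicator (avAbs f n) z = ∫⁻ z in strip N, P.indicator (fun z => ‖f z‖ₑ) z := by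
  classical
  have e1 : ∀ z, P.indicator (avAbs f n) z =
      ∫⁻ w, P.indicator 1 z * (ENNReal.ofReal (pk n z w) * ‖f w‖ₑ) := by
    intro z
    by_cases h : z ∈ P <;> simp [h, avAbs]
  have hm : Measurable (Function.uncurry fun z w : XT N =>
      (P.indicator 1 z : ENNReal) * (ENNReal.ofReal (pk n z w) * ‖f w‖ₑ)) :=
    ((measurable_one.indicator hP).comp measurable_fst).mul
      ((measurable_pk n).ennreal_ofReal.mul (hf.comp measurable_snd).enorm)
  simp_rw [e1]
  rw [lintegral_unfold_swap hm]
  · congr 1; ext z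
    have e2 : ∀ x, (P.indicator 1 x : ENNReal) * (ENNReal.ofReal (pk n x z) * ‖f z‖ₑ) =
        ENNReal.ofReal (pk n z x) * P.indicator (fun z => ‖f z‖ₑ) z := by
      intro x
      by_cases h : cor n x = cor n z
      · by_cases hz : z ∈ P
        · simp [(hsat x z h).2 hz, hz, pk_symm n x z]
        · have : x ∉ P := fun hx => hz ((hsat x z h).1 hx)
          simp [this, hz]
      · simp [pk, h, Ne.symm h]
    simp_rw [e2]
    rw [lintegral_mul_const _ (measurable_pk_right n z).ennreal_ofReal, lintegral_pk, one_mul]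
  · intro x z k
    have : (P.indicator 1 (x + latHom N k) : ENNReal) = P.indicator 1 x := by
      by_cases h : x ∈ P
      · simp [h, (hPper x k).2 h]
      · simp [h, mt (hPper x k).1 h]
    rw [this, pk_latHom, hper]

end

/-- Enlarged parabolic boxes around the origin. -/
def Bn (N n : ℕ) : Set (XT N) :=
  (Set.univ.pi fun _ => Icc (-(2 * ((2:ℝ) ^ n)⁻¹)) (2 * ((2:ℝ) ^ n)⁻¹)) ×ˢ
    Icc (-(4 * ((4:ℝ) ^ n)⁻¹)) (4 * ((4:ℝ) ^ n)⁻¹)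

lemma measurableSet_Bn (n : ℕ) : MeasurableSet (Bn N n) :=
  (MeasurableSet.univ_pi fun _ => measurableSet_Icc).prod measurableSet_Icc

lemma bdens_mul_volume_Bn (n : ℕ) :
    ENNReal.ofReal (bdens N n) * volume (Bn N n) = ENNReal.ofReal (4 ^ N * 8) := by
  rw [Bn, Measure.volume_eq_prod, Measure.prod_prod, volume_pi_pi, Real.volume_Icc, Real.volume_Icc,
    Finset.prod_const, Finset.card_univ, Fintype.card_fin,
    ← ENNReal.ofReal_pow (by rw [sub_neg_eq_add]; positivity),
    ← ENNReal.ofReal_mul (by rw [sub_neg_eq_add]; positivity), ← ENNReal.ofReal_mul (bdens_pos n).le]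
  congr 1
  have e1 : (2 * ((2:ℝ) ^ n)⁻¹ - -(2 * ((2:ℝ) ^ n)⁻¹)) = 4 * ((2:ℝ) ^ n)⁻¹ := by ring
  have e2 : (4 * ((4:ℝ) ^ n)⁻¹ - -(4 * ((4:ℝ) ^ n)⁻¹)) = 8 * ((4:ℝ) ^ n)⁻¹ := by ring
  rw [e1, e2, mul_pow, bdens, inv_pow]
  field_simp

/-- Hörmander's condition at the parabolic dyadic scales. -/
def HorC (κ : XT N → ℝ) (C : ENNReal) : Prop :=
  ∀ (n : ℕ) (h : XT N), (∀ i, 0 ≤ h.1 i ∧ h.1 i ≤ ((2:ℝ) ^ n)⁻¹) →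
    0 ≤ h.2 ∧ h.2 ≤ ((4:ℝ) ^ n)⁻¹ → ∫⁻ u in (Bn N n)ᶜ, ‖κ (u - h) - κ u‖ₑ ≤ C

lemma integral_pk (n : ℕ) (z : XT N) : ∫ w, pk n z w = 1 := by
  rw [integral_eq_lintegral_of_nonneg_ae (Eventually.of_forall fun w => pk_nonneg n z w)
    (measurable_pk_right n z).aestronglyMeasurable, lintegral_pk, ENNReal.toReal_one]

lemma integrable_pk (n : ℕ) (z : XT N) : Integrable fun w => pk n z w := by
  by_contra h
  simpa [integral_undef h] using integral_pk n z

lemma BPc.integrable_pk_mul {f : XT N → ℝ} {M R : ℝ} (hf : BPc f M R) (n : ℕ) (z : XT N) :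
    Integrable fun w => pk n z w * f w :=
  (integrable_pk n z).mul_bdd (c := M) hf.meas.aestronglyMeasurable
    (Eventually.of_forall fun w => hf.bdd w)

section
variable {f : XT N → ℝ} {M R : ℝ} {P : Set (XT N)} {n : ℕ}

/-- Localised mean-zero part. -/
def badPart (f : XT N → ℝ) (P : Set (XT N)) (n : ℕ) : XT N → ℝ :=
  P.indicator fun z => f z - avR f n z

lemma BPc.avR_badPart (hf : BPc f M R) (hsat : ∀ z w, cor n z = cor n w → (z ∈ P ↔ w ∈ P))
    (w : XT N) : avR (badPart f P n) n w = 0 := by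
  unfold avR
  by_cases hw : w ∈ P
  · have e : ∀ z, pk n w z * badPart f P n z = pk n w z * f z - pk n w z * avR f n w := by
      intro z
      by_cases h : cor n w = cor n z
      · rw [badPart, indicator_of_mem ((hsat w z h).1 hw), ← avR_congr h]; ring
      · simp [pk, h]
    simp_rw [e]
    rw [integral_sub (hf.integrable_pk_mul n w) ((integrable_pk n w).mul_const _),
      integral_mul_const, integral_pk, one_mul]
    exact sub_self _
  · have e : ∀ z, pk n w z * badPart f P n z = 0 := by
      intro z
      by_cases h : cor n w = cor n z
      · rw [badPart, indicator_of_notMem (fun hz => hw ((hsat w z h).2 hz)), mul_zero]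
      · simp [pk, h]
    simp [e]

lemma integral_cor_mul_eq_zero {b g : XT N → ℝ} (hb : Measurable b) (hg : Measurable g)
    (h0 : ∀ w, avR b n w = 0)
    (hin : Integrable fun z => g (cor n z) * b z) : ∫ z, g (cor n z) * b z = 0 := by
  have hm : Measurable fun p : XT N × XT N => pk n p.1 p.2 * (g (cor n p.1) * b p.1) :=
    (measurable_pk n).mul (((hg.comp (measurable_cor n)).comp measurable_fst).mul
      (hb.comp measurable_fst))
  have hI : Integrable (Function.uncurry fun z w : XT N => pk n z w * (g (cor n z) * b z))
      (volume.prod volume) := by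
    refine (integrable_prod_iff hm.aestronglyMeasurable).2 ?_
    refine ⟨Eventually.of_forall fun z => (integrable_pk n z).mul_const (g (cor n z) * b z), ?_⟩
    refine hin.norm.congr (Eventually.of_forall fun z => ?_)
    have : ∀ w, ‖Function.uncurry (fun z w : XT N => pk n z w * (g (cor n z) * b z)) (z, w)‖
        = pk n z w * ‖g (cor n z) * b z‖ := fun w => by
      simp only [Function.uncurry, norm_mul, Real.norm_of_nonneg (pk_nonneg n z w)]
    refine Eq.trans ?_ (integral_congr_ae (Eventually.of_forall this)).symm
    rw [integral_mul_const, integral_pk, one_mul]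
  calc ∫ z, g (cor n z) * b z = ∫ z, ∫ w, pk n z w * (g (cor n z) * b z) := by
        simp_rw [integral_mul_const, integral_pk, one_mul]
    _ = ∫ w, ∫ z, pk n z w * (g (cor n z) * b z) := integral_integral_swap hI
    _ = ∫ w, g (cor n w) * avR b n w := by
        congr 1; ext w
        rw [avR, ← integral_const_mul]
        congr 1; ext z
        by_cases h : cor n z = cor n w
        · rw [pk_symm, h]; ring
        · simp [pk, h, Ne.symm h]
    _ = 0 := by simp [h0]

lemma BPc.bpc_badPart (hf : BPc f M R) (hP : MeasurableSet P)
    (hPper : ∀ q k, q + latHom N k ∈ P ↔ q ∈ P)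
    (hPs : ∀ q ∈ P, |q.2| ≤ R) : BPc (badPart f P n) (2 * M) R where
  meas := (hf.meas.sub (measurable_avR hf.meas n)).indicator hP
  per q k := by
    by_cases h : q ∈ P
    · rw [badPart, indicator_of_mem h, indicator_of_mem ((hPper q k).2 h), hf.per,
        per_avR hf.per]
    · rw [badPart, indicator_of_notMem h, indicator_of_notMem (mt (hPper q k).1 h)]
  bdd q := by
    have hM : 0 ≤ M := (abs_nonneg _).trans (hf.bdd q)
    by_cases h : q ∈ P
    · rw [badPart, indicator_of_mem h]
      have h2 : |avR f n q| ≤ M := by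
        have h3 := (enorm_avR_le (f := f) n q).trans (avAbs_le_of_bdd (M := ENNReal.ofReal M) (fun w => by
          rw [← ofReal_norm]; exact ENNReal.ofReal_le_ofReal (hf.bdd w)) n q)
        rw [← ofReal_norm] at h3
        exact (ENNReal.ofReal_le_ofReal_iff hM).1 h3
      exact (abs_sub _ _).trans (by linarith [hf.bdd q])
    · rw [badPart, indicator_of_notMem h, abs_zero]; linarith
  supp q hq := indicator_of_notMem (fun h => absurd (hPs q h) (not_le.2 hq)) _

lemma lintegral_badPart_le (hf : BPc f M R) (hP : MeasurableSet P)
    (hPper : ∀ q k, q + latHom N k ∈ P ↔ q ∈ P)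
    (hsat : ∀ z w, cor n z = cor n w → (z ∈ P ↔ w ∈ P)) :
    ∫⁻ z in strip N, ‖badPart f P n z‖ₑ ≤
      2 * ∫⁻ z in strip N, P.indicator (fun z => ‖f z‖ₑ) z := by
  calc ∫⁻ z in strip N, ‖badPart f P n z‖ₑ
      ≤ ∫⁻ z in strip N, (P.indicator (fun z => ‖f z‖ₑ) z + P.indicator (avAbs f n) z) := by
        refine lintegral_mono fun z => ?_
        by_cases h : z ∈ P
        · simp only [badPart, indicator_of_mem h]
          exact (enorm_sub_le).trans (add_le_add le_rfl (enorm_avR_le n z))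
        · simp [badPart, h]
    _ = _ := by
        rw [lintegral_add_left (hf.meas.enorm.indicator hP), lintegral_indicator_avAbs hf.meas hf.per
          hP hPper hsat, two_mul]

/-- The part of space-time close to the saturated set `P`. -/
def nearSet (P : Set (XT N)) (n : ℕ) : Set (XT N) :=
  {x | 1 ≤ ∫⁻ z, P.indicator 1 z * ((Bn N n).indicator 1 (x - cor n z) * ENNReal.ofReal (bdens N n))}

lemma measurable_near (hP : MeasurableSet P) : Measurable (Function.uncurry fun x z : XT N =>
    (P.indicator 1 z * ((Bn N n).indicator 1 (x - cor n z) * ENNReal.ofReal (bdens N n)) : ENNReal)) :=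
  ((measurable_one.indicator hP).comp measurable_snd).mul
    (((measurable_one.indicator (measurableSet_Bn n)).comp
      (measurable_fst.sub ((measurable_cor n).comp measurable_snd))).mul_const _)

lemma measurableSet_nearSet (hP : MeasurableSet P) : MeasurableSet (nearSet P n) :=
  measurableSet_le measurable_const ((measurable_near hP).lintegral_prod_right' (ν := volume))

lemma mem_nearSet (hsat : ∀ z w, cor n z = cor n w → (z ∈ P ↔ w ∈ P)) {x z : XT N} (hz : z ∈ P)
    (hx : x - cor n z ∈ Bn N n) : x ∈ nearSet P n := by
  rw [nearSet, mem_ofPred_eq, ← lintegral_pk n z]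
  refine lintegral_mono fun w => ?_
  by_cases h : cor n z = cor n w
  · rw [indicator_of_mem ((hsat z w h).1 hz), ← h, indicator_of_mem hx]
    simp [pk, h]
  · simp [pk, h]

lemma volume_nearSet_le (hP : MeasurableSet P)
    (hPper : ∀ q k, q + latHom N k ∈ P ↔ q ∈ P) :
    volume (strip N ∩ nearSet P n) ≤ ENNReal.ofReal (4 ^ N * 8) * volume (strip N ∩ P) := by
  have h1 := mul_meas_ge_le_lintegral (μ := volume.restrict (strip N))
    ((measurable_near (n := n) hP).lintegral_prod_right' (ν := volume)) 1
  rw [one_mul] at h1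
  change volume.restrict (strip N) (nearSet P n) ≤ _ at h1
  rw [Measure.restrict_apply (measurableSet_nearSet hP), inter_comm] at h1
  refine h1.trans ?_
  have hsw := lintegral_unfold_swap (measurable_near (n := n) hP) (fun x z k => by
    rw [cor_add_latHom, add_sub_add_right_eq_sub]
    congr 1
    by_cases h : z ∈ P
    · rw [indicator_of_mem h, indicator_of_mem ((hPper z k).2 h), Pi.one_apply, Pi.one_apply]
    · rw [indicator_of_notMem h, indicator_of_notMem (mt (hPper z k).1 h)])
  refine (hsw.trans_le ?_)
  have e : ∀ z, ∫⁻ x, P.indicator 1 z * ((Bn N n).indicator 1 (x - cor n z) * ENNReal.ofReal (bdens N n))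
      = ENNReal.ofReal (4 ^ N * 8) * P.indicator 1 z := by
    intro z
    have hm : Measurable fun x : XT N => (Bn N n).indicator (1 : XT N → ENNReal) (x - cor n z) :=
      (measurable_one.indicator (measurableSet_Bn n)).comp (measurable_id.sub_const _)
    rw [lintegral_const_mul _ (hm.mul_const _), lintegral_mul_const _ hm,
      lintegral_sub_right_eq_self (fun x => (Bn N n).indicator 1 x) (cor n z),
      lintegral_indicator_one (measurableSet_Bn n), mul_comm (volume _), bdens_mul_volume_Bn, mul_comm]
  simp_rw [e]
  rw [lintegral_const_mul _ (measurable_one.indicator hP), lintegral_indicator_one hP,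
    Measure.restrict_apply hP, inter_comm]

lemma lintegral_cvk_badPart_le {κ : XT N → ℝ} {C : ENNReal} (hκ : Integrable κ) (hκ' : Measurable κ)
    (hC : HorC κ C) (hf : BPc f M R) (hP : MeasurableSet P)
    (hPper : ∀ q k, q + latHom N k ∈ P ↔ q ∈ P) (hPs : ∀ q ∈ P, |q.2| ≤ R)
    (hsat : ∀ z w, cor n z = cor n w → (z ∈ P ↔ w ∈ P)) :
    ∫⁻ x in strip N ∩ (nearSet P n)ᶜ, ‖cvk κ (badPart f P n) x‖ₑ ≤
      C * ∫⁻ z in strip N, ‖badPart f P n z‖ₑ := by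
  have hb := hf.bpc_badPart (n := n) hP hPper hPs
  set b := badPart f P n with hbdef
  have hb0 : ∀ z ∉ P, b z = 0 := fun z hz => indicator_of_notMem hz _
  let F : XT N → XT N → ENNReal := fun x z =>
    (Bn N n)ᶜ.indicator 1 (x - cor n z) * ‖κ (x - z) - κ (x - cor n z)‖ₑ * ‖b z‖ₑ
  have hcor : Measurable fun p : XT N × XT N => p.1 - cor n p.2 :=
    measurable_fst.sub ((measurable_cor n).comp measurable_snd)
  have hF : Measurable (Function.uncurry F) :=
    (((measurable_one.indicator (measurableSet_Bn n).compl).comp hcor).mul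
      ((hκ'.comp (measurable_fst.sub measurable_snd)).sub (hκ'.comp hcor)).enorm).mul
      (hb.meas.comp measurable_snd).enorm
  have key : ∀ x ∉ nearSet P n, ‖cvk κ b x‖ₑ ≤ ∫⁻ z, F x z := by
    intro x hx
    have hFx : ∀ z, F x z = ‖κ (x - z) * b z - κ (x - cor n z) * b z‖ₑ := by
      intro z
      by_cases hz : z ∈ P
      · have : x - cor n z ∈ (Bn N n)ᶜ := fun h => hx (mem_nearSet hsat hz h)
        simp only [F, indicator_of_mem this, ← sub_mul, enorm_mul, Pi.one_apply, one_mul]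
      · simp [F, hb0 z hz]
    have e1 : cvk κ b x = ∫ z, κ (x - z) * b z := by
      unfold cvk
      rw [← integral_sub_left_eq_self _ _ x]
      simp
    have i1 : Integrable fun z => κ (x - z) * b z := by
      have := (hb.integrable_cvk hκ x).comp_sub_left x
      simpa using this
    by_cases htop : ∫⁻ z, F x z = ⊤
    · rw [htop]; exact le_top
    have i2 : Integrable fun z => κ (x - z) * b z - κ (x - cor n z) * b z := by
      refine ⟨?_, ?_⟩
      · exact (((hκ'.comp (measurable_const.sub measurable_id)).mul hb.meas).sub
          ((hκ'.comp (measurable_const.sub (measurable_cor n))).mul hb.meas)).aestronglyMeasurable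
      · rw [hasFiniteIntegral_iff_enorm]
        simp_rw [← hFx]
        exact lt_top_iff_ne_top.2 htop
    have i3 : Integrable fun z => κ (x - cor n z) * b z := by
      refine (i1.sub i2).congr (Eventually.of_forall fun z => ?_)
      simp
    have e3 := integral_cor_mul_eq_zero (n := n) hb.meas (g := fun w => κ (x - w))
      (hκ'.comp (measurable_const.sub measurable_id)) (hf.avR_badPart hsat) i3
    have e4 : cvk κ b x = ∫ z, (κ (x - z) * b z - κ (x - cor n z) * b z) := by
      rw [integral_sub i1 i3, e3, sub_zero, e1]
    rw [e4]
    simp_rw [hFx]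
    exact enorm_integral_le_lintegral_enorm _
  calc ∫⁻ x in strip N ∩ (nearSet P n)ᶜ, ‖cvk κ b x‖ₑ
      ≤ ∫⁻ x in strip N ∩ (nearSet P n)ᶜ, ∫⁻ z, F x z :=
        setLIntegral_mono' (measurableSet_strip.inter (measurableSet_nearSet hP).compl)
          fun x hx => key x hx.2
    _ ≤ ∫⁻ x in strip N, ∫⁻ z, F x z := lintegral_mono_set inter_subset_left
    _ = ∫⁻ z in strip N, ∫⁻ x, F x z := by
        refine lintegral_unfold_swap hF fun x z k => ?_
        simp only [F, cor_add_latHom, add_sub_add_right_eq_sub, hb.per z k]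
    _ ≤ ∫⁻ z in strip N, C * ‖b z‖ₑ := by
        refine lintegral_mono fun z => ?_
        have hmz : Measurable fun x => (Bn N n)ᶜ.indicator (1 : XT N → ENNReal) (x - cor n z) *
            ‖κ (x - z) - κ (x - cor n z)‖ₑ :=
          ((measurable_one.indicator (measurableSet_Bn n).compl).comp (measurable_id.sub_const _)).mul
            ((hκ'.comp (measurable_id.sub_const _)).sub (hκ'.comp (measurable_id.sub_const _))).enorm
        rw [lintegral_mul_const _ hmz]
        gcongr
        refine le_trans (le_of_eq ?_) (hC n (z - cor n z) (sub_cor_fst n z) (sub_cor_snd n z))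
        rw [← lintegral_indicator (measurableSet_Bn n).compl,
          ← lintegral_sub_right_eq_self (fun x => (Bn N n)ᶜ.indicator
            (fun u => ‖κ (u - (z - cor n z)) - κ u‖ₑ) x) (cor n z)]
        congr 1; ext x
        by_cases h : x - cor n z ∈ (Bn N n)ᶜ
        · rw [indicator_of_mem h, indicator_of_mem h, Pi.one_apply, one_mul, sub_sub_sub_cancel_right]
        · rw [indicator_of_notMem h, indicator_of_notMem h, zero_mul]
    _ = _ := by rw [lintegral_const_mul _ hb.meas.enorm]

end

lemma BPc.mono {f : XT N → ℝ} {M R R' : ℝ} (hf : BPc f M R) (h : R ≤ R') : BPc f M R' :=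
  ⟨hf.meas, hf.per, hf.bdd, fun q hq => hf.supp q (h.trans_lt hq)⟩

lemma BPc.sub {f g : XT N → ℝ} {M M' R : ℝ} (hf : BPc f M R) (hg : BPc g M' R) :
    BPc (fun q => f q - g q) (M + M') R where
  meas := hf.meas.sub hg.meas
  per q z := by simp only [hf.per q z, hg.per q z]
  bdd q := (abs_sub _ _).trans (add_le_add (hf.bdd q) (hg.bdd q))
  supp q hq := by simp only [hf.supp q hq, hg.supp q hq, sub_zero]

lemma BPc.sum {ι : Type*} {s : Finset ι} {g : ι → XT N → ℝ} {M R : ℝ}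
    (hg : ∀ i ∈ s, BPc (g i) M R) : BPc (fun q => ∑ i ∈ s, g i q) (s.card * M) R where
  meas := Finset.measurable_fun_sum _ fun i hi => (hg i hi).meas
  per q z := Finset.sum_congr rfl fun i hi => (hg i hi).per q z
  bdd q := (Finset.abs_sum_le_sum_abs _ _).trans
    ((Finset.sum_le_sum fun i hi => (hg i hi).bdd q).trans (by simp))
  supp q hq := Finset.sum_eq_zero fun i hi => (hg i hi).supp q hq

lemma cvk_sub {κ f g : XT N → ℝ} {M M' R R' : ℝ} (hκ : Integrable κ) (hf : BPc f M R)
    (hg : BPc g M' R') (q : XT N) : cvk κ (fun q => f q - g q) q = cvk κ f q - cvk κ g q := by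
  unfold cvk
  rw [← integral_sub (hf.integrable_cvk hκ q) (hg.integrable_cvk hκ q)]
  simp_rw [mul_sub]

lemma cvk_sum {ι : Type*} {s : Finset ι} {κ : XT N → ℝ} {g : ι → XT N → ℝ} {M R : ℝ}
    (hκ : Integrable κ) (hg : ∀ i ∈ s, BPc (g i) M R) (q : XT N) :
    cvk κ (fun q => ∑ i ∈ s, g i q) q = ∑ i ∈ s, cvk κ (g i) q := by
  unfold cvk
  rw [← integral_finsetSum _ fun i hi => (hg i hi).integrable_cvk hκ q]
  simp_rw [Finset.mul_sum]

/-- Points stopped exactly at generation `j`. -/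
def St (f : XT N → ℝ) (L : ENNReal) (j : ℕ) : Set (XT N) :=
  {z | L < avAbs f j z ∧ ∀ i < j, avAbs f i z ≤ L}

section
variable {f : XT N → ℝ} {M R : ℝ} {L : ENNReal} {j : ℕ}

lemma measurableSet_St (hf : Measurable f) : MeasurableSet (St f L j) := by
  have : St f L j = {z | L < avAbs f j z} ∩ ⋂ i, ⋂ (_ : i < j), {z | avAbs f i z ≤ L} := by
    ext z; simp [St]
  rw [this]
  exact (measurableSet_lt measurable_const (measurable_avAbs hf j)).inter
    (MeasurableSet.iInter fun i => MeasurableSet.iInter fun _ =>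
      measurableSet_le (measurable_avAbs hf i) measurable_const)

lemma St_per (hf : PerQ f) (q : XT N) (k : Fin N → ℤ) : q + latHom N k ∈ St f L j ↔ q ∈ St f L j := by
  simp [St, per_avAbs hf _ q k]

lemma St_sat {z w : XT N} (h : cor j z = cor j w) : z ∈ St f L j ↔ w ∈ St f L j := by
  simp only [St, mem_ofPred_eq, avAbs_congr h]
  refine and_congr_right fun _ => forall₂_congr fun i hi => ?_
  rw [avAbs_congr (cor_mono hi.le h)]

lemma St_disj {i : ℕ} {z : XT N} (hi : z ∈ St f L i) (hj : z ∈ St f L j) : i = j := by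
  rcases lt_trichotomy i j with h | h | h
  · exact absurd (hj.2 i h) (not_le.2 hi.1)
  · exact h
  · exact absurd (hi.2 j h) (not_le.2 hj.1)

lemma BPc.avAbs_supp (hf : BPc f M R) {z : XT N} (hz : avAbs f j z ≠ 0) : |z.2| ≤ R + 1 := by
  by_contra hlt
  refine hz ?_
  unfold avAbs
  rw [← lintegral_zero (μ := (volume : Measure (XT N)))]
  congr 1; ext w
  by_cases h : cor j z = cor j w
  · have h1 := sub_cor_snd j z
    have h2 := sub_cor_snd j w
    rw [← h] at h2
    have h4 : ((4:ℝ) ^ j)⁻¹ ≤ 1 := inv_le_one_of_one_le₀ (one_le_pow₀ (by norm_num))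
    have e1 : (z - cor j z).2 = z.2 - (cor j z).2 := rfl
    have e2 : (w - cor j z).2 = w.2 - (cor j z).2 := rfl
    rw [e1] at h1; rw [e2] at h2
    have : |z.2 - w.2| ≤ 1 := by rw [abs_le]; constructor <;> linarith
    have h5 : |z.2| ≤ |w.2| + 1 := by
      have := abs_sub_abs_le_abs_sub z.2 w.2; linarith
    rw [hf.supp w (by linarith)]; simp
  · simp [pk, h]

lemma St_supp (hf : BPc f M R) {q : XT N} (hq : q ∈ St f L j) : |q.2| ≤ R + 1 :=
  hf.avAbs_supp (j := j) (bot_lt_of_lt hq.1).ne'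

lemma avAbs_le_of_mem_St (hf : PerQ f) (hI : ∫⁻ z in strip N, ‖f z‖ₑ ≤ L) {z : XT N}
    (hz : z ∈ St f L j) : avAbs f j z ≤ 2 ^ (N + 2) * L := by
  cases j with
  | zero =>
    refine ((avAbs_zero_le hf z).trans hI).trans ?_
    conv_lhs => rw [← one_mul L]
    gcongr
    exact one_le_pow₀ (by norm_num)
  | succ i =>
    refine (avAbs_succ_le i z).trans ?_
    gcongr
    exact hz.2 i (Nat.lt_succ_self i)

lemma sum_indicator_St_le (n : ℕ) (z : XT N) :
    ∑ j ∈ Finset.range n, (St f L j).indicator (fun z => ‖f z‖ₑ) z ≤ ‖f z‖ₑ := by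
  by_cases h : ∃ i ∈ Finset.range n, z ∈ St f L i
  · obtain ⟨i, hi, hz⟩ := h
    rw [Finset.sum_eq_single_of_mem i hi fun k _ hk =>
      indicator_of_notMem (fun h' => hk (St_disj h' hz)) _, indicator_of_mem hz]
  · push Not at h
    rw [Finset.sum_eq_zero fun i hi => indicator_of_notMem (h i hi) _]
    exact zero_le

lemma sum_lintegral_St_le (hf : Measurable f) (n : ℕ) :
    ∑ j ∈ Finset.range n, ∫⁻ z in strip N, (St f L j).indicator (fun z => ‖f z‖ₑ) z ≤
      ∫⁻ z in strip N, ‖f z‖ₑ := by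
  rw [← lintegral_finsetSum _ fun j _ => hf.enorm.indicator (measurableSet_St hf)]
  exact lintegral_mono fun z => sum_indicator_St_le n z

lemma mul_volume_St_le (hf : Measurable f) (hper : PerQ f) :
    L * volume (strip N ∩ St f L j) ≤ ∫⁻ z in strip N, (St f L j).indicator (fun z => ‖f z‖ₑ) z := by
  rw [← lintegral_indicator_avAbs hf hper (measurableSet_St hf) (St_per hper) (fun z w h => St_sat h),
    inter_comm, ← Measure.restrict_apply (measurableSet_St hf), ← setLIntegral_const,
    lintegral_indicator (measurableSet_St hf)]
  exact setLIntegral_mono' (measurableSet_St hf) fun z hz => hz.1.le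

end

/-- The `L²` bound for convolution with `κ`. -/
def L2C (κ : XT N → ℝ) (C : ENNReal) : Prop :=
  ∀ (f : XT N → ℝ) (M R : ℝ), BPc f M R →
    ∫⁻ q in strip N, ‖cvk κ f q‖ₑ ^ 2 ≤ C * ∫⁻ q in strip N, ‖f q‖ₑ ^ 2

/-- Constant of the weak type estimate. -/
def wtC (N : ℕ) (C2 CH : ENNReal) : ENNReal := C2 * 2 ^ (N + 2) * 3 + (ENNReal.ofReal (4 ^ N * 8) + 2 * CH)

/-- Weak type estimate for dyadic step functions. -/
lemma weak_type {κ f : XT N → ℝ} {C2 CH L : ENNReal} {M R : ℝ} {n : ℕ} (hκ : Integrable κ)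
    (hκ' : Measurable κ) (hH : HorC κ CH) (h2 : L2C κ C2) (hf : BPc f M R)
    (hfn : ∀ q, f (cor n q) = f q) (hL : L ≠ 0) (hL' : L ≠ ⊤)
    (hI : ∫⁻ z in strip N, ‖f z‖ₑ ≤ L) :
    L * volume (strip N ∩ {x | 2 * L < ‖cvk κ f x‖ₑ}) ≤ wtC N C2 CH * ∫⁻ z in strip N, ‖f z‖ₑ := by
  set I := ∫⁻ z in strip N, ‖f z‖ₑ with hIdef
  set s := Finset.range (n + 1)
  have hf1 : BPc f M (R + 1) := hf.mono (by linarith)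
  let b : ℕ → XT N → ℝ := fun j => badPart f (St f L j) j
  have hb0 : ∀ j z, z ∉ St f L j → b j z = 0 := fun j z hz => indicator_of_notMem hz _
  have hb : ∀ j, BPc (b j) (2 * M) (R + 1) := fun j =>
    hf1.bpc_badPart (measurableSet_St hf.meas) (St_per hf.per) fun q hq => St_supp hf hq
  have hbs := BPc.sum (s := s) (g := b) fun j _ => hb j
  let g : XT N → ℝ := fun q => f q - ∑ j ∈ s, b j q
  have hg := hf1.sub hbs
  change BPc g _ _ at hg
  have hIj : ∑ j ∈ s, ∫⁻ z in strip N, (St f L j).indicator (fun z => ‖f z‖ₑ) z ≤ I :=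
    sum_lintegral_St_le hf.meas (n + 1)
  have hbI : ∀ j, ∫⁻ z in strip N, ‖b j z‖ₑ ≤
      2 * ∫⁻ z in strip N, (St f L j).indicator (fun z => ‖f z‖ₑ) z := fun j =>
    lintegral_badPart_le hf (measurableSet_St hf.meas) (St_per hf.per) fun z w h => St_sat h
  have hbI' : ∑ j ∈ s, ∫⁻ z in strip N, ‖b j z‖ₑ ≤ 2 * I := by
    refine (Finset.sum_le_sum fun j _ => hbI j).trans ?_
    rw [← Finset.mul_sum]; gcongr
  have hgL : ∀ z, ‖g z‖ₑ ≤ 2 ^ (N + 2) * L := by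
    intro z
    by_cases h : ∃ i ∈ s, z ∈ St f L i
    · obtain ⟨i, hi, hz⟩ := h
      have : g z = avR f i z := by
        simp only [g]
        rw [Finset.sum_eq_single_of_mem i hi fun k _ hk =>
          hb0 k z (fun h' => hk (St_disj h' hz))]
        simp only [b, badPart, indicator_of_mem hz]; ring
      rw [this]
      exact (enorm_avR_le i z).trans (avAbs_le_of_mem_St hf.per hI hz)
    · push Not at h
      have : g z = f z := by
        simp only [g]
        rw [Finset.sum_eq_zero fun i hi => hb0 i z (h i hi), sub_zero]
      have hall : ∀ i ≤ n, avAbs f i z ≤ L := by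
        intro i
        induction i using Nat.strong_induction_on with
        | _ i ih =>
          intro hi
          by_contra hlt
          exact h i (Finset.mem_range.2 (by omega)) ⟨not_le.1 hlt, fun k hk => ih k hk (by omega)⟩
      rw [this, ← avAbs_of_const hfn z]
      refine (hall n le_rfl).trans ?_
      conv_lhs => rw [← one_mul L]
      gcongr
      exact one_le_pow₀ (by norm_num)
  have hgI : ∫⁻ z in strip N, ‖g z‖ₑ ≤ 3 * I := by
    calc ∫⁻ z in strip N, ‖g z‖ₑ ≤ ∫⁻ z in strip N, (‖f z‖ₑ + ∑ j ∈ s, ‖b j z‖ₑ) := by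
          refine lintegral_mono fun z => enorm_sub_le.trans ?_
          gcongr
          exact enorm_sum_le _ _
      _ = I + ∑ j ∈ s, ∫⁻ z in strip N, ‖b j z‖ₑ := by
          rw [lintegral_add_left hf.meas.enorm, lintegral_finsetSum _ fun j _ => (hb j).meas.enorm]
      _ ≤ I + 2 * I := by gcongr
      _ = 3 * I := by ring
  have hTg : Measurable (cvk κ g) := hg.measurable_cvk hκ'
  have good : L * volume (strip N ∩ {x | L < ‖cvk κ g x‖ₑ}) ≤ C2 * 2 ^ (N + 2) * 3 * I := by
    have h3 : L ^ 2 * volume (strip N ∩ {x | L < ‖cvk κ g x‖ₑ}) ≤ ∫⁻ q in strip N, ‖cvk κ g q‖ₑ ^ 2 := by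
      rw [inter_comm, ← Measure.restrict_apply (measurableSet_lt measurable_const hTg.enorm),
        ← setLIntegral_const]
      refine (setLIntegral_mono' (measurableSet_lt measurable_const hTg.enorm) fun x hx => ?_).trans
        (setLIntegral_le_lintegral _ _)
      have hx' : L ≤ ‖cvk κ g x‖ₑ := le_of_lt hx
      gcongr
    have h4 : ∫⁻ q in strip N, ‖g q‖ₑ ^ 2 ≤ L * (2 ^ (N + 2) * (3 * I)) := by
      calc ∫⁻ q in strip N, ‖g q‖ₑ ^ 2 ≤ ∫⁻ q in strip N, 2 ^ (N + 2) * L * ‖g q‖ₑ := by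
            refine lintegral_mono fun q => ?_
            rw [sq]; gcongr; exact hgL q
        _ = 2 ^ (N + 2) * L * ∫⁻ q in strip N, ‖g q‖ₑ := lintegral_const_mul _ hg.meas.enorm
        _ ≤ 2 ^ (N + 2) * L * (3 * I) := by gcongr
        _ = _ := by ring
    have h5 := h3.trans ((h2 g _ _ hg).trans (mul_le_mul_right h4 C2))
    have h6 : L * (L * volume (strip N ∩ {x | L < ‖cvk κ g x‖ₑ})) ≤ L * (C2 * 2 ^ (N + 2) * 3 * I) := by
      refine le_trans (le_of_eq ?_) (h5.trans (le_of_eq ?_)) <;> ring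
    exact (ENNReal.mul_le_mul_iff_right hL hL').1 h6
  let Ω : Set (XT N) := ⋃ j ∈ s, nearSet (St f L j) j
  have hΩ : MeasurableSet Ω := Finset.measurableSet_biUnion _ fun j _ =>
    measurableSet_nearSet (measurableSet_St hf.meas)
  have near : L * volume (strip N ∩ Ω) ≤ ENNReal.ofReal (4 ^ N * 8) * I := by
    calc L * volume (strip N ∩ Ω) ≤ L * ∑ j ∈ s, volume (strip N ∩ nearSet (St f L j) j) := by
          gcongr
          rw [inter_iUnion₂]
          exact measure_biUnion_finset_le _ _
      _ = ∑ j ∈ s, L * volume (strip N ∩ nearSet (St f L j) j) := Finset.mul_sum _ _ _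
      _ ≤ ∑ j ∈ s, ENNReal.ofReal (4 ^ N * 8) *
            ∫⁻ z in strip N, (St f L j).indicator (fun z => ‖f z‖ₑ) z := by
          refine Finset.sum_le_sum fun j _ => ?_
          calc L * volume (strip N ∩ nearSet (St f L j) j)
              ≤ L * (ENNReal.ofReal (4 ^ N * 8) * volume (strip N ∩ St f L j)) := by
                gcongr
                exact volume_nearSet_le (measurableSet_St hf.meas) (St_per hf.per)
            _ = ENNReal.ofReal (4 ^ N * 8) * (L * volume (strip N ∩ St f L j)) := by ring
            _ ≤ _ := by gcongr; exact mul_volume_St_le hf.meas hf.per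
      _ ≤ _ := by rw [← Finset.mul_sum]; gcongr
  have hTb : ∀ j, Measurable (cvk κ (b j)) := fun j => (hb j).measurable_cvk hκ'
  have hTs : Measurable fun x => ∑ j ∈ s, ‖cvk κ (b j) x‖ₑ :=
    Finset.measurable_fun_sum _ fun j _ => (hTb j).enorm
  have far : L * volume ((strip N ∩ Ωᶜ) ∩ {x | L < ∑ j ∈ s, ‖cvk κ (b j) x‖ₑ}) ≤ 2 * CH * I := by
    rw [inter_comm, ← Measure.restrict_apply (measurableSet_lt measurable_const hTs),
        ← setLIntegral_const]
    calc _ ≤ ∫⁻ x in strip N ∩ Ωᶜ, ∑ j ∈ s, ‖cvk κ (b j) x‖ₑ :=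
          (setLIntegral_mono' (measurableSet_lt measurable_const hTs) fun x hx => le_of_lt hx).trans
            (setLIntegral_le_lintegral _ _)
      _ = ∑ j ∈ s, ∫⁻ x in strip N ∩ Ωᶜ, ‖cvk κ (b j) x‖ₑ :=
          lintegral_finsetSum _ fun j _ => (hTb j).enorm
      _ ≤ ∑ j ∈ s, CH * ∫⁻ z in strip N, ‖b j z‖ₑ := by
          refine Finset.sum_le_sum fun j hj => ?_
          refine (lintegral_mono_set ?_).trans (lintegral_cvk_badPart_le hκ hκ' hH hf1
            (measurableSet_St hf.meas) (St_per hf.per) (fun q hq => St_supp hf hq)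
            fun z w h => St_sat h)
          exact inter_subset_inter_right _ (compl_subset_compl.2
            (subset_biUnion_of_mem (u := fun j => nearSet (St f L j) j) hj))
      _ ≤ CH * (2 * I) := by rw [← Finset.mul_sum]; gcongr
      _ = _ := by ring
  have hsub : strip N ∩ {x | 2 * L < ‖cvk κ f x‖ₑ} ⊆ (strip N ∩ {x | L < ‖cvk κ g x‖ₑ}) ∪
      ((strip N ∩ Ω) ∪ ((strip N ∩ Ωᶜ) ∩ {x | L < ∑ j ∈ s, ‖cvk κ (b j) x‖ₑ})) := by
    rintro x ⟨hx, hx2⟩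
    by_cases h1 : L < ‖cvk κ g x‖ₑ
    · exact Or.inl ⟨hx, h1⟩
    refine Or.inr ?_
    by_cases h3 : x ∈ Ω
    · exact Or.inl ⟨hx, h3⟩
    refine Or.inr ⟨⟨hx, h3⟩, ?_⟩
    by_contra h4
    have e : cvk κ f x = cvk κ g x + ∑ j ∈ s, cvk κ (b j) x := by
      rw [← cvk_sum hκ (fun j _ => hb j)]
      simp only [g]
      rw [cvk_sub hκ hf1 hbs]; ring
    have : ‖cvk κ f x‖ₑ ≤ 2 * L := by
      rw [e, two_mul]
      refine (enorm_add_le _ _).trans (add_le_add (not_lt.1 h1) ?_)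
      exact (enorm_sum_le _ _).trans (not_lt.1 h4)
    exact absurd hx2 (not_lt.2 this)
  calc _ ≤ L * (volume (strip N ∩ {x | L < ‖cvk κ g x‖ₑ}) + (volume (strip N ∩ Ω) +
        volume ((strip N ∩ Ωᶜ) ∩ {x | L < ∑ j ∈ s, ‖cvk κ (b j) x‖ₑ}))) := by
        gcongr
        exact (measure_mono hsub).trans ((measure_union_le _ _).trans
          (add_le_add le_rfl (measure_union_le _ _)))
    _ ≤ C2 * 2 ^ (N + 2) * 3 * I + (ENNReal.ofReal (4 ^ N * 8) * I + 2 * CH * I) := by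
        rw [mul_add, mul_add]
        gcongr
    _ = _ := by rw [wtC]; ring

lemma lintegral_rpow_Ioo {a s : ℝ} (ha : 0 ≤ a) (hs : -1 < s) :
    ∫⁻ l in Ioo 0 a, ENNReal.ofReal (l ^ s) = ENNReal.ofReal (a ^ (s + 1) / (s + 1)) := by
  have hi : IntegrableOn (fun l : ℝ => l ^ s) (Ioc 0 a) :=
    (intervalIntegrable_iff_integrableOn_Ioc_of_le ha).1 (intervalIntegral.intervalIntegrable_rpow' hs)
  rw [restrict_Ioo_eq_restrict_Ioc, ← ofReal_integral_eq_lintegral_ofReal hi]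
  · rw [← intervalIntegral.integral_of_le ha, integral_rpow (Or.inl hs),
      Real.zero_rpow (by linarith), sub_zero]
  · filter_upwards [ae_restrict_mem measurableSet_Ioc] with l hl
    exact Real.rpow_nonneg hl.1.le _

lemma lintegral_rpow_Ioi {a s : ℝ} (ha : 0 < a) (hs : s < -1) :
    ∫⁻ l in Ioi a, ENNReal.ofReal (l ^ s) = ENNReal.ofReal (-a ^ (s + 1) / (s + 1)) := by
  rw [← ofReal_integral_eq_lintegral_ofReal (integrableOn_Ioi_rpow_of_lt hs ha),
    integral_Ioi_rpow_of_lt hs ha]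
  filter_upwards [ae_restrict_mem measurableSet_Ioi] with l hl
  exact Real.rpow_nonneg (ha.le.trans (le_of_lt hl)) _

open Classical in
/-- Truncation to small values. -/
def smallPart (f : XT N → ℝ) (l : ℝ) (z : XT N) : ℝ := if |f z| ≤ l then f z else 0

open Classical in
/-- Truncation to large values. -/
def largePart (f : XT N → ℝ) (l : ℝ) (z : XT N) : ℝ := if |f z| ≤ l then 0 else f z

section
variable {f : XT N → ℝ} {M R : ℝ}

lemma BPc.smallPart (hf : BPc f M R) (l : ℝ) : BPc (smallPart f l) M R where
  meas := Measurable.ite (measurableSet_le hf.meas.abs measurable_const) hf.meas measurable_const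
  per q z := by simp only [_root_.smallPart, hf.per q z]
  bdd q := by
    have := (abs_nonneg _).trans (hf.bdd q)
    unfold _root_.smallPart
    split_ifs
    exacts [hf.bdd q, by simpa]
  supp q hq := by simp [_root_.smallPart, hf.supp q hq]

lemma BPc.largePart (hf : BPc f M R) (l : ℝ) : BPc (largePart f l) M R where
  meas := Measurable.ite (measurableSet_le hf.meas.abs measurable_const) measurable_const hf.meas
  per q z := by simp only [_root_.largePart, hf.per q z]
  bdd q := by
    have := (abs_nonneg _).trans (hf.bdd q)
    unfold _root_.largePart
    split_ifs
    exacts [by simpa, hf.bdd q]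
  supp q hq := by simp [_root_.largePart, hf.supp q hq]

lemma smallPart_add_largePart (l : ℝ) (z : XT N) : f z - smallPart f l z = largePart f l z := by
  unfold smallPart largePart; split_ifs <;> simp

end

/-- The weak type bound on slabs, at all levels. -/
lemma weak_type_slab {κ f : XT N → ℝ} {C2 CH L : ENNReal} {M R R' : ℝ} {n : ℕ} (hκ : Integrable κ)
    (hκ' : Measurable κ) (hH : HorC κ CH) (h2 : L2C κ C2) (hf : BPc f M R)
    (hfn : ∀ q, f (cor n q) = f q) (hL : L ≠ 0) (hL' : L ≠ ⊤) :
    L * volume (slab N R' ∩ {x | 2 * L < ‖cvk κ f x‖ₑ}) ≤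
      (wtC N C2 CH + ENNReal.ofReal (2 * R')) * ∫⁻ z in strip N, ‖f z‖ₑ := by
  rw [add_mul]
  by_cases hI : ∫⁻ z in strip N, ‖f z‖ₑ ≤ L
  · refine le_trans ?_ ((weak_type hκ hκ' hH h2 hf hfn hL hL' hI).trans le_self_add)
    gcongr
    exact inter_subset_left
  · refine le_trans ?_ le_add_self
    rw [mul_comm, ← volume_slab (N := N)]
    gcongr
    · exact inter_subset_left
    · exact (not_le.1 hI).le

/-- Constant of the strong type estimate. -/
def stC (N : ℕ) (C2 CH : ENNReal) (R' r : ℝ) : ENNReal :=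
  3 ^ r * ENNReal.ofReal r * ((wtC N C2 CH + ENNReal.ofReal (2 * R')) * ENNReal.ofReal (1 / (r - 1))
    + C2 * ENNReal.ofReal (1 / (2 - r)))

lemma strong_type_step {κ f : XT N → ℝ} {C2 CH : ENNReal} {M R R' r : ℝ} {n : ℕ} (hκ : Integrable κ)
    (hκ' : Measurable κ) (hH : HorC κ CH) (h2 : L2C κ C2) (hr : 1 < r) (hr2 : r < 2) (hf : BPc f M R)
    (hfn : ∀ q, f (cor n q) = f q) :
    ∫⁻ x in slab N R', ‖cvk κ f x‖ₑ ^ r ≤ stC N C2 CH R' r * ∫⁻ z in strip N, ‖f z‖ₑ ^ r := by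
  classical
  set K := wtC N C2 CH + ENNReal.ofReal (2 * R')
  have hTf : Measurable (cvk κ f) := hf.measurable_cvk hκ'
  -- level sets
  have hlev : ∀ l : ℝ, 0 < l → volume.restrict (slab N R') {x | l < |cvk κ f x| / 3} *
      ENNReal.ofReal (l ^ (r - 1)) ≤
      K * (∫⁻ z in strip N, ENNReal.ofReal (l ^ (r - 2)) * ‖largePart f l z‖ₑ) +
      C2 * ∫⁻ z in strip N, ENNReal.ofReal (l ^ (r - 3)) * ‖smallPart f l z‖ₑ ^ 2 := by
    intro l hl
    have hs := hf.smallPart l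
    have hlg := hf.largePart l
    have hTs := hs.measurable_cvk hκ'
    set L := ENNReal.ofReal l
    have hL : L ≠ 0 := by simpa [L] using hl
    have h1 := weak_type_slab (R' := R') hκ hκ' hH h2 hlg (n := n)
      (fun q => by simp [largePart, hfn q]) hL ENNReal.ofReal_ne_top
    have h3 : L ^ 2 * volume (strip N ∩ {x | L < ‖cvk κ (smallPart f l) x‖ₑ}) ≤
        C2 * ∫⁻ z in strip N, ‖smallPart f l z‖ₑ ^ 2 := by
      refine le_trans ?_ (h2 _ _ _ hs)
      rw [inter_comm, ← Measure.restrict_apply (measurableSet_lt measurable_const hTs.enorm),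
        ← setLIntegral_const]
      refine (setLIntegral_mono' (measurableSet_lt measurable_const hTs.enorm) fun x hx => ?_).trans
        (setLIntegral_le_lintegral _ _)
      have hx' : L ≤ ‖cvk κ (smallPart f l) x‖ₑ := le_of_lt hx
      gcongr
    have hsub : {x | l < |cvk κ f x| / 3} ∩ slab N R' ⊆
        (slab N R' ∩ {x | 2 * L < ‖cvk κ (largePart f l) x‖ₑ}) ∪
        (strip N ∩ {x | L < ‖cvk κ (smallPart f l) x‖ₑ}) := by
      rintro x ⟨hx, hx2⟩
      by_contra hc
      simp only [mem_union, mem_inter_iff, hx2, hx2.1, true_and, mem_ofPred_eq, not_or, not_lt] at hc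
      have e : cvk κ (largePart f l) x = cvk κ f x - cvk κ (smallPart f l) x := by
        rw [← cvk_sub hκ hf hs]; congr 1; ext z; rw [smallPart_add_largePart]
      have e2 : cvk κ f x = cvk κ (largePart f l) x + cvk κ (smallPart f l) x := by rw [e]; ring
      have h5 : ‖cvk κ f x‖ₑ ≤ 2 * L + L := by
        rw [e2]; exact (enorm_add_le _ _).trans (add_le_add hc.1 hc.2)
      have h6 : 2 * L + L = ENNReal.ofReal (3 * l) := by
        rw [ENNReal.ofReal_mul (by norm_num)]; simp [L]; ring
      rw [h6, ← ofReal_norm, ENNReal.ofReal_le_ofReal_iff (by positivity), Real.norm_eq_abs] at h5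
      have : l < |cvk κ f x| / 3 := hx
      linarith
    have e1 : ENNReal.ofReal (l ^ (r - 1)) = ENNReal.ofReal (l ^ (r - 2)) * L := by
      rw [← ENNReal.ofReal_mul (by positivity)]
      congr 1
      nth_rewrite 3 [← Real.rpow_one l]
      rw [← Real.rpow_add hl]; congr 1; ring
    have e2 : ENNReal.ofReal (l ^ (r - 1)) = ENNReal.ofReal (l ^ (r - 3)) * L ^ 2 := by
      rw [← ENNReal.ofReal_pow hl.le, ← ENNReal.ofReal_mul (by positivity)]
      congr 1
      rw [← Real.rpow_two, ← Real.rpow_add hl]; congr 1; ring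
    rw [Measure.restrict_apply (measurableSet_lt measurable_const (hTf.abs.div_const 3))]
    calc _ ≤ (volume (slab N R' ∩ {x | 2 * L < ‖cvk κ (largePart f l) x‖ₑ}) +
          volume (strip N ∩ {x | L < ‖cvk κ (smallPart f l) x‖ₑ})) * ENNReal.ofReal (l ^ (r - 1)) := by
          gcongr
          exact (measure_mono hsub).trans (measure_union_le _ _)
      _ = ENNReal.ofReal (l ^ (r - 2)) *
            (L * volume (slab N R' ∩ {x | 2 * L < ‖cvk κ (largePart f l) x‖ₑ})) +
          ENNReal.ofReal (l ^ (r - 3)) *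
            (L ^ 2 * volume (strip N ∩ {x | L < ‖cvk κ (smallPart f l) x‖ₑ})) := by
          rw [add_mul]
          nth_rewrite 1 [e1]
          rw [e2]; ring
      _ ≤ ENNReal.ofReal (l ^ (r - 2)) * (K * ∫⁻ z in strip N, ‖largePart f l z‖ₑ) +
          ENNReal.ofReal (l ^ (r - 3)) * (C2 * ∫⁻ z in strip N, ‖smallPart f l z‖ₑ ^ 2) := by
          gcongr
      _ = _ := by
          rw [lintegral_const_mul _ hlg.meas.enorm, lintegral_const_mul _ (hs.meas.enorm.pow_const 2)]
          ring
  have hmf : Measurable fun p : ℝ × XT N => f p.2 := hf.meas.comp measurable_snd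
  have hml : Measurable fun p : ℝ × XT N => ENNReal.ofReal (p.1 ^ (r - 2)) * ‖largePart f p.1 p.2‖ₑ :=
    (measurable_fst.pow_const _).ennreal_ofReal.mul
      (Measurable.ite (measurableSet_le hmf.abs measurable_fst) measurable_const hmf).enorm
  have hms : Measurable fun p : ℝ × XT N =>
      ENNReal.ofReal (p.1 ^ (r - 3)) * ‖smallPart f p.1 p.2‖ₑ ^ 2 :=
    (measurable_fst.pow_const _).ennreal_ofReal.mul
      ((Measurable.ite (measurableSet_le hmf.abs measurable_fst) hmf measurable_const).enorm.pow_const 2)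
  have hA : ∀ z, ∫⁻ l in Ioi (0:ℝ), ENNReal.ofReal (l ^ (r - 2)) * ‖largePart f l z‖ₑ ≤
      ENNReal.ofReal (1 / (r - 1)) * ‖f z‖ₑ ^ r := by
    intro z
    have e : ∀ l ∈ Ioi (0:ℝ), ENNReal.ofReal (l ^ (r - 2)) * ‖largePart f l z‖ₑ =
        (Ioo 0 |f z|).indicator (fun l => ENNReal.ofReal (l ^ (r - 2)) * ‖f z‖ₑ) l := by
      intro l hl
      by_cases h : |f z| ≤ l
      · rw [indicator_of_notMem (fun h' => absurd h'.2 (not_lt.2 h))]; simp [largePart, h]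
      · rw [indicator_of_mem (show l ∈ Ioo 0 |f z| from ⟨hl, not_le.1 h⟩)]; simp [largePart, h]
    rw [setLIntegral_congr_fun measurableSet_Ioi e, lintegral_indicator measurableSet_Ioo,
      Measure.restrict_restrict measurableSet_Ioo,
      inter_eq_self_of_subset_left (show Ioo 0 |f z| ⊆ Ioi 0 from fun x hx => hx.1),
      lintegral_mul_const' _ _ (by simp), lintegral_rpow_Ioo (abs_nonneg _) (by linarith)]
    rw [← ofReal_norm, Real.norm_eq_abs, ENNReal.ofReal_rpow_of_nonneg (abs_nonneg _) (by linarith),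
      ← ENNReal.ofReal_mul (div_nonneg (by positivity) (by linarith)),
      ← ENNReal.ofReal_mul (div_nonneg (by positivity) (by linarith))]
    apply ENNReal.ofReal_le_ofReal
    rcases (abs_nonneg (f z)).eq_or_lt with h0 | h0
    · rw [← h0]; simp [Real.zero_rpow (show r ≠ 0 by linarith)]
    · have : |f z| ^ r = |f z| ^ (r - 2 + 1) * |f z| := by
        nth_rewrite 3 [← Real.rpow_one |f z|]
        rw [← Real.rpow_add h0]; congr 1; ring
      rw [this, show r - 2 + 1 = r - 1 by ring]
      apply le_of_eq; ring
  have hB : ∀ z, ∫⁻ l in Ioi (0:ℝ), ENNReal.ofReal (l ^ (r - 3)) * ‖smallPart f l z‖ₑ ^ 2 ≤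
      ENNReal.ofReal (1 / (2 - r)) * ‖f z‖ₑ ^ r := by
    intro z
    rcases (abs_nonneg (f z)).eq_or_lt with h0 | h0
    · have : f z = 0 := abs_eq_zero.1 h0.symm
      simp [smallPart, this]
    have e : ∀ l ∈ Ioi (0:ℝ), ENNReal.ofReal (l ^ (r - 3)) * ‖smallPart f l z‖ₑ ^ 2 =
        (Ici |f z|).indicator (fun l => ENNReal.ofReal (l ^ (r - 3)) * ‖f z‖ₑ ^ 2) l := by
      intro l hl
      by_cases h : |f z| ≤ l
      · rw [indicator_of_mem (show l ∈ Ici |f z| from h)]; simp [smallPart, h]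
      · rw [indicator_of_notMem (show l ∉ Ici |f z| from h)]; simp [smallPart, h]
    rw [setLIntegral_congr_fun measurableSet_Ioi e, lintegral_indicator measurableSet_Ici,
      Measure.restrict_restrict measurableSet_Ici,
      inter_eq_self_of_subset_left (show Ici |f z| ⊆ Ioi 0 from fun x (hx : |f z| ≤ x) => h0.trans_le hx),
      lintegral_mul_const' _ _ (by simp), ← restrict_Ioi_eq_restrict_Ici,
      lintegral_rpow_Ioi h0 (by linarith)]
    rw [← ofReal_norm, Real.norm_eq_abs, ENNReal.ofReal_rpow_of_nonneg (abs_nonneg _) (by linarith),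
      ← ENNReal.ofReal_pow (abs_nonneg _),
      ← ENNReal.ofReal_mul (div_nonneg_of_nonpos (by simp; positivity) (by linarith)),
      ← ENNReal.ofReal_mul (div_nonneg (by positivity) (by linarith))]
    apply ENNReal.ofReal_le_ofReal
    have : |f z| ^ r = |f z| ^ (r - 2) * |f z| ^ 2 := by
      rw [← Real.rpow_two, ← Real.rpow_add h0]; congr 1; ring
    rw [this, show r - 3 + 1 = r - 2 by ring, ← neg_sub r 2, div_neg, neg_div]
    apply le_of_eq; ring
  calc ∫⁻ x in slab N R', ‖cvk κ f x‖ₑ ^ r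
      = 3 ^ r * ∫⁻ x in slab N R', ENNReal.ofReal ((|cvk κ f x| / 3) ^ r) := by
        rw [← lintegral_const_mul' _ _ (by finiteness)]
        congr 1; ext x
        rw [Real.div_rpow (abs_nonneg _) (by norm_num), ENNReal.ofReal_div_of_pos (by positivity),
          ← ENNReal.ofReal_rpow_of_nonneg (abs_nonneg _) (by linarith),
          ← ENNReal.ofReal_rpow_of_nonneg (by norm_num) (by linarith), ← Real.norm_eq_abs, ofReal_norm,
          ENNReal.ofReal_ofNat, ENNReal.mul_div_cancel (by positivity) (by finiteness)]
    _ = 3 ^ r * (ENNReal.ofReal r * ∫⁻ l in Ioi (0:ℝ),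
          volume.restrict (slab N R') {x | l < |cvk κ f x| / 3} * ENNReal.ofReal (l ^ (r - 1))) := by
        rw [lintegral_rpow_eq_lintegral_meas_lt_mul _
          (Eventually.of_forall fun x => by positivity)
          (hTf.abs.div_const 3).aemeasurable (by linarith)]
    _ ≤ 3 ^ r * (ENNReal.ofReal r * ∫⁻ l in Ioi (0:ℝ),
          (K * (∫⁻ z in strip N, ENNReal.ofReal (l ^ (r - 2)) * ‖largePart f l z‖ₑ) +
          C2 * ∫⁻ z in strip N, ENNReal.ofReal (l ^ (r - 3)) * ‖smallPart f l z‖ₑ ^ 2)) := by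
        gcongr 3 ^ r * (ENNReal.ofReal r * ?_)
        exact setLIntegral_mono' measurableSet_Ioi fun l hl => hlev l hl
    _ = 3 ^ r * (ENNReal.ofReal r * (
          K * (∫⁻ z in strip N, ∫⁻ l in Ioi (0:ℝ), ENNReal.ofReal (l ^ (r - 2)) * ‖largePart f l z‖ₑ) +
          C2 * ∫⁻ z in strip N, ∫⁻ l in Ioi (0:ℝ),
            ENNReal.ofReal (l ^ (r - 3)) * ‖smallPart f l z‖ₑ ^ 2)) := by
        rw [lintegral_add_left (hml.lintegral_prod_right'.const_mul K),
          lintegral_const_mul _ hml.lintegral_prod_right', lintegral_const_mul _ hms.lintegral_prod_right',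
          lintegral_lintegral_swap (μ := volume.restrict (Ioi (0:ℝ))) (ν := volume.restrict (strip N))
            (f := fun l z => ENNReal.ofReal (l ^ (r - 2)) * ‖largePart f l z‖ₑ) hml.aemeasurable,
          lintegral_lintegral_swap (μ := volume.restrict (Ioi (0:ℝ))) (ν := volume.restrict (strip N))
            (f := fun l z => ENNReal.ofReal (l ^ (r - 3)) * ‖smallPart f l z‖ₑ ^ 2) hms.aemeasurable]
    _ ≤ 3 ^ r * (ENNReal.ofReal r * (
          K * (∫⁻ z in strip N, ENNReal.ofReal (1 / (r - 1)) * ‖f z‖ₑ ^ r) +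
          C2 * ∫⁻ z in strip N, ENNReal.ofReal (1 / (2 - r)) * ‖f z‖ₑ ^ r)) := by
        gcongr with z z
        · exact hA z
        · exact hB z
    _ = _ := by
        rw [lintegral_const_mul _ (hf.meas.enorm.pow_const r),
          lintegral_const_mul _ (hf.meas.enorm.pow_const r), stC]
        ring

lemma tendsto_cor (q : XT N) : Tendsto (fun n => cor n q) atTop (𝓝 q) := by
  have h2 : Tendsto (fun n : ℕ => ((2:ℝ) ^ n)⁻¹) atTop (𝓝 0) := by
    simpa [inv_pow] using tendsto_pow_atTop_nhds_zero_of_lt_one (r := (2:ℝ)⁻¹) (by norm_num) (by norm_num)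
  have h4 : Tendsto (fun n : ℕ => ((4:ℝ) ^ n)⁻¹) atTop (𝓝 0) := by
    simpa [inv_pow] using tendsto_pow_atTop_nhds_zero_of_lt_one (r := (4:ℝ)⁻¹) (by norm_num) (by norm_num)
  have key : Tendsto (fun n => q - cor n q) atTop (𝓝 0) := by
    refine Tendsto.prodMk_nhds (x := (0 : RN N)) (y := (0:ℝ)) (tendsto_pi_nhds.2 fun i => ?_) ?_
    · exact squeeze_zero (fun n => (sub_cor_fst n q i).1) (fun n => (sub_cor_fst n q i).2) h2
    · exact squeeze_zero (fun n => (sub_cor_snd n q).1) (fun n => (sub_cor_snd n q).2) h4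
  simpa using tendsto_const_nhds (x := q).sub key

lemma cor_cor (n : ℕ) (q : XT N) : cor n (cor n q) = cor n q := by
  have h2 : (2:ℝ) ^ n ≠ 0 := by positivity
  have h4 : (4:ℝ) ^ n ≠ 0 := by positivity
  rw [cor_eq_iff]
  refine ⟨fun i => ?_, ?_⟩
  · simp only [cor]; rw [mul_div_cancel₀ _ h2, Int.floor_intCast]
  · simp only [cor]; rw [mul_div_cancel₀ _ h4, Int.floor_intCast]

lemma SPc.bpc_comp_cor {f : XT N → ℝ} {M R : ℝ} (hf : SPc f R) (hM : ∀ q, |f q| ≤ M) (n : ℕ) :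
    BPc (fun q => f (cor n q)) M (R + 1) where
  meas := hf.smooth.continuous.measurable.comp (measurable_cor n)
  per q z := by simp only [cor_add_latHom, hf.per _ z]
  bdd q := hM _
  supp q hq := by
    apply hf.supp
    have h1 := sub_cor_snd n q
    have h2 : ((4:ℝ) ^ n)⁻¹ ≤ 1 := inv_le_one_of_one_le₀ (one_le_pow₀ (by norm_num))
    have e : (cor n q).2 = q.2 - (q - cor n q).2 := by simp
    rw [e]
    have := abs_sub_abs_le_abs_sub q.2 (q - cor n q).2
    rw [abs_of_nonneg h1.1] at this
    linarith

lemma stC_ne_top {C2 CH : ENNReal} {R' r : ℝ} (h2 : C2 ≠ ⊤) (hH : CH ≠ ⊤) (_hr : 0 ≤ r) :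
    stC N C2 CH R' r ≠ ⊤ := by
  unfold stC wtC
  have : (3:ENNReal) ^ r ≠ ⊤ := by finiteness
  finiteness

/-- Strong type estimate below the exponent two. -/
lemma strong_type_lt_two {κ f : XT N → ℝ} {C2 CH : ENNReal} {M R R' r : ℝ} (hκ : Integrable κ)
    (hκ' : Measurable κ) (hH : HorC κ CH) (h2 : L2C κ C2) (hC2 : C2 ≠ ⊤) (hCH : CH ≠ ⊤)
    (hr : 1 < r) (hr2 : r < 2) (hf : BPc f M R) :
    ∫⁻ x in slab N R', ‖cvk κ f x‖ₑ ^ r ≤ stC N C2 CH R' r * ∫⁻ z in strip N, ‖f z‖ₑ ^ r := by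
  have h0 : 0 < r := by linarith
  have hC := stC_ne_top (N := N) (R' := R') hC2 hCH h0.le
  have hsm : ∀ (g : XT N → ℝ) (R : ℝ), SPc g R → (∀ q, |g q| ≤ M) →
      ∫⁻ x in slab N R', ‖cvk κ g x‖ₑ ^ r ≤ stC N C2 CH R' r * ∫⁻ z in strip N, ‖g z‖ₑ ^ r := by
    intro g R hg hM
    have := cvk_bound_of_approx (f := g) (fn := fun n q => g (cor n q)) (D := slab N R') hκ h0 h0 hC
      (fun n => hg.bpc_comp_cor hM n)
      (Eventually.of_forall fun q => (hg.smooth.continuous.tendsto q).comp (tendsto_cor q)) hκ' ?_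
    · simpa [div_self h0.ne'] using this
    · intro n
      rw [div_self h0.ne', ENNReal.rpow_one]
      exact strong_type_step hκ hκ' hH h2 hr hr2 (hg.bpc_comp_cor hM n)
        (n := n) (fun q => by simp only [cor_cor])
  obtain ⟨fn, h1, h3, -, h4⟩ := hf.exists_approx one_pos
  have := cvk_bound_of_approx (D := slab N R') hκ h0 h0 hC (fun n => (h1 n).bpc (h3 n)) h4 hκ' ?_
  · simpa [div_self h0.ne'] using this
  · intro n
    rw [div_self h0.ne', ENNReal.rpow_one]
    exact hsm _ _ (h1 n) (h3 n)

lemma PerQ.lintegral_neg {g : XT N → ENNReal} (hg : PerQ g) :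
    ∫⁻ q in strip N, g (-q) = ∫⁻ q in strip N, g q := by
  have hd : IsAddFundamentalDomain (latHom N).range (-strip N : Set (XT N)) volume := by
    refine IsAddFundamentalDomain.mk' measurableSet_strip.neg.nullMeasurableSet fun q => ?_
    obtain ⟨k, hk, hu⟩ := existsUnique_lattice 0 (-q)
    refine ⟨-k, ?_, fun y hy => ?_⟩
    · simpa [vadd_range, add_comm] using hk
    · have := hu (-y) (by simpa [vadd_range, add_comm] using hy)
      rw [← this, neg_neg]
  have h0 : (fun q : XT N => q + 0) ⁻¹' strip N = strip N := by ext; simp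
  have h1 := hd.setLIntegral_eq (isAddFundamentalDomain_strip (N := N) 0) g hg.vadd
  rw [h0] at h1
  rw [← h1, ← (Measure.measurePreserving_neg (volume : Measure (XT N))).setLIntegral_comp_preimage_emb
    (MeasurableEquiv.neg (XT N)).measurableEmbedding g]
  simp

lemma BPc.comp_neg {f : XT N → ℝ} {M R : ℝ} (hf : BPc f M R) : BPc (fun q => f (-q)) M R where
  meas := hf.meas.comp measurable_neg
  per q z := by
    have := hf.per (-q) (-z)
    simp only [← this, map_neg]; congr 1; abel
  bdd q := hf.bdd _
  supp q hq := hf.supp _ (by simpa using hq)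

lemma PerQ.comp_neg {β : Type*} {f : XT N → β} (hf : PerQ f) : PerQ (fun q => f (-q)) := by
  intro q z
  have := hf (-q) (-z)
  simp only [← this, map_neg]; congr 1; abel

/-- The adjoint of a convolution. -/
lemma integral_cvk_mul {κ f g : XT N → ℝ} {M M' R R' : ℝ} (hκ : Integrable κ)
    (hf : BPc f M R) (hg : BPc g M' R') :
    ∫ q in strip N, cvk κ f q * g q = ∫ q in strip N, f q * cvk κ (fun x => g (-x)) (-q) := by
  have hi : ∀ {f g : XT N → ℝ} {M M' R R' : ℝ} (hf : BPc f M R) (hg : BPc g M' R'),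
      Integrable (Function.uncurry fun (q u : XT N) => κ u * (f (q - u) * g q))
      ((volume.restrict (strip N)).prod volume) := by
    intro f g M M' R R' hf hg
    have h1 : Integrable (fun p : XT N × XT N => g p.1 * κ p.2)
        ((volume.restrict (strip N)).prod volume) := Integrable.mul_prod hg.integrableOn hκ
    refine (h1.bdd_mul (c := M) (f := fun p : XT N × XT N => f (p.1 - p.2))
      (hf.meas.comp (measurable_fst.sub measurable_snd)).aestronglyMeasurable
      (Eventually.of_forall fun p => hf.bdd _)).congr (Eventually.of_forall fun p => ?_)
    simp only [Function.uncurry]; ring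
  have e1 : ∀ q, cvk κ f q * g q = ∫ u, κ u * (f (q - u) * g q) := fun q => by
    rw [cvk, ← integral_mul_const]; congr 1; ext u; ring
  have hi2 : Integrable (Function.uncurry fun (q u : XT N) => κ u * (f q * g (q + u)))
      ((volume.restrict (strip N)).prod volume) := by
    have h1 : Integrable (fun p : XT N × XT N => f p.1 * κ p.2)
        ((volume.restrict (strip N)).prod volume) := Integrable.mul_prod hf.integrableOn hκ
    refine (h1.bdd_mul (c := M') (f := fun p : XT N × XT N => g (p.1 + p.2))
      (hg.meas.comp (measurable_fst.add measurable_snd)).aestronglyMeasurable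
      (Eventually.of_forall fun p => hg.bdd _)).congr (Eventually.of_forall fun p => ?_)
    simp only [Function.uncurry]; ring
  have e2 : ∀ q, f q * cvk κ (fun x => g (-x)) (-q) = ∫ u, κ u * (f q * g (q + u)) := fun q => by
    rw [cvk, ← integral_const_mul]; congr 1; ext u
    rw [show -(-q - u) = q + u by abel]; ring
  simp_rw [e1, e2]
  rw [integral_integral_swap (hi hf hg), integral_integral_swap hi2]
  congr 1; ext u
  rw [integral_const_mul, integral_const_mul]
  congr 1
  have : PerQ fun q => f (q - u) * g q := by
    intro q z
    simp only
    rw [hg.per, show q + latHom N z - u = q - u + latHom N z by abel, hf.per]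
  rw [← this.integral_shift u]
  simp

/-- Strong type estimate above the exponent two, by duality. -/
lemma strong_type_gt_two {κ f : XT N → ℝ} {C2 CH : ENNReal} {M R R' r : ℝ} (hκ : Integrable κ)
    (hκ' : Measurable κ) (hH : HorC κ CH) (h2 : L2C κ C2) (hC2 : C2 ≠ ⊤) (hCH : CH ≠ ⊤)
    (hr : 2 < r) (hf : BPc f M R) :
    ∫⁻ x in slab N R', ‖cvk κ f x‖ₑ ^ r ≤
      stC N C2 CH R (r / (r - 1)) ^ (r - 1) * ∫⁻ z in strip N, ‖f z‖ₑ ^ r := by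
  have hr1 : 0 < r - 1 := by linarith
  set r' := r / (r - 1) with hr'
  have hr'1 : 1 < r' := by rw [hr', lt_div_iff₀ hr1]; linarith
  have hr'2 : r' < 2 := by rw [hr', div_lt_iff₀ hr1]; linarith
  set C := stC N C2 CH R r' with hCdef
  have hC : C ≠ ⊤ := stC_ne_top hC2 hCH (by linarith)
  set h := cvk κ f with hh
  have hhm : Measurable h := hf.measurable_cvk hκ'
  set B := (∫ u, |κ u|) * M with hB
  have hhb : ∀ q, |h q| ≤ B := fun q => by
    have := hf.abs_cvk_le hκ q
    first | exact this | (rw [hB]; linarith)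
  have hB0 : 0 ≤ B := (abs_nonneg _).trans (hhb 0)
  set g : XT N → ℝ := {q : XT N | |q.2| ≤ R'}.indicator fun q => |h q| ^ (r - 2) * h q with hg
  have hgm : MeasurableSet {q : XT N | |q.2| ≤ R'} :=
    measurableSet_le measurable_snd.abs measurable_const
  have hgB : BPc g (B ^ (r - 2) * B) R' := by
    refine ⟨((hhm.abs.pow_const _).mul hhm).indicator hgm, fun q z => ?_, fun q => ?_, fun q hq => ?_⟩
    · simp only [hg, indicator, mem_ofPred_eq, Prod.snd_add, latHom_snd, add_zero, hf.per_cvk q z, hh]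
    · by_cases hq : |q.2| ≤ R'
      · rw [hg, indicator_of_mem (show q ∈ {q : XT N | |q.2| ≤ R'} from hq), abs_mul,
          abs_of_nonneg (Real.rpow_nonneg (abs_nonneg _) _)]
        have := hhb q
        gcongr
      · rw [hg, indicator_of_notMem (show q ∉ {q : XT N | |q.2| ≤ R'} from hq), abs_zero]
        positivity
    · exact indicator_of_notMem (show q ∉ {q : XT N | |q.2| ≤ R'} from not_le.2 hq) _

  set I := ∫⁻ x in slab N R', ‖h x‖ₑ ^ r with hI
  have hIfin : I ≠ ⊤ := by
    refine ((setLIntegral_mono' (measurableSet_slab R') (g := fun _ => ENNReal.ofReal B ^ r)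
      fun x _ => ?_).trans_lt ?_).ne
    · gcongr
      rw [← ofReal_norm]; exact ENNReal.ofReal_le_ofReal (hhb x)
    · rw [setLIntegral_const]
      exact ENNReal.mul_lt_top (by finiteness) (volume_slab_lt_top R')
  have hgr : ∫⁻ z in strip N, ‖g z‖ₑ ^ r' = I := by
    rw [setLIntegral_strip_eq_slab (R := R')]
    · refine setLIntegral_congr_fun (measurableSet_slab R') fun x hx => ?_
      simp only [hg]
      rw [indicator_of_mem (show x ∈ {q : XT N | |q.2| ≤ R'} from hx.2), ← ofReal_norm, ← ofReal_norm,
        ENNReal.ofReal_rpow_of_nonneg (norm_nonneg _) (by linarith),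
        ENNReal.ofReal_rpow_of_nonneg (norm_nonneg _) (by linarith)]
      congr 1
      rw [norm_mul, Real.norm_of_nonneg (Real.rpow_nonneg (abs_nonneg _) _), Real.norm_eq_abs]
      have : |h x| ^ (r - 2) * |h x| = |h x| ^ (r - 1) := by
        nth_rewrite 2 [← Real.rpow_one |h x|]
        rw [← Real.rpow_add_of_nonneg (abs_nonneg _) (by linarith) (by norm_num)]; congr 1; ring
      rw [this, ← Real.rpow_mul (abs_nonneg _), hr', mul_div_cancel₀ _ hr1.ne']
    · intro q hq; rw [hgB.supp q hq]; simp [show 0 < r' by linarith]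
  have hIr : I = ENNReal.ofReal (∫ q in strip N, h q * g q) := by
    rw [ofReal_integral_eq_lintegral_ofReal]
    · rw [setLIntegral_strip_eq_slab (R := R')]
      · refine setLIntegral_congr_fun (measurableSet_slab R') fun x hx => ?_
        simp only [hg]
        rw [indicator_of_mem (show x ∈ {q : XT N | |q.2| ≤ R'} from hx.2), ← ofReal_norm,
          ENNReal.ofReal_rpow_of_nonneg (norm_nonneg _) (by linarith)]
        congr 1
        rw [Real.norm_eq_abs, show h x * (|h x| ^ (r - 2) * h x) = |h x| ^ (r - 2) * |h x| ^ 2 by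
          rw [sq_abs]; ring, ← Real.rpow_two,
          ← Real.rpow_add_of_nonneg (abs_nonneg _) (by linarith) (by norm_num)]
        congr 1; ring
      · intro q hq; rw [hgB.supp q hq]; simp
    · exact hgB.integrableOn.bdd_mul (c := B) hhm.aestronglyMeasurable (Eventually.of_forall hhb)
    · refine Eventually.of_forall fun q => ?_
      simp only [Pi.zero_apply, hg]
      by_cases hq : |q.2| ≤ R'
      · rw [indicator_of_mem (show q ∈ {q : XT N | |q.2| ≤ R'} from hq), mul_left_comm]
        exact mul_nonneg (Real.rpow_nonneg (abs_nonneg _) _) (mul_self_nonneg _)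
      · rw [indicator_of_notMem (show q ∉ {q : XT N | |q.2| ≤ R'} from hq), mul_zero]
  have hgn := hgB.comp_neg
  have hdual : ∫⁻ q in slab N R, ‖cvk κ (fun x => g (-x)) (-q)‖ₑ ^ r' ≤ C * I := by
    have e : ∫⁻ q in slab N R, ‖cvk κ (fun x => g (-x)) (-q)‖ₑ ^ r' =
        ∫⁻ q in slab N R, ‖cvk κ (fun x => g (-x)) q‖ₑ ^ r' := by
      set G : XT N → ENNReal := {q : XT N | |q.2| ≤ R}.indicator
        fun q => ‖cvk κ (fun x => g (-x)) q‖ₑ ^ r' with hG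
      have hGp : PerQ G := fun q z => by
        simp only [hG, indicator, mem_ofPred_eq, Prod.snd_add, latHom_snd, add_zero, hgn.per_cvk q z]
      have hmR : MeasurableSet {q : XT N | |q.2| ≤ R} := measurableSet_le measurable_snd.abs measurable_const
      have e1 := hGp.lintegral_neg
      have e2 : (fun q => G (-q)) = {q : XT N | |q.2| ≤ R}.indicator
        fun q => ‖cvk κ (fun x => g (-x)) (-q)‖ₑ ^ r' := by
        ext q; simp [hG, indicator]
      rw [e2, hG, lintegral_indicator hmR, lintegral_indicator hmR, Measure.restrict_restrict hmR,
        inter_comm] at e1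
      exact e1
    rw [e]
    refine (strong_type_lt_two hκ hκ' hH h2 hC2 hCH hr'1 hr'2 hgn).trans (le_of_eq ?_)
    rw [hCdef, ← hgr]
    congr 1
    exact PerQ.lintegral_neg (g := fun q => ‖g q‖ₑ ^ r') fun q z => by simp only [hgB.per q z]
  have hpq : r.HolderConjugate r' := by
    rw [Real.holderConjugate_iff]; refine ⟨by linarith, ?_⟩
    rw [hr']; field_simp; ring
  have hmain : I ≤ (∫⁻ z in strip N, ‖f z‖ₑ ^ r) ^ (1 / r) * (C * I) ^ (1 / r') := by
    calc I = ENNReal.ofReal (∫ q in strip N, f q * cvk κ (fun x => g (-x)) (-q)) := by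
          rw [hIr, hh, integral_cvk_mul hκ hf hgB]
      _ ≤ ∫⁻ q in strip N, ‖f q * cvk κ (fun x => g (-x)) (-q)‖ₑ := by
          refine (ENNReal.ofReal_le_ofReal (le_abs_self _)).trans ?_
          rw [← Real.norm_eq_abs, ofReal_norm]
          exact enorm_integral_le_lintegral_enorm _
      _ = ∫⁻ q in slab N R, ‖f q‖ₑ * ‖cvk κ (fun x => g (-x)) (-q)‖ₑ := by
          rw [setLIntegral_strip_eq_slab (R := R)]
          · simp_rw [enorm_mul]
          · intro q hq; simp [hf.supp q hq]
      _ ≤ (∫⁻ z in slab N R, ‖f z‖ₑ ^ r) ^ (1 / r) *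
            (∫⁻ q in slab N R, ‖cvk κ (fun x => g (-x)) (-q)‖ₑ ^ r') ^ (1 / r') :=
          ENNReal.lintegral_mul_le_Lp_mul_Lq _ hpq hf.meas.enorm.aemeasurable
            ((hgn.measurable_cvk hκ').comp measurable_neg).enorm.aemeasurable
      _ ≤ _ := by
          gcongr
          exact inter_subset_left
  rcases eq_or_ne I 0 with h0 | h0
  · rw [h0]; exact zero_le
  set F := ∫⁻ z in strip N, ‖f z‖ₑ ^ r with hF
  have e3 : I ^ (1 / r) * I ^ (1 / r') = I := by
    rw [← ENNReal.rpow_add _ _ h0 hIfin, one_div, one_div, hpq.inv_add_inv_eq_one, ENNReal.rpow_one]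
  have h5 : I ^ (1 / r) ≤ F ^ (1 / r) * C ^ (1 / r') := by
    rw [ENNReal.mul_rpow_of_nonneg _ _ (by positivity), ← mul_assoc] at hmain
    nth_rewrite 1 [← e3] at hmain
    refine (ENNReal.mul_le_mul_iff_left ?_ ?_).1 hmain
    · simp [h0, hIfin]
    · finiteness
  have hr0 : 0 < r := by linarith
  calc I = (I ^ (1 / r)) ^ r := by
        rw [← ENNReal.rpow_mul, one_div_mul_cancel hr0.ne', ENNReal.rpow_one]
    _ ≤ (F ^ (1 / r) * C ^ (1 / r')) ^ r := by gcongr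
    _ = C ^ (r - 1) * F := by
        rw [ENNReal.mul_rpow_of_nonneg _ _ hr0.le, ← ENNReal.rpow_mul, ← ENNReal.rpow_mul,
          one_div_mul_cancel hr0.ne', ENNReal.rpow_one, mul_comm, hr']
        congr 2; field_simp

/-- **Calderón–Zygmund** estimate: constant independent of the kernel. -/
lemma strong_type (N : ℕ) (C2 CH : ENNReal) (hC2 : C2 ≠ ⊤) (hCH : CH ≠ ⊤) (R R' r : ℝ) (hr : 1 < r) :
    ∃ C : ENNReal, C ≠ ⊤ ∧ ∀ (κ f : XT N → ℝ) (M : ℝ), Integrable κ → Measurable κ → HorC κ CH →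
      L2C κ C2 → BPc f M R →
      ∫⁻ x in slab N R', ‖cvk κ f x‖ₑ ^ r ≤ C * ∫⁻ z in strip N, ‖f z‖ₑ ^ r := by
  rcases lt_trichotomy r 2 with h | rfl | h
  · exact ⟨_, stC_ne_top hC2 hCH (by linarith), fun κ f M hκ hκ' hH h2 hf =>
      strong_type_lt_two hκ hκ' hH h2 hC2 hCH hr h hf⟩
  · refine ⟨C2, hC2, fun κ f M hκ hκ' hH h2 hf => ?_⟩
    refine (lintegral_mono_set inter_subset_left).trans ?_
    simpa using h2 f M R hf
  · have : 0 ≤ r / (r - 1) := div_nonneg (by linarith) (by linarith)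
    exact ⟨_, ENNReal.rpow_ne_top_of_nonneg (by linarith) (stC_ne_top hC2 hCH this),
      fun κ f M hκ hκ' hH h2 hf => strong_type_gt_two hκ hκ' hH h2 hC2 hCH h hf⟩

/-- The sum of the squares of the coordinates. -/
def sqs (z : RN N) : ℝ := ∑ i, z i ^ 2

/-- Gaussian weight with parameter `b`. -/
def gsw (b : ℝ) (z : RN N) : ℝ := Real.exp (-b * sqs z)

lemma gsw_pos (b : ℝ) (z : RN N) : 0 < gsw b z := Real.exp_pos _

lemma sqs_nonneg (z : RN N) : 0 ≤ sqs z := Finset.sum_nonneg fun _ _ => sq_nonneg _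

lemma contDiff_sqs {n : WithTop ℕ∞} : ContDiff ℝ n (sqs (N := N)) := by
  unfold sqs; fun_prop

lemma contDiff_gsw (b : ℝ) {n : WithTop ℕ∞} : ContDiff ℝ n (gsw (N := N) b) :=
  Real.contDiff_exp.comp (contDiff_const.mul contDiff_sqs)

lemma measurable_gsw (b : ℝ) : Measurable (gsw (N := N) b) :=
  (contDiff_gsw b (n := 0)).continuous.measurable

lemma integrable_gsw {b : ℝ} (hb : 0 < b) : Integrable (gsw (N := N) b) := by
  have := Integrable.fintype_prod (ι := Fin N) (f := fun _ x => Real.exp (-b * x ^ 2))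
    (μ := fun _ => volume) (fun _ => integrable_exp_neg_mul_sq hb)
  refine this.congr (Eventually.of_forall fun z => ?_)
  simp only [gsw, sqs, Finset.mul_sum, Real.exp_sum]

lemma norm_sq_le_sqs (z : RN N) : ‖z‖ ^ 2 ≤ sqs z := by
  have h : ‖z‖ ≤ Real.sqrt (sqs z) := by
    rw [pi_norm_le_iff_of_nonneg (Real.sqrt_nonneg _)]
    intro i
    apply Real.le_sqrt_of_sq_le
    rw [Real.norm_eq_abs, sq_abs]
    exact Finset.single_le_sum (f := fun i => z i ^ 2) (fun i _ => sq_nonneg _) (Finset.mem_univ i)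
  calc ‖z‖ ^ 2 ≤ Real.sqrt (sqs z) ^ 2 := by gcongr
    _ = _ := Real.sq_sqrt (sqs_nonneg z)

/-- Polynomial factors are absorbed by a Gaussian. -/
lemma exists_pow_mul_gsw_le (m : ℕ) {b b' : ℝ} (hb : b' < b) :
    ∃ C : ℝ, 0 < C ∧ ∀ z : RN N, (1 + ‖z‖) ^ m * gsw b z ≤ C * gsw b' z := by
  set ε := (b - b') / (m + 1) with hε
  have hε0 : 0 < ε := div_pos (by linarith) (by positivity)
  set B := 2 * (1 + 1 / ε) with hB
  have hB0 : 0 < B := by positivity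
  refine ⟨B ^ m, by positivity, fun z => ?_⟩
  have h1 : 1 + ‖z‖ ≤ B * Real.exp (ε * sqs z) := by
    have h2 := norm_sq_le_sqs z
    have h3 : 1 + ‖z‖ ≤ 2 * (1 + sqs z) := by nlinarith [norm_nonneg z, sq_nonneg (‖z‖ - 1)]
    have h4 := Real.add_one_le_exp (ε * sqs z)
    have h5 : 1 ≤ Real.exp (ε * sqs z) := Real.one_le_exp (mul_nonneg hε0.le (sqs_nonneg z))
    have h6 : sqs z ≤ 1 / ε * Real.exp (ε * sqs z) := by
      rw [one_div, ← div_eq_inv_mul, le_div_iff₀ hε0]; linarith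
    rw [hB]; nlinarith
  calc (1 + ‖z‖) ^ m * gsw b z ≤ (B * Real.exp (ε * sqs z)) ^ m * gsw b z := by
        gcongr
        exact (gsw_pos b z).le
    _ = B ^ m * (Real.exp (m * (ε * sqs z) + (-b * sqs z))) := by
        rw [mul_pow, ← Real.exp_nat_mul, Real.exp_add, gsw]; ring
    _ ≤ B ^ m * gsw b' z := by
        unfold gsw
        gcongr
        have : (m:ℝ) * ε ≤ b - b' := by
          rw [hε, mul_div_assoc', div_le_iff₀ (by positivity)]; nlinarith
        nlinarith [sqs_nonneg z]

lemma integrable_pow_mul_gsw (m : ℕ) {b : ℝ} (hb : 0 < b) :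
    Integrable fun z : RN N => (1 + ‖z‖) ^ m * gsw b z := by
  obtain ⟨C, hC, h⟩ := exists_pow_mul_gsw_le (N := N) m (half_lt_self hb)
  refine ((integrable_gsw (half_pos hb)).const_mul C).mono'
    ((by fun_prop : Measurable fun z : RN N => (1 + ‖z‖) ^ m).mul (measurable_gsw b)).aestronglyMeasurable
    (Eventually.of_forall fun z => ?_)
  rw [Real.norm_of_nonneg (mul_nonneg (by positivity) (gsw_pos b z).le)]
  exact h z

/-- A `C¹` profile with Gaussian decay. -/
structure KD (k : RN N → ℝ) (C : ℝ) : Prop where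
  cd : ContDiff ℝ 1 k
  nonneg : 0 ≤ C
  bd : ∀ z, |k z| ≤ C * gsw (1 / 8) z
  dbd : ∀ z, ‖fderiv ℝ k z‖ ≤ C * gsw (1 / 8) z

/-- The Gaussian probability density. -/
def gau (z : RN N) : ℝ := (∫ w : RN N, gsw (1 / 4) w)⁻¹ * gsw (1 / 4) z

/-- First derivatives of the Gaussian. -/
def gam1 (i : Fin N) (z : RN N) : ℝ := -(z i / 2) * gau z

/-- Second derivatives of the Gaussian. -/
def gam2 (i j : Fin N) (z : RN N) : ℝ := (z i * z j / 4 - (if i = j then 1 else 0) / 2) * gau z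

lemma integral_gsw_pos {b : ℝ} (hb : 0 < b) : 0 < ∫ w : RN N, gsw b w :=
  integral_exp_pos (integrable_gsw hb)

lemma gau_pos (z : RN N) : 0 < gau z :=
  mul_pos (inv_pos.2 (integral_gsw_pos (by norm_num))) (gsw_pos _ _)

lemma integral_gau : ∫ z : RN N, gau z = 1 := by
  unfold gau
  rw [integral_const_mul, inv_mul_cancel₀ (integral_gsw_pos (by norm_num)).ne']

lemma contDiff_gau {n : WithTop ℕ∞} : ContDiff ℝ n (gau (N := N)) :=
  contDiff_const.mul (contDiff_gsw _)

lemma integrable_gau : Integrable (gau (N := N)) := (integrable_gsw (by norm_num)).const_mul _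

lemma contDiff_gam1 (i : Fin N) {n : WithTop ℕ∞} : ContDiff ℝ n (gam1 i) := by
  unfold gam1
  have := contDiff_gau (N := N) (n := n)
  fun_prop

lemma contDiff_gam2 (i j : Fin N) {n : WithTop ℕ∞} : ContDiff ℝ n (gam2 i j) := by
  unfold gam2
  have := contDiff_gau (N := N) (n := n)
  fun_prop

lemma hasFDerivAt_coord (i : Fin N) (z : RN N) :
    HasFDerivAt (fun z : RN N => z i) (ContinuousLinearMap.proj (R := ℝ) (φ := fun _ => ℝ) i) z :=
  (ContinuousLinearMap.proj (R := ℝ) (φ := fun _ => ℝ) i).hasFDerivAt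

lemma fderiv_gau (z v : RN N) : fderiv ℝ gau z v = -(∑ i, z i * v i) / 2 * gau z := by
  have h1 : HasFDerivAt (sqs (N := N)) (∑ i, (2 * z i) •
      ContinuousLinearMap.proj (R := ℝ) (φ := fun _ => ℝ) i) z := by
    refine (HasFDerivAt.fun_sum fun i _ => (hasFDerivAt_coord i z).pow 2).congr_fderiv ?_
    simp
  have h2 : HasFDerivAt (gau (N := N)) _ z := ((h1.const_mul (-(1/4))).exp.const_mul
    (∫ w : RN N, gsw (1 / 4) w)⁻¹)
  rw [h2.fderiv]
  simp only [_root_.smul_apply, _root_.sum_apply,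
    ContinuousLinearMap.proj_apply, smul_eq_mul, gau, gsw]
  rw [neg_div, Finset.sum_div, ← Finset.sum_neg_distrib, Finset.mul_sum, Finset.mul_sum, Finset.mul_sum,
    Finset.sum_mul]
  refine Finset.sum_congr rfl fun i _ => ?_
  ring

lemma fderiv_gau_single (i : Fin N) (z : RN N) : fderiv ℝ gau z (Pi.single i 1) = gam1 i z := by
  rw [fderiv_gau, gam1]
  simp [Pi.single_apply]; ring

lemma fderiv_gam1 (i : Fin N) (z v : RN N) : fderiv ℝ (gam1 i) z v =
    -(v i / 2) * gau z - z i / 2 * fderiv ℝ gau z v := by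
  have hg : DifferentiableAt ℝ (gau (N := N)) z := (contDiff_gau (n := 1)).differentiable one_ne_zero z
  have h : HasFDerivAt (gam1 i) _ z := (((hasFDerivAt_coord i z).mul_const (-(1 / 2) : ℝ)).congr_of_eventuallyEq
      (f₁ := fun z : RN N => -(z i / 2))
      (Eventually.of_forall fun z => by simp only []; ring)).mul hg.hasFDerivAt
  rw [h.fderiv]
  simp; ring

lemma fderiv_gam1_single (i j : Fin N) (z : RN N) : fderiv ℝ (gam1 i) z (Pi.single j 1) = gam2 i j z := by
  rw [fderiv_gam1, fderiv_gau_single, gam1, gam2]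
  simp only [Pi.single_apply]
  split_ifs <;> ring

lemma fderiv_gam2 (i j : Fin N) (z v : RN N) : fderiv ℝ (gam2 i j) z v =
    (v i * z j + z i * v j) / 4 * gau z +
      (z i * z j / 4 - (if i = j then 1 else 0) / 2) * fderiv ℝ gau z v := by
  have hg : DifferentiableAt ℝ (gau (N := N)) z := (contDiff_gau (n := 1)).differentiable one_ne_zero z
  have h : HasFDerivAt (gam2 i j) _ z := ((((hasFDerivAt_coord i z).mul (hasFDerivAt_coord j z)).mul_const
    (1 / 4 : ℝ)).sub_const ((if i = j then 1 else 0) / 2 : ℝ) |>.congr_of_eventuallyEq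
      (f₁ := fun z : RN N => z i * z j / 4 - (if i = j then 1 else 0) / 2)
      (Eventually.of_forall fun z => by simp only [Pi.mul_apply]; ring)).mul hg.hasFDerivAt
  rw [h.fderiv]
  simp; ring

lemma abs_fderiv_gau_le (z v : RN N) : |fderiv ℝ gau z v| ≤ N * ‖z‖ * ‖v‖ * gau z := by
  rw [fderiv_gau, abs_mul, abs_of_pos (gau_pos z), abs_div, abs_neg, abs_two]
  have h0 : |∑ i, z i * v i| ≤ N * (‖z‖ * ‖v‖) := by
    refine (Finset.abs_sum_le_sum_abs _ _).trans ?_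
    refine (Finset.sum_le_card_nsmul _ _ (‖z‖ * ‖v‖) fun i _ => ?_).trans (by simp)
    rw [abs_mul]
    exact mul_le_mul (norm_le_pi_norm z i) (norm_le_pi_norm v i) (abs_nonneg _) (norm_nonneg _)
  have h2 := abs_nonneg (∑ i, z i * v i)
  refine mul_le_mul_of_nonneg_right ?_ (gau_pos z).le
  rw [mul_assoc]; linarith

lemma exists_KD_of {k : RN N → ℝ} (m : ℕ) {C : ℝ} (hC : 0 ≤ C) (hk : ContDiff ℝ 1 k)
    (h0 : ∀ z, |k z| ≤ C * (1 + ‖z‖) ^ m * gau z)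
    (h1 : ∀ z v, |fderiv ℝ k z v| ≤ C * (1 + ‖z‖) ^ m * gau z * ‖v‖) : ∃ C', KD k C' := by
  obtain ⟨B, hB, h⟩ := exists_pow_mul_gsw_le (N := N) m (show (1 / 8 : ℝ) < 1 / 4 by norm_num)
  set c := (∫ w : RN N, gsw (1 / 4) w)⁻¹ with hc
  have hc0 : 0 < c := inv_pos.2 (integral_gsw_pos (by norm_num))
  have key : ∀ z : RN N, C * (1 + ‖z‖) ^ m * gau z ≤ C * c * B * gsw (1 / 8) z := fun z => by
    have := mul_le_mul_of_nonneg_left (h z) (mul_nonneg hC hc0.le)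
    unfold gau; rw [← hc]; linarith
  refine ⟨C * c * B, hk, by positivity, fun z => (h0 z).trans (key z), fun z => ?_⟩
  refine ContinuousLinearMap.opNorm_le_bound _
    (mul_nonneg (by positivity) (gsw_pos _ _).le) fun v => ?_
  refine (h1 z v).trans ?_
  exact mul_le_mul_of_nonneg_right (key z) (norm_nonneg v)

lemma exists_KD_gam1 (i : Fin N) : ∃ C, KD (gam1 i) C := by
  refine exists_KD_of 2 (C := N + 1) (by positivity) (contDiff_gam1 i) (fun z => ?_) fun z v => ?_
  · rw [gam1, abs_mul, abs_of_pos (gau_pos z), abs_neg, abs_div, abs_two]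
    have h1 : |z i| ≤ ‖z‖ := norm_le_pi_norm z i
    have := gau_pos z
    gcongr
    have h2 := norm_nonneg z
    have h3 : (0:ℝ) ≤ N := by positivity
    nlinarith [mul_nonneg h3 (sq_nonneg (1 + ‖z‖))]
  · rw [fderiv_gam1]
    have h1 : |z i| ≤ ‖z‖ := norm_le_pi_norm z i
    have h2 : |v i| ≤ ‖v‖ := norm_le_pi_norm v i
    have h3 := abs_fderiv_gau_le z v
    have := gau_pos z
    calc _ ≤ |v i| / 2 * gau z + |z i| / 2 * |fderiv ℝ gau z v| := by
          refine (abs_sub _ _).trans (le_of_eq ?_)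
          rw [abs_mul, abs_mul, abs_neg, abs_div, abs_div, abs_two, abs_of_pos this]
      _ ≤ ‖v‖ / 2 * gau z + ‖z‖ / 2 * (N * ‖z‖ * ‖v‖ * gau z) := by gcongr
      _ = (1 / 2 + N / 2 * ‖z‖ ^ 2) * gau z * ‖v‖ := by ring
      _ ≤ _ := by
          gcongr
          have h3 : (0:ℝ) ≤ N := by positivity
          have := norm_nonneg z
          nlinarith [mul_nonneg h3 this, mul_nonneg h3 (sq_nonneg ‖z‖)]

lemma exists_KD_gam2 (i j : Fin N) : ∃ C, KD (gam2 i j) C := by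
  refine exists_KD_of 3 (C := N + 1) (by positivity) (contDiff_gam2 i j) (fun z => ?_) fun z v => ?_
  all_goals
    have h1 : |z i| ≤ ‖z‖ := norm_le_pi_norm z i
    have h1' : |z j| ≤ ‖z‖ := norm_le_pi_norm z j
    have hg := gau_pos z
    have hn := norm_nonneg z
    have h3 : (0:ℝ) ≤ N := by positivity
    have hq : |z i * z j / 4 - (if i = j then 1 else 0) / 2| ≤ ‖z‖ ^ 2 / 4 + 1 / 2 := by
      refine (abs_sub (G := ℝ) (z i * z j / 4) ((if i = j then (1:ℝ) else 0) / 2)).trans (add_le_add (α := ℝ) ?_ ?_)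
      · rw [abs_div, abs_mul, sq, abs_of_pos (show (0:ℝ) < 4 by norm_num)]; gcongr
      · split_ifs <;> simp [abs_of_pos]
    have hN := mul_nonneg h3 (pow_nonneg hn 3)
    have hN2 := mul_nonneg h3 (pow_nonneg hn 2)
    have hN1 := mul_nonneg h3 hn
    have hn2 := pow_nonneg hn 2
    have hn3 := pow_nonneg hn 3
  · rw [gam2, abs_mul, abs_of_pos hg]
    gcongr
    refine hq.trans ?_
    nlinarith
  · rw [fderiv_gam2]
    have h2 : |v i| ≤ ‖v‖ := norm_le_pi_norm v i
    have h2' : |v j| ≤ ‖v‖ := norm_le_pi_norm v j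
    have h4 := abs_fderiv_gau_le z v
    have h5 : |v i * z j + z i * v j| ≤ |v i| * |z j| + |z i| * |v j| := by
      simpa only [abs_mul] using abs_add_le (v i * z j) (z i * v j)
    calc _ ≤ (|v i| * |z j| + |z i| * |v j|) / 4 * gau z +
            |z i * z j / 4 - (if i = j then 1 else 0) / 2| * |fderiv ℝ gau z v| := by
          refine (abs_add_le _ _).trans ?_
          rw [abs_mul, abs_mul, abs_div, abs_of_pos hg, abs_of_pos (show (0:ℝ) < 4 by norm_num)]
          gcongr
      _ ≤ (‖v‖ * ‖z‖ + ‖z‖ * ‖v‖) / 4 * gau z + (‖z‖ ^ 2 / 4 + 1 / 2) * (N * ‖z‖ * ‖v‖ * gau z) := by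
          gcongr
      _ = (‖z‖ / 2 + (‖z‖ ^ 2 / 4 + 1 / 2) * (N * ‖z‖)) * gau z * ‖v‖ := by ring
      _ ≤ _ := by
          gcongr
          nlinarith

/-- The parabolic rescaling `y ↦ y / √s` of the space variable. -/
def psc (u : XT N) : RN N := u.2 ^ (-(1 / 2) : ℝ) • u.1

/-- The self-similar kernel of homogeneity `p` and profile `k`. -/
def kq (p : ℝ) (k : RN N → ℝ) (u : XT N) : ℝ := u.2 ^ p * k (psc u)

/-- The self-similar kernel truncated to times in `(a, b)`. -/
def hk (p : ℝ) (k : RN N → ℝ) (a b : ℝ) (u : XT N) : ℝ :=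
  {u : XT N | u.2 ∈ Ioo a b}.indicator (kq p k) u

lemma measurable_psc : Measurable (psc (N := N)) := by
  unfold psc; fun_prop

lemma measurable_kq (p : ℝ) {k : RN N → ℝ} (hk : Measurable k) : Measurable (kq p k) := by
  exact (measurable_snd.pow_const p).mul (hk.comp measurable_psc)

lemma measurable_hk (p : ℝ) {k : RN N → ℝ} (h : Measurable k) (a b : ℝ) : Measurable (hk p k a b) :=
  (measurable_kq p h).indicator (measurable_snd measurableSet_Ioo)

lemma lintegral_comp_rpow_smul {g : RN N → ENNReal} (hg : Measurable g) {s : ℝ} (hs : 0 < s) (c : ℝ) :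
    ∫⁻ y, g (s ^ c • y) = ENNReal.ofReal (s ^ (-(c * N))) * ∫⁻ z, g z := by
  have hs' : s ^ c ≠ 0 := (Real.rpow_pos_of_pos hs _).ne'
  rw [← lintegral_map (f := g) (g := fun y => s ^ c • y) hg (measurable_const_smul _),
    Measure.map_addHaar_smul _ hs', lintegral_smul_measure, smul_eq_mul]
  congr 2
  rw [Module.finrank_pi, Fintype.card_fin, abs_of_pos (by positivity), Real.rpow_neg hs.le,
    Real.rpow_mul_natCast hs.le]

lemma lintegral_parabolic {S : Set ℝ} (hS : MeasurableSet S) (hS0 : S ⊆ Ioi 0) (e : ℝ)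
    {g : RN N → ENNReal} (hg : Measurable g) :
    ∫⁻ u : XT N, {u : XT N | u.2 ∈ S}.indicator
      (fun u => ENNReal.ofReal (u.2 ^ e) * g (psc u)) u =
    (∫⁻ s in S, ENNReal.ofReal (s ^ (e + N / 2))) * ∫⁻ z, g z := by
  have hm : Measurable fun u : XT N => {u : XT N | u.2 ∈ S}.indicator
      (fun u => ENNReal.ofReal (u.2 ^ e) * g (psc u)) u := by
    have := hg.comp (measurable_psc (N := N))
    exact ((measurable_snd.pow_const e).ennreal_ofReal.mul this).indicator
      (measurable_snd hS)
  rw [Measure.volume_eq_prod, lintegral_prod_symm' _ hm, ← lintegral_mul_const _ (by fun_prop),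
    ← lintegral_indicator hS]
  refine lintegral_congr fun s => ?_
  by_cases hs : s ∈ S
  · have hs0 : 0 < s := hS0 hs
    simp only [indicator, mem_ofPred_eq, hs, if_true, psc]
    rw [lintegral_const_mul _ (by have := hg; fun_prop), lintegral_comp_rpow_smul hg hs0, ← mul_assoc,
      ← ENNReal.ofReal_mul (Real.rpow_nonneg hs0.le _), ← Real.rpow_add hs0]
    congr 4; ring
  · simp [indicator, hs]

lemma lintegral_gsw_ne_top {b : ℝ} (hb : 0 < b) : ∫⁻ z : RN N, ENNReal.ofReal (gsw b z) ≠ ⊤ := by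
  rw [← ofReal_integral_eq_lintegral_ofReal (integrable_gsw hb)
    (Eventually.of_forall fun z => (gsw_pos b z).le)]
  exact ENNReal.ofReal_ne_top

lemma lintegral_parabolic_gsw {S : Set ℝ} (hS : MeasurableSet S) (hS0 : S ⊆ Ioi 0) (c e b : ℝ)
    (hc : 0 ≤ c) :
    ∫⁻ u : XT N, {u : XT N | u.2 ∈ S}.indicator
      (fun u => ENNReal.ofReal (c * u.2 ^ e * gsw b (psc u))) u =
    ENNReal.ofReal c * (∫⁻ s in S, ENNReal.ofReal (s ^ (e + N / 2))) *
      ∫⁻ z : RN N, ENNReal.ofReal (gsw b z) := by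
  rw [mul_assoc, ← lintegral_parabolic hS hS0 e (measurable_gsw b).ennreal_ofReal,
    ← lintegral_const_mul' _ _ ENNReal.ofReal_ne_top]
  refine lintegral_congr fun u => ?_
  by_cases hs : u.2 ∈ S
  · simp only [indicator, mem_ofPred_eq, hs, if_true]
    rw [ENNReal.ofReal_mul (mul_nonneg hc (Real.rpow_nonneg (hS0 hs).le _)), ENNReal.ofReal_mul hc,
      mul_assoc]
  · simp [indicator, hs]

lemma abs_kq_le {k : RN N → ℝ} {C : ℝ} (h : KD k C) (p : ℝ) {u : XT N} (hu : 0 < u.2) :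
    |kq p k u| ≤ C * u.2 ^ p * gsw (1 / 8) (psc u) := by
  rw [kq, abs_mul, abs_of_pos (Real.rpow_pos_of_pos hu _)]
  have := mul_le_mul_of_nonneg_left (h.bd (psc u)) (Real.rpow_pos_of_pos hu p).le
  linarith

lemma lintegral_Ioo_rpow_ne_top {a b : ℝ} (ha : 0 < a) (e : ℝ) :
    ∫⁻ s in Ioo a b, ENNReal.ofReal (s ^ e) ≠ ⊤ := by
  have : IntegrableOn (fun s : ℝ => s ^ e) (Icc a b) :=
    ContinuousOn.integrableOn_Icc fun s hs =>
      (Real.continuousAt_rpow_const s e (Or.inl (ha.trans_le hs.1).ne')).continuousWithinAt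
  exact ((hasFiniteIntegral_iff_ofReal ((ae_restrict_mem measurableSet_Ioo).mono fun s hs =>
    Real.rpow_nonneg (ha.trans hs.1).le _)).1 (this.mono_set Ioo_subset_Icc_self).2).ne

lemma integrable_hk_of_lintegral {k : RN N → ℝ} {C : ℝ} (h : KD k C) (p : ℝ) {a b : ℝ} (ha : 0 ≤ a)
    (hI : ∫⁻ s in Ioo a b, ENNReal.ofReal (s ^ (p + N / 2)) ≠ ⊤) : Integrable (hk p k a b) := by
  refine ⟨(measurable_hk p h.cd.continuous.measurable a b).aestronglyMeasurable, ?_⟩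
  rw [hasFiniteIntegral_iff_enorm]
  refine lt_of_le_of_lt (b := ∫⁻ u : XT N, {u : XT N | u.2 ∈ Ioo a b}.indicator
      (fun u => ENNReal.ofReal (C * u.2 ^ p * gsw (1 / 8) (psc u))) u) (lintegral_mono fun u => ?_) ?_
  · by_cases hu : u.2 ∈ Ioo a b
    · simp only [hk, indicator, mem_ofPred_eq, hu, if_true]
      rw [Real.enorm_eq_ofReal_abs]
      exact ENNReal.ofReal_le_ofReal (abs_kq_le h p (ha.trans_lt hu.1))
    · rw [hk, indicator_of_notMem (show u ∉ {u : XT N | u.2 ∈ Ioo a b} from hu)]; simp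
  · rw [lintegral_parabolic_gsw measurableSet_Ioo (fun s hs => ha.trans_lt hs.1) _ _ _ h.nonneg]
    exact ENNReal.mul_lt_top (ENNReal.mul_lt_top ENNReal.ofReal_lt_top hI.lt_top)
      (lintegral_gsw_ne_top (by norm_num)).lt_top

lemma integrable_hk {k : RN N → ℝ} {C : ℝ} (h : KD k C) (p : ℝ) {a b : ℝ} (ha : 0 < a) :
    Integrable (hk p k a b) :=
  integrable_hk_of_lintegral h p ha.le (lintegral_Ioo_rpow_ne_top ha _)

/-- The increment of a self-similar kernel along a segment in the region of large times. -/
lemma exists_bound_deriv_kq {k : RN N → ℝ} {C : ℝ} (h : KD k C) (p : ℝ) :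
    ∃ C' : ℝ, 0 ≤ C' ∧ ∀ (δ : ℝ) (v u : XT N), 0 < δ → ‖v.1‖ ≤ δ → |v.2| ≤ δ ^ 2 → δ ^ 2 ≤ u.2 →
      ∃ d, HasDerivAt (fun θ : ℝ => kq p k (u + θ • v)) d 0 ∧
        |d| ≤ (C' * δ) * u.2 ^ (p - 1 / 2) * gsw (1 / 16) (psc u) := by
  obtain ⟨B, hB, hBz⟩ := exists_pow_mul_gsw_le (N := N) 1 (show (1 / 16 : ℝ) < 1 / 8 by norm_num)
  refine ⟨(|p| + 1) * C * B, mul_nonneg (mul_nonneg (by positivity) h.nonneg) hB.le,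
    fun δ v u hδ hv1 hv2 hu => ?_⟩
  have hs : 0 < u.2 := (by positivity : 0 < δ ^ 2).trans_le hu
  set s := u.2 with hsdef
  set z := psc u with hz
  have hA : HasDerivAt (fun θ : ℝ => s + θ * v.2) v.2 0 := by
    simpa using ((hasDerivAt_id (0:ℝ)).mul_const v.2).const_add s
  have hD : HasDerivAt (fun θ : ℝ => u.1 + θ • v.1) v.1 0 := by
    simpa using ((hasDerivAt_id (0:ℝ)).smul_const v.1).const_add u.1
  have hp : ∀ e : ℝ, HasDerivAt (fun θ : ℝ => (s + θ * v.2) ^ e) (v.2 * e * s ^ (e - 1)) 0 := fun e => by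
    simpa using hA.rpow_const (p := e) (Or.inl (by simpa using hs.ne'))
  have hZ := (hp (-(1 / 2))).smul hD
  set z' : RN N := s ^ (-(1 / 2) : ℝ) • v.1 + (v.2 * (-(1 / 2)) * s ^ (-(1 / 2) - 1 : ℝ)) • u.1 with hz'
  have hZ' : HasDerivAt (fun θ : ℝ => psc (u + θ • v)) z' 0 := by
    refine hZ.congr_deriv ?_
    simp [hz']
  have hK : HasDerivAt (fun θ : ℝ => k (psc (u + θ • v))) (fderiv ℝ k z z') 0 := by
    have h1 : HasFDerivAt k (fderiv ℝ k z) (psc (u + (0:ℝ) • v)) := by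
      simpa [hz] using (h.cd.differentiable one_ne_zero z).hasFDerivAt
    exact h1.comp_hasDerivAt (0:ℝ) hZ'
  have hT := (hp p).mul hK
  refine ⟨_, hT, ?_⟩
  have e0 : psc (u + (0:ℝ) • v) = z := by simp [hz]
  have e1 : s + 0 * v.2 = s := by ring
  rw [e0, e1]
  have hr : s ^ (-(1 / 2) : ℝ) * s ^ (-(1 / 2) : ℝ) = s⁻¹ := by
    rw [← Real.rpow_add hs, ← Real.rpow_neg_one]; norm_num
  set q := s ^ (-(1 / 2) : ℝ) with hq
  have hq0 : 0 < q := Real.rpow_pos_of_pos hs _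
  have hp0 : 0 < s ^ p := Real.rpow_pos_of_pos hs _
  have hδq : δ * q ≤ 1 := by
    have : (δ * q) ^ 2 ≤ 1 := by
      rw [mul_pow, sq q, hr, ← div_eq_mul_inv, div_le_one hs]; exact hu
    nlinarith [mul_pos hδ hq0]
  have hzn : ‖z'‖ ≤ δ * q * (1 + ‖z‖) := by
    have e2 : (v.2 * (-(1 / 2)) * s ^ (-(1 / 2) - 1 : ℝ)) • u.1 = (v.2 * (-(1 / 2)) * (q * q)) • z := by
      rw [hr, hz, psc, smul_smul, Real.rpow_sub_one hs.ne']; congr 1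
      rw [← hsdef, ← hq]; field_simp
    have e3 : ‖z'‖ ≤ q * ‖v.1‖ + |v.2| * (1 / 2) * (q * q) * ‖z‖ := by
      rw [hz', e2]
      refine (norm_add_le _ _).trans (le_of_eq ?_)
      rw [norm_smul, norm_smul, Real.norm_of_nonneg hq0.le]
      congr 2
      rw [Real.norm_eq_abs, abs_mul, abs_mul, abs_mul, abs_neg, abs_of_pos hq0]
      norm_num
    refine e3.trans ?_
    have : |v.2| * (1 / 2) * (q * q) ≤ δ * q := by
      calc |v.2| * (1 / 2) * (q * q) ≤ δ ^ 2 * 1 * (q * q) := by gcongr; norm_num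
        _ = δ * q * (δ * q) := by ring
        _ ≤ δ * q * 1 := by gcongr
        _ = _ := by ring
    have h2 := mul_le_mul_of_nonneg_right this (norm_nonneg z)
    have h3 := mul_le_mul_of_nonneg_left hv1 hq0.le
    nlinarith
  have hg := gsw_pos (1 / 8) z
  have e4 : |v.2 * p * s ^ (p - 1) * k z| ≤ |p| * (δ * q) * (s ^ p * (C * gsw (1 / 8) z)) := by
    have : s ^ (p - 1) = s ^ p * (q * q) := by rw [hr, Real.rpow_sub_one hs.ne', div_eq_mul_inv]
    rw [abs_mul, abs_mul, abs_mul, this, abs_of_pos (by positivity : 0 < s ^ p * (q * q))]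
    have h5 : |v.2| * (q * q) ≤ δ * q := by
      calc |v.2| * (q * q) ≤ δ ^ 2 * (q * q) := by gcongr
        _ = δ * q * (δ * q) := by ring
        _ ≤ δ * q * 1 := by gcongr
        _ = _ := by ring
    calc |v.2| * |p| * (s ^ p * (q * q)) * |k z| = |p| * (|v.2| * (q * q)) * (s ^ p * |k z|) := by ring
      _ ≤ _ := by
        gcongr
        exact h.bd z
  have e5 : |s ^ p * fderiv ℝ k z z'| ≤ (δ * q * (1 + ‖z‖)) * (s ^ p * (C * gsw (1 / 8) z)) := by
    rw [abs_mul, abs_of_pos hp0]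
    have := (fderiv ℝ k z).le_opNorm z'
    rw [Real.norm_eq_abs] at this
    have h6 : |fderiv ℝ k z z'| ≤ (C * gsw (1 / 8) z) * (δ * q * (1 + ‖z‖)) :=
      this.trans (mul_le_mul (h.dbd z) hzn (norm_nonneg _) (mul_nonneg h.nonneg hg.le))
    calc _ ≤ s ^ p * ((C * gsw (1 / 8) z) * (δ * q * (1 + ‖z‖))) := by gcongr
      _ = _ := by ring
  have e6 : s ^ (p - 1 / 2) = s ^ p * q := by
    rw [hq, ← Real.rpow_add hs]; rfl
  rw [e6]
  have hb := hBz z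
  rw [pow_one] at hb
  refine (abs_add_le _ _).trans ((add_le_add e4 e5).trans ?_)
  have h7 : |p| * (δ * q) ≤ |p| * (δ * q * (1 + ‖z‖)) := by
    have := norm_nonneg z
    have h8 : δ * q * 1 ≤ δ * q * (1 + ‖z‖) := by gcongr; linarith
    have := mul_le_mul_of_nonneg_left h8 (abs_nonneg p)
    linarith
  have hC := h.nonneg
  calc _ ≤ |p| * (δ * q * (1 + ‖z‖)) * (s ^ p * (C * gsw (1 / 8) z)) +
        (δ * q * (1 + ‖z‖)) * (s ^ p * (C * gsw (1 / 8) z)) := by gcongr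
    _ = (|p| + 1) * C * (δ * q * s ^ p) * ((1 + ‖z‖) * gsw (1 / 8) z) := by ring
    _ ≤ (|p| + 1) * C * (δ * q * s ^ p) * (B * gsw (1 / 16) z) := by gcongr
    _ = _ := by ring

lemma enorm_kq_sub_le {k : RN N → ℝ} {C' δ : ℝ} {p : ℝ} (hk : ContDiff ℝ 1 k)
    (hC' : ∀ (δ : ℝ) (v u : XT N), 0 < δ → ‖v.1‖ ≤ δ → |v.2| ≤ δ ^ 2 → δ ^ 2 ≤ u.2 →
      ∃ d, HasDerivAt (fun θ : ℝ => kq p k (u + θ • v)) d 0 ∧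
        |d| ≤ (C' * δ) * u.2 ^ (p - 1 / 2) * gsw (1 / 16) (psc u))
    (hδ : 0 < δ) {h u : XT N} (h1 : ‖h.1‖ ≤ δ) (h2 : |h.2| ≤ δ ^ 2) (hu : 4 * δ ^ 2 < u.2) :
    ‖kq p k (u - h) - kq p k u‖ₑ ≤ ∫⁻ θ in Icc (0:ℝ) 1, {u : XT N | u.2 ∈ Ioi (δ ^ 2)}.indicator
      (fun u => ENNReal.ofReal ((C' * δ) * u.2 ^ (p - 1 / 2) * gsw (1 / 16) (psc u))) (u - θ • h) := by
  have hpos : ∀ θ ∈ Icc (0:ℝ) 1, δ ^ 2 < (u - θ • h).2 := fun θ hθ => by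
    have : θ * h.2 ≤ δ ^ 2 := by
      calc θ * h.2 ≤ |θ * h.2| := le_abs_self _
        _ = θ * |h.2| := by rw [abs_mul, abs_of_nonneg hθ.1]
        _ ≤ 1 * δ ^ 2 := by gcongr; exact hθ.2
        _ = _ := one_mul _
    have h3 : (u - θ • h).2 = u.2 - θ * h.2 := by simp
    rw [h3]; nlinarith [sq_nonneg δ, pow_pos hδ 2]
  have hcd : ContDiffOn ℝ 1 (fun θ : ℝ => kq p k (u - θ • h)) (Icc 0 1) := by
    have hs : ContDiffOn ℝ 1 (fun θ : ℝ => (u - θ • h).2) (Icc 0 1) := by fun_prop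
    have hy : ContDiffOn ℝ 1 (fun θ : ℝ => (u - θ • h).1) (Icc 0 1) := by fun_prop
    have hr : ∀ e : ℝ, ContDiffOn ℝ 1 (fun θ : ℝ => (u - θ • h).2 ^ e) (Icc 0 1) := fun e =>
      hs.rpow_const_of_ne fun θ hθ => ((pow_pos hδ 2).trans (hpos θ hθ)).ne'
    exact (hr p).mul (hk.comp_contDiffOn ((hr _).smul hy))
  have := enorm_sub_le_lintegral_deriv_of_contDiffOn_Icc hcd zero_le_one
  simp only [one_smul, zero_smul, sub_zero] at this
  refine this.trans (setLIntegral_mono_ae' measurableSet_Icc (Eventually.of_forall fun θ hθ => ?_))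
  have hm : (u - θ • h) ∈ {u : XT N | u.2 ∈ Ioi (δ ^ 2)} := hpos θ hθ
  rw [indicator_of_mem hm, Real.enorm_eq_ofReal_abs]
  obtain ⟨d, hd, hdb⟩ := hC' δ (-h) (u - θ • h) hδ (by simpa using h1) (by simpa using h2)
    (hpos θ hθ).le
  have hd' : HasDerivAt (fun θ' : ℝ => kq p k ((u - θ • h) + (θ' - θ) • (-h))) d θ := by
    have e : (0:ℝ) = θ - θ := by ring
    rw [e] at hd
    exact hd.comp_sub_const θ θ
  have e : (fun θ' : ℝ => kq p k ((u - θ • h) + (θ' - θ) • (-h))) = fun θ' => kq p k (u - θ' • h) := by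
    funext θ'
    congr 1
    module
  rw [e] at hd'
  rw [hd'.deriv]
  exact ENNReal.ofReal_le_ofReal hdb

/-- Hörmander's condition for truncated parabolic kernels, uniformly in the truncation. -/
theorem exists_horC_hk {k : RN N → ℝ} {C : ℝ} (h : KD k C) :
    ∃ CH : ENNReal, CH ≠ ⊤ ∧ ∀ a b : ℝ, 0 ≤ a → HorC (hk (-(N / 2) - 1) k a b) CH := by
  obtain ⟨C', hC'0, hC'⟩ := exists_bound_deriv_kq h (-(N / 2) - 1)
  obtain ⟨B, hB, hBz⟩ := exists_pow_mul_gsw_le (N := N) 1 (show (1 / 16 : ℝ) < 1 / 8 by norm_num)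
  set p : ℝ := -(N / 2) - 1 with hp
  set G : ENNReal := ∫⁻ z : RN N, ENNReal.ofReal (gsw (1 / 16) z) with hG
  have hGt : G ≠ ⊤ := lintegral_gsw_ne_top (by norm_num)
  set G' : ENNReal := ∫⁻ z : RN N, ENNReal.ofReal (gsw (1 / 8) z) with hG'
  have hGt' : G' ≠ ⊤ := lintegral_gsw_ne_top (by norm_num)
  refine ⟨ENNReal.ofReal (6 * C * B) * G + ENNReal.ofReal (6 * C * B) * G + ENNReal.ofReal (2 * C') * G +
    ENNReal.ofReal C * G', ?_, ?_⟩
  · have := ENNReal.mul_ne_top (ENNReal.ofReal_ne_top (r := 6 * C * B)) hGt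
    have := ENNReal.mul_ne_top (ENNReal.ofReal_ne_top (r := 2 * C')) hGt
    have := ENNReal.mul_ne_top (ENNReal.ofReal_ne_top (r := C)) hGt'
    exact ENNReal.add_ne_top.2 ⟨ENNReal.add_ne_top.2 ⟨ENNReal.add_ne_top.2 ⟨by assumption, by assumption⟩,
      by assumption⟩, by assumption⟩
  intro a b ha n v hv1 hv2
  set δ : ℝ := ((2:ℝ) ^ n)⁻¹ with hδ
  have hδ0 : 0 < δ := by positivity
  have hδ2 : ((4:ℝ) ^ n)⁻¹ = δ ^ 2 := by
    rw [hδ, inv_pow, ← pow_mul, mul_comm n 2, pow_mul]; norm_num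
  rw [hδ2] at hv2
  have hδp : 0 < δ ^ 2 := by positivity
  have hvn : ‖v.1‖ ≤ δ := (pi_norm_le_iff_of_nonneg hδ0.le).2 fun i => by
    rw [Real.norm_of_nonneg (hv1 i).1]; exact (hv1 i).2
  have hC := h.nonneg
  let F1 : XT N → ENNReal := fun u => {u : XT N | u.2 ∈ Ioo 0 (9 * δ ^ 2)}.indicator
      (fun u => ENNReal.ofReal ((C * B / δ) * u.2 ^ (p + 1 / 2) * gsw (1 / 16) (psc u))) u
  let B2 : XT N → ENNReal := fun u => {u : XT N | u.2 ∈ Ioi (δ ^ 2)}.indicator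
      (fun u => ENNReal.ofReal ((C' * δ) * u.2 ^ (p - 1 / 2) * gsw (1 / 16) (psc u))) u
  let F2 : XT N → ENNReal := fun u => ∫⁻ θ in Icc (0:ℝ) 1, B2 (u - θ • v)
  let J : Set ℝ := Ioi (4 * δ ^ 2) ∩ (Icc a (a + δ ^ 2) ∪ Icc b (b + δ ^ 2))
  let F3 : XT N → ENNReal := fun u => {u : XT N | u.2 ∈ J}.indicator
      (fun u => ENNReal.ofReal (C * u.2 ^ p * gsw (1 / 8) (psc u))) u
  have hJ : MeasurableSet J := measurableSet_Ioi.inter (measurableSet_Icc.union measurableSet_Icc)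
  have hJ0 : J ⊆ Ioi 0 := fun s hs => (by positivity : 0 < 4 * δ ^ 2).trans hs.1
  have hmg : ∀ (S : Set ℝ) (c e b' : ℝ), MeasurableSet S → Measurable fun u : XT N =>
      {u : XT N | u.2 ∈ S}.indicator
        (fun u => ENNReal.ofReal (c * u.2 ^ e * gsw b' (psc u))) u := fun S c e b' hS =>
    (((measurable_snd.pow_const e).const_mul c).mul
      ((measurable_gsw b').comp measurable_psc)).ennreal_ofReal.indicator (measurable_snd hS)
  have hF1m : Measurable F1 := hmg _ _ _ _ measurableSet_Ioo
  have hB2m : Measurable B2 := hmg _ _ _ _ measurableSet_Ioi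
  have hF3m : Measurable F3 := hmg _ _ _ _ hJ
  have hBm' : Measurable (Function.uncurry fun (u : XT N) (θ : ℝ) => B2 (u - θ • v)) :=
    hB2m.comp (by fun_prop)
  have hF2m : Measurable F2 := hBm'.lintegral_prod_right'
  have hkK : ∀ u : XT N, ‖hk p k a b u‖ₑ ≤ ‖kq p k u‖ₑ := fun u => by
    rw [hk]; exact enorm_indicator_le_enorm_self _ _
  have b1 : ∀ u : XT N, δ ≤ ‖u.1‖ → u.2 < 9 * δ ^ 2 → ‖hk p k a b u‖ₑ ≤ F1 u := by
    intro u hu1 hu2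
    by_cases hu0 : 0 < u.2
    · have hm : u ∈ {u : XT N | u.2 ∈ Ioo 0 (9 * δ ^ 2)} := ⟨hu0, hu2⟩
      refine (hkK u).trans ?_
      simp only [F1]
      rw [indicator_of_mem hm, Real.enorm_eq_ofReal_abs]
      refine ENNReal.ofReal_le_ofReal ((abs_kq_le h p hu0).trans ?_)
      set q := u.2 ^ (1 / 2 : ℝ) with hq
      have hq0 : 0 < q := Real.rpow_pos_of_pos hu0 _
      have e1 : u.1 = q • psc u := by
        rw [psc, smul_smul, hq, ← Real.rpow_add hu0]; norm_num
      have e2 : δ ≤ q * (1 + ‖psc u‖) := by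
        rw [e1, norm_smul, Real.norm_of_nonneg hq0.le] at hu1
        linarith
      rw [Real.rpow_add hu0, ← hq]
      have hb := hBz (psc u)
      rw [pow_one] at hb
      have hg := gsw_pos (1 / 8) (psc u)
      have hpp := Real.rpow_pos_of_pos hu0 p
      calc C * u.2 ^ p * gsw (1 / 8) (psc u) = C * u.2 ^ p / δ * (δ * gsw (1 / 8) (psc u)) := by
            field_simp
        _ ≤ C * u.2 ^ p / δ * (q * (1 + ‖psc u‖) * gsw (1 / 8) (psc u)) := by gcongr
        _ = C * u.2 ^ p / δ * q * ((1 + ‖psc u‖) * gsw (1 / 8) (psc u)) := by ring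
        _ ≤ C * u.2 ^ p / δ * q * (B * gsw (1 / 16) (psc u)) := by gcongr
        _ = _ := by ring
    · have : u ∉ {u : XT N | u.2 ∈ Ioo a b} := fun hm => hu0 (ha.trans_lt hm.1)
      rw [hk, indicator_of_notMem this]; simp
  have b2 : ∀ u : XT N, 4 * δ ^ 2 < u.2 → ‖kq p k (u - v) - kq p k u‖ₑ ≤ F2 u := fun u hu =>
    enorm_kq_sub_le h.cd hC' hδ0 hvn (by rw [abs_of_nonneg hv2.1]; exact hv2.2) hu
  have b3 : ∀ u : XT N, u.2 ∈ J → ‖kq p k u‖ₑ ≤ F3 u := fun u hu => by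
    have hm : u ∈ {u : XT N | u.2 ∈ J} := hu
    simp only [F3]
    rw [indicator_of_mem hm, Real.enorm_eq_ofReal_abs]
    exact ENNReal.ofReal_le_ofReal (abs_kq_le h p (hJ0 hu))
  have key : ∀ u ∈ (Bn N n)ᶜ, ‖hk p k a b (u - v) - hk p k a b u‖ₑ ≤
      F1 (u - v) + F1 u + F2 u + F3 u := by
    intro u hu
    have e2 : (u - v).2 = u.2 - v.2 := rfl
    by_cases hs : u.2 ≤ 4 * δ ^ 2
    · by_cases hs0 : u.2 ≤ 0
      · have m1 : u ∉ {u : XT N | u.2 ∈ Ioo a b} := fun hm => absurd hm.1 (by linarith)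
        have m2 : u - v ∉ {u : XT N | u.2 ∈ Ioo a b} := fun hm =>
          absurd hm.1 (by rw [e2]; linarith [hv2.1])
        rw [hk, hk, indicator_of_notMem m1, indicator_of_notMem m2]; simp
      · push Not at hs0
        have : ∃ i, 2 * δ < |u.1 i| := by
          by_contra! hcon
          refine hu ⟨?_, ?_⟩
          · rw [Set.mem_pi]
            exact fun i _ => abs_le.1 (hcon i)
          · rw [hδ2]; exact ⟨by linarith, hs⟩
        obtain ⟨i, hi⟩ := this
        have n1 : δ ≤ ‖u.1‖ := by
          have := norm_le_pi_norm u.1 i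
          rw [Real.norm_eq_abs] at this; linarith
        have n2 : δ ≤ ‖(u - v).1‖ := by
          have := norm_le_pi_norm (u - v).1 i
          rw [Real.norm_eq_abs] at this
          have h3 : |u.1 i| ≤ |(u - v).1 i| + |v.1 i| := by
            have := abs_add_le ((u - v).1 i) (v.1 i)
            simpa using this
          have h4 : |v.1 i| ≤ δ := by rw [abs_of_nonneg (hv1 i).1]; exact (hv1 i).2
          linarith
        calc _ ≤ ‖hk p k a b (u - v)‖ₑ + ‖hk p k a b u‖ₑ := enorm_sub_le
          _ ≤ F1 (u - v) + F1 u := add_le_add (b1 _ n2 (by rw [e2]; linarith [hv2.1]))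
              (b1 _ n1 (by linarith))
          _ ≤ _ := le_add_right (le_add_right le_rfl)
    · push Not at hs
      have hstep : ‖hk p k a b (u - v) - hk p k a b u‖ₑ ≤ F2 u + F3 u := by
        by_cases m1 : u ∈ {u : XT N | u.2 ∈ Ioo a b} <;>
        by_cases m2 : u - v ∈ {u : XT N | u.2 ∈ Ioo a b}
        · rw [hk, hk, indicator_of_mem m1, indicator_of_mem m2]
          exact le_add_right (b2 u hs)
        · rw [hk, hk, indicator_of_mem m1, indicator_of_notMem m2, zero_sub, enorm_neg]
          refine le_add_left (b3 u ⟨hs, Or.inl ⟨m1.1.le, ?_⟩⟩)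
          by_contra! hc
          exact m2 ⟨by rw [e2]; linarith [hv2.2], by rw [e2]; linarith [hv2.1, m1.2]⟩
        · rw [hk, hk, indicator_of_notMem m1, indicator_of_mem m2, sub_zero]
          have hJu : u.2 ∈ J := by
            refine ⟨hs, Or.inr ⟨?_, ?_⟩⟩
            · by_contra! hc
              have := m2.1
              rw [e2] at this
              exact m1 ⟨by linarith [hv2.1], hc⟩
            · have := m2.2
              rw [e2] at this
              linarith [hv2.2]
          calc ‖kq p k (u - v)‖ₑ = ‖(kq p k (u - v) - kq p k u) + kq p k u‖ₑ := by rw [sub_add_cancel]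
            _ ≤ _ := (enorm_add_le _ _).trans (add_le_add (b2 u hs) (b3 u hJu))
        · rw [hk, hk, indicator_of_notMem m1, indicator_of_notMem m2]; simp
      refine hstep.trans ?_
      rw [add_assoc]
      exact le_add_left le_rfl
  have i1 : ∫⁻ u, F1 u = ENNReal.ofReal (6 * C * B) * G := by
    simp only [F1]
    rw [lintegral_parabolic_gsw measurableSet_Ioo (fun s hs => hs.1) _ _ _ (by positivity)]
    have e : p + 1 / 2 + N / 2 = -(1 / 2) := by rw [hp]; ring
    rw [e, lintegral_rpow_Ioo (by positivity) (by norm_num), ← ENNReal.ofReal_mul (by positivity)]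
    congr 2
    have : (9 * δ ^ 2) ^ (-(1 / 2) + 1 : ℝ) = 3 * δ := by
      rw [show 9 * δ ^ 2 = (3 * δ) ^ (2:ℝ) by rw [Real.rpow_two]; ring, ← Real.rpow_mul (by positivity)]
      norm_num
    rw [this]; field_simp; ring
  have iB : ∫⁻ u, B2 u = ENNReal.ofReal (2 * C') * G := by
    simp only [B2]
    rw [lintegral_parabolic_gsw measurableSet_Ioi (fun s hs => hδp.trans hs) _ _ _ (by positivity)]
    have e : p - 1 / 2 + N / 2 = -(3 / 2) := by rw [hp]; ring
    rw [e, lintegral_rpow_Ioi (by positivity) (by norm_num), ← ENNReal.ofReal_mul (by positivity)]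
    congr 2
    have : (δ ^ 2) ^ (-(3 / 2) + 1 : ℝ) = δ⁻¹ := by
      rw [← Real.rpow_two, ← Real.rpow_mul hδ0.le, ← Real.rpow_neg_one]; norm_num
    rw [this]; field_simp; norm_num
  have i2 : ∫⁻ u, F2 u ≤ ENNReal.ofReal (2 * C') * G := by
    simp only [F2]
    rw [lintegral_lintegral_swap (μ := volume) (ν := volume.restrict (Icc (0:ℝ) 1))
      (f := fun (u : XT N) (θ : ℝ) => B2 (u - θ • v)) hBm'.aemeasurable]
    have : ∀ θ : ℝ, ∫⁻ u, B2 (u - θ • v) = ENNReal.ofReal (2 * C') * G := fun θ => by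
      rw [lintegral_sub_right_eq_self, iB]
    simp only [this]
    simp
  have i3 : ∫⁻ u, F3 u ≤ ENNReal.ofReal C * G' := by
    simp only [F3]
    rw [lintegral_parabolic_gsw hJ hJ0 _ _ _ hC]
    have : ∫⁻ s in J, ENNReal.ofReal (s ^ (p + N / 2)) ≤ 1 := by
      have e : p + N / 2 = -1 := by rw [hp]; ring
      rw [e]
      calc _ ≤ ∫⁻ s in J, ENNReal.ofReal ((4 * δ ^ 2)⁻¹) :=
            setLIntegral_mono' hJ fun s hs => by
              rw [Real.rpow_neg_one]
              exact ENNReal.ofReal_le_ofReal (inv_anti₀ (by positivity) hs.1.le)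
        _ ≤ ENNReal.ofReal ((4 * δ ^ 2)⁻¹) * (ENNReal.ofReal (δ ^ 2) + ENNReal.ofReal (δ ^ 2)) := by
            rw [setLIntegral_const]
            gcongr
            refine (measure_mono inter_subset_right).trans ((measure_union_le _ _).trans ?_)
            simp [Real.volume_Icc]
        _ ≤ 1 := by
            rw [← ENNReal.ofReal_add hδp.le hδp.le, ← ENNReal.ofReal_mul (by positivity)]
            refine ENNReal.ofReal_le_one.2 ?_
            rw [inv_mul_le_iff₀ (by positivity)]; linarith
    calc _ ≤ ENNReal.ofReal C * 1 * G' := by gcongr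
      _ = _ := by rw [mul_one]
  calc _ ≤ ∫⁻ u in (Bn N n)ᶜ, (F1 (u - v) + F1 u + F2 u + F3 u) :=
        setLIntegral_mono' (measurableSet_Bn n).compl key
    _ ≤ ∫⁻ u, (F1 (u - v) + F1 u + F2 u + F3 u) := setLIntegral_le_lintegral _ _
    _ = (∫⁻ u, F1 (u - v)) + (∫⁻ u, F1 u) + (∫⁻ u, F2 u) + ∫⁻ u, F3 u := by
        rw [lintegral_add_right _ hF3m, lintegral_add_right _ hF2m, lintegral_add_right _ hF1m]
    _ ≤ _ := by
        rw [lintegral_sub_right_eq_self, i1]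
        gcongr

/-- Spatial coordinate directions in space-time. -/
def ei (i : Fin N) : XT N := (Pi.single i 1, 0)

/-- The time direction. -/
def et (N : ℕ) : XT N := (0, 1)

/-- Parabolic displacement. -/
def dh (ω : ℝ × RN N) : XT N := (√ω.1 • ω.2, ω.1)

lemma measurable_dh : Measurable (dh (N := N)) := by unfold dh; fun_prop

lemma measurable_dh_right (s : ℝ) : Measurable fun z : RN N => dh (s, z) := by unfold dh; fun_prop

/-- Average of `f` over parabolic displacements of duration `s`, with spatial profile `k`. -/
def Gk (k : RN N → ℝ) (s : ℝ) (f : XT N → ℝ) (q : XT N) : ℝ := ∫ z, k z * f (q - dh (s, z))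

lemma KD.integrable {k : RN N → ℝ} {C : ℝ} (h : KD k C) : Integrable k :=
  ((integrable_gsw (by norm_num : (0:ℝ) < 1 / 8)).const_mul C).mono'
    h.cd.continuous.aestronglyMeasurable (Eventually.of_forall h.bd)

lemma KD.integrable_fderiv {k : RN N → ℝ} {C : ℝ} (h : KD k C) (v : RN N) :
    Integrable fun z => fderiv ℝ k z v := by
  refine ((integrable_gsw (by norm_num : (0:ℝ) < 1 / 8)).const_mul (C * ‖v‖)).mono'
    ((h.cd.continuous_fderiv one_ne_zero).clm_apply continuous_const).aestronglyMeasurable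
    (Eventually.of_forall fun z => ?_)
  calc ‖fderiv ℝ k z v‖ ≤ ‖fderiv ℝ k z‖ * ‖v‖ := ContinuousLinearMap.le_opNorm _ _
    _ ≤ C * gsw (1 / 8) z * ‖v‖ := by gcongr; exact h.dbd z
    _ = _ := by ring

lemma exists_KD_gau : ∃ C, KD (gau (N := N)) C := by
  refine exists_KD_of 1 (C := N + 1) (by positivity) contDiff_gau (fun z => ?_) fun z v => ?_
  · rw [abs_of_pos (gau_pos z)]
    have : 1 ≤ ((N : ℝ) + 1) * (1 + ‖z‖) ^ 1 := by nlinarith [norm_nonneg z, N.cast_nonneg (α := ℝ)]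
    have := gau_pos z
    nlinarith
  · refine (abs_fderiv_gau_le z v).trans ?_
    have := gau_pos z
    have h1 : (N : ℝ) * ‖z‖ ≤ (N + 1) * (1 + ‖z‖) ^ 1 := by nlinarith [norm_nonneg z, N.cast_nonneg (α := ℝ)]
    calc N * ‖z‖ * ‖v‖ * gau z = (N * ‖z‖) * (‖v‖ * gau z) := by ring
      _ ≤ ((N + 1) * (1 + ‖z‖) ^ 1) * (‖v‖ * gau z) := by gcongr
      _ = _ := by ring

lemma SPc.continuous_dh {f : XT N → ℝ} {R : ℝ} (hf : SPc f R) (s : ℝ) (q : XT N) :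
    Continuous fun z : RN N => f (q - dh (s, z)) := by
  refine hf.smooth.continuous.comp ?_
  unfold dh; fun_prop

lemma SPc.integrable_Gk {k : RN N → ℝ} (hk : Integrable k) {f : XT N → ℝ} {R : ℝ} (hf : SPc f R)
    (s : ℝ) (q : XT N) : Integrable fun z => k z * f (q - dh (s, z)) := by
  obtain ⟨C, hC0, hC⟩ := hf.exists_bound
  exact hk.mul_bdd (c := C) (hf.continuous_dh s q).aestronglyMeasurable
    (Eventually.of_forall fun z => hC _)

lemma SPc.Gk_dir {k : RN N → ℝ} {C : ℝ} (hk : KD k C) {f : XT N → ℝ} {R : ℝ} (hf : SPc f R)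
    {s : ℝ} (hs : 0 < s) (q : XT N) (i : Fin N) :
    Gk k s (fun x => fderiv ℝ f x (ei i)) q =
      (√s)⁻¹ * Gk (fun z => fderiv ℝ k z (Pi.single i 1)) s f q := by
  have hs' : 0 < √s := Real.sqrt_pos.2 hs
  have hder : ∀ z v : RN N, HasFDerivAt (fun z : RN N => f (q - dh (s, z)))
      ((fderiv ℝ f (q - dh (s, z))).comp
        (-((√s • ContinuousLinearMap.id ℝ (RN N)).prod (0 : RN N →L[ℝ] ℝ)))) z := by
    intro z v
    have h1 : HasFDerivAt (fun z : RN N => q - dh (s, z))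
        (-((√s • ContinuousLinearMap.id ℝ (RN N)).prod (0 : RN N →L[ℝ] ℝ))) z := by
      have : HasFDerivAt (fun z : RN N => dh (s, z))
          ((√s • ContinuousLinearMap.id ℝ (RN N)).prod (0 : RN N →L[ℝ] ℝ)) z :=
        ((hasFDerivAt_id z).const_smul √s).prodMk (hasFDerivAt_const s z)
      exact this.const_sub q
    exact ((hf.smooth.differentiable (by simp)) _).hasFDerivAt.comp z h1
  have hv : ∀ z : RN N, fderiv ℝ (fun z : RN N => f (q - dh (s, z))) z (Pi.single i 1)
      = -√s * fderiv ℝ f (q - dh (s, z)) (ei i) := by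
    intro z
    rw [(hder z 0).fderiv]
    have : (-((√s • ContinuousLinearMap.id ℝ (RN N)).prod (0 : RN N →L[ℝ] ℝ))) (Pi.single i 1)
        = (-√s) • (ei i : XT N) := by
      ext <;> simp [ei]
    rw [ContinuousLinearMap.comp_apply, this, map_smul, smul_eq_mul]
  have hin : Integrable fun z => k z * fderiv ℝ (fun z : RN N => f (q - dh (s, z))) z (Pi.single i 1) := by
    simp only [hv]
    refine (((hf.dir (ei i)).integrable_Gk hk.integrable s q).const_mul (-√s)).congr
      (Eventually.of_forall fun z => ?_)
    simp only; ring
  have key := integral_mul_fderiv_eq_neg_fderiv_mul_of_integrable (μ := volume)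
    (hf.integrable_Gk (hk.integrable_fderiv (Pi.single i 1)) s q)
    hin (hf.integrable_Gk hk.integrable s q)
    (fun z _ => hk.cd.differentiable one_ne_zero z) (fun z _ => (hder z 0).differentiableAt)
  simp only [hv] at key
  have e : ∀ z, k z * (-√s * fderiv ℝ f (q - dh (s, z)) (ei i)) =
      -√s * (k z * fderiv ℝ f (q - dh (s, z)) (ei i)) := fun z => by ring
  simp only [e] at key
  rw [integral_const_mul] at key
  unfold Gk
  rw [eq_inv_mul_iff_mul_eq₀ hs'.ne']
  linarith

/-- The spatial Laplacian in terms of directional derivatives. -/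
def lapD (f : XT N → ℝ) (q : XT N) : ℝ :=
  ∑ i, fderiv ℝ (fun x => fderiv ℝ f x (ei i)) q (ei i)

lemma SPc.lapl {f : XT N → ℝ} {R : ℝ} (hf : SPc f R) : SPc (lapD f) R :=
  SPc.sum fun i _ => (hf.dir (ei i)).dir (ei i)

lemma SPc.abs_Gk_le {k : RN N → ℝ} (hk : Integrable k) {f : XT N → ℝ} {B : ℝ}
    (hB : ∀ q, ‖f q‖ ≤ B) (s : ℝ) (q : XT N) : |Gk k s f q| ≤ B * ∫ z, ‖k z‖ := by
  rw [← integral_const_mul, ← Real.norm_eq_abs]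
  refine norm_integral_le_of_norm_le (hk.norm.const_mul B) (Eventually.of_forall fun z => ?_)
  rw [norm_mul, mul_comm]
  gcongr
  exact hB _

lemma SPc.continuous_Gk {k : RN N → ℝ} (hk : Integrable k) {f : XT N → ℝ} {R : ℝ} (hf : SPc f R)
    (q : XT N) : Continuous fun s => Gk k s f q := by
  obtain ⟨C, hC0, hC⟩ := hf.exists_bound
  refine continuous_of_dominated (bound := fun z => ‖k z‖ * C)
    (fun s => (hf.integrable_Gk hk s q).1) (fun s => Eventually.of_forall fun z => ?_)
    (hk.norm.mul_const C) (Eventually.of_forall fun z => ?_)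
  · rw [norm_mul]; gcongr; exact hC _
  · refine continuous_const.mul (hf.smooth.continuous.comp ?_)
    unfold dh; fun_prop

lemma Gk_gau_zero (f : XT N → ℝ) (q : XT N) : Gk gau 0 f q = f q := by
  unfold Gk dh
  have : ∀ z : RN N, ((√(0:ℝ) • z, (0:ℝ)) : XT N) = 0 := fun z => by simp
  simp only [this, sub_zero]
  rw [integral_mul_const, integral_gau, one_mul]

lemma SPc.hasDerivAt_Gk {f : XT N → ℝ} {R : ℝ} (hf : SPc f R) {s : ℝ} (hs : 0 < s) (q : XT N) :
    HasDerivAt (fun s => Gk gau s f q) (Gk gau s (fun x => lapD f x - fderiv ℝ f x (et N)) q) s := by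
  obtain ⟨C, hC0, hC⟩ := hf.fderivMap.exists_bound
  obtain ⟨Cg, hCg⟩ := exists_KD_gau (N := N)
  set w : ℝ → RN N → XT N := fun s z => ((1 / (2 * √s)) • z, 1) with hw
  have hder : ∀ z : RN N, ∀ x ∈ Ioi (s / 4), HasDerivAt (fun s => gau z * f (q - dh (s, z)))
      (gau z * -(fderiv ℝ f (q - dh (x, z)) (w x z))) x := by
    intro z x hx
    have hx0 : 0 < x := lt_trans (by positivity) hx
    have h1 : HasDerivAt (fun x : ℝ => dh (x, z)) (w x z) x :=
      ((Real.hasDerivAt_sqrt hx0.ne').smul_const z).prodMk (hasDerivAt_id x)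
    have h2 := h1.const_sub q
    have h3 := ((hf.smooth.differentiable (by simp)) (q - dh (x, z))).hasFDerivAt.comp_hasDerivAt x h2
    rw [map_neg] at h3
    exact h3.const_mul (gau z)
  have hb : ∀ z : RN N, ∀ x ∈ Ioi (s / 4), ‖gau z * -(fderiv ℝ f (q - dh (x, z)) (w x z))‖ ≤
      (C * ((1 / √s) + 1)) * ((1 + ‖z‖) ^ 1 * gau z) := by
    intro z x hx
    have hx0 : 0 < x := lt_trans (by positivity) hx
    have h4 : √s ≤ 2 * √x := by
      rw [Real.sqrt_le_left (by positivity), mul_pow, Real.sq_sqrt hx0.le]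
      have := mem_Ioi.1 hx
      linarith
    have hss : 0 < √s := Real.sqrt_pos.2 hs
    have h5 : ‖w x z‖ ≤ ((1 / √s) + 1) * (1 + ‖z‖) := by
      rw [hw, Prod.norm_def]
      refine max_le ?_ ?_
      · rw [norm_smul, Real.norm_of_nonneg (by positivity)]
        gcongr
        · exact (one_div_le_one_div_of_le hss h4).trans (by linarith)
        · linarith
      · have := norm_nonneg z
        have : 0 < 1 / √s := by positivity
        simp only [norm_one]
        nlinarith
    rw [norm_mul, norm_neg, Real.norm_of_nonneg (gau_pos z).le, pow_one]
    calc gau z * ‖fderiv ℝ f (q - dh (x, z)) (w x z)‖ ≤ gau z * (C * (((1 / √s) + 1) * (1 + ‖z‖))) := by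
          have := gau_pos z
          gcongr
          exact (ContinuousLinearMap.le_opNorm _ _).trans (by gcongr; exact hC _)
      _ = _ := by ring
  have hbi : Integrable fun z : RN N => (C * ((1 / √s) + 1)) * ((1 + ‖z‖) ^ 1 * gau z) := by
    refine Integrable.const_mul ?_ _
    have := (integrable_pow_mul_gsw (N := N) 1 (by norm_num : (0:ℝ) < 1 / 4)).const_mul
      (∫ w : RN N, gsw (1 / 4) w)⁻¹
    refine this.congr (Eventually.of_forall fun z => ?_)
    simp only [gau]; ring
  have hm : AEStronglyMeasurable (fun z : RN N => gau z * -(fderiv ℝ f (q - dh (s, z)) (w s z))) := by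
    refine Continuous.aestronglyMeasurable ?_
    refine (contDiff_gau (n := 1)).continuous.mul (Continuous.neg (Continuous.clm_apply
      (hf.fderivMap.smooth.continuous.comp ?_) ?_))
    · unfold dh; fun_prop
    · rw [hw]; fun_prop
  have key := hasDerivAt_integral_of_dominated_loc_of_deriv_le (μ := volume) (s := Ioi (s / 4)) (x₀ := s)
    (Ioi_mem_nhds (by linarith)) (F := fun s z => gau z * f (q - dh (s, z)))
    (F' := fun s z => gau z * -(fderiv ℝ f (q - dh (s, z)) (w s z)))
    (Eventually.of_forall fun x => (hf.integrable_Gk integrable_gau x q).1)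
    (hf.integrable_Gk integrable_gau s q) hm (Eventually.of_forall hb) hbi (Eventually.of_forall hder)
  refine key.2.congr_deriv ?_
  have hss : 0 < √s := Real.sqrt_pos.2 hs
  have e1 : ∀ z, gau z * -(fderiv ℝ f (q - dh (s, z)) (w s z)) =
      ((√s)⁻¹ * ∑ i, gam1 i z * fderiv ℝ f (q - dh (s, z)) (ei i)) -
        gau z * fderiv ℝ f (q - dh (s, z)) (et N) := by
    intro z
    have : w s z = (∑ i, (1 / (2 * √s) * z i) • (ei i : XT N)) + et N := by
      have hz : ((1 / (2 * √s)) • z : RN N) = ∑ i, (1 / (2 * √s) * z i) • (Pi.single i 1 : RN N) := by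
        ext j
        simp [Finset.sum_apply, Pi.single_apply]
      ext1
      · simp only [hw, et, Prod.fst_add, Prod.fst_sum, Prod.smul_fst, ei, add_zero]
        exact hz
      · simp [hw, et, ei, Prod.snd_sum]
    rw [this, map_add, map_sum]
    simp only [map_smul, smul_eq_mul, gam1]
    rw [neg_add, mul_add, mul_neg, mul_neg, Finset.mul_sum, Finset.mul_sum, sub_eq_add_neg]
    congr 1
    rw [← Finset.sum_neg_distrib]
    refine Finset.sum_congr rfl fun i _ => ?_
    field_simp
  refine (integral_congr_ae (Eventually.of_forall e1)).trans ?_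
  have hi1 : ∀ i, Integrable fun z => gam1 i z * fderiv ℝ f (q - dh (s, z)) (ei i) := fun i =>
    (hf.dir (ei i)).integrable_Gk (by obtain ⟨C, hC⟩ := exists_KD_gam1 i; exact hC.integrable) s q
  rw [integral_sub ((integrable_finsetSum _ fun i _ => hi1 i).const_mul _)
    ((hf.dir (et N)).integrable_Gk integrable_gau s q), integral_const_mul, integral_finsetSum _ fun i _ => hi1 i]
  have e2 : ∀ i, Gk gau s (fun x => fderiv ℝ (fun x => fderiv ℝ f x (ei i)) x (ei i)) q =
      (√s)⁻¹ * ∫ z, gam1 i z * fderiv ℝ f (q - dh (s, z)) (ei i) := by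
    intro i
    rw [(hf.dir (ei i)).Gk_dir hCg hs]
    simp only [fderiv_gau_single]
    rfl
  rw [Finset.mul_sum]
  simp only [← e2]
  unfold Gk lapD
  rw [← integral_finsetSum _ fun i _ => ((hf.dir (ei i)).dir (ei i)).integrable_Gk integrable_gau s q,
    ← integral_sub (integrable_finsetSum _ fun i _ =>
      ((hf.dir (ei i)).dir (ei i)).integrable_Gk integrable_gau s q)
      ((hf.dir (et N)).integrable_Gk integrable_gau s q)]
  refine integral_congr_ae (Eventually.of_forall fun z => ?_)
  simp only [mul_sub, Finset.mul_sum]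

lemma SPc.Gk_dir2 {f : XT N → ℝ} {R : ℝ} (hf : SPc f R) {s : ℝ} (hs : 0 < s) (q : XT N)
    (i j : Fin N) :
    Gk gau s (fun x => fderiv ℝ (fun y => fderiv ℝ f y (ei j)) x (ei i)) q =
      s⁻¹ * Gk (gam2 i j) s f q := by
  obtain ⟨C, hC⟩ := exists_KD_gau (N := N)
  obtain ⟨C', hC'⟩ := exists_KD_gam1 i
  rw [(hf.dir (ei j)).Gk_dir hC hs]
  have : (fun z => fderiv ℝ gau z (Pi.single i 1)) = gam1 i := funext (fderiv_gau_single i)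
  rw [this, hf.Gk_dir hC' hs]
  have : (fun z => fderiv ℝ (gam1 i) z (Pi.single j 1)) = gam2 i j := funext (fderiv_gam1_single i j)
  rw [this, ← mul_assoc, ← mul_inv, Real.mul_self_sqrt hs.le]

lemma integrable_hk_zero {k : RN N → ℝ} {C : ℝ} (h : KD k C) {p b : ℝ} (hb : 0 ≤ b)
    (hp : -1 < p + N / 2) : Integrable (hk p k 0 b) :=
  integrable_hk_of_lintegral h p le_rfl (by
    rw [lintegral_rpow_Ioo hb hp]; exact ENNReal.ofReal_ne_top)

/-- The Gaussian probability measure. -/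
def gmeas (N : ℕ) : Measure (RN N) := volume.withDensity fun z => ENNReal.ofReal (gau z)

instance : IsProbabilityMeasure (gmeas N) where
  measure_univ := by
    rw [gmeas, withDensity_apply _ MeasurableSet.univ, Measure.restrict_univ,
      ← ofReal_integral_eq_lintegral_ofReal integrable_gau (Eventually.of_forall fun z => (gau_pos z).le),
      integral_gau, ENNReal.ofReal_one]

lemma integral_gmeas (g : RN N → ℝ) : ∫ z, g z ∂(gmeas N) = ∫ z, gau z * g z := by
  rw [gmeas, integral_withDensity_eq_integral_toReal_smul
    ((contDiff_gau (n := 0)).continuous.measurable.ennreal_ofReal)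
    (Eventually.of_forall fun _ => ENNReal.ofReal_lt_top)]
  simp only [ENNReal.toReal_ofReal (gau_pos _).le, smul_eq_mul]

/-- Law of the parabolic displacement with duration in `(a, b)`. -/
def hmeas (N : ℕ) (a b : ℝ) : Measure (ℝ × RN N) := (volume.restrict (Ioo a b)).prod (gmeas N)

instance (a b : ℝ) : IsFiniteMeasure (hmeas N a b) := by unfold hmeas; infer_instance

/-- The heat potential with durations in `(a, b)`. -/
def heat (a b : ℝ) (f : XT N → ℝ) : XT N → ℝ := Av (hmeas N a b) dh f

lemma Gk_gau_eq_Av (s : ℝ) (f : XT N → ℝ) :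
    Gk gau s f = Av (gmeas N) (fun z => dh (s, z)) f := by
  ext q
  rw [Av, integral_gmeas, Gk]

section
variable {f : XT N → ℝ} {R : ℝ}

lemma SPc.heat_eq (hf : SPc f R) (a b : ℝ) (q : XT N) :
    heat a b f q = ∫ s in Ioo a b, Gk gau s f q := by
  rw [heat, Av, hmeas, integral_prod]
  · simp only [integral_gmeas]; rfl
  · exact hf.integrable_translate (ν := hmeas N a b) measurable_dh q

lemma SPc.spc_heat {a b : ℝ} (ha : 0 ≤ a) (hf : SPc f R) : SPc (heat a b f) (R + b) := by
  refine hf.av measurable_dh ?_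
  have h : ∀ᵐ s ∂(volume.restrict (Ioo a b)), |s| ≤ b := (ae_restrict_mem measurableSet_Ioo).mono
    fun s hs => by rw [abs_of_pos (ha.trans_lt hs.1)]; exact hs.2.le
  exact (Measure.quasiMeasurePreserving_fst (μ := volume.restrict (Ioo a b)) (ν := gmeas N)).ae h

lemma SPc.heat_dir (hf : SPc f R) (a b : ℝ) (q v : XT N) :
    fderiv ℝ (heat a b f) q v = heat a b (fun x => fderiv ℝ f x v) q :=
  hf.fderiv_Av_apply measurable_dh q v

lemma SPc.heat_sub_dir (hf : SPc f R) {a b : ℝ} (ha : 0 ≤ a) (hab : a ≤ b) (q : XT N) :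
    heat a b (fun x => lapD f x - fderiv ℝ f x (et N)) q = Gk gau b f q - Gk gau a f q := by
  have h := hf.lapl.sub (hf.dir (et N))
  rw [h.heat_eq, ← integral_Ioc_eq_integral_Ioo, ← intervalIntegral.integral_of_le hab]
  exact intervalIntegral.integral_eq_sub_of_hasDerivAt_of_le hab
    (hf.continuous_Gk integrable_gau q).continuousOn
    (fun s hs => hf.hasDerivAt_Gk (ha.trans_lt hs.1) q)
    ((h.continuous_Gk integrable_gau q).intervalIntegrable _ _)

lemma SPc.cvk_hk (hf : SPc f R) {k : RN N → ℝ} {p a b : ℝ} (ha : 0 ≤ a)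
    (hi : Integrable (hk p k a b)) (q : XT N) :
    cvk (hk p k a b) f q = ∫ s in Ioo a b, s ^ (p + N / 2) * Gk k s f q := by
  obtain ⟨C, hC0, hC⟩ := hf.exists_bound
  have hin := (hf.bpc hC).integrable_cvk hi q
  rw [cvk, Measure.volume_eq_prod, integral_prod_symm _ hin, ← integral_indicator measurableSet_Ioo]
  refine integral_congr_ae (Eventually.of_forall fun s => ?_)
  by_cases hs : s ∈ Ioo a b
  · have hs0 : 0 < s := ha.trans_lt hs.1
    have hR : 0 < s ^ (-(1 / 2) : ℝ) := Real.rpow_pos_of_pos hs0 _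
    have e : ∀ y : RN N, hk p k a b (y, s) * f (q - (y, s)) =
        s ^ p * ((fun z => k z * f (q - dh (s, z))) (s ^ (-(1 / 2) : ℝ) • y)) := by
      intro y
      have h1 : √s • s ^ (-(1 / 2) : ℝ) • y = y := by
        rw [smul_smul, Real.sqrt_eq_rpow, ← Real.rpow_add hs0]
        norm_num
      have hm : (y, s) ∈ {u : XT N | u.2 ∈ Ioo a b} := hs
      rw [hk, indicator_of_mem hm]
      simp only [kq, psc, dh, h1]
      ring
    simp only [e]
    rw [integral_const_mul, Measure.integral_comp_smul volume (fun z => k z * f (q - dh (s, z))), indicator_of_mem hs, Module.finrank_pi,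
      Fintype.card_fin, abs_of_pos (by positivity), smul_eq_mul, ← mul_assoc, ← Real.rpow_mul_natCast hs0.le,
      ← Real.rpow_neg hs0.le, ← Real.rpow_add hs0]
    unfold Gk
    congr 3
    ring
  · rw [indicator_of_notMem hs]
    have e : ∀ y : RN N, hk p k a b (y, s) = 0 := fun y =>
      indicator_of_notMem (show (y, s) ∉ {u : XT N | u.2 ∈ Ioo a b} from hs) _
    simp [e]

lemma SPc.heat_dir1 (hf : SPc f R) {b : ℝ} (hb : 0 ≤ b) (q : XT N) (i : Fin N) :
    heat 0 b (fun x => fderiv ℝ f x (ei i)) q = cvk (hk (-((N + 1) / 2)) (gam1 i) 0 b) f q := by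
  obtain ⟨C, hC⟩ := exists_KD_gau (N := N)
  obtain ⟨C', hC'⟩ := exists_KD_gam1 i
  rw [hf.cvk_hk le_rfl (integrable_hk_zero hC' hb (by ring_nf; norm_num)), (hf.dir (ei i)).heat_eq]
  refine setIntegral_congr_fun measurableSet_Ioo fun s hs => ?_
  have : (fun z => fderiv ℝ gau z (Pi.single i 1)) = gam1 i := funext (fderiv_gau_single i)
  rw [hf.Gk_dir hC hs.1, this, Real.sqrt_eq_rpow, ← Real.rpow_neg hs.1.le]
  congr 2
  ring

lemma SPc.heat_dir2 (hf : SPc f R) {a b : ℝ} (ha : 0 < a) (q : XT N) (i j : Fin N) :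
    heat a b (fun x => fderiv ℝ (fun y => fderiv ℝ f y (ei j)) x (ei i)) q =
      cvk (hk (-(N / 2) - 1) (gam2 i j) a b) f q := by
  obtain ⟨C', hC'⟩ := exists_KD_gam2 i j
  rw [hf.cvk_hk ha.le (integrable_hk hC' _ ha), ((hf.dir (ei j)).dir (ei i)).heat_eq]
  refine setIntegral_congr_fun measurableSet_Ioo fun s hs => ?_
  rw [hf.Gk_dir2 (ha.trans hs.1), ← Real.rpow_neg_one]
  congr 2
  ring

end

section
variable {f : XT N → ℝ} {R : ℝ}

lemma SPc.Gk_gau (hf : SPc f R) {s : ℝ} (hs : 0 ≤ s) : SPc (Gk gau s f) (R + s) := by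
  rw [Gk_gau_eq_Av]
  exact hf.av (measurable_dh_right s) (Eventually.of_forall fun z => by simp [dh, abs_of_nonneg hs])

lemma SPc.Gk_gau_dir (hf : SPc f R) (s : ℝ) (q v : XT N) :
    fderiv ℝ (Gk gau s f) q v = Gk gau s (fun x => fderiv ℝ f x v) q := by
  rw [Gk_gau_eq_Av, Gk_gau_eq_Av]
  exact hf.fderiv_Av_apply (measurable_dh_right s) q v

lemma enorm_integral_sq_le {Ω : Type*} [MeasurableSpace Ω] (ν : Measure Ω) [IsProbabilityMeasure ν]
    {g : Ω → ℝ} (hg : AEMeasurable g ν) : ‖∫ ω, g ω ∂ν‖ₑ ^ 2 ≤ ∫⁻ ω, ‖g ω‖ₑ ^ 2 ∂ν := by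
  have h := ENNReal.lintegral_mul_le_Lp_mul_Lq ν Real.HolderConjugate.two_two hg.enorm
    (aemeasurable_const (b := (1 : ENNReal)))
  have h1 : ‖∫ ω, g ω ∂ν‖ₑ ≤ (∫⁻ ω, ‖g ω‖ₑ ^ 2 ∂ν) ^ (1 / 2 : ℝ) := by
    refine (enorm_integral_le_lintegral_enorm _).trans ?_
    simpa using h
  calc ‖∫ ω, g ω ∂ν‖ₑ ^ 2 ≤ ((∫⁻ ω, ‖g ω‖ₑ ^ 2 ∂ν) ^ (1 / 2 : ℝ)) ^ 2 := by gcongr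
    _ = _ := by rw [← ENNReal.rpow_natCast, ← ENNReal.rpow_mul]; norm_num

lemma SPc.lintegral_Gk_sq_le (hf : SPc f R) (s : ℝ) :
    ∫⁻ q in strip N, ‖Gk gau s f q‖ₑ ^ 2 ≤ ∫⁻ q in strip N, ‖f q‖ₑ ^ 2 := by
  rw [Gk_gau_eq_Av]
  have hm : Measurable (Function.uncurry fun (q : XT N) (z : RN N) => ‖f (q - dh (s, z))‖ₑ ^ 2) :=
    (hf.smooth.continuous.measurable.comp
      (measurable_fst.sub ((measurable_dh_right s).comp measurable_snd))).enorm.pow_const 2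
  calc ∫⁻ q in strip N, ‖Av (gmeas N) (fun z => dh (s, z)) f q‖ₑ ^ 2
      ≤ ∫⁻ q in strip N, ∫⁻ z, ‖f (q - dh (s, z))‖ₑ ^ 2 ∂(gmeas N) := lintegral_mono fun q =>
        enorm_integral_sq_le _ (hf.continuous_dh s q).measurable.aemeasurable
    _ = ∫⁻ z, ∫⁻ q in strip N, ‖f (q - dh (s, z))‖ₑ ^ 2 ∂volume ∂(gmeas N) :=
        lintegral_lintegral_swap (μ := volume.restrict (strip N)) (ν := gmeas N)
          (f := fun q z => ‖f (q - dh (s, z))‖ₑ ^ 2) hm.aemeasurable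
    _ = ∫⁻ z, ∫⁻ q in strip N, ‖f q‖ₑ ^ 2 ∂volume ∂(gmeas N) := by
        refine lintegral_congr fun z => ?_
        have hp : PerQ fun q => ‖f q‖ₑ ^ 2 := fun q z => by simp only [hf.per q z]
        simpa only [sub_eq_add_neg] using hp.lintegral_shift (-dh (s, z))
    _ = _ := by rw [lintegral_const, measure_univ, mul_one]

lemma SPc.sq (hf : SPc f R) : SPc (fun q => f q ^ 2) R := by
  simpa only [pow_two] using hf.mul hf.per hf.smooth

lemma SPc.lintegral_sq (hf : SPc f R) :
    ∫⁻ q in strip N, ‖f q‖ₑ ^ 2 = ENNReal.ofReal (∫ q in strip N, f q ^ 2) := by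
  rw [ofReal_integral_eq_lintegral_ofReal hf.sq.integrableOn (Eventually.of_forall fun q => sq_nonneg _)]
  refine lintegral_congr fun q => ?_
  rw [Real.enorm_eq_ofReal_abs, ← ENNReal.ofReal_pow (abs_nonneg _), sq_abs]

lemma SPc.integral_Gk_sq_le (hf : SPc f R) {s : ℝ} (hs : 0 ≤ s) :
    ∫ q in strip N, Gk gau s f q ^ 2 ≤ ∫ q in strip N, f q ^ 2 := by
  have h := hf.lintegral_Gk_sq_le s
  rw [(hf.Gk_gau hs).lintegral_sq, hf.lintegral_sq] at h
  exact (ENNReal.ofReal_le_ofReal_iff (integral_nonneg fun _ => sq_nonneg _)).1 h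

lemma SPc.integral_heat_dir2_sq_le (hf : SPc f R) {a b : ℝ} (ha : 0 ≤ a) (hab : a ≤ b) (i j : Fin N) :
    ∫ q in strip N, heat a b (fun x => fderiv ℝ (fun y => fderiv ℝ f y (ei j)) x (ei i)) q ^ 2 ≤
      4 * ∫ q in strip N, f q ^ 2 := by
  have hb : 0 ≤ b := ha.trans hab
  have hg := hf.dir (ei j)
  set g := fun y => fderiv ℝ f y (ei j)
  have hw := hg.spc_heat (b := b) ha
  set w := heat a b g
  have e1 : ∀ v, (fun q => fderiv ℝ w q v) = heat a b (fun x => fderiv ℝ g x v) := fun v =>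
    funext fun q => hg.heat_dir a b q v
  set D : XT N → ℝ := fun q => Gk gau b f q - Gk gau a f q
  have hD : SPc D (R + b) := (hf.Gk_gau hb).sub ((hf.Gk_gau ha).mono (by linarith))
  have e2 : ∀ q, lapD w q - fderiv ℝ w q (et N) = fderiv ℝ D q (ei j) := by
    intro q
    have hl : lapD w q = heat a b (lapD g) q := by
      have h1 : ∀ i, fderiv ℝ (fun x => fderiv ℝ w x (ei i)) q (ei i) =
          heat a b (fun x => fderiv ℝ (fun x => fderiv ℝ g x (ei i)) x (ei i)) q := fun i => by
        rw [e1, (hg.dir (ei i)).heat_dir]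
      unfold lapD
      simp only [h1]
      unfold heat Av
      rw [integral_finsetSum _ fun i _ =>
        ((hg.dir (ei i)).dir (ei i)).integrable_translate measurable_dh q]
    have h2 := hg.heat_sub_dir ha hab q
    have h3 : heat a b (fun x => lapD g x - fderiv ℝ g x (et N)) q =
        heat a b (lapD g) q - heat a b (fun x => fderiv ℝ g x (et N)) q := by
      unfold heat Av
      exact integral_sub (hg.lapl.integrable_translate measurable_dh q)
        ((hg.dir (et N)).integrable_translate measurable_dh q)
    rw [hl, hg.heat_dir, ← h3, h2]
    have hd : ∀ s, 0 ≤ s → DifferentiableAt ℝ (Gk gau s f) q := fun s hs =>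
      (hf.Gk_gau hs).smooth.differentiable (by simp) q
    change _ = fderiv ℝ (fun q => Gk gau b f q - Gk gau a f q) q (ei j)
    rw [fderiv_fun_sub (hd b hb) (hd a ha), ← hf.Gk_gau_dir, ← hf.Gk_gau_dir]
    rfl
  have hsq : ∀ i, IntegrableOn (fun q => fderiv ℝ w q (ei i) ^ 2) (strip N) := fun i =>
    (hw.dir (ei i)).sq.integrableOn
  have e3 : ∑ i, ∫ q in strip N, fderiv ℝ w q (ei i) ^ 2 = - ∫ q in strip N, w q * lapD w q := by
    have h1 : ∀ i, ∫ q in strip N, fderiv ℝ w q (ei i) ^ 2 =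
        - ∫ q in strip N, w q * fderiv ℝ (fun x => fderiv ℝ w x (ei i)) q (ei i) := fun i => by
      rw [hw.integral_mul_dir (hw.dir (ei i)).per (hw.dir (ei i)).smooth, neg_neg]
      simp only [pow_two]
    simp only [h1, Finset.sum_neg_distrib, lapD, Finset.mul_sum]
    rw [integral_finsetSum _ fun i _ => (hw.mul ((hw.dir (ei i)).dir (ei i)).per
      ((hw.dir (ei i)).dir (ei i)).smooth).integrableOn]
  have e4 : ∫ q in strip N, w q * fderiv ℝ w q (et N) = 0 := by
    have := hw.integral_mul_dir hw.per hw.smooth (et N)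
    simp only [mul_comm (fderiv ℝ w _ (et N))] at this
    linarith
  have e5 : - ∫ q in strip N, w q * lapD w q = ∫ q in strip N, fderiv ℝ w q (ei j) * D q := by
    have h1 := hw.integral_mul_dir hD.per hD.smooth (ei j)
    have h2 : ∫ q in strip N, w q * fderiv ℝ D q (ei j) =
        (∫ q in strip N, w q * lapD w q) - ∫ q in strip N, w q * fderiv ℝ w q (et N) := by
      rw [← integral_sub (hw.mul hw.lapl.per hw.lapl.smooth).integrableOn
        (hw.mul (hw.dir (et N)).per (hw.dir (et N)).smooth).integrableOn]
      simp only [← e2, mul_sub]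
    linarith
  have hDi : IntegrableOn (fun q => D q ^ 2) (strip N) := hD.sq.integrableOn
  have e6 : ∫ q in strip N, fderiv ℝ w q (ei j) * D q ≤
      (∫ q in strip N, fderiv ℝ w q (ei j) ^ 2) / 2 + (∫ q in strip N, D q ^ 2) / 2 := by
    rw [← integral_div, ← integral_div, ← integral_add ((hsq j).div_const 2) (hDi.div_const 2)]
    refine integral_mono ((hw.dir (ei j)).mul hD.per hD.smooth).integrableOn
      (((hsq j).div_const 2).add (hDi.div_const 2)) fun q => ?_
    simp only
    nlinarith [sq_nonneg (fderiv ℝ w q (ei j) - D q)]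
  have e7 : ∫ q in strip N, D q ^ 2 ≤ 4 * ∫ q in strip N, f q ^ 2 := by
    have h1 := hf.integral_Gk_sq_le hb
    have h2 := hf.integral_Gk_sq_le ha
    have i1 : IntegrableOn (fun q => Gk gau b f q ^ 2) (strip N) := (hf.Gk_gau hb).sq.integrableOn
    have i2 : IntegrableOn (fun q => Gk gau a f q ^ 2) (strip N) := (hf.Gk_gau ha).sq.integrableOn
    have h3 : ∫ q in strip N, D q ^ 2 ≤ 2 * (∫ q in strip N, Gk gau b f q ^ 2) +
        2 * ∫ q in strip N, Gk gau a f q ^ 2 := by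
      rw [← integral_const_mul, ← integral_const_mul, ← integral_add (i1.const_mul 2) (i2.const_mul 2)]
      refine integral_mono hDi ((i1.const_mul 2).add (i2.const_mul 2)) fun q => ?_
      simp only [D]
      nlinarith [sq_nonneg (Gk gau b f q + Gk gau a f q)]
    linarith
  have hnn : ∀ i, 0 ≤ ∫ q in strip N, fderiv ℝ w q (ei i) ^ 2 := fun i =>
    integral_nonneg fun _ => sq_nonneg _
  have e8 := Finset.single_le_sum (fun i _ => hnn i) (Finset.mem_univ i)
  have e9 := Finset.single_le_sum (fun i _ => hnn i) (Finset.mem_univ j)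
  rw [← e1]
  simp only at e8 e9 ⊢
  linarith

end

lemma L2C_hk (i j : Fin N) {a b : ℝ} (ha : 0 < a) (hab : a ≤ b) :
    L2C (hk (-(N / 2) - 1) (gam2 i j) a b) 4 := by
  obtain ⟨C, hC⟩ := exists_KD_gam2 i j
  have hi : Integrable (hk (-(N / 2) - 1) (gam2 i j) a b) := integrable_hk hC _ ha
  have hm := measurable_hk (-(N / 2) - 1) hC.cd.continuous.measurable a b
  intro f M R hf
  obtain ⟨fn, h1, h2, -, h4⟩ := hf.exists_approx one_pos
  have key := cvk_bound_of_approx (r := 2) (q := 2) (C := 4) (D := strip N) hi two_pos two_pos (by norm_num)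
    (fun n => (h1 n).bpc (h2 n)) h4 hm fun n => by
      have e : cvk (hk (-(N / 2) - 1) (gam2 i j) a b) (fn n) =
          heat a b (fun x => fderiv ℝ (fun y => fderiv ℝ (fn n) y (ei j)) x (ei i)) :=
        funext fun q => ((h1 n).heat_dir2 ha q i j).symm
      have h := (h1 n).integral_heat_dir2_sq_le ha.le hab i j
      have h' := ENNReal.ofReal_le_ofReal h
      rw [ENNReal.ofReal_mul (by norm_num), ← (h1 n).lintegral_sq,
        ← ((((h1 n).dir (ei j)).dir (ei i)).spc_heat ha.le).lintegral_sq] at h'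
      rw [e, div_self two_ne_zero, ENNReal.rpow_one]
      simpa using h'
  simpa using key

section

lemma lintegral_le_of_tendsto_of_le {α : Type*} [MeasurableSpace α] {μ : Measure α}
    {F : ℕ → α → ENNReal} {G : α → ENNReal} {c : ENNReal} (hF : ∀ n, AEMeasurable (F n) μ)
    (hlim : ∀ᵐ x ∂μ, Tendsto (fun n => F n x) atTop (𝓝 (G x))) (hle : ∀ n, ∫⁻ x, F n x ∂μ ≤ c) :
    ∫⁻ x, G x ∂μ ≤ c :=
  calc ∫⁻ x, G x ∂μ = ∫⁻ x, liminf (fun n => F n x) atTop ∂μ :=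
        lintegral_congr_ae (hlim.mono fun x hx => hx.liminf_eq.symm)
    _ ≤ liminf (fun n => ∫⁻ x, F n x ∂μ) atTop := lintegral_liminf_le' hF
    _ ≤ c := liminf_le_of_le (by isBoundedDefault) fun b hb => by
        obtain ⟨n, hn⟩ := hb.exists
        exact hn.trans (hle n)

/-- Second spatial derivatives. -/
def d2 (i j : Fin N) (f : XT N → ℝ) (x : XT N) : ℝ :=
  fderiv ℝ (fun y => fderiv ℝ f y (ei j)) x (ei i)

variable {f : XT N → ℝ} {R : ℝ}

lemma SPc.spc_d2 (hf : SPc f R) (i j : Fin N) : SPc (d2 i j f) R := (hf.dir (ei j)).dir (ei i)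

lemma SPc.heat_eq_intervalIntegral (hf : SPc f R) {a b : ℝ} (hab : a ≤ b) (q : XT N) :
    heat a b f q = ∫ s in a..b, Gk gau s f q := by
  rw [hf.heat_eq, ← integral_Ioc_eq_integral_Ioo, ← intervalIntegral.integral_of_le hab]

lemma SPc.tendsto_heat (hf : SPc f R) {b : ℝ} (hb : 0 < b) (q : XT N) :
    Tendsto (fun n : ℕ => heat (b / (n + 1)) b f q) atTop (𝓝 (heat 0 b f q)) := by
  obtain ⟨C, hC⟩ := exists_KD_gau (N := N)
  have hc := hf.continuous_Gk hC.integrable q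
  have h1 : Continuous fun a => ∫ s in b..a, Gk gau s f q :=
    intervalIntegral.continuous_primitive (fun a b => hc.intervalIntegrable a b) b
  have h2 : Tendsto (fun n : ℕ => b / ((n : ℝ) + 1)) atTop (𝓝 0) := by
    have := (tendsto_const_div_atTop_nhds_zero_nat b).comp (tendsto_add_atTop_nat 1)
    simpa [Function.comp_def] using this
  have h3 := ((h1.tendsto 0).comp h2).neg
  rw [hf.heat_eq_intervalIntegral hb.le, intervalIntegral.integral_symm]
  refine h3.congr fun n => ?_
  rw [hf.heat_eq_intervalIntegral, intervalIntegral.integral_symm b]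
  · rfl
  · exact div_le_self hb.le (by simp)

lemma SPc.abs_heat_le {B : ℝ} (hf : SPc f R) (hB : ∀ q, ‖f q‖ ≤ B) {a b : ℝ} (ha : 0 ≤ a)
    (hab : a ≤ b) (q : XT N) : |heat a b f q| ≤ B * b := by
  have hB0 : 0 ≤ B := (norm_nonneg _).trans (hB 0)
  obtain ⟨C, hC⟩ := exists_KD_gau (N := N)
  rw [hf.heat_eq]
  have h1 : ∀ s, ‖Gk gau s f q‖ ≤ B := fun s => by
    have := SPc.abs_Gk_le hC.integrable hB s q
    simp only [Real.norm_eq_abs, abs_of_pos (gau_pos _), integral_gau, mul_one] at this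
    exact this
  have h2 := norm_setIntegral_le_of_norm_le_const (μ := volume) (s := Ioo a b) (C := B)
    (f := fun s => Gk gau s f q) (by simp) fun s _ => h1 s
  rw [Real.norm_eq_abs] at h2
  refine h2.trans ?_
  rw [Real.volume_real_Ioo_of_le hab]
  gcongr; linarith

lemma exists_lintegral_heat_d2_le (N : ℕ) {b : ℝ} (hb : 0 < b) {r : ℝ} (hr : 1 < r) (R R' : ℝ)
    (i j : Fin N) : ∃ C : ENNReal, C ≠ ⊤ ∧ ∀ f : XT N → ℝ, SPc f R →
      ∫⁻ q in slab N R', ‖heat 0 b (d2 i j f) q‖ₑ ^ r ≤ C * ∫⁻ q in strip N, ‖f q‖ₑ ^ r := by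
  obtain ⟨C', hC'⟩ := exists_KD_gam2 i j
  obtain ⟨CH, hCH, hH⟩ := exists_horC_hk hC'
  obtain ⟨C, hC, h⟩ := strong_type N 4 CH (by simp) hCH R R' r hr
  refine ⟨C, hC, fun f hf => ?_⟩
  obtain ⟨M, -, hM⟩ := hf.exists_bound
  have hpos : ∀ n : ℕ, 0 < b / ((n : ℝ) + 1) := fun n => by positivity
  refine lintegral_le_of_tendsto_of_le
    (F := fun (n : ℕ) q => ‖heat (b / ((n : ℝ) + 1)) b (d2 i j f) q‖ₑ ^ r) (fun n => ?_)
    (Eventually.of_forall fun q => ?_) fun n => ?_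
  · exact (((hf.spc_d2 i j).spc_heat (hpos n).le).smooth.continuous.measurable.enorm.pow_const r).aemeasurable
  · exact (ENNReal.continuous_rpow_const.tendsto _).comp
      (((hf.spc_d2 i j).tendsto_heat hb q).enorm)
  · have : ∀ q, heat (b / ((n : ℝ) + 1)) b (d2 i j f) q =
        cvk (hk (-(N / 2) - 1) (gam2 i j) (b / ((n : ℝ) + 1)) b) f q := fun q =>
      hf.heat_dir2 (hpos n) q i j
    simp only [this]
    exact h _ f M (integrable_hk hC' _ (hpos n))
      (measurable_hk _ hC'.cd.continuous.measurable _ _) (hH _ _ (hpos n).le)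
      (L2C_hk i j (hpos n) (div_le_self hb.le (by simp))) (hf.bpc hM)

lemma SPc.comp_neg (hf : SPc f R) : SPc (fun q => f (-q)) R where
  smooth := hf.smooth.comp contDiff_neg
  per := PerQ.comp_neg hf.per
  supp q hq := hf.supp _ (by simpa using hq)

lemma SPc.integral_heat_d2_mul {g : XT N → ℝ} {R' : ℝ} (hf : SPc f R) (hg : SPc g R') {b : ℝ}
    (hb : 0 < b) (i j : Fin N) :
    ∫ q in strip N, heat 0 b (d2 i j f) q * g q =
      ∫ q in strip N, f q * heat 0 b (d2 i j fun x => g (-x)) (-q) := by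
  obtain ⟨C', hC'⟩ := exists_KD_gam2 i j
  obtain ⟨M, -, hM⟩ := hf.exists_bound
  obtain ⟨M', -, hM'⟩ := hg.exists_bound
  obtain ⟨B, -, hB⟩ := (hf.spc_d2 i j).exists_bound
  obtain ⟨B', -, hB'⟩ := (hg.comp_neg.spc_d2 i j).exists_bound
  have hpos : ∀ n : ℕ, 0 < b / ((n : ℝ) + 1) := fun n => by positivity
  have hle : ∀ n : ℕ, b / ((n : ℝ) + 1) ≤ b := fun n => div_le_self hb.le (by simp)
  have heq : ∀ n : ℕ, ∫ q in strip N, heat (b / ((n : ℝ) + 1)) b (d2 i j f) q * g q =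
      ∫ q in strip N, f q * heat (b / ((n : ℝ) + 1)) b (d2 i j fun x => g (-x)) (-q) := fun n => by
    have h1 : ∀ q, heat (b / ((n : ℝ) + 1)) b (d2 i j f) q =
        cvk (hk (-(N / 2) - 1) (gam2 i j) (b / ((n : ℝ) + 1)) b) f q := fun q =>
      hf.heat_dir2 (hpos n) q i j
    have h2 : ∀ q, heat (b / ((n : ℝ) + 1)) b (d2 i j fun x => g (-x)) q =
        cvk (hk (-(N / 2) - 1) (gam2 i j) (b / ((n : ℝ) + 1)) b) (fun x => g (-x)) q := fun q =>
      hg.comp_neg.heat_dir2 (hpos n) q i j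
    simp only [h1, h2]
    exact integral_cvk_mul (integrable_hk hC' _ (hpos n)) (hf.bpc hM) (hg.bpc hM')
  have l1 : Tendsto (fun n : ℕ => ∫ q in strip N, heat (b / ((n : ℝ) + 1)) b (d2 i j f) q * g q)
      atTop (𝓝 (∫ q in strip N, heat 0 b (d2 i j f) q * g q)) := by
    refine tendsto_integral_of_dominated_convergence (fun q => B * b * ‖g q‖) (fun n => ?_)
      (hg.integrableOn.norm.const_mul _) (fun n => Eventually.of_forall fun q => ?_)
      (Eventually.of_forall fun q => ((hf.spc_d2 i j).tendsto_heat hb q).mul_const _)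
    · exact (((hf.spc_d2 i j).spc_heat (hpos n).le).smooth.continuous.mul
        hg.smooth.continuous).aestronglyMeasurable
    · rw [norm_mul]
      gcongr
      exact (hf.spc_d2 i j).abs_heat_le hB (hpos n).le (hle n) q
  have l2 : Tendsto (fun n : ℕ => ∫ q in strip N,
        f q * heat (b / ((n : ℝ) + 1)) b (d2 i j fun x => g (-x)) (-q))
      atTop (𝓝 (∫ q in strip N, f q * heat 0 b (d2 i j fun x => g (-x)) (-q))) := by
    refine tendsto_integral_of_dominated_convergence (fun q => ‖f q‖ * (B' * b)) (fun n => ?_)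
      (hf.integrableOn.norm.mul_const _) (fun n => Eventually.of_forall fun q => ?_)
      (Eventually.of_forall fun q => ((hg.comp_neg.spc_d2 i j).tendsto_heat hb (-q)).const_mul _)
    · exact (hf.smooth.continuous.mul (((hg.comp_neg.spc_d2 i j).spc_heat
        (hpos n).le).comp_neg.smooth.continuous)).aestronglyMeasurable
    · rw [norm_mul]
      gcongr
      exact (hg.comp_neg.spc_d2 i j).abs_heat_le hB' (hpos n).le (hle n) (-q)
  exact tendsto_nhds_unique (l1.congr heq) l2

lemma fderiv_neg_apply (F : XT N → ℝ) (q v : XT N) :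
    fderiv ℝ (fun x => F (-x)) q v = -fderiv ℝ F (-q) v := by
  have := (ContinuousLinearEquiv.neg ℝ (M := XT N)).comp_right_fderiv (f := F) (x := q)
  change fderiv ℝ (F ∘ ContinuousLinearEquiv.neg ℝ) q v = _
  rw [this]
  simp

lemma d2_comp_neg (F : XT N → ℝ) (i j : Fin N) (q : XT N) :
    d2 i j (fun x => F (-x)) q = d2 i j F (-q) := by
  unfold d2
  simp only [fderiv_neg_apply]
  rw [fderiv_fun_neg, _root_.neg_apply, fderiv_neg_apply (fun y => fderiv ℝ F y (ei j)), neg_neg]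

lemma lapD_eq (F : XT N → ℝ) (q : XT N) : lapD F q = ∑ i, d2 i i F q := rfl

lemma SPc.lapD_sub_heat (hf : SPc f R) {b : ℝ} (hb : 0 ≤ b) (q : XT N) :
    lapD (heat 0 b f) q - fderiv ℝ (heat 0 b f) q (et N) = Gk gau b f q - f q := by
  have h := hf.heat_sub_dir le_rfl hb q
  rw [Gk_gau_zero] at h
  rw [← h, hf.heat_dir, lapD_eq]
  have h1 : ∀ i, d2 i i (heat 0 b f) q = heat 0 b (d2 i i f) q := fun i => by
    unfold d2
    rw [show (fun y => fderiv ℝ (heat 0 b f) y (ei i)) = heat 0 b (fun y => fderiv ℝ f y (ei i)) from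
      funext fun y => hf.heat_dir 0 b y _]
    exact (hf.dir (ei i)).heat_dir 0 b q _
  simp only [h1]
  have hi : ∀ {g : XT N → ℝ}, SPc g R → Integrable (fun ω => g (q - dh ω)) (hmeas N 0 b) :=
    fun hg => hg.integrable_translate (ν := hmeas N 0 b) measurable_dh q
  simp only [heat, Av, lapD_eq]
  rw [integral_sub (integrable_finsetSum _ fun i _ => hi (hf.spc_d2 i i)) (hi (hf.dir (et N))),
    integral_finsetSum _ fun i _ => hi (hf.spc_d2 i i)]

/-- Solution of the backward heat equation with zero terminal datum. -/
def bsol (T : ℝ) (ψ : XT N → ℝ) (q : XT N) : ℝ := heat 0 T (fun x => ψ (-x)) (-q)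

lemma SPc.spc_bsol {T : ℝ} (hf : SPc f R) : SPc (bsol T f) (R + T) :=
  (hf.comp_neg.spc_heat le_rfl).comp_neg

lemma SPc.bsol_eq_zero {T : ℝ} (hf : SPc f R) (h0 : ∀ q : XT N, T ≤ q.2 → f q = 0) (q : XT N)
    (hq : T ≤ q.2) : bsol T f q = 0 := by
  rw [bsol, hf.comp_neg.heat_eq]
  refine (setIntegral_congr_fun (g := fun _ => (0:ℝ)) measurableSet_Ioo fun s hs => ?_).trans (by simp)
  unfold Gk
  refine (integral_congr_ae (Eventually.of_forall fun z => ?_)).trans (integral_zero _ _)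
  simp only
  rw [h0, mul_zero]
  simp only [dh, Prod.snd_neg, Prod.snd_sub]
  linarith [hs.1]

lemma SPc.bsol_equation {T : ℝ} (hT : 0 ≤ T) (hf : SPc f R) (h0 : ∀ q : XT N, T ≤ q.2 → f q = 0)
    (q : XT N) (hq : 0 ≤ q.2) :
    lapD (bsol T f) q + fderiv ℝ (bsol T f) q (et N) = -f q := by
  have h := hf.comp_neg.lapD_sub_heat hT (-q)
  have hG : Gk gau T (fun x => f (-x)) (-q) = 0 := by
    unfold Gk
    refine (integral_congr_ae (Eventually.of_forall fun z => ?_)).trans (integral_zero _ _)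
    simp only
    rw [h0, mul_zero]
    simp only [dh, Prod.snd_neg, Prod.snd_sub]
    linarith
  rw [hG, neg_neg, zero_sub] at h
  rw [← h]
  unfold bsol
  rw [fderiv_neg_apply, lapD_eq, lapD_eq, sub_eq_add_neg]
  simp only [d2_comp_neg]

lemma SPc.bsol_dir {T : ℝ} (hT : 0 ≤ T) (hf : SPc f R) (q : XT N) (i : Fin N) :
    fderiv ℝ (bsol T f) q (ei i) =
      -cvk (hk (-((N + 1) / 2)) (gam1 i) 0 T) (fun x => f (-x)) (-q) := by
  unfold bsol
  rw [fderiv_neg_apply, hf.comp_neg.heat_dir, hf.comp_neg.heat_dir1 hT]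

lemma SPc.bsol_dir_dir {T : ℝ} (hf : SPc f R) (q : XT N) (i j : Fin N) :
    fderiv ℝ (bsol T fun x => fderiv ℝ f x (ei j)) q (ei i) =
      heat 0 T (d2 i j fun x => f (-x)) (-q) := by
  unfold bsol
  rw [fderiv_neg_apply, (hf.dir (ei j)).comp_neg.heat_dir, heat, Av, heat, Av, ← integral_neg]
  congr 1; ext ω
  unfold d2
  simp only [fderiv_neg_apply]
  rw [fderiv_fun_neg, _root_.neg_apply, fderiv_neg_apply (fun y => fderiv ℝ f y (ei j))]

end

/-- Measurable periodic functions supported in the time interval `(0, T)`. -/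
structure TPc (f : XT N → ℝ) (T : ℝ) : Prop where
  meas : Measurable f
  per : PerQ f
  supp : ∀ q : XT N, q.2 ∉ Ioo 0 T → f q = 0

section

variable {T : ℝ}

lemma measurableSet_QQ : MeasurableSet (QQ N T) := measurableSet_Icc.prod measurableSet_Ioo

lemma restrict_QQ :
    (volume : Measure (XT N)).restrict (QQ N T) =
      volume.restrict (strip N ∩ {q | q.2 ∈ Ioo 0 T}) :=
  Measure.restrict_congr_set (QQ_ae_eq T)

lemma measurableSet_time : MeasurableSet ({q | q.2 ∈ Ioo 0 T} : Set (XT N)) :=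
  measurable_snd measurableSet_Ioo

lemma setLIntegral_strip_eq_QQ {g : XT N → ENNReal} (h : ∀ q : XT N, q.2 ∉ Ioo 0 T → g q = 0) :
    ∫⁻ q in strip N, g q = ∫⁻ q in QQ N T, g q := by
  rw [restrict_QQ, inter_comm, ← Measure.restrict_restrict measurableSet_time,
    ← lintegral_indicator measurableSet_time]
  congr 1; ext q
  by_cases hq : q.2 ∈ Ioo 0 T
  · rw [indicator_of_mem (by exact hq)]
  · rw [indicator_of_notMem (by exact hq), h q hq]

lemma setIntegral_strip_eq_QQ {g : XT N → ℝ} (h : ∀ q : XT N, q.2 ∉ Ioo 0 T → g q = 0) :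
    ∫ q in strip N, g q = ∫ q in QQ N T, g q := by
  rw [restrict_QQ, inter_comm, ← Measure.restrict_restrict measurableSet_time,
    ← integral_indicator measurableSet_time]
  congr 1; ext q
  by_cases hq : q.2 ∈ Ioo 0 T
  · rw [indicator_of_mem (by exact hq)]
  · rw [indicator_of_notMem (by exact hq), h q hq]

lemma integrableOn_strip_iff_QQ {g : XT N → ℝ} (h : ∀ q : XT N, q.2 ∉ Ioo 0 T → g q = 0) :
    IntegrableOn g (strip N) ↔ IntegrableOn g (QQ N T) := by
  rw [IntegrableOn, IntegrableOn, restrict_QQ, inter_comm,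
    ← Measure.restrict_restrict measurableSet_time]
  refine Iff.trans ?_ (integrable_indicator_iff measurableSet_time)
  have : indicator {q : XT N | q.2 ∈ Ioo 0 T} g = g := by
    ext q
    by_cases hq : q.2 ∈ Ioo 0 T
    · rw [indicator_of_mem (by exact hq)]
    · rw [indicator_of_notMem (by exact hq), h q hq]
  rw [this]

lemma volume_QQ : volume (QQ N T : Set (XT N)) = ENNReal.ofReal T := by
  rw [QQ, Measure.volume_eq_prod, Measure.prod_prod, cube, Real.volume_Icc_pi]
  simp

instance : IsFiniteMeasure ((volume : Measure (XT N)).restrict (QQ N T)) := by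
  refine ⟨?_⟩
  rw [Measure.restrict_apply_univ, QQ, Measure.volume_eq_prod, Measure.prod_prod, cube,
    Real.volume_Icc_pi]
  simp

lemma ae_strip_of_ae_QQ {p : XT N → Prop} (hp : ∀ᵐ q ∂volume.restrict (QQ N T : Set (XT N)), p q) :
    ∀ᵐ q ∂volume.restrict (strip N), q.2 ∈ Ioo 0 T → p q := by
  rw [restrict_QQ, inter_comm, ← Measure.restrict_restrict measurableSet_time,
    ae_restrict_iff' measurableSet_time] at hp
  exact hp

lemma exists_TPc {g : XT N → ℝ} (hg : AEMeasurable g (volume.restrict (QQ N T))) :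
    ∃ f : XT N → ℝ, TPc f T ∧ f =ᵐ[volume.restrict (QQ N T)] g := by
  classical
  let fr : XT N → XT N := fun q => (fun i => Int.fract (q.1 i), q.2)
  have hfr : Measurable fr := by
    refine Measurable.prodMk (measurable_pi_lambda _ fun i => ?_) measurable_snd
    exact measurable_fract.comp ((measurable_pi_apply i).comp measurable_fst)
  refine ⟨indicator {q | q.2 ∈ Ioo 0 T} fun q => hg.mk g (fr q),
    ⟨(hg.measurable_mk.comp hfr).indicator measurableSet_time, fun q z => ?_, fun q hq =>
      indicator_of_notMem (by exact hq) _⟩, ?_⟩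
  · have h1 : (q + latHom N z).2 = q.2 := by simp [latHom_snd]
    have h2 : fr (q + latHom N z) = fr q := by
      refine Prod.ext (funext fun i => ?_) h1
      simp [fr, latHom]
    simp only [indicator, mem_ofPred_eq, h1, h2]
  · have h1 := hg.ae_eq_mk
    have h2 : ∀ᵐ q ∂volume.restrict (QQ N T : Set (XT N)), q ∈ strip N ∩ {q | q.2 ∈ Ioo 0 T} := by
      rw [restrict_QQ]
      exact ae_restrict_mem (measurableSet_strip.inter measurableSet_time)
    filter_upwards [h1, h2] with q hq hm
    rw [indicator_of_mem (by exact hm.2), hq]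
    congr 1
    refine Prod.ext (funext fun i => ?_) rfl
    exact Int.fract_eq_self.2 (hm.1 i)

/-- Integrals of directional derivatives vanish, under pointwise differentiability. -/
lemma integral_dirDeriv_eq_zero {h h' : XT N → ℝ} {M R C : ℝ} (hh : BPc h M R)
    (hC : ∀ q, |h' q| ≤ C) {v : XT N} (hv : v.2 = 0)
    (hd : ∀ q, HasDerivAt (fun θ : ℝ => h (q + θ • v)) (h' q) 0) :
    ∫ q in strip N, h' q = 0 := by
  have hd' : ∀ q (θ : ℝ), HasDerivAt (fun θ : ℝ => h (q + θ • v)) (h' (q + θ • v)) θ := fun q θ => by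
    have h1 := hd (q + θ • v)
    have h2 := HasDerivAt.comp_sub_const θ θ (f := fun θ' : ℝ => h (q + θ • v + θ' • v))
      (f' := h' (q + θ • v)) (by simpa using h1)
    refine h2.congr_of_eventuallyEq (Eventually.of_forall fun s => ?_)
    simp only
    congr 1
    rw [sub_smul]; abel
  set D : ℕ → XT N → ℝ := fun n q => ((n : ℝ) + 1) * (h (q + ((n : ℝ) + 1)⁻¹ • v) - h q)
  have hsupp : ∀ (θ : ℝ) (q : XT N), R < |q.2| → h (q + θ • v) = 0 := fun θ q hq =>
    hh.supp _ (by simpa [hv] using hq)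
  have hsh : ∀ θ : ℝ, IntegrableOn (fun q => h (q + θ • v)) (strip N) := fun θ => by
    refine BPc.integrableOn (M := M) (R := R) ⟨hh.meas.comp (measurable_id.add_const _), fun q z => ?_,
      fun q => hh.bdd _, hsupp θ⟩
    rw [add_right_comm, hh.per]
  have hD0 : ∀ n, ∫ q in strip N, D n q = 0 := fun n => by
    simp only [D]
    rw [integral_const_mul, integral_sub (hsh _) hh.integrableOn, hh.per.integral_shift, sub_self,
      mul_zero]
  have hlim : Tendsto (fun n => ∫ q in slab N R, D n q) atTop (𝓝 (∫ q in slab N R, h' q)) := by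
    refine tendsto_integral_of_dominated_convergence (fun _ => C) (fun n => ?_)
      (integrable_const C) (fun n => Eventually.of_forall fun q => ?_) (Eventually.of_forall fun q => ?_)
    · exact (measurable_const.mul ((hh.meas.comp (measurable_id.add_const _)).sub
        hh.meas)).aestronglyMeasurable
    · have := Convex.norm_image_sub_le_of_norm_hasDerivWithin_le (𝕜 := ℝ) (s := univ) (C := C)
        (f := fun θ : ℝ => h (q + θ • v)) (f' := fun θ => h' (q + θ • v)) (x := 0)
        (y := ((n : ℝ) + 1)⁻¹) (fun θ _ => (hd' q θ).hasDerivWithinAt) (fun θ _ => hC _) convex_univ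
        (mem_univ _) (mem_univ _)
      simp only [zero_smul, add_zero, sub_zero] at this
      have hn : 0 < (n : ℝ) + 1 := by positivity
      rw [norm_mul, Real.norm_of_nonneg hn.le]
      calc ((n : ℝ) + 1) * ‖h (q + ((n : ℝ) + 1)⁻¹ • v) - h q‖
          ≤ ((n : ℝ) + 1) * (C * ‖((n : ℝ) + 1)⁻¹‖) := by gcongr
        _ = C := by rw [Real.norm_of_nonneg (by positivity)]; field_simp
    · have h1 := (hasDerivAt_iff_tendsto_slope.1 (hd q))
      have h2 : Tendsto (fun n : ℕ => ((n : ℝ) + 1)⁻¹) atTop (𝓝[≠] 0) := by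
        refine tendsto_nhdsWithin_iff.2 ⟨?_, Eventually.of_forall fun n => ?_⟩
        · simpa [one_div] using tendsto_one_div_add_atTop_nhds_zero_nat (𝕜 := ℝ)
        · simp only [mem_compl_iff, mem_singleton_iff]; positivity
      refine (h1.comp h2).congr fun n => ?_
      simp [slope_def_field, D, div_eq_mul_inv, mul_comm]
  have hs0 : ∀ q ∈ strip N \ slab N R, h' q = 0 := fun q hq => by
    have hq' : R < |q.2| := not_le.1 fun h => hq.2 ⟨hq.1, h⟩
    have h0 : (fun θ : ℝ => h (q + θ • v)) = fun _ => 0 := funext fun θ => hsupp θ q hq'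
    exact (hd q).unique (h0 ▸ hasDerivAt_const 0 (0:ℝ))
  have hDs : ∀ n, ∫ q in slab N R, D n q = 0 := fun n => by
    rw [← hD0 n]
    refine (setIntegral_eq_of_subset_of_forall_sdiff_eq_zero measurableSet_strip
      inter_subset_left fun q hq => ?_).symm
    have hq' : R < |q.2| := not_le.1 fun h => hq.2 ⟨hq.1, h⟩
    simp only [D, hsupp _ q hq', hh.supp q hq', sub_self, mul_zero]
  rw [setIntegral_eq_of_subset_of_forall_sdiff_eq_zero measurableSet_strip
    (inter_subset_left (t := {q : XT N | |q.2| ≤ R})) hs0]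
  exact tendsto_nhds_unique hlim (by simp only [hDs]; exact tendsto_const_nhds)

end

section

variable {T : ℝ}

lemma hasDerivAt_time_slice {φ : XT N → ℝ} (hφ : Differentiable ℝ φ) (x : RN N) (t : ℝ) :
    HasDerivAt (fun s => φ (x, s)) (fderiv ℝ φ (x, t) (et N)) t :=
  (hφ (x, t)).hasFDerivAt.comp_hasDerivAt t ((hasDerivAt_const t x).prodMk (hasDerivAt_id t))

lemma pd_slice {φ : XT N → ℝ} (hφ : Differentiable ℝ φ) (x : RN N) (t : ℝ) (i : Fin N) :
    pd i (fun y => φ (y, t)) x = fderiv ℝ φ (x, t) (ei i) := by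
  have h := (hφ (x, t)).hasFDerivAt.comp x (hasFDerivAt_prodMk_left (𝕜 := ℝ) x t)
  have h' : fderiv ℝ (fun y => φ (y, t)) x = _ := h.fderiv
  rw [pd, h']
  rfl

lemma differentiable_fderiv_apply {φ : XT N → ℝ} (hφ : ContDiff ℝ (⊤ : ℕ∞) φ) (v : XT N) :
    Differentiable ℝ fun q => fderiv ℝ φ q v :=
  ((hφ.fderiv_right (m := (⊤ : ℕ∞)) (by norm_cast)).clm_apply contDiff_const).differentiable
    (by norm_num)

lemma lap_slice {φ : XT N → ℝ} (hφ : ContDiff ℝ (⊤ : ℕ∞) φ) (x : RN N) (t : ℝ) :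
    lap (fun y => φ (y, t)) x = lapD φ (x, t) := by
  refine Finset.sum_congr rfl fun i _ => ?_
  have h : pd i (fun y => φ (y, t)) = fun y => fderiv ℝ φ (y, t) (ei i) :=
    funext fun y => pd_slice (hφ.differentiable (by norm_num)) y t i
  rw [h]
  exact pd_slice (differentiable_fderiv_apply hφ (ei i)) x t i

lemma perQ_iff {β : Type*} {g : XT N → β} : PerQ g ↔ ∀ t, ZPeriodic fun x => g (x, t) := by
  have h : ∀ (x : RN N) (t : ℝ) (z : Fin N → ℤ),
      ((x, t) : XT N) + latHom N z = (fun i => x i + (z i : ℝ), t) := fun x t z =>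
    Prod.ext rfl (by simp [latHom_snd])
  constructor
  · intro hg t x z
    have := hg (x, t) z
    rwa [h] at this
  · rintro hg ⟨x, t⟩ z
    rw [h]
    exact hg t x z

lemma abs_le_euclNorm (p : RN N) (i : Fin N) : |p i| ≤ euclNorm p := by
  rw [euclNorm, ← Real.sqrt_sq_eq_abs]
  exact Real.sqrt_le_sqrt (Finset.single_le_sum (f := fun i => p i ^ 2) (fun j _ => sq_nonneg _)
    (Finset.mem_univ i))

lemma FPData.abs_pd_le {K₀ : ℝ} {m₀ : RN N → ℝ} (h : FPData N K₀ m₀) (i : Fin N) (x : RN N) :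
    |pd i m₀ x| ≤ K₀ :=
  (abs_le_euclNorm (grad m₀ x) i).trans (h.2.2.2.2 x)

lemma FPData.norm_fderiv_le {K₀ : ℝ} {m₀ : RN N → ℝ} (h : FPData N K₀ m₀) (hK₀ : 0 ≤ K₀)
    (x : RN N) : ‖fderiv ℝ m₀ x‖ ≤ N * K₀ := by
  refine ContinuousLinearMap.opNorm_le_bound _ (by positivity) fun v => ?_
  have hv : v = ∑ i, v i • (Pi.single i (1:ℝ) : RN N) := by
    conv_lhs => rw [← Finset.univ_sum_single v]
    refine Finset.sum_congr rfl fun i _ => ?_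
    rw [← Pi.single_smul, smul_eq_mul, mul_one]
  calc ‖fderiv ℝ m₀ x v‖ = ‖∑ i, v i * pd i m₀ x‖ := by
        conv_lhs => rw [hv]
        rw [map_sum]
        simp only [map_smul, smul_eq_mul, pd]
    _ ≤ ∑ i : Fin N, ‖v‖ * K₀ := by
        refine (norm_sum_le _ _).trans (Finset.sum_le_sum fun i _ => ?_)
        rw [norm_mul]
        gcongr
        · exact norm_le_pi_norm v i
        · exact h.abs_pd_le i x
    _ = N * K₀ * ‖v‖ := by simp; ring

lemma FPData.le {K₀ : ℝ} {m₀ : RN N → ℝ} (h : FPData N K₀ m₀) (hK₀ : 0 ≤ K₀) (x : RN N) :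
    m₀ x ≤ 1 + N * K₀ := by
  wlog hx : x ∈ cube N generalizing x
  · obtain ⟨z, hz⟩ := exists_latHom_add_mem ((x, 0) : XT N)
    have h1 := h.1 x z
    rw [← h1]
    refine this _ ⟨fun i => (hz i).1, fun i => (hz i).2.le⟩
  have hlip : ∀ y ∈ cube N, m₀ x - N * K₀ ≤ m₀ y := fun y hy => by
    have h1 := Convex.norm_image_sub_le_of_norm_fderiv_le (𝕜 := ℝ) (s := univ) (f := m₀)
      (fun z _ => h.2.2.2.1 z) (fun z _ => h.norm_fderiv_le hK₀ z) convex_univ (mem_univ y)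
      (mem_univ x)
    have h2 : ‖x - y‖ ≤ 1 := by
      refine (pi_norm_le_iff_of_nonneg zero_le_one).2 fun i => ?_
      have a1 := hx.1 i; have a2 := hx.2 i; have a3 := hy.1 i; have a4 := hy.2 i
      simp only [Pi.zero_apply, Pi.one_apply] at a1 a2 a3 a4
      rw [Pi.sub_apply, Real.norm_eq_abs, abs_le]
      constructor <;> linarith
    have h3 : (N : ℝ) * K₀ * ‖x - y‖ ≤ N * K₀ := mul_le_of_le_one_right (by positivity) h2
    have := (le_abs_self _).trans (h1.trans h3)
    linarith
  have hv : volume.real (cube N) = 1 := by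
    rw [Measure.real, cube, Real.volume_Icc_pi]; simp
  have hc : IntegrableOn m₀ (cube N) :=
    h.2.2.2.1.continuous.continuousOn.integrableOn_compact isCompact_Icc
  have h4 : ∫ y in cube N, (m₀ x - N * K₀) ≤ ∫ y in cube N, m₀ y :=
    setIntegral_mono_on (integrableOn_const (by rw [cube, Real.volume_Icc_pi]; simp)) hc measurableSet_Icc hlip
  rw [h.2.2.1, setIntegral_const, hv, one_smul] at h4
  linarith

/-- The datum, extended to be constant in time on `(0, T)` and zero elsewhere. -/
def cut (T : ℝ) (g : RN N → ℝ) : XT N → ℝ := indicator {q | q.2 ∈ Ioo 0 T} fun q => g q.1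

lemma cut_mem {g : RN N → ℝ} {q : XT N} (hq : q.2 ∈ Ioo 0 T) : cut T g q = g q.1 :=
  indicator_of_mem (by exact hq) _

lemma cut_notMem {g : RN N → ℝ} {q : XT N} (hq : q.2 ∉ Ioo 0 T) : cut T g q = 0 :=
  indicator_of_notMem (by exact hq) _

lemma TPc_cut {g : RN N → ℝ} (hg : Measurable g) (hp : ZPeriodic g) : TPc (cut T g) T where
  meas := (hg.comp measurable_fst).indicator measurableSet_time
  per q z := by
    have h1 : (q + latHom N z).2 = q.2 := by simp [latHom_snd]
    have h2 : g (q + latHom N z).1 = g q.1 := hp q.1 z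
    simp only [cut, indicator, mem_ofPred_eq, h1, h2]
  supp q hq := cut_notMem hq

lemma TPc.bpc {f : XT N → ℝ} {M : ℝ} (hf : TPc f T) (hM : ∀ q, |f q| ≤ M) : BPc f M T :=
  ⟨hf.meas, hf.per, hM, fun q hq => hf.supp q fun h => by
    rw [abs_of_pos h.1] at hq; exact lt_asymm hq h.2⟩

lemma abs_cut_le {g : RN N → ℝ} {M : ℝ} (hM : 0 ≤ M) (hg : ∀ x, |g x| ≤ M) (q : XT N) :
    |cut T g q| ≤ M := by
  by_cases hq : q.2 ∈ Ioo 0 T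
  · rw [cut_mem hq]; exact hg _
  · rw [cut_notMem hq]; simpa using hM

lemma FPData.TPc_cut {K₀ : ℝ} {m₀ : RN N → ℝ} (h : FPData N K₀ m₀) : TPc (cut T m₀) T :=
  _root_.TPc_cut h.2.2.2.1.continuous.measurable h.1

lemma FPData.TPc_cut_pd {K₀ : ℝ} {m₀ : RN N → ℝ} (h : FPData N K₀ m₀) (i : Fin N) :
    TPc (cut T (pd i m₀)) T := by
  refine _root_.TPc_cut (measurable_fderiv_apply_const ℝ m₀ _) fun x z => ?_
  have h1 : (fun y : RN N => m₀ (y + fun i => (z i : ℝ))) = m₀ := funext fun y => h.1 y z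
  have h2 := fderiv_comp_add_right (𝕜 := ℝ) (f := m₀) (x := x) (fun i => (z i : ℝ))
  rw [h1] at h2
  simp only [pd]
  rw [h2]
  rfl

lemma FPData.abs_cut_le {K₀ : ℝ} {m₀ : RN N → ℝ} (h : FPData N K₀ m₀) (hK₀ : 0 ≤ K₀) (q : XT N) :
    |cut T m₀ q| ≤ 1 + N * K₀ :=
  _root_.abs_cut_le (by positivity) (fun x => by rw [abs_of_nonneg (h.2.1 x)]; exact h.le hK₀ x) q

lemma FPData.abs_cut_pd_le {K₀ : ℝ} {m₀ : RN N → ℝ} (h : FPData N K₀ m₀) (hK₀ : 0 ≤ K₀)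
    (i : Fin N) (q : XT N) : |cut T (pd i m₀) q| ≤ K₀ :=
  _root_.abs_cut_le hK₀ (h.abs_pd_le i) q

lemma FPData.integral_cut_mul_dir {K₀ : ℝ} {m₀ : RN N → ℝ} (h : FPData N K₀ m₀) (hK₀ : 0 ≤ K₀)
    {g : XT N → ℝ} {R : ℝ} (hg : SPc g R) (i : Fin N) :
    ∫ q in strip N, cut T m₀ q * fderiv ℝ g q (ei i) =
      -∫ q in strip N, cut T (pd i m₀) q * g q := by
  obtain ⟨B, hB0, hB⟩ := hg.exists_bound
  obtain ⟨B', hB0', hB'⟩ := (hg.dir (ei i)).exists_bound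
  have hb : BPc (fun q => cut T m₀ q * g q) ((1 + N * K₀) * B) R := by
    refine ⟨h.TPc_cut.meas.mul hg.smooth.continuous.measurable, fun q z => ?_, fun q => ?_, fun q hq => ?_⟩
    · simp only [h.TPc_cut.per q z, hg.per q z]
    · rw [abs_mul]
      exact mul_le_mul (h.abs_cut_le hK₀ q) (hB q) (abs_nonneg _) (by positivity)
    · simp only [hg.supp q hq, mul_zero]
  have key := integral_dirDeriv_eq_zero hb (C := K₀ * B + (1 + N * K₀) * B') (v := ei i)
    (h' := fun q => cut T (pd i m₀) q * g q + cut T m₀ q * fderiv ℝ g q (ei i)) (fun q => ?_) rfl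
    fun q => ?_
  · rw [integral_add] at key
    · linarith
    · exact hg.integrableOn.bdd_mul (c := K₀) (h.TPc_cut_pd i).meas.aestronglyMeasurable
        (Eventually.of_forall fun q => h.abs_cut_pd_le hK₀ i q)
    · exact (hg.dir (ei i)).integrableOn.bdd_mul (c := 1 + N * K₀) h.TPc_cut.meas.aestronglyMeasurable
        (Eventually.of_forall fun q => h.abs_cut_le hK₀ q)
  · refine (abs_add_le _ _).trans (add_le_add ?_ ?_) <;> rw [abs_mul]
    · exact mul_le_mul (h.abs_cut_pd_le hK₀ i q) (hB q) (abs_nonneg _) hK₀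
    · exact mul_le_mul (h.abs_cut_le hK₀ q) (hB' q) (abs_nonneg _) (by positivity)
  · have h1 : HasDerivAt (fun θ : ℝ => g (q + θ • ei i)) (fderiv ℝ g q (ei i)) 0 := by
      have h0 : HasDerivAt (fun θ : ℝ => q + θ • ei i) (ei i) 0 := by
        simpa using ((hasDerivAt_id (0:ℝ)).smul_const (ei i)).const_add q
      have hd : HasFDerivAt g (fderiv ℝ g q) (q + (0:ℝ) • ei i) := by
        rw [zero_smul, add_zero]
        exact (hg.smooth.differentiable (by norm_num) q).hasFDerivAt
      exact hd.comp_hasDerivAt 0 h0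
    have h2 : HasDerivAt (fun θ : ℝ => cut T m₀ (q + θ • ei i)) (cut T (pd i m₀) q) 0 := by
      by_cases hq : q.2 ∈ Ioo 0 T
      · have h0 : HasDerivAt (fun θ : ℝ => q.1 + θ • (Pi.single i 1 : RN N)) (Pi.single i 1) 0 := by
          simpa using ((hasDerivAt_id (0:ℝ)).smul_const (Pi.single i (1:ℝ) : RN N)).const_add q.1
        have hd : HasFDerivAt m₀ (fderiv ℝ m₀ q.1) (q.1 + (0:ℝ) • (Pi.single i 1 : RN N)) := by
          rw [zero_smul, add_zero]
          exact (h.2.2.2.1 q.1).hasFDerivAt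
        rw [cut_mem hq]
        refine (hd.comp_hasDerivAt 0 h0).congr_of_eventuallyEq (Eventually.of_forall fun θ => ?_)
        simp only
        rw [cut_mem (by simpa [ei] using hq)]
        rfl
      · rw [cut_notMem hq]
        refine (hasDerivAt_const 0 (0:ℝ)).congr_of_eventuallyEq (Eventually.of_forall fun θ => ?_)
        simp only
        rw [cut_notMem (by simpa [ei] using hq)]
    have h3 := h2.mul h1
    simp only [zero_smul, add_zero] at h3
    exact h3

lemma FPData.integral_cut_mul_lapD {K₀ : ℝ} {m₀ : RN N → ℝ} (h : FPData N K₀ m₀) (hK₀ : 0 ≤ K₀)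
    {g : XT N → ℝ} {R : ℝ} (hg : SPc g R) :
    ∫ q in strip N, cut T m₀ q * lapD g q =
      -∫ q in strip N, ∑ i, cut T (pd i m₀) q * fderiv ℝ g q (ei i) := by
  simp only [lapD, Finset.mul_sum]
  rw [integral_finsetSum, integral_finsetSum, ← Finset.sum_neg_distrib]
  · exact Finset.sum_congr rfl fun i _ => h.integral_cut_mul_dir hK₀ (hg.dir (ei i)) i
  · exact fun i _ => (hg.dir (ei i)).integrableOn.bdd_mul (c := K₀)
      (h.TPc_cut_pd i).meas.aestronglyMeasurable
      (Eventually.of_forall fun q => h.abs_cut_pd_le hK₀ i q)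
  · exact fun i _ => ((hg.dir (ei i)).dir (ei i)).integrableOn.bdd_mul (c := 1 + N * K₀)
      h.TPc_cut.meas.aestronglyMeasurable (Eventually.of_forall fun q => h.abs_cut_le hK₀ q)

lemma FPData.integral_initial {K₀ : ℝ} {m₀ : RN N → ℝ} (h : FPData N K₀ m₀)
    (hT : 0 ≤ T) {g : XT N → ℝ} {R : ℝ} (hg : SPc g R) (h0 : ∀ x, g (x, T) = 0) :
    ∫ x in cube N, m₀ x * g (x, 0) = -∫ q in strip N, cut T m₀ q * fderiv ℝ g q (et N) := by
  have hdc : Continuous fun q => fderiv ℝ g q (et N) := (hg.dir (et N)).smooth.continuous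
  rw [setIntegral_strip_eq_QQ (T := T) (fun q hq => by rw [cut_notMem hq, zero_mul])]
  have h1 : ∫ q in QQ N T, cut T m₀ q * fderiv ℝ g q (et N) =
      ∫ q in cube N ×ˢ Ioo 0 T, m₀ q.1 * fderiv ℝ g q (et N) :=
    setIntegral_congr_fun measurableSet_QQ fun q hq => by
      rw [cut_mem hq.2]
  have hin : IntegrableOn (fun q : XT N => m₀ q.1 * fderiv ℝ g q (et N)) (cube N ×ˢ Ioo 0 T) := by
    have hc : IsCompact (cube N ×ˢ Icc 0 T) := isCompact_Icc.prod isCompact_Icc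
    exact (((h.2.2.2.1.continuous.comp continuous_fst).mul hdc).continuousOn.integrableOn_compact
      hc).mono_set (prod_mono le_rfl Ioo_subset_Icc_self)
  rw [h1, Measure.volume_eq_prod, setIntegral_prod _ (by rwa [← Measure.volume_eq_prod]),
    ← integral_neg]
  refine integral_congr_ae (Eventually.of_forall fun x => ?_)
  simp only
  rw [integral_const_mul, ← mul_neg]
  congr 1
  have h2 := intervalIntegral.integral_eq_sub_of_hasDerivAt (a := 0) (b := T)
    (fun t _ => hasDerivAt_time_slice (hg.smooth.differentiable (by norm_num)) x t)
    ((hdc.comp (by fun_prop : Continuous fun t : ℝ => ((x, t) : XT N))).intervalIntegrable 0 T)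
  rw [intervalIntegral.integral_of_le hT, integral_Ioc_eq_integral_Ioo, h0] at h2
  rw [h2]; ring

end

/-- Measurable periodic representatives of a weak solution `m`, of its energy density and of its
flux `m A`. -/
structure FPRep (N : ℕ) (T γ' : ℝ) (m₀ : RN N → ℝ) (m : RN N → ℝ → ℝ) (A : RN N → ℝ → RN N)
    (u e : XT N → ℝ) (W : Fin N → XT N → ℝ) : Prop where
  tu : TPc u T
  te : TPc e T
  tW : ∀ i, TPc (W i) T
  u_nonneg : ∀ q, 0 ≤ u q
  e_nonneg : ∀ q, 0 ≤ e q
  u_eq : u =ᵐ[volume.restrict (QQ N T)] fun q => m q.1 q.2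
  e_eq : e =ᵐ[volume.restrict (QQ N T)] fun q => euclNorm (A q.1 q.2) ^ γ' * m q.1 q.2
  W_eq : ∀ i, W i =ᵐ[volume.restrict (QQ N T)] fun q => m q.1 q.2 * A q.1 q.2 i
  int_u : IntegrableOn u (strip N)
  int_e : IntegrableOn e (strip N)
  int_W : ∀ i, IntegrableOn (W i) (strip N)
  bound : ∀ i, ∀ᵐ q ∂volume.restrict (strip N), |W i q| ≤ e q ^ (1 / γ') * u q ^ (1 - 1 / γ')
  weak : ∀ φ : XT N → ℝ, ContDiff ℝ (⊤ : ℕ∞) φ → PerQ φ → (∀ x, φ (x, T) = 0) →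
    (∫ q in QQ N T, (u q * (fderiv ℝ φ q (et N) + lapD φ q) + ∑ i, W i q * fderiv ℝ φ q (ei i))) +
      ∫ x in cube N, m₀ x * φ (x, 0) = 0

section

variable {T γ' : ℝ} {m₀ : RN N → ℝ} {m : RN N → ℝ → ℝ} {A : RN N → ℝ → RN N}

lemma FPSol.weak_XT (h : FPSol N T γ' m₀ m A) {φ : XT N → ℝ} (hφ : ContDiff ℝ (⊤ : ℕ∞) φ)
    (hp : PerQ φ) (h0 : ∀ x, φ (x, T) = 0) :
    (∫ q in QQ N T, m q.1 q.2 * (fderiv ℝ φ q (et N) + lapD φ q +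
      ∑ i, A q.1 q.2 i * fderiv ℝ φ q (ei i))) + ∫ x in cube N, m₀ x * φ (x, 0) = 0 := by
  have hd := hφ.differentiable (by norm_num)
  refine Eq.trans ?_ (h.weak (fun x t => φ (x, t)) ⟨hφ, perQ_iff.1 hp⟩ h0)
  rw [intQ]
  congr 1
  refine integral_congr_ae (Eventually.of_forall fun q => ?_)
  simp only
  congr 1
  rw [(hasDerivAt_time_slice hd q.1 q.2).deriv, lap_slice hφ]
  congr 1
  refine Finset.sum_congr rfl fun i _ => ?_
  rw [grad, pd_slice hd]

lemma continuous_lapD {φ : XT N → ℝ} (hφ : ContDiff ℝ (⊤ : ℕ∞) φ) : Continuous (lapD φ) := by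
  refine continuous_finsetSum _ fun i _ => ?_
  have h1 : ContDiff ℝ (⊤ : ℕ∞) fun x => fderiv ℝ φ x (ei i) :=
    (hφ.fderiv_right (m := (⊤ : ℕ∞)) (by norm_cast)).clm_apply contDiff_const
  exact ((h1.fderiv_right (m := (⊤ : ℕ∞)) (by norm_cast)).clm_apply contDiff_const).continuous

lemma fderiv_add_time {φ : XT N → ℝ} (hφ : Differentiable ℝ φ) (T : ℝ) (q v : XT N) :
    fderiv ℝ (fun q : XT N => φ q + (T - q.2)) q v = fderiv ℝ φ q v - v.2 := by
  have h1 : HasFDerivAt (fun q : XT N => φ q + (T - q.2))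
      (fderiv ℝ φ q + (-(ContinuousLinearMap.snd ℝ (RN N) ℝ))) q :=
    (hφ q).hasFDerivAt.add (hasFDerivAt_snd.const_sub T)
  rw [h1.fderiv]
  simp [sub_eq_add_neg]

lemma FPSol.integrableOn_weak (h : FPSol N T γ' m₀ m A) (hT : 0 < T) (hm : ∫ x in cube N, m₀ x = 1)
    {φ : XT N → ℝ} (hφ : ContDiff ℝ (⊤ : ℕ∞) φ) (hp : PerQ φ) (h0 : ∀ x, φ (x, T) = 0)
    (hm₀ : Continuous m₀) :
    IntegrableOn (fun q : XT N => m q.1 q.2 * (fderiv ℝ φ q (et N) + lapD φ q +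
      ∑ i, A q.1 q.2 i * fderiv ℝ φ q (ei i))) (QQ N T) := by
  by_contra hni
  have hd := hφ.differentiable (by norm_num)
  have h1 := h.weak_XT hφ hp h0
  have h1' : ∫ q in QQ N T, m q.1 q.2 * (fderiv ℝ φ q (et N) + lapD φ q +
      ∑ i, A q.1 q.2 i * fderiv ℝ φ q (ei i)) = 0 := integral_undef hni
  rw [h1', zero_add] at h1
  have e1 : ∀ q (i : Fin N), fderiv ℝ (fun q : XT N => φ q + (T - q.2)) q (ei i) =
      fderiv ℝ φ q (ei i) := fun q i => by rw [fderiv_add_time hd]; simp [ei]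
  have e2 : ∀ q, lapD (fun q : XT N => φ q + (T - q.2)) q = lapD φ q := fun q => by
    simp only [lapD, e1]
  have h2 := h.weak_XT (φ := fun q => φ q + (T - q.2)) (hφ.add (contDiff_const.sub contDiff_snd))
    (fun q z => by
      have h1 : (q + latHom N z).2 = q.2 := by simp [latHom_snd]
      simp only [hp q z, h1]) (fun x => by simp [h0])
  simp only [e1, e2, fderiv_add_time hd] at h2
  rw [integral_undef, zero_add] at h2
  · have hc : IntegrableOn (fun x => m₀ x * φ (x, 0)) (cube N) :=
      (hm₀.mul (hφ.continuous.comp (by fun_prop : Continuous fun x : RN N => ((x, 0) : XT N)))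
        ).continuousOn.integrableOn_compact isCompact_Icc
    have hc' : IntegrableOn (fun x => m₀ x * (T - 0)) (cube N) :=
      (hm₀.mul continuous_const).continuousOn.integrableOn_compact isCompact_Icc
    simp only [mul_add] at h2
    rw [integral_add hc hc', h1, integral_mul_const, hm] at h2
    linarith
  · intro hi
    refine hni ((hi.add h.int_m).congr (Eventually.of_forall fun q => ?_))
    simp only [Pi.add_apply, et]
    ring

lemma FPSol.aemeasurable_flux_mul (h : FPSol N T γ' m₀ m A) (hT : 0 < T)
    (hm : ∫ x in cube N, m₀ x = 1) (hm₀ : Continuous m₀) {s : ℝ → ℝ} (hs : ContDiff ℝ (⊤ : ℕ∞) s)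
    (hp : ∀ (x : ℝ) (k : ℤ), s (x + k) = s x) (i : Fin N) :
    AEMeasurable (fun q : XT N => m q.1 q.2 * A q.1 q.2 i * ((T - q.2) * deriv s (q.1 i)))
      (volume.restrict (QQ N T)) := by
  set φ : XT N → ℝ := fun q => (T - q.2) * s (q.1 i) with hφd
  have hφ : ContDiff ℝ (⊤ : ℕ∞) φ :=
    (contDiff_const.sub contDiff_snd).mul (hs.comp ((contDiff_apply ℝ ℝ i).comp contDiff_fst))
  have hpφ : PerQ φ := fun q z => by
    have h1 : (q + latHom N z).2 = q.2 := by simp [latHom_snd]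
    have h2 : (q + latHom N z).1 i = q.1 i + z i := rfl
    simp only [hφd, h1, h2, hp]
  have hd : ∀ q (j : Fin N), fderiv ℝ φ q (ei j) =
      if j = i then (T - q.2) * deriv s (q.1 i) else 0 := fun q j => by
    have hs' : HasFDerivAt (fun q : XT N => s (q.1 i)) (deriv s (q.1 i) •
        ((ContinuousLinearMap.proj i).comp (ContinuousLinearMap.fst ℝ (RN N) ℝ))) q :=
      ((hs.differentiable (by norm_num) (q.1 i)).hasDerivAt).comp_hasFDerivAt q
        (((ContinuousLinearMap.proj (R := ℝ) (φ := fun _ : Fin N => ℝ) i).comp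
          (ContinuousLinearMap.fst ℝ (RN N) ℝ)).hasFDerivAt)
    have ht : HasFDerivAt (fun q : XT N => T - q.2) (-(ContinuousLinearMap.snd ℝ (RN N) ℝ)) q :=
      hasFDerivAt_snd.const_sub T
    have hm' : HasFDerivAt φ _ q := ht.mul hs'
    rw [hm'.fderiv]
    by_cases hij : j = i
    · subst hij; simp [ei]
    · simp [ei, hij]
  have hi := h.integrableOn_weak hT hm hφ hpφ (fun x => by simp [hφd]) hm₀
  have hc : Measurable fun q : XT N => fderiv ℝ φ q (et N) + lapD φ q :=
    ((differentiable_fderiv_apply hφ _).continuous.add (continuous_lapD hφ)).measurable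
  refine (hi.1.aemeasurable.sub (h.int_m.1.aemeasurable.mul hc.aemeasurable)).congr
    (Eventually.of_forall fun q => ?_)
  simp only [Pi.sub_apply, Pi.mul_apply, hd, mul_ite, mul_zero, Finset.sum_ite_eq',
    Finset.mem_univ, if_true]
  ring

lemma FPSol.aemeasurable_flux (h : FPSol N T γ' m₀ m A) (hT : 0 < T)
    (hm : ∫ x in cube N, m₀ x = 1) (hm₀ : Continuous m₀) (i : Fin N) :
    AEMeasurable (fun q : XT N => m q.1 q.2 * A q.1 q.2 i) (volume.restrict (QQ N T)) := by
  have hlin : ∀ x : ℝ, HasDerivAt (fun x : ℝ => 2 * Real.pi * x) (2 * Real.pi) x := fun x => by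
    simpa using (hasDerivAt_id x).const_mul (2 * Real.pi)
  have d1 : ∀ x, deriv (fun x : ℝ => Real.sin (2 * Real.pi * x)) x =
      Real.cos (2 * Real.pi * x) * (2 * Real.pi) := fun x => (hlin x).sin.deriv
  have d2 : ∀ x, deriv (fun x : ℝ => Real.cos (2 * Real.pi * x)) x =
      -Real.sin (2 * Real.pi * x) * (2 * Real.pi) := fun x => (hlin x).cos.deriv
  have h1 := h.aemeasurable_flux_mul hT hm hm₀ (s := fun x => Real.sin (2 * Real.pi * x))
    (by fun_prop) (fun x k => by
      rw [mul_add, mul_comm _ (k : ℝ), Real.sin_add_int_mul_two_pi]) i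
  have h2 := h.aemeasurable_flux_mul hT hm hm₀ (s := fun x => Real.cos (2 * Real.pi * x))
    (by fun_prop) (fun x k => by
      rw [mul_add, mul_comm _ (k : ℝ), Real.cos_add_int_mul_two_pi]) i
  simp only [d1] at h1
  simp only [d2] at h2
  have m1 : Measurable fun q : XT N => Real.cos (2 * Real.pi * q.1 i) := by fun_prop
  have m2 : Measurable fun q : XT N => Real.sin (2 * Real.pi * q.1 i) := by fun_prop
  have m3 : Measurable fun q : XT N => ((T - q.2) * (2 * Real.pi))⁻¹ := by fun_prop
  refine (((h1.mul m1.aemeasurable).sub (h2.mul m2.aemeasurable)).mul m3.aemeasurable).congr ?_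
  filter_upwards [ae_restrict_mem measurableSet_QQ] with q hq
  have hq2 : T - q.2 ≠ 0 := (sub_pos.2 hq.2.2).ne'
  have hsc := Real.sin_sq_add_cos_sq (2 * Real.pi * q.1 i)
  simp only [Pi.sub_apply, Pi.mul_apply]
  rw [mul_inv_eq_iff_eq_mul₀ (mul_ne_zero hq2 (by positivity))]
  linear_combination (m q.1 q.2 * A q.1 q.2 i * (T - q.2) * (2 * Real.pi)) * hsc

lemma FPSol.exists_FPRep (h : FPSol N T γ' m₀ m A) (hT : 0 < T) (hγ' : 1 < γ')
    (hm : ∫ x in cube N, m₀ x = 1) (hm₀ : Continuous m₀) :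
    ∃ u e W, FPRep N T γ' m₀ m A u e W := by
  obtain ⟨u, tu, u_eq⟩ := exists_TPc h.int_m.1.aemeasurable
  obtain ⟨e, te, e_eq⟩ := exists_TPc h.int_E.1.aemeasurable
  choose W tW W_eq using fun i => exists_TPc (h.aemeasurable_flux hT hm hm₀ i)
  have abs_T : ∀ {f : XT N → ℝ}, TPc f T → TPc (fun q => |f q|) T := fun hf =>
    ⟨hf.meas.abs, fun q z => by simp only [hf.per q z], fun q hq => by simp only [hf.supp q hq, abs_zero]⟩
  have e_nn : ∀ q : XT N, 0 ≤ euclNorm (A q.1 q.2) ^ γ' * m q.1 q.2 := fun q =>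
    mul_nonneg (Real.rpow_nonneg (Real.sqrt_nonneg _) _) (h.nonneg _ _)
  have u_eq' : (fun q => |u q|) =ᵐ[volume.restrict (QQ N T)] fun q => m q.1 q.2 := by
    filter_upwards [u_eq] with q hq
    rw [hq, abs_of_nonneg (h.nonneg _ _)]
  have e_eq' : (fun q => |e q|) =ᵐ[volume.restrict (QQ N T)]
      fun q => euclNorm (A q.1 q.2) ^ γ' * m q.1 q.2 := by
    filter_upwards [e_eq] with q hq
    rw [hq, abs_of_nonneg (e_nn q)]
  have key : ∀ i, ∀ᵐ q ∂volume.restrict (QQ N T),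
      |W i q| ≤ |e q| ^ (1 / γ') * |u q| ^ (1 - 1 / γ') := fun i => by
    filter_upwards [u_eq', e_eq', W_eq i] with q h1 h2 h3
    rw [h1, h2, h3, abs_mul, abs_of_nonneg (h.nonneg _ _)]
    have hA : 0 ≤ euclNorm (A q.1 q.2) := Real.sqrt_nonneg _
    have hγ0 : γ' ≠ 0 := by linarith
    rw [Real.mul_rpow (Real.rpow_nonneg hA _) (h.nonneg _ _), ← Real.rpow_mul hA,
      mul_one_div_cancel hγ0, Real.rpow_one, mul_assoc, mul_comm]
    refine mul_le_mul (abs_le_euclNorm _ i) ?_ (h.nonneg _ _) hA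
    rcases (h.nonneg q.1 q.2).eq_or_lt with h0 | h0
    · rw [← h0]; positivity
    · rw [← Real.rpow_add h0, add_sub_cancel, Real.rpow_one]
  have key2 : ∀ i, ∀ᵐ q ∂volume.restrict (QQ N T), |W i q| ≤ |e q| + |u q| := fun i => by
    filter_upwards [key i] with q hq
    refine hq.trans ?_
    have h1 : 0 ≤ 1 / γ' := by positivity
    have h2 : 1 / γ' ≤ 1 := by rw [div_le_one (by linarith)]; exact hγ'.le
    refine (Real.geom_mean_le_arith_mean2_weighted h1 (by linarith : 0 ≤ 1 - 1 / γ') (abs_nonneg _)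
      (abs_nonneg _) (by ring)).trans ?_
    have := abs_nonneg (e q)
    have := abs_nonneg (u q)
    nlinarith
  have int_u : IntegrableOn (fun q => |u q|) (QQ N T) := h.int_m.congr u_eq'.symm
  have int_e : IntegrableOn (fun q => |e q|) (QQ N T) := h.int_E.congr e_eq'.symm
  have int_W : ∀ i, IntegrableOn (W i) (QQ N T) := fun i =>
    (int_e.add int_u).mono' (tW i).meas.aestronglyMeasurable (key2 i)
  refine ⟨fun q => |u q|, fun q => |e q|, W, abs_T tu, abs_T te, tW, fun q => abs_nonneg _,
    fun q => abs_nonneg _, u_eq', e_eq', W_eq, ?_, ?_, fun i => ?_, fun i => ?_, fun φ hφ hp h0 => ?_⟩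
  · exact (integrableOn_strip_iff_QQ (abs_T tu).supp).2 int_u
  · exact (integrableOn_strip_iff_QQ (abs_T te).supp).2 int_e
  · exact (integrableOn_strip_iff_QQ (tW i).supp).2 (int_W i)
  · filter_upwards [ae_strip_of_ae_QQ (key i)] with q hq
    by_cases hq2 : q.2 ∈ Ioo 0 T
    · exact hq hq2
    · rw [(tW i).supp q hq2, abs_zero]; positivity
  · refine Eq.trans ?_ (h.weak_XT hφ hp h0)
    congr 1
    refine integral_congr_ae ?_
    simp only [EventuallyEq]
    have hW : ∀ᵐ q ∂volume.restrict (QQ N T), ∀ i, W i q = m q.1 q.2 * A q.1 q.2 i :=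
      ae_all_iff.2 W_eq
    filter_upwards [u_eq', hW] with q h1 h2
    rw [h1]
    simp only [h2]
    rw [mul_add (m q.1 q.2) (_ + _), Finset.mul_sum]
    simp only [mul_assoc]

end

section

variable {T γ' K₀ : ℝ} {m₀ : RN N → ℝ} {m : RN N → ℝ → ℝ} {A : RN N → ℝ → RN N}
  {u e : XT N → ℝ} {W : Fin N → XT N → ℝ}

lemma IntegrableOn.mul_SPc {f g : XT N → ℝ} {R : ℝ} (hf : IntegrableOn f (strip N)) (hg : SPc g R) :
    IntegrableOn (fun q => f q * g q) (strip N) := by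
  obtain ⟨C, -, hC⟩ := hg.exists_bound
  exact hf.mul_bdd (c := C) hg.smooth.continuous.aestronglyMeasurable
    (Eventually.of_forall hC)

lemma TPc.integrableOn {f : XT N → ℝ} {M : ℝ} (hf : TPc f T) (hM : ∀ q, |f q| ≤ M) :
    IntegrableOn f (strip N) := (hf.bpc hM).integrableOn

/-- The source term of the heat equation solved by `m - m₀`. -/
def FPflux (T : ℝ) (m₀ : RN N → ℝ) (W : Fin N → XT N → ℝ) (i : Fin N) (q : XT N) : ℝ :=
  W i q - cut T (pd i m₀) q

lemma FPRep.TPc_flux (h : FPRep N T γ' m₀ m A u e W) (hd : FPData N K₀ m₀) (i : Fin N) :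
    TPc (FPflux T m₀ W i) T :=
  ⟨(h.tW i).meas.sub (hd.TPc_cut_pd i).meas, fun q z => by
    rw [FPflux, FPflux, (h.tW i).per, (hd.TPc_cut_pd i).per], fun q hq => by
    rw [FPflux, (h.tW i).supp q hq, (hd.TPc_cut_pd i).supp q hq, sub_zero]⟩

lemma FPRep.integrableOn_flux (h : FPRep N T γ' m₀ m A u e W) (hd : FPData N K₀ m₀) (hK₀ : 0 ≤ K₀)
    (i : Fin N) : IntegrableOn (FPflux T m₀ W i) (strip N) :=
  (h.int_W i).sub ((hd.TPc_cut_pd i).integrableOn (hd.abs_cut_pd_le hK₀ i))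

lemma FPRep.weak_bsol (h : FPRep N T γ' m₀ m A u e W) (hd : FPData N K₀ m₀) (hK₀ : 0 ≤ K₀)
    (hT : 0 ≤ T) {ψ : XT N → ℝ} {R : ℝ} (hψ : SPc ψ R) (h0 : ∀ q : XT N, T ≤ q.2 → ψ q = 0) :
    ∫ q in strip N, (u q - cut T m₀ q) * ψ q =
      ∑ i, ∫ q in strip N, FPflux T m₀ W i q * fderiv ℝ (bsol T ψ) q (ei i) := by
  have hφ := hψ.spc_bsol (T := T)
  have hφ0 : ∀ x, bsol T ψ (x, T) = 0 := fun x => hψ.bsol_eq_zero h0 _ le_rfl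
  have hw := h.weak _ hφ.smooth hφ.per hφ0
  rw [hd.integral_initial hT hφ hφ0] at hw
  have iu : IntegrableOn (fun q => u q * ψ q) (strip N) := IntegrableOn.mul_SPc h.int_u hψ
  have ic := hd.TPc_cut.integrableOn (T := T) (hd.abs_cut_le hK₀)
  have im : IntegrableOn (fun q => cut T m₀ q * ψ q) (strip N) := IntegrableOn.mul_SPc ic hψ
  have iW : ∀ i, IntegrableOn (fun q => W i q * fderiv ℝ (bsol T ψ) q (ei i)) (strip N) :=
    fun i => IntegrableOn.mul_SPc (h.int_W i) (hφ.dir _)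
  have id : ∀ i, IntegrableOn (fun q => cut T (pd i m₀) q * fderiv ℝ (bsol T ψ) q (ei i))
      (strip N) := fun i => IntegrableOn.mul_SPc
        ((hd.TPc_cut_pd i).integrableOn (hd.abs_cut_pd_le hK₀ i)) (hφ.dir _)
  have e1 : ∫ q in QQ N T, (u q * (fderiv ℝ (bsol T ψ) q (et N) + lapD (bsol T ψ) q) +
      ∑ i, W i q * fderiv ℝ (bsol T ψ) q (ei i)) =
      -(∫ q in strip N, u q * ψ q) +
        ∑ i, ∫ q in strip N, W i q * fderiv ℝ (bsol T ψ) q (ei i) := by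
    rw [← setIntegral_strip_eq_QQ fun q hq => by
      rw [h.tu.supp q hq, zero_mul, zero_add]
      exact Finset.sum_eq_zero fun i _ => by rw [(h.tW i).supp q hq, zero_mul],
      ← integral_finsetSum _ fun i _ => iW i, ← integral_neg,
      ← integral_add (f := fun q => -(u q * ψ q)) iu.neg (integrable_finsetSum _ fun i _ => iW i)]
    refine integral_congr_ae (Eventually.of_forall fun q => ?_)
    simp only
    congr 1
    by_cases hq : 0 ≤ q.2
    · rw [add_comm, hψ.bsol_equation hT h0 q hq, mul_neg]
    · rw [h.tu.supp q fun h => hq h.1.le]; simp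
  have e2 : ∫ q in strip N, cut T m₀ q * fderiv ℝ (bsol T ψ) q (et N) =
      (∑ i, ∫ q in strip N, cut T (pd i m₀) q * fderiv ℝ (bsol T ψ) q (ei i)) -
        ∫ q in strip N, cut T m₀ q * ψ q := by
    have h1 := hd.integral_cut_mul_lapD (T := T) hK₀ hφ
    rw [integral_finsetSum _ fun i _ => id i] at h1
    have hl : IntegrableOn (fun q => cut T m₀ q * lapD (bsol T ψ) q) (strip N) :=
      IntegrableOn.mul_SPc ic hφ.lapl
    have h2 : ∫ q in strip N, cut T m₀ q * fderiv ℝ (bsol T ψ) q (et N) =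
        ∫ q in strip N, (-(cut T m₀ q * ψ q) - cut T m₀ q * lapD (bsol T ψ) q) := by
      refine integral_congr_ae (Eventually.of_forall fun q => ?_)
      simp only
      by_cases hq : 0 ≤ q.2
      · linear_combination cut T m₀ q * hψ.bsol_equation hT h0 q hq
      · rw [hd.TPc_cut.supp q fun h => hq h.1.le]; simp
    rw [h2, integral_sub (f := fun q => -(cut T m₀ q * ψ q)) im.neg hl, integral_neg, h1]
    ring
  rw [e1, e2] at hw
  simp only [FPflux, sub_mul]
  rw [integral_sub iu im]
  simp only [integral_sub (iW _) (id _), Finset.sum_sub_distrib]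
  linarith

lemma FPRep.integral_eq (h : FPRep N T γ' m₀ m A u e W) (hm : ∫ x in cube N, m₀ x = 1) :
    ∫ q in strip N, u q = T := by
  have hw := h.weak (fun q => T - q.2) (contDiff_const.sub contDiff_snd)
    (fun q z => by simp [latHom_snd]) (fun x => by simp)
  have e1 : ∀ q (v : XT N), fderiv ℝ (fun q : XT N => T - q.2) q v = - v.2 := fun q v => by
    have := fderiv_add_time (N := N) (φ := fun _ => 0) (differentiable_const 0) T q v
    simpa only [zero_add, fderiv_const_apply, _root_.zero_apply, zero_sub] using this
  have e2 : ∀ q, lapD (fun q : XT N => T - q.2) q = 0 := fun q => by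
    simp only [lapD, e1, ei, fderiv_const_apply, _root_.zero_apply, Finset.sum_const_zero]
  simp only [e1, e2, ei, et, neg_zero, mul_zero, Finset.sum_const_zero, add_zero,
    sub_zero, integral_mul_const, hm, one_mul, mul_neg, mul_one, integral_neg] at hw
  rw [setIntegral_strip_eq_QQ h.tu.supp]
  linarith

/-- Convolution of `|F i|` with the heat kernel's gradient, summed over `i`. -/
def FPpot (N : ℕ) (T : ℝ) (F : Fin N → XT N → ℝ) (q : XT N) : ENNReal :=
  ∑ i, ∫⁻ v, ‖hk (-(((N : ℝ) + 1) / 2)) (gam1 i) 0 T v‖ₑ * ‖F i (q - v)‖ₑ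

lemma measurable_FPpot {F : Fin N → XT N → ℝ} (hF : ∀ i, Measurable (F i)) :
    Measurable (FPpot N T F) := by
  refine Finset.measurable_sum _ fun i _ => ?_
  obtain ⟨C, hC⟩ := exists_KD_gam1 i
  have hk' : Measurable (hk (-(((N : ℝ) + 1) / 2)) (gam1 i) 0 T) :=
    measurable_hk _ hC.cd.continuous.measurable _ _
  exact Measurable.lintegral_prod_right' (f := fun p : XT N × XT N =>
    ‖hk (-(((N : ℝ) + 1) / 2)) (gam1 i) 0 T p.2‖ₑ * ‖F i (p.1 - p.2)‖ₑ)
    ((hk'.comp measurable_snd).enorm.mul ((hF i).comp (measurable_fst.sub measurable_snd)).enorm)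

lemma lintegral_FPpot_mul {F : Fin N → XT N → ℝ} (hF : ∀ i, Measurable (F i)) (hp : ∀ i, PerQ (F i))
    {g : XT N → ENNReal} (hg : Measurable g) (hgp : PerQ g) :
    ∫⁻ q in strip N, FPpot N T F q * g q = ∑ i, ∫⁻ q in strip N, ‖F i q‖ₑ *
      ∫⁻ v, ‖hk (-(((N : ℝ) + 1) / 2)) (gam1 i) 0 T v‖ₑ * g (q + v) := by
  simp only [FPpot, Finset.sum_mul]
  have hk' : ∀ i : Fin N, Measurable (hk (-(((N : ℝ) + 1) / 2)) (gam1 i) 0 T) := fun i => by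
    obtain ⟨C, hC⟩ := exists_KD_gam1 i
    exact measurable_hk _ hC.cd.continuous.measurable _ _
  have hm1 : ∀ i, Measurable (Function.uncurry fun (q v : XT N) =>
      ‖hk (-(((N : ℝ) + 1) / 2)) (gam1 i) 0 T v‖ₑ * ‖F i (q - v)‖ₑ * g q) := fun i =>
    (((hk' i).comp measurable_snd).enorm.mul
      ((hF i).comp (measurable_fst.sub measurable_snd)).enorm).mul (hg.comp measurable_fst)
  have hm2 : ∀ i, Measurable (Function.uncurry fun (q v : XT N) =>
      ‖F i q‖ₑ * (‖hk (-(((N : ℝ) + 1) / 2)) (gam1 i) 0 T v‖ₑ * g (q + v))) := fun i =>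
    ((hF i).comp measurable_fst).enorm.mul (((hk' i).comp measurable_snd).enorm.mul
      (hg.comp (measurable_fst.add measurable_snd)))
  rw [lintegral_finsetSum]
  swap
  · intro i _
    exact (Measurable.lintegral_prod_right' (f := fun p : XT N × XT N =>
      ‖hk (-(((N : ℝ) + 1) / 2)) (gam1 i) 0 T p.2‖ₑ * ‖F i (p.1 - p.2)‖ₑ)
      (((hk' i).comp measurable_snd).enorm.mul
        ((hF i).comp (measurable_fst.sub measurable_snd)).enorm)).mul hg
  refine Finset.sum_congr rfl fun i _ => ?_
  have s1 : ∀ q, (∫⁻ v, ‖hk (-(((N : ℝ) + 1) / 2)) (gam1 i) 0 T v‖ₑ * ‖F i (q - v)‖ₑ) * g q =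
      ∫⁻ v, ‖hk (-(((N : ℝ) + 1) / 2)) (gam1 i) 0 T v‖ₑ * ‖F i (q - v)‖ₑ * g q := fun q =>
    (lintegral_mul_const _ ((hk' i).enorm.mul
      ((hF i).comp (measurable_const.sub measurable_id)).enorm)).symm
  have s2 : ∀ q, ‖F i q‖ₑ * (∫⁻ v, ‖hk (-(((N : ℝ) + 1) / 2)) (gam1 i) 0 T v‖ₑ * g (q + v)) =
      ∫⁻ v, ‖F i q‖ₑ * (‖hk (-(((N : ℝ) + 1) / 2)) (gam1 i) 0 T v‖ₑ * g (q + v)) := fun q =>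
    (lintegral_const_mul _ ((hk' i).enorm.mul
      (hg.comp (measurable_const.add measurable_id)))).symm
  simp only [s1, s2]
  rw [lintegral_lintegral_swap (μ := volume.restrict (strip N)) (ν := volume) (hm1 i).aemeasurable,
    lintegral_lintegral_swap (μ := volume.restrict (strip N)) (ν := volume) (hm2 i).aemeasurable]
  refine lintegral_congr fun v => ?_
  have hper : PerQ fun q => ‖hk (-(((N : ℝ) + 1) / 2)) (gam1 i) 0 T v‖ₑ * ‖F i (q - v)‖ₑ * g q :=
    fun q z => by
      have : q + latHom N z - v = q - v + latHom N z := by abel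
      simp only [this, hp i _ z, hgp q z]
  rw [← hper.lintegral_shift v]
  refine lintegral_congr fun q => ?_
  rw [add_sub_cancel_right]
  ring

lemma integrable_hk_gam1 (T : ℝ) (hT : 0 ≤ T) (i : Fin N) :
    Integrable (hk (-(((N : ℝ) + 1) / 2)) (gam1 i) 0 T) := by
  obtain ⟨C, hC⟩ := exists_KD_gam1 i
  exact integrable_hk_zero hC hT (by linarith)

lemma lintegral_FPpot_ne_top (hT : 0 ≤ T) {F : Fin N → XT N → ℝ} (hF : ∀ i, Measurable (F i))
    (hp : ∀ i, PerQ (F i)) (hi : ∀ i, IntegrableOn (F i) (strip N)) :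
    ∫⁻ q in strip N, FPpot N T F q ≠ ⊤ := by
  have h1 := lintegral_FPpot_mul (T := T) hF hp (g := fun _ => 1) measurable_const (fun _ _ => rfl)
  simp only [mul_one] at h1
  rw [h1]
  refine ENNReal.sum_ne_top.2 fun i _ => ?_
  rw [lintegral_mul_const _ (hF i).enorm]
  exact ENNReal.mul_ne_top (hi i).2.ne (integrable_hk_gam1 T hT i).2.ne

lemma FPRep.enorm_integral_le (h : FPRep N T γ' m₀ m A u e W) (hd : FPData N K₀ m₀)
    (hK₀ : 0 ≤ K₀) (hT : 0 ≤ T) {ψ : XT N → ℝ} {R : ℝ} (hψ : SPc ψ R)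
    (h0 : ∀ q : XT N, T ≤ q.2 → ψ q = 0) :
    ‖∫ q in strip N, (u q - cut T m₀ q) * ψ q‖ₑ ≤
      ∫⁻ q in strip N, FPpot N T (FPflux T m₀ W) q * ‖ψ q‖ₑ := by
  rw [h.weak_bsol hd hK₀ hT hψ h0, lintegral_FPpot_mul (fun i => (h.TPc_flux hd i).meas)
    (fun i => (h.TPc_flux hd i).per) hψ.smooth.continuous.measurable.enorm
    (fun q z => by simp only [hψ.per q z])]
  refine (enorm_sum_le _ _).trans (Finset.sum_le_sum fun i _ => ?_)
  refine (enorm_integral_le_lintegral_enorm _).trans (lintegral_mono fun q => ?_)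
  rw [enorm_mul, hψ.bsol_dir hT, enorm_neg, cvk]
  gcongr
  refine (enorm_integral_le_lintegral_enorm _).trans_eq (lintegral_congr fun v => ?_)
  rw [enorm_mul]
  congr 3
  abel

lemma FPRep.ae_le_pot_of_mem (h : FPRep N T γ' m₀ m A u e W) (hd : FPData N K₀ m₀)
    (hK₀ : 0 ≤ K₀) (hT : 0 ≤ T) {δ : ℝ} (hδ : 0 < δ) :
    ∀ᵐ q ∂volume.restrict (strip N), q.2 ∈ Icc δ (T - δ) →
      u q - cut T m₀ q ≤ (FPpot N T (FPflux T m₀ W) q).toReal := by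
  set V := FPpot N T (FPflux T m₀ W) with hV
  have hFm : ∀ i, Measurable (FPflux T m₀ W i) := fun i => (h.TPc_flux hd i).meas
  have hFp : ∀ i, PerQ (FPflux T m₀ W i) := fun i => (h.TPc_flux hd i).per
  have Vm : Measurable V := measurable_FPpot hFm
  have Vp : PerQ V := fun q z => by
    simp only [hV, FPpot]
    refine Finset.sum_congr rfl fun i _ => lintegral_congr fun v => ?_
    rw [add_sub_right_comm, hFp i]
  have Vt : ∫⁻ q in strip N, V q ≠ ⊤ :=
    lintegral_FPpot_ne_top hT hFm hFp (h.integrableOn_flux hd hK₀)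
  have Vf : ∀ᵐ q ∂volume.restrict (strip N), V q < ⊤ := ae_lt_top Vm Vt
  have Vi : IntegrableOn (fun q => (V q).toReal) (strip N) :=
    integrable_toReal_of_lintegral_ne_top Vm.aemeasurable Vt
  have ic := hd.TPc_cut.integrableOn (T := T) (hd.abs_cut_le hK₀)
  have iuc : IntegrableOn (fun q => u q - cut T m₀ q) (strip N) := h.int_u.sub ic
  set E : Set (XT N) := {q | q.2 ∈ Icc δ (T - δ) ∧ (V q).toReal < u q - cut T m₀ q} with hE
  have mE : MeasurableSet E := (measurable_snd measurableSet_Icc).inter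
    (measurableSet_lt Vm.ennreal_toReal (h.tu.meas.sub hd.TPc_cut.meas))
  set f : XT N → ℝ := E.indicator 1 with hf
  have f_nn : ∀ q, 0 ≤ f q := fun q => indicator_nonneg (fun _ _ => zero_le_one) q
  have f_le : ∀ q, |f q| ≤ 1 := fun q => by
    rw [abs_of_nonneg (f_nn q)]; exact indicator_le_self' (fun _ _ => zero_le_one) q
  have f_supp : ∀ q : XT N, q.2 ∉ Icc δ (T - δ) → f q = 0 := fun q hq =>
    indicator_of_notMem (fun h' => hq h'.1) _
  have fB : BPc f 1 T := by
    refine ⟨measurable_one.indicator mE, fun q z => ?_, f_le, fun q hq => f_supp q fun h' => ?_⟩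
    · have h1 : (q + latHom N z).2 = q.2 := by simp [latHom_snd]
      have : q + latHom N z ∈ E ↔ q ∈ E := by
        simp only [hE, mem_ofPred_eq, h1, Vp q z, h.tu.per q z, hd.TPc_cut.per q z]
      by_cases hq : q ∈ E
      · simp [hf, hq, this.2 hq]
      · simp [hf, hq, mt this.1 hq]
    · rw [abs_of_nonneg (hδ.le.trans h'.1)] at hq
      linarith [h'.2]
  obtain ⟨ψ, hψ, ψ_le, ψ_supp, ψ_lim⟩ := fB.exists_approx (half_pos hδ)
  have ψ_lim' := ae_restrict_of_ae (s := strip N) ψ_lim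
  have hle : ∀ n, ∫ q in strip N, (u q - cut T m₀ q) * ψ n q ≤
      ∫ q in strip N, (V q).toReal * |ψ n q| := fun n => by
    have h1 := h.enorm_integral_le hd hK₀ hT (hψ n) fun q hq =>
      ψ_supp _ _ f_supp n q fun h' => by linarith [h'.2]
    have h2 : ∫⁻ q in strip N, V q * ‖ψ n q‖ₑ =
        ENNReal.ofReal (∫ q in strip N, (V q).toReal * |ψ n q|) := by
      rw [ofReal_integral_eq_lintegral_ofReal]
      · refine lintegral_congr_ae ?_
        filter_upwards [Vf] with q hq
        rw [ENNReal.ofReal_mul ENNReal.toReal_nonneg, ENNReal.ofReal_toReal hq.ne,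
          Real.enorm_eq_ofReal_abs]
      · exact Vi.mul_bdd (c := 1) (hψ n).smooth.continuous.abs.aestronglyMeasurable
          (Eventually.of_forall fun q => by rw [Real.norm_eq_abs, abs_abs]; exact ψ_le n q)
      · exact Eventually.of_forall fun q => mul_nonneg ENNReal.toReal_nonneg (abs_nonneg _)
    rw [h2, Real.enorm_eq_ofReal_abs, ENNReal.ofReal_le_ofReal_iff] at h1
    · exact (le_abs_self _).trans h1
    · exact integral_nonneg fun q => mul_nonneg ENNReal.toReal_nonneg (abs_nonneg _)
  have t1 : Tendsto (fun n => ∫ q in strip N, (u q - cut T m₀ q) * ψ n q) atTop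
      (𝓝 (∫ q in strip N, (u q - cut T m₀ q) * f q)) := by
    refine tendsto_integral_of_dominated_convergence (fun q => ‖u q - cut T m₀ q‖)
      (fun n => iuc.1.mul (hψ n).smooth.continuous.aestronglyMeasurable) iuc.norm
      (fun n => Eventually.of_forall fun q => ?_) ?_
    · rw [norm_mul]
      exact mul_le_of_le_one_right (norm_nonneg _) (ψ_le n q)
    · filter_upwards [ψ_lim'] with q hq using hq.const_mul _
  have t2 : Tendsto (fun n => ∫ q in strip N, (V q).toReal * |ψ n q|) atTop
      (𝓝 (∫ q in strip N, (V q).toReal * f q)) := by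
    refine tendsto_integral_of_dominated_convergence (fun q => ‖(V q).toReal‖)
      (fun n => Vi.1.mul (hψ n).smooth.continuous.abs.aestronglyMeasurable) Vi.norm
      (fun n => Eventually.of_forall fun q => ?_) ?_
    · rw [norm_mul, Real.norm_eq_abs |ψ n q|, abs_abs]
      exact mul_le_of_le_one_right (norm_nonneg _) (ψ_le n q)
    · filter_upwards [ψ_lim'] with q hq
      have := hq.abs.const_mul (V q).toReal
      rwa [abs_of_nonneg (f_nn q)] at this
  have hfin := le_of_tendsto_of_tendsto' t1 t2 hle
  have i1 : IntegrableOn (fun q => (u q - cut T m₀ q) * f q) (strip N) :=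
    iuc.mul_bdd (c := 1) fB.meas.aestronglyMeasurable (Eventually.of_forall f_le)
  have i2 : IntegrableOn (fun q => (V q).toReal * f q) (strip N) :=
    Vi.mul_bdd (c := 1) fB.meas.aestronglyMeasurable (Eventually.of_forall f_le)
  have hnn : ∀ q, 0 ≤ (u q - cut T m₀ q) * f q - (V q).toReal * f q := fun q => by
    by_cases hq : q ∈ E
    · simp only [hf, indicator_of_mem hq, Pi.one_apply, mul_one]
      exact sub_nonneg.2 hq.2.le
    · simp [hf, hq]
  have hz : ∫ q in strip N, ((u q - cut T m₀ q) * f q - (V q).toReal * f q) = 0 :=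
    le_antisymm (by rw [integral_sub i1 i2]; linarith) (integral_nonneg hnn)
  rw [integral_eq_zero_iff_of_nonneg hnn (i1.sub i2)] at hz
  filter_upwards [hz] with q hq hq2
  by_contra hlt
  have hqE : q ∈ E := ⟨hq2, not_le.1 hlt⟩
  simp only [hf, indicator_of_mem hqE, Pi.one_apply, mul_one, Pi.zero_apply] at hq
  linarith [hqE.2]

lemma FPRep.ae_le_pot (h : FPRep N T γ' m₀ m A u e W) (hd : FPData N K₀ m₀)
    (hK₀ : 0 ≤ K₀) (hT : 0 ≤ T) :
    ∀ᵐ q ∂volume.restrict (strip N), ‖u q‖ₑ ≤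
      ENNReal.ofReal (1 + N * K₀) + FPpot N T (FPflux T m₀ W) q := by
  have h1 : ∀ᵐ q ∂volume.restrict (strip N), ∀ n : ℕ,
      q.2 ∈ Icc (1 / ((n : ℝ) + 1)) (T - 1 / ((n : ℝ) + 1)) →
        u q - cut T m₀ q ≤ (FPpot N T (FPflux T m₀ W) q).toReal :=
    ae_all_iff.2 fun n => h.ae_le_pot_of_mem hd hK₀ hT Nat.one_div_pos_of_nat
  filter_upwards [h1] with q hq
  by_cases hq2 : q.2 ∈ Ioo 0 T
  · obtain ⟨n, hn⟩ := exists_nat_one_div_lt (lt_min hq2.1 (sub_pos.2 hq2.2))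
    have hn' := lt_min_iff.1 hn
    have h2 := hq n ⟨hn'.1.le, by linarith [hn'.2]⟩
    have h3 := (le_abs_self _).trans (hd.abs_cut_le (T := T) hK₀ q)
    rw [Real.enorm_eq_ofReal (h.u_nonneg q)]
    calc ENNReal.ofReal (u q) ≤ ENNReal.ofReal ((1 + N * K₀) +
          (FPpot N T (FPflux T m₀ W) q).toReal) := ENNReal.ofReal_le_ofReal (by linarith)
      _ ≤ _ := by
        rw [ENNReal.ofReal_add (by positivity) ENNReal.toReal_nonneg]
        gcongr
        exact ENNReal.ofReal_toReal_le
  · rw [h.tu.supp q hq2]; simp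

end

/-- A weight integrable in space. -/
def wgt (v : XT N) : ℝ := (1 + ‖v.1‖) ^ (-((N : ℝ) + 1))

lemma wgt_pos (v : XT N) : 0 < wgt v := Real.rpow_pos_of_pos (by positivity) _

lemma measurable_wgt : Measurable (wgt (N := N)) := by
  have : Measurable fun v : XT N => 1 + ‖v.1‖ := by fun_prop
  exact this.pow_const _

lemma wgt_le_of_strip (k : XT N) {v v' : XT N} (hv : v ∈ strip N) (hv' : v' ∈ strip N) :
    wgt (k + v) ≤ 2 ^ ((N : ℝ) + 1) * wgt (k + v') := by
  have h1 : ‖(k + v').1‖ ≤ ‖(k + v).1‖ + 1 := by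
    have h2 : ‖v'.1 - v.1‖ ≤ 1 := (pi_norm_le_iff_of_nonneg zero_le_one).2 fun i => by
      have h3 := hv i
      have h4 := hv' i
      rw [Pi.sub_apply, Real.norm_eq_abs, abs_le]
      exact ⟨by linarith [h3.2, h4.1], by linarith [h3.1, h4.2]⟩
    have h5 : (k + v').1 = (k + v).1 + (v'.1 - v.1) := by simp only [Prod.fst_add]; abel
    rw [h5]
    exact (norm_add_le _ _).trans (by gcongr)
  have hpos : 0 < 1 + ‖(k + v).1‖ := by positivity
  have h6 : (2 * (1 + ‖(k + v).1‖)) ^ (-((N : ℝ) + 1)) ≤ wgt (k + v') :=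
    Real.rpow_le_rpow_of_nonpos (by positivity) (by linarith [norm_nonneg (k + v).1])
      (by linarith [(N.cast_nonneg : (0 : ℝ) ≤ N)])
  rw [Real.mul_rpow zero_le_two hpos.le] at h6
  calc wgt (k + v) = 2 ^ ((N : ℝ) + 1) * (2 ^ (-((N : ℝ) + 1)) * wgt (k + v)) := by
        rw [← mul_assoc, ← Real.rpow_add two_pos, add_neg_cancel, Real.rpow_zero, one_mul]
    _ ≤ _ := by gcongr; exact h6

lemma lintegral_wgt_ne_top (N : ℕ) :
    ∫⁻ v : XT N, {v | v.2 ∈ Ioo (0 : ℝ) 1}.indicator (fun v => ENNReal.ofReal (wgt v)) v ≠ ⊤ := by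
  have h1 : Integrable (fun x : RN N => (1 + ‖x‖) ^ (-((N : ℝ) + 1))) :=
    integrable_one_add_norm (by simp)
  have h2 : Integrable ((Ioo (0 : ℝ) 1).indicator fun _ => (1 : ℝ)) :=
    (integrable_indicator_iff measurableSet_Ioo).2 (integrableOn_const (by simp))
  have h3 := (h1.mul_prod h2).2
  rw [hasFiniteIntegral_iff_enorm] at h3
  refine ((lintegral_congr fun v => ?_).trans_lt h3).ne
  by_cases hv : v.2 ∈ Ioo (0 : ℝ) 1
  · rw [indicator_of_mem (by exact hv), indicator_of_mem hv, mul_one,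
      ← wgt, Real.enorm_eq_ofReal (wgt_pos v).le]
  · rw [indicator_of_notMem (by exact hv), indicator_of_notMem hv, mul_zero, enorm_zero]

lemma PerQ.lintegral_sub {H : XT N → ENNReal} (hp : PerQ H) (q : XT N) :
    ∫⁻ v in strip N, H (q - v) = ∫⁻ v in strip N, H v := by
  have h1 : PerQ fun v => H (q + v) := fun v z => by simp only [← add_assoc, hp _ z]
  have h2 := h1.lintegral_neg
  simp only [← sub_eq_add_neg] at h2
  rw [h2, ← hp.lintegral_shift q]
  simp only [add_comm]

lemma exists_lintegral_mul_wgt_le (N : ℕ) : ∃ c : ENNReal, c ≠ ⊤ ∧ ∀ H : XT N → ENNReal,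
    Measurable H → PerQ H → ∀ q, ∫⁻ v, H (q - v) * ENNReal.ofReal (wgt v) ≤
      c * ∫⁻ v in strip N, H v := by
  set S : Set (XT N) := {v | v.2 ∈ Ioo (0 : ℝ) 1} with hS
  have mS : MeasurableSet S := measurable_snd measurableSet_Ioo
  set g : XT N → ENNReal := S.indicator fun v => ENNReal.ofReal (wgt v) with hg
  have mw : Measurable fun v : XT N => ENNReal.ofReal (wgt v) := measurable_wgt.ennreal_ofReal
  have vS : volume.restrict (strip N) S = 1 := by
    have h1 : volume.restrict (strip N) S = volume (slab N 1 ∩ S) := by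
      rw [Measure.restrict_apply mS]
      congr 1
      ext v
      simp only [slab, hS, mem_inter_iff, mem_ofPred_eq, mem_Ioo]
      constructor
      · rintro ⟨h1, h2⟩; exact ⟨⟨h2, abs_le.2 ⟨by linarith, h1.2.le⟩⟩, h1⟩
      · rintro ⟨h1, h2⟩; exact ⟨h2, h1.1⟩
    have h2 : ∫⁻ q in strip N, S.indicator (fun _ => (1 : ENNReal)) q =
        ∫⁻ q in QQ N 1, S.indicator (fun _ => (1 : ENNReal)) q :=
      setLIntegral_strip_eq_QQ fun q hq => indicator_of_notMem (show q ∉ S from hq) _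
    rw [lintegral_indicator_const mS, one_mul] at h2
    rw [h2, setLIntegral_congr_fun measurableSet_QQ (g := fun _ => 1) fun q hq =>
      indicator_of_mem (show q ∈ S from hq.2) _, setLIntegral_one, volume_QQ, ENNReal.ofReal_one]
  have key : ∀ v ∈ strip N, ∑' k : (latHom N).range, ENNReal.ofReal (wgt ((k : XT N) + v)) ≤
      ENNReal.ofReal (2 ^ ((N : ℝ) + 1)) * ∫⁻ v, g v := fun v hv => by
    rw [lintegral_eq_tsum_strip, ← ENNReal.tsum_mul_left]
    refine ENNReal.tsum_le_tsum fun k => ?_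
    have hk : (k : XT N).2 = 0 := by
      obtain ⟨z, hz⟩ := k.2
      rw [← hz]; rfl
    calc ENNReal.ofReal (wgt ((k : XT N) + v))
        = ∫⁻ v' in strip N, S.indicator (fun _ => ENNReal.ofReal (wgt ((k : XT N) + v))) v' := by
          rw [lintegral_indicator_const mS, vS, mul_one]
      _ ≤ ∫⁻ v' in strip N, ENNReal.ofReal (2 ^ ((N : ℝ) + 1)) * g ((k : XT N) + v') := by
          refine setLIntegral_mono' (measurableSet_strip) fun v' hv' => ?_
          by_cases h : v' ∈ S
          · have h' : (k : XT N) + v' ∈ S := by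
              simp only [hS, mem_ofPred_eq, Prod.snd_add, hk, zero_add]; exact h
            rw [hg, indicator_of_mem h, indicator_of_mem h', ← ENNReal.ofReal_mul (by positivity)]
            exact ENNReal.ofReal_le_ofReal (wgt_le_of_strip _ hv hv')
          · rw [indicator_of_notMem h]; exact bot_le
      _ = _ := lintegral_const_mul' _ _ ENNReal.ofReal_ne_top
  refine ⟨ENNReal.ofReal (2 ^ ((N : ℝ) + 1)) * ∫⁻ v, g v, ENNReal.mul_ne_top ENNReal.ofReal_ne_top
    (lintegral_wgt_ne_top N), fun H mH hp q => ?_⟩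
  rw [lintegral_eq_tsum_strip, ← lintegral_tsum fun k => by
    exact ((mH.comp (by fun_prop)).mul (mw.comp (by fun_prop))).aemeasurable]
  have mHq : Measurable fun v => H (q - v) := mH.comp (by fun_prop)
  rw [← hp.lintegral_sub q, ← lintegral_const_mul _ mHq]
  refine setLIntegral_mono' (measurableSet_strip) fun v hv => ?_
  have e1 : ∀ k : (latHom N).range, H (q - ((k : XT N) + v)) = H (q - v) := fun k => by
    obtain ⟨z, hz⟩ := k.2
    rw [← hz, ← hp (q - (latHom N z + v)) z]
    congr 1; abel
  simp only [e1]
  rw [ENNReal.tsum_mul_left, mul_comm]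
  exact mul_le_mul_left (key v hv) _

/-- The product inequality behind Young's convolution inequality. -/
lemma lintegral_mul_rpow_le_of_three {α : Type*} [MeasurableSpace α] {μ : Measure α}
    {K G w : α → ENNReal} (hK : Measurable K) (hG : Measurable G) (hw : Measurable w)
    (hw0 : ∀ v, w v ≠ 0) (hwt : ∀ v, w v ≠ ⊤) {σ a R : ℝ} (hσ : 1 ≤ σ) (ha : 1 ≤ a) (hR : 0 < R)
    (hR' : 1 / R = 1 / a + 1 / σ - 1) :
    (∫⁻ v, K v * G v ∂μ) ^ R ≤ (∫⁻ v, K v ^ σ * w v ^ (1 - σ) * G v ^ a ∂μ) *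
      (∫⁻ v, K v ^ σ * w v ^ (1 - σ) ∂μ) ^ (R / σ - 1) *
        (∫⁻ v, G v ^ a * w v ∂μ) ^ (R / a - 1) := by
  have hσ0 : 0 < σ := by linarith
  have ha0 : 0 < a := by linarith
  have hσ1 : 1 / σ ≤ 1 := by rw [div_le_one hσ0]; exact hσ
  have ha1 : 1 / a ≤ 1 := by rw [div_le_one ha0]; exact ha
  have p1 : 0 ≤ 1 / R := by positivity
  have p2 : 0 ≤ 1 / σ - 1 / R := by linarith
  have p3 : 0 ≤ 1 / a - 1 / R := by linarith
  have hm1 : Measurable fun v => K v ^ σ * w v ^ (1 - σ) := (hK.pow_const _).mul (hw.pow_const _)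
  have hm2 : Measurable fun v => G v ^ a := hG.pow_const _
  have h := ENNReal.lintegral_prod_norm_pow_le (μ := μ) (Finset.univ : Finset (Fin 3))
    (f := ![fun v => K v ^ σ * w v ^ (1 - σ) * G v ^ a, fun v => K v ^ σ * w v ^ (1 - σ),
      fun v => G v ^ a * w v]) (fun i _ => by
        fin_cases i
        · exact (hm1.mul hm2).aemeasurable
        · exact hm1.aemeasurable
        · exact (hm2.mul hw).aemeasurable)
    (p := ![1 / R, 1 / σ - 1 / R, 1 / a - 1 / R]) (by simp [Fin.sum_univ_three]; simp at hR'; linarith)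
    (fun i _ => by fin_cases i; exacts [p1, p2, p3])
  simp only [Fin.prod_univ_three, Matrix.cons_val_zero, Matrix.cons_val_one, Matrix.cons_val] at h
  have e : ∀ v, (K v ^ σ * w v ^ (1 - σ) * G v ^ a) ^ (1 / R) *
      (K v ^ σ * w v ^ (1 - σ)) ^ (1 / σ - 1 / R) * (G v ^ a * w v) ^ (1 / a - 1 / R) =
        K v * G v := fun v => by
    rw [ENNReal.mul_rpow_of_nonneg _ _ p1, ENNReal.mul_rpow_of_nonneg _ _ p1,
      ENNReal.mul_rpow_of_nonneg _ _ p2, ENNReal.mul_rpow_of_nonneg _ _ p3]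
    simp only [← ENNReal.rpow_mul]
    have kK : K v ^ (σ * (1 / R)) * K v ^ (σ * (1 / σ - 1 / R)) = K v := by
      rw [← ENNReal.rpow_add_of_nonneg _ _ (by positivity) (by positivity), ← mul_add,
        add_sub_cancel, mul_one_div_cancel hσ0.ne', ENNReal.rpow_one]
    have kG : G v ^ (a * (1 / R)) * G v ^ (a * (1 / a - 1 / R)) = G v := by
      rw [← ENNReal.rpow_add_of_nonneg _ _ (by positivity) (by positivity), ← mul_add,
        add_sub_cancel, mul_one_div_cancel ha0.ne', ENNReal.rpow_one]
    have kw : w v ^ ((1 - σ) * (1 / R)) * w v ^ ((1 - σ) * (1 / σ - 1 / R)) *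
        w v ^ (1 / a - 1 / R) = 1 := by
      rw [← ENNReal.rpow_add _ _ (hw0 v) (hwt v), ← ENNReal.rpow_add _ _ (hw0 v) (hwt v)]
      have : (1 - σ) * (1 / R) + (1 - σ) * (1 / σ - 1 / R) + (1 / a - 1 / R) = 0 := by
        rw [hR']; field_simp; ring
      rw [this, ENNReal.rpow_zero]
    calc _ = (K v ^ (σ * (1 / R)) * K v ^ (σ * (1 / σ - 1 / R))) *
          (G v ^ (a * (1 / R)) * G v ^ (a * (1 / a - 1 / R))) *
          (w v ^ ((1 - σ) * (1 / R)) * w v ^ ((1 - σ) * (1 / σ - 1 / R)) *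
        w v ^ (1 / a - 1 / R)) := by ring
      _ = _ := by rw [kK, kG, kw, mul_one]
  simp only [e] at h
  refine (ENNReal.rpow_le_rpow h hR.le).trans_eq ?_
  rw [ENNReal.mul_rpow_of_nonneg _ _ hR.le, ENNReal.mul_rpow_of_nonneg _ _ hR.le,
    ← ENNReal.rpow_mul, ← ENNReal.rpow_mul, ← ENNReal.rpow_mul, one_div_mul_cancel hR.ne',
    ENNReal.rpow_one]
  congr 3 <;> field_simp

lemma exists_lintegral_hk_rpow_ne_top {k : RN N → ℝ} {C p : ℝ} (h : KD k C) {b : ℝ} (hb : 0 ≤ b)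
    {σ : ℝ} (hσ : 1 ≤ σ) (hσ' : σ ≤ 2) (hp : -1 < σ * p + N / 2) :
    ∫⁻ v : XT N, ‖hk p k 0 b v‖ₑ ^ σ * ENNReal.ofReal (wgt v) ^ (1 - σ) ≠ ⊤ := by
  obtain ⟨C', hC', hle⟩ := exists_pow_mul_gsw_le (N := N) (N + 1)
    (show (1 / 16 : ℝ) < 1 / 8 by norm_num)
  have hC0 : 0 ≤ C := h.nonneg
  set D : ℝ := C ^ σ * (1 + √b) ^ (N + 1) * C' with hD
  have hD0 : 0 ≤ D := by positivity
  refine ne_top_of_le_ne_top (b := ∫⁻ v : XT N, {v | v.2 ∈ Ioo 0 b}.indicator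
    (fun v => ENNReal.ofReal (D * v.2 ^ (σ * p) * gsw (1 / 16) (psc v))) v) ?_ ?_
  · rw [lintegral_parabolic_gsw measurableSet_Ioo (fun x hx => hx.1) _ _ _ hD0,
      lintegral_rpow_Ioo hb hp]
    exact ENNReal.mul_ne_top (ENNReal.mul_ne_top ENNReal.ofReal_ne_top ENNReal.ofReal_ne_top)
      (lintegral_gsw_ne_top (by norm_num))
  · refine lintegral_mono fun v => ?_
    by_cases hv : v.2 ∈ Ioo 0 b
    · have hv0 : 0 < v.2 := hv.1
      rw [hk, indicator_of_mem (by exact hv), indicator_of_mem (by exact hv),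
        ENNReal.ofReal_rpow_of_pos (wgt_pos v), Real.enorm_eq_ofReal_abs,
        ENNReal.ofReal_rpow_of_nonneg (abs_nonneg _) (by linarith),
        ← ENNReal.ofReal_mul (by positivity)]
      refine ENNReal.ofReal_le_ofReal ?_
      have h1 : |kq p k v| ^ σ ≤ C ^ σ * v.2 ^ (σ * p) * gsw (1 / 8) (psc v) := by
        refine (Real.rpow_le_rpow (abs_nonneg _) (abs_kq_le h p hv0) (by linarith)).trans ?_
        have hg := (gsw_pos (1 / 8) (psc v)).le
        rw [Real.mul_rpow (by positivity) hg, Real.mul_rpow hC0 (by positivity),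
          ← Real.rpow_mul hv0.le, mul_comm p σ]
        gcongr
        refine Real.rpow_le_self_of_le_one hg ?_ hσ
        rw [gsw, Real.exp_le_one_iff]
        have : 0 ≤ sqs (psc v) := Finset.sum_nonneg fun i _ => sq_nonneg _
        linarith
      have h2 : wgt v ^ (1 - σ) ≤ (1 + √b) ^ (N + 1) * (1 + ‖psc v‖) ^ (N + 1) := by
        have e1 : wgt v ^ (1 - σ) = (1 + ‖v.1‖) ^ (((N : ℝ) + 1) * (σ - 1)) := by
          rw [wgt, ← Real.rpow_mul (by positivity)]; congr 1; ring
        have e2 : ((N : ℝ) + 1) * (σ - 1) ≤ ((N + 1 : ℕ) : ℝ) := by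
          push_cast
          have : (0 : ℝ) ≤ N := N.cast_nonneg
          nlinarith
        rw [e1, ← mul_pow, ← Real.rpow_natCast _ (N + 1)]
        refine (Real.rpow_le_rpow_of_exponent_le (by linarith [norm_nonneg v.1]) e2).trans ?_
        refine Real.rpow_le_rpow (by positivity) ?_ (by positivity)
        have e3 : ‖v.1‖ = √v.2 * ‖psc v‖ := by
          rw [psc, norm_smul, Real.norm_eq_abs, abs_of_nonneg (by positivity), Real.sqrt_eq_rpow,
            ← mul_assoc, ← Real.rpow_add hv0]
          norm_num
        have e4 : √v.2 ≤ √b := Real.sqrt_le_sqrt hv.2.le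
        have e5 : √v.2 * ‖psc v‖ ≤ √b * ‖psc v‖ := by gcongr
        rw [e3]
        nlinarith [Real.sqrt_nonneg b, norm_nonneg (psc v)]
      calc _ ≤ (C ^ σ * v.2 ^ (σ * p) * gsw (1 / 8) (psc v)) *
            ((1 + √b) ^ (N + 1) * (1 + ‖psc v‖) ^ (N + 1)) := by
              gcongr
              · exact Real.rpow_nonneg (wgt_pos v).le _
              · have := (gsw_pos (1 / 8) (psc v)).le; positivity
        _ = (C ^ σ * v.2 ^ (σ * p) * (1 + √b) ^ (N + 1)) *
            ((1 + ‖psc v‖) ^ (N + 1) * gsw (1 / 8) (psc v)) := by ring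
        _ ≤ (C ^ σ * v.2 ^ (σ * p) * (1 + √b) ^ (N + 1)) * (C' * gsw (1 / 16) (psc v)) := by
              exact mul_le_mul_of_nonneg_left (hle _) (by positivity)
        _ = _ := by rw [hD]; ring
    · rw [hk, indicator_of_notMem (by exact hv), enorm_zero,
        ENNReal.zero_rpow_of_pos (by linarith), zero_mul]
      exact bot_le

/-- Young's inequality for the gradient of the heat kernel. -/
lemma exists_young_gam1 (N : ℕ) {T : ℝ} (hT : 0 ≤ T) (i : Fin N) {σ a R : ℝ} (hσ : 1 ≤ σ)
    (hσ' : σ < ((N : ℝ) + 2) / (N + 1)) (ha : 1 ≤ a) (hR : 0 < R)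
    (hR' : 1 / R = 1 / a + 1 / σ - 1) :
    ∃ c : ENNReal, c ≠ ⊤ ∧ ∀ G : XT N → ENNReal, Measurable G → PerQ G →
      ∫⁻ q in strip N, (∫⁻ v, ‖hk (-(((N : ℝ) + 1) / 2)) (gam1 i) 0 T v‖ₑ * G (q - v)) ^ R ≤
        c * (∫⁻ q in strip N, G q ^ a) ^ (R / a) := by
  obtain ⟨C, hC⟩ := exists_KD_gam1 i
  obtain ⟨c, hc, hcle⟩ := exists_lintegral_mul_wgt_le N
  set κ := hk (-(((N : ℝ) + 1) / 2)) (gam1 i) 0 T with hκ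
  have hN1 : (0 : ℝ) < N + 1 := by positivity
  rw [lt_div_iff₀ hN1] at hσ'
  have hσ2 : σ ≤ 2 := by
    have : (0 : ℝ) ≤ N := N.cast_nonneg
    by_contra! h2
    nlinarith
  have hA := exists_lintegral_hk_rpow_ne_top (p := -(((N : ℝ) + 1) / 2)) hC hT hσ hσ2 (by linarith)
  set A := ∫⁻ v : XT N, ‖κ v‖ₑ ^ σ * ENNReal.ofReal (wgt v) ^ (1 - σ) with hAd
  have mκ : Measurable fun v => ‖κ v‖ₑ := (measurable_hk _ hC.cd.continuous.measurable _ _).enorm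
  have mw : Measurable fun v : XT N => ENNReal.ofReal (wgt v) := measurable_wgt.ennreal_ofReal
  have e1 : 0 ≤ R / σ - 1 := by
    have : 1 / R ≤ 1 / σ := by
      have := (div_le_one (by linarith : 0 < a)).2 ha
      linarith
    rw [sub_nonneg, le_div_iff₀ (by linarith), one_mul]
    exact (one_div_le_one_div hR (by linarith)).1 this
  have e2 : 0 ≤ R / a - 1 := by
    have : 1 / R ≤ 1 / a := by
      have := (div_le_one (by linarith : 0 < σ)).2 hσ
      linarith
    rw [sub_nonneg, le_div_iff₀ (by linarith), one_mul]
    exact (one_div_le_one_div hR (by linarith)).1 this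
  refine ⟨A * A ^ (R / σ - 1) * c ^ (R / a - 1), ENNReal.mul_ne_top (ENNReal.mul_ne_top hA
    (ENNReal.rpow_ne_top_of_nonneg e1 hA)) (ENNReal.rpow_ne_top_of_nonneg e2 hc),
    fun G mG pG => ?_⟩
  set I := ∫⁻ q in strip N, G q ^ a with hI
  have pGa : PerQ fun q => G q ^ a := fun q z => by simp only [pG q z]
  have mGa : Measurable fun q => G q ^ a := mG.pow_const _
  have mKw : Measurable fun v => ‖κ v‖ₑ ^ σ * ENNReal.ofReal (wgt v) ^ (1 - σ) :=
    (mκ.pow_const _).mul (mw.pow_const _)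
  have hpt : ∀ q, (∫⁻ v, ‖κ v‖ₑ * G (q - v)) ^ R ≤
      (∫⁻ v, ‖κ v‖ₑ ^ σ * ENNReal.ofReal (wgt v) ^ (1 - σ) * G (q - v) ^ a) *
        (A ^ (R / σ - 1) * (c * I) ^ (R / a - 1)) := fun q => by
    have mGq : Measurable fun v => G (q - v) := mG.comp (by fun_prop)
    refine (lintegral_mul_rpow_le_of_three mκ mGq mw
      (fun v => by simpa using wgt_pos v) (fun v => ENNReal.ofReal_ne_top) hσ ha hR hR').trans ?_
    rw [mul_assoc]
    gcongr
    exact hcle _ mGa pGa q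
  refine (lintegral_mono hpt).trans ?_
  have mU : Measurable (Function.uncurry fun (q v : XT N) =>
      ‖κ v‖ₑ ^ σ * ENNReal.ofReal (wgt v) ^ (1 - σ) * G (q - v) ^ a) :=
    (mKw.comp measurable_snd).mul (mGa.comp (measurable_fst.sub measurable_snd))
  have mV : Measurable fun q => ∫⁻ v, ‖κ v‖ₑ ^ σ * ENNReal.ofReal (wgt v) ^ (1 - σ) *
      G (q - v) ^ a := mU.lintegral_prod_right'
  rw [lintegral_mul_const _ mV,
    lintegral_lintegral_swap (μ := volume.restrict (strip N)) (ν := volume) mU.aemeasurable]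
  have h3 : ∀ v, ∫⁻ q in strip N, ‖κ v‖ₑ ^ σ * ENNReal.ofReal (wgt v) ^ (1 - σ) * G (q - v) ^ a =
      ‖κ v‖ₑ ^ σ * ENNReal.ofReal (wgt v) ^ (1 - σ) * I := fun v => by
    have mGv : Measurable fun q => G (q - v) ^ a := mGa.comp (by fun_prop)
    rw [lintegral_const_mul _ mGv, hI, ← pGa.lintegral_shift (-v)]
    simp only [← sub_eq_add_neg]
  simp only [h3]
  rw [lintegral_mul_const _ mKw, ENNReal.mul_rpow_of_nonneg _ _ e2]
  have h4 : I * I ^ (R / a - 1) = I ^ (R / a) := by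
    nth_rewrite 1 [← ENNReal.rpow_one I]
    rw [← ENNReal.rpow_add_of_nonneg _ _ zero_le_one e2, add_sub_cancel]
  rw [← h4]
  exact le_of_eq (by ring)

/-- Solutions of the Fokker–Planck equation with data controlled by `K` and `K₀`, represented on
the strip. -/
structure FPAll (N : ℕ) (T γ' K K₀ : ℝ) (m₀ : RN N → ℝ) (m : RN N → ℝ → ℝ) (A : RN N → ℝ → RN N)
    (u e : XT N → ℝ) (W : Fin N → XT N → ℝ) : Prop where
  data : FPData N K₀ m₀
  rep : FPRep N T γ' m₀ m A u e W
  energy : ∫ q in strip N, e q ≤ K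

/-- An a priori bound for the solution in `L^{1/(1-x)}`. -/
def DensBd (N : ℕ) (T γ' K K₀ x : ℝ) : Prop :=
  ∃ c : ENNReal, c ≠ ⊤ ∧ ∀ m₀ m A u e W, FPAll N T γ' K K₀ m₀ m A u e W →
    ∫⁻ q in strip N, ‖u q‖ₑ ^ (1 / (1 - x)) ≤ c

section

variable {T γ' K K₀ : ℝ}

lemma DensBd.zero : DensBd N T γ' K K₀ 0 := by
  refine ⟨ENNReal.ofReal T, ENNReal.ofReal_ne_top, fun m₀ m A u e W h => ?_⟩
  simp only [sub_zero, div_one, ENNReal.rpow_one]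
  rw [← h.rep.integral_eq h.data.2.2.1, ofReal_integral_eq_lintegral_ofReal h.rep.int_u
    (Eventually.of_forall h.rep.u_nonneg)]
  exact lintegral_mono fun q => by rw [Real.enorm_of_nonneg (h.rep.u_nonneg q)]

lemma DensBd.flux {x : ℝ} (hx : DensBd N T γ' K K₀ x) (hγ' : 1 < γ') (hx0 : 0 ≤ x) (hx1 : x < 1)
    (hK₀ : 0 ≤ K₀) :
    ∃ c : ENNReal, c ≠ ⊤ ∧ ∀ m₀ m A u e W, FPAll N T γ' K K₀ m₀ m A u e W → ∀ i,
      ∫⁻ q in strip N, ‖FPflux T m₀ W i q‖ₑ ^ (1 / (1 - (1 - 1 / γ') * x)) ≤ c := by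
  obtain ⟨c, hc, hle⟩ := hx
  set s := 1 - 1 / γ' with hs
  have hγ0 : 0 < γ' := by linarith
  have hs1 : s < 1 := by rw [hs]; linarith [show 0 < 1 / γ' by positivity]
  have hs0 : 0 < s := by
    have : 1 / γ' < 1 := by rw [div_lt_one hγ0]; exact hγ'
    rw [hs]; linarith
  have hsx : 0 < 1 - s * x := by nlinarith
  set a := 1 / (1 - s * x) with ha
  have ha0 : 0 < a := by positivity
  have ha1 : 1 ≤ a := by
    rw [ha, le_div_iff₀ hsx]; nlinarith
  have hθ : a * (1 / γ') + a * s * (1 - x) = 1 := by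
    rw [show 1 / γ' = 1 - s by rw [hs]; ring, ha]; field_simp; ring
  have hp1 : 0 ≤ a * (1 / γ') := by positivity
  have hp2 : 0 ≤ a * s * (1 - x) := mul_nonneg (by positivity) (by linarith)
  refine ⟨2 ^ (a - 1) * (ENNReal.ofReal K ^ (a * (1 / γ')) * c ^ (a * s * (1 - x)) +
    ENNReal.ofReal K₀ ^ a * ENNReal.ofReal T), ?_, fun m₀ m A u e W h i => ?_⟩
  · exact ENNReal.mul_ne_top (ENNReal.rpow_ne_top_of_nonneg (by linarith) (by simp))
      (ENNReal.add_ne_top.2 ⟨ENNReal.mul_ne_top (ENNReal.rpow_ne_top_of_nonneg hp1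
        ENNReal.ofReal_ne_top) (ENNReal.rpow_ne_top_of_nonneg hp2 hc),
        ENNReal.mul_ne_top (ENNReal.rpow_ne_top_of_nonneg ha0.le ENNReal.ofReal_ne_top)
        ENNReal.ofReal_ne_top⟩)
  have hr := h.rep
  have mW : Measurable fun q => ‖W i q‖ₑ ^ a := (hr.tW i).meas.enorm.pow_const _
  have h1 : ∫⁻ q in strip N, ‖W i q‖ₑ ^ a ≤
      ENNReal.ofReal K ^ (a * (1 / γ')) * c ^ (a * s * (1 - x)) := by
    have hE : ∫⁻ q in strip N, ‖e q‖ₑ ≤ ENNReal.ofReal K := by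
      refine le_trans ?_ (ENNReal.ofReal_le_ofReal h.energy)
      rw [ofReal_integral_eq_lintegral_ofReal hr.int_e (Eventually.of_forall hr.e_nonneg)]
      exact lintegral_mono fun q => by rw [Real.enorm_of_nonneg (hr.e_nonneg q)]
    calc ∫⁻ q in strip N, ‖W i q‖ₑ ^ a
        ≤ ∫⁻ q in strip N, ‖e q‖ₑ ^ (a * (1 / γ')) *
            (‖u q‖ₑ ^ (1 / (1 - x))) ^ (a * s * (1 - x)) := by
          refine lintegral_mono_ae ?_
          filter_upwards [hr.bound i] with q hq
          have e0 := hr.e_nonneg q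
          have u0 := hr.u_nonneg q
          rw [Real.enorm_eq_ofReal_abs, Real.enorm_of_nonneg e0, Real.enorm_of_nonneg u0,
            ← ENNReal.rpow_mul, show 1 / (1 - x) * (a * s * (1 - x)) = s * a by
              have : 1 - x ≠ 0 := by linarith
              field_simp, mul_comm a (1 / γ'), ENNReal.rpow_mul, ENNReal.rpow_mul,
            ← ENNReal.mul_rpow_of_nonneg _ _ ha0.le,
            ENNReal.ofReal_rpow_of_nonneg e0 (by positivity),
            ENNReal.ofReal_rpow_of_nonneg u0 hs0.le, ← ENNReal.ofReal_mul (by positivity)]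
          exact ENNReal.rpow_le_rpow (ENNReal.ofReal_le_ofReal hq) ha0.le
      _ ≤ _ := ENNReal.lintegral_mul_norm_pow_le hr.te.meas.enorm.aemeasurable
          (hr.tu.meas.enorm.pow_const _).aemeasurable hp1 hp2 hθ
      _ ≤ _ := mul_le_mul' (ENNReal.rpow_le_rpow hE hp1)
          (ENNReal.rpow_le_rpow (hle _ _ _ _ _ _ h) hp2)
  have h2 : ∫⁻ q in strip N, ‖cut T (pd i m₀) q‖ₑ ^ a ≤
      ENNReal.ofReal K₀ ^ a * ENNReal.ofReal T := by
    rw [setLIntegral_strip_eq_QQ (T := T) fun q hq => by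
      rw [(h.data.TPc_cut_pd i).supp q hq, enorm_zero, ENNReal.zero_rpow_of_pos ha0]]
    refine (lintegral_mono (g := fun _ => ENNReal.ofReal K₀ ^ a) fun q => ?_).trans_eq ?_
    · refine ENNReal.rpow_le_rpow ?_ ha0.le
      rw [Real.enorm_eq_ofReal_abs]
      exact ENNReal.ofReal_le_ofReal (h.data.abs_cut_pd_le hK₀ i q)
    · rw [setLIntegral_const, volume_QQ]
  calc ∫⁻ q in strip N, ‖FPflux T m₀ W i q‖ₑ ^ a
      ≤ ∫⁻ q in strip N, 2 ^ (a - 1) * (‖W i q‖ₑ ^ a + ‖cut T (pd i m₀) q‖ₑ ^ a) := by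
        refine lintegral_mono fun q => ?_
        refine le_trans (ENNReal.rpow_le_rpow ?_ ha0.le)
          (ENNReal.rpow_add_le_mul_rpow_add_rpow _ _ ha1)
        exact enorm_sub_le
    _ = 2 ^ (a - 1) * ((∫⁻ q in strip N, ‖W i q‖ₑ ^ a) +
          ∫⁻ q in strip N, ‖cut T (pd i m₀) q‖ₑ ^ a) := by
        rw [lintegral_const_mul' _ _ (ENNReal.rpow_ne_top_of_nonneg (by linarith) (by simp)),
          lintegral_add_left mW]
    _ ≤ _ := by gcongr

lemma DensBd.step {x y : ℝ} (hx : DensBd N T γ' K K₀ x) (hγ' : 1 < γ') (hx0 : 0 ≤ x) (hx1 : x < 1)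
    (hK₀ : 0 ≤ K₀) (hT : 0 ≤ T) (hy1 : y < 1) (hxy : (1 - 1 / γ') * x ≤ y)
    (hxy' : y - (1 - 1 / γ') * x < 1 / (N + 2)) : DensBd N T γ' K K₀ y := by
  obtain ⟨c, hc, hle⟩ := hx.flux hγ' hx0 hx1 hK₀
  set s := 1 - 1 / γ' with hs
  have hγ0 : 0 < γ' := by linarith
  have hs1 : s < 1 := by rw [hs]; linarith [show 0 < 1 / γ' by positivity]
  have hs0 : 0 < s := by
    have : 1 / γ' < 1 := by rw [div_lt_one hγ0]; exact hγ'
    rw [hs]; linarith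
  have hsx0 : 0 ≤ s * x := by positivity
  have hsx : 0 < 1 - s * x := by nlinarith
  set a := 1 / (1 - s * x) with ha
  have ha1 : 1 ≤ a := by
    rw [ha, le_div_iff₀ hsx]; linarith
  set R := 1 / (1 - y) with hR
  have hR0 : 0 < R := by rw [hR]; exact one_div_pos.2 (by linarith)
  have hR1 : 1 ≤ R := by rw [hR, le_div_iff₀ (by linarith)]; linarith
  set σ := 1 / (1 - (y - s * x)) with hσ
  have hN2 : (0 : ℝ) < N + 2 := by positivity
  have hN1 : (0 : ℝ) < N + 1 := by positivity
  have hlt : 1 / ((N : ℝ) + 2) ≤ 1 / 2 := one_div_le_one_div_of_le (by norm_num) (by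
    linarith [(N.cast_nonneg : (0 : ℝ) ≤ N)])
  have hd : 0 < 1 - (y - s * x) := by linarith
  have hσ1 : 1 ≤ σ := by rw [hσ, le_div_iff₀ hd]; linarith
  have hσ2 : σ < ((N : ℝ) + 2) / (N + 1) := by
    rw [hσ, div_lt_div_iff₀ hd hN1]
    rw [lt_div_iff₀ hN2] at hxy'
    nlinarith
  choose cY hcY hY using fun i : Fin N => exists_young_gam1 N hT i hσ1 hσ2 ha1 hR0 (by
    rw [hR, ha, hσ, one_div_one_div, one_div_one_div, one_div_one_div]; ring)
  refine ⟨2 ^ (R - 1) * (ENNReal.ofReal (1 + N * K₀) ^ R * ENNReal.ofReal T +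
    (N : ENNReal) ^ (R - 1) * ∑ i, cY i * c ^ (R / a)), ?_, fun m₀ m A u e W h => ?_⟩
  · refine ENNReal.mul_ne_top (ENNReal.rpow_ne_top_of_nonneg (by linarith) (by simp))
      (ENNReal.add_ne_top.2 ⟨ENNReal.mul_ne_top (ENNReal.rpow_ne_top_of_nonneg hR0.le
        ENNReal.ofReal_ne_top) ENNReal.ofReal_ne_top, ENNReal.mul_ne_top
        (ENNReal.rpow_ne_top_of_nonneg (by linarith) (by simp)) ?_⟩)
    exact ENNReal.sum_ne_top.2 fun i _ => ENNReal.mul_ne_top (hcY i)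
      (ENNReal.rpow_ne_top_of_nonneg (by positivity) hc)
  have hr := h.rep
  have hF : ∀ i, TPc (FPflux T m₀ W i) T := fun i => hr.TPc_flux h.data i
  have h1 : ∫⁻ q in strip N, FPpot N T (FPflux T m₀ W) q ^ R ≤
      (N : ENNReal) ^ (R - 1) * ∑ i, cY i * c ^ (R / a) := by
    have mI : ∀ i, Measurable fun q => (∫⁻ v, ‖hk (-(((N : ℝ) + 1) / 2)) (gam1 i) 0 T v‖ₑ *
        ‖FPflux T m₀ W i (q - v)‖ₑ) ^ R := fun i => by
      obtain ⟨C, hC⟩ := exists_KD_gam1 i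
      have hk' : Measurable (hk (-(((N : ℝ) + 1) / 2)) (gam1 i) 0 T) :=
        measurable_hk _ hC.cd.continuous.measurable _ _
      refine Measurable.pow_const (Measurable.lintegral_prod_right' (f := fun p : XT N × XT N =>
        ‖hk (-(((N : ℝ) + 1) / 2)) (gam1 i) 0 T p.2‖ₑ * ‖FPflux T m₀ W i (p.1 - p.2)‖ₑ) ?_) _
      exact (hk'.comp measurable_snd).enorm.mul
        ((hF i).meas.comp (measurable_fst.sub measurable_snd)).enorm
    calc ∫⁻ q in strip N, FPpot N T (FPflux T m₀ W) q ^ R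
        ≤ ∫⁻ q in strip N, (N : ENNReal) ^ (R - 1) * ∑ i, (∫⁻ v,
            ‖hk (-(((N : ℝ) + 1) / 2)) (gam1 i) 0 T v‖ₑ * ‖FPflux T m₀ W i (q - v)‖ₑ) ^ R := by
          refine lintegral_mono fun q => ?_
          refine (ENNReal.rpow_sum_le_const_mul_sum_rpow _ _ hR1).trans_eq ?_
          simp
      _ = (N : ENNReal) ^ (R - 1) * ∑ i, ∫⁻ q in strip N, (∫⁻ v,
            ‖hk (-(((N : ℝ) + 1) / 2)) (gam1 i) 0 T v‖ₑ * ‖FPflux T m₀ W i (q - v)‖ₑ) ^ R := by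
          rw [lintegral_const_mul' _ _ (ENNReal.rpow_ne_top_of_nonneg (by linarith) (by simp)),
            lintegral_finsetSum _ fun i _ => mI i]
      _ ≤ _ := by
          gcongr with i
          refine (hY i (fun q => ‖FPflux T m₀ W i q‖ₑ) (hF i).meas.enorm fun q z => by
            simp only [(hF i).per q z]).trans ?_
          gcongr
          exact hle _ _ _ _ _ _ h i
  have mP : Measurable (FPpot N T (FPflux T m₀ W)) := measurable_FPpot fun i => (hF i).meas
  have hsub : ∀ᵐ q ∂volume.restrict (QQ N T), ‖u q‖ₑ ≤
      ENNReal.ofReal (1 + N * K₀) + FPpot N T (FPflux T m₀ W) q := by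
    refine ae_mono ?_ (hr.ae_le_pot h.data hK₀ hT)
    rw [restrict_QQ]
    exact Measure.restrict_mono_set _ inter_subset_left
  calc ∫⁻ q in strip N, ‖u q‖ₑ ^ R = ∫⁻ q in QQ N T, ‖u q‖ₑ ^ R :=
        setLIntegral_strip_eq_QQ fun q hq => by
          rw [hr.tu.supp q hq, enorm_zero, ENNReal.zero_rpow_of_pos hR0]
    _ ≤ ∫⁻ q in QQ N T, 2 ^ (R - 1) * (ENNReal.ofReal (1 + N * K₀) ^ R +
          FPpot N T (FPflux T m₀ W) q ^ R) := by
        refine lintegral_mono_ae ?_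
        filter_upwards [hsub] with q hq
        exact (ENNReal.rpow_le_rpow hq hR0.le).trans
          (ENNReal.rpow_add_le_mul_rpow_add_rpow _ _ hR1)
    _ = 2 ^ (R - 1) * (ENNReal.ofReal (1 + N * K₀) ^ R * ENNReal.ofReal T +
          ∫⁻ q in QQ N T, FPpot N T (FPflux T m₀ W) q ^ R) := by
        rw [lintegral_const_mul' _ _ (ENNReal.rpow_ne_top_of_nonneg (by linarith) (by simp)),
          lintegral_add_left measurable_const, setLIntegral_const, volume_QQ]
    _ ≤ _ := by
        gcongr
        refine le_trans ?_ h1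
        rw [restrict_QQ]
        exact lintegral_mono_set inter_subset_left

/-- The bootstrap: bounds in all subcritical Lebesgue spaces. -/
lemma DensBd.of_lt {y : ℝ} (hγ' : 1 < γ') (hK₀ : 0 ≤ K₀) (hT : 0 ≤ T) (hy0 : 0 ≤ y) (hy1 : y < 1)
    (hy : y < γ' / (N + 2)) : DensBd N T γ' K K₀ y := by
  set s := 1 - 1 / γ' with hs
  have hγ0 : 0 < γ' := by linarith
  have hs1 : s < 1 := by rw [hs]; linarith [show 0 < 1 / γ' by positivity]
  have hs0 : 0 < s := by
    have : 1 / γ' < 1 := by rw [div_lt_one hγ0]; exact hγ'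
    rw [hs]; linarith
  have hyg : y * (1 - s) < 1 / ((N : ℝ) + 2) := by
    rw [hs, sub_sub_cancel, mul_one_div, div_lt_div_iff₀ hγ0 (by positivity)]
    rw [lt_div_iff₀ (by positivity)] at hy
    linarith
  have hpow : ∀ n : ℕ, 0 ≤ y * (1 - s ^ n) ∧ y * (1 - s ^ n) < 1 := fun n => by
    have h1 : s ^ n ≤ 1 := pow_le_one₀ hs0.le hs1.le
    have h0 : 0 ≤ s ^ n := by positivity
    constructor <;> nlinarith
  have hn : ∀ n : ℕ, DensBd N T γ' K K₀ (y * (1 - s ^ n)) := fun n => by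
    induction n with
    | zero => simpa using DensBd.zero
    | succ n ih =>
      have e : y * (1 - s ^ (n + 1)) - s * (y * (1 - s ^ n)) = y * (1 - s) := by ring
      refine ih.step hγ' (hpow n).1 (hpow n).2 hK₀ hT (hpow _).2 ?_ ?_
      · have : 0 ≤ y * (1 - s) := mul_nonneg hy0 (by linarith)
        linarith
      · linarith
  have hlim : Tendsto (fun n : ℕ => y * (1 - s) + y * s * s ^ n) atTop (𝓝 (y * (1 - s))) := by
    simpa using ((tendsto_pow_atTop_nhds_zero_of_lt_one hs0.le hs1).const_mul (y * s)).const_add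
      (y * (1 - s))
  obtain ⟨n, hn'⟩ := (hlim.eventually_lt_const hyg).exists
  have e : y - s * (y * (1 - s ^ n)) = y * (1 - s) + y * s * s ^ n := by ring
  refine (hn n).step hγ' (hpow n).1 (hpow n).2 hK₀ hT hy1 ?_ (by linarith)
  have h1 : 0 ≤ y * (1 - s) := mul_nonneg hy0 (by linarith)
  have h2 : 0 ≤ y * s * s ^ n := by positivity
  linarith

end

section

variable {T r : ℝ}

lemma tendsto_integral_mul_of_tendsto_eLpNorm {α : Type*} [MeasurableSpace α] {μ : Measure α}
    [IsFiniteMeasure μ] {p : ENNReal} (hp : 1 ≤ p) {f : ℕ → α → ℝ} {F : α → ℝ}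
    (hf : ∀ n, MemLp (f n) p μ) (hF : MemLp F p μ)
    (hlim : Tendsto (fun n => eLpNorm (f n - F) p μ) atTop (𝓝 0)) {Φ : α → ℝ}
    (hΦ : AEStronglyMeasurable Φ μ) {B : ℝ} (hB : ∀ x, |Φ x| ≤ B) :
    Tendsto (fun n => ∫ x, f n x * Φ x ∂μ) atTop (𝓝 (∫ x, F x * Φ x ∂μ)) := by
  have hi : ∀ {g : α → ℝ}, MemLp g p μ → Integrable (fun x => g x * Φ x) μ := fun hg =>
    (memLp_one_iff_integrable.1 (hg.mono_exponent hp)).mul_bdd (c := B) hΦ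
      (Eventually.of_forall fun x => hB x)
  refine tendsto_integral_of_L1' _ (hi hF).1 (Eventually.of_forall fun n => hi (hf n)) ?_
  set c : ENNReal := ENNReal.ofReal B *
    μ univ ^ (1 / (1 : ENNReal).toReal - 1 / p.toReal) with hc
  have hct : c ≠ ⊤ := by
    refine ENNReal.mul_ne_top ENNReal.ofReal_ne_top (ENNReal.rpow_ne_top_of_nonneg ?_
      (measure_ne_top _ _))
    rcases eq_or_ne p ⊤ with rfl | hpt
    · simp
    · have : 1 ≤ p.toReal := by
        rw [← ENNReal.toReal_one]; exact ENNReal.toReal_mono hpt hp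
      simp only [ENNReal.toReal_one, div_one, sub_nonneg]
      rw [div_le_one (by linarith)]; exact this
  have h0 : Tendsto (fun n => c * eLpNorm (f n - F) p μ) atTop (𝓝 0) := by
    simpa using ENNReal.Tendsto.const_mul hlim (Or.inr hct)
  refine tendsto_of_tendsto_of_tendsto_of_le_of_le tendsto_const_nhds h0 (fun _ => bot_le)
    fun n => ?_
  refine (eLpNorm_le_mul_eLpNorm_of_ae_le_mul (g := f n - F) (c := B)
    (Eventually.of_forall fun x => ?_) 1).trans ?_
  · simp only [Pi.sub_apply, Real.norm_eq_abs, ← sub_mul, abs_mul]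
    rw [mul_comm]
    exact mul_le_mul_of_nonneg_right (hB x) (abs_nonneg _)
  · refine (mul_le_mul_right (eLpNorm_le_eLpNorm_mul_rpow_measure_univ hp
      ((hf n).1.sub hF.1)) _).trans_eq ?_
    rw [hc]; ring

lemma TPc.exists_SPc_close {F : XT N → ℝ} (hF : TPc F T) (hr : 1 < r)
    (hFm : MemLp F (ENNReal.ofReal r) (volume.restrict (strip N))) {ε : ℝ} (hε : 0 < ε) :
    ∃ f : XT N → ℝ, SPc f (T + 1) ∧
      eLpNorm (f - F) (ENNReal.ofReal r) (volume.restrict (strip N)) ≤ ENNReal.ofReal ε := by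
  obtain ⟨M, hM0, hM⟩ := hFm.eLpNorm_indicator_norm_ge_pos_le hF.meas.stronglyMeasurable
    (half_pos hε)
  set S : Set (XT N) := {x | M ≤ ‖F x‖₊} with hS
  have mS : MeasurableSet S := measurableSet_le measurable_const hF.meas.nnnorm.coe_nnreal_real
  have hmem : ∀ x, x ∈ S ↔ M ≤ |F x| := fun x => by simp [hS]
  have hG : BPc (Sᶜ.indicator F) M T := by
    refine ⟨hF.meas.indicator mS.compl, fun q z => ?_, fun q => ?_, fun q hq => ?_⟩
    · simp only [indicator, mem_compl_iff, hmem, hF.per q z]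
    · by_cases h : q ∈ S
      · rw [indicator_of_notMem (by simpa using h), abs_zero]; exact hM0.le
      · rw [indicator_of_mem (by exact h)]
        rw [hmem] at h; linarith
    · have : F q = 0 := hF.supp q fun h => by
        rw [abs_of_pos h.1] at hq; exact absurd h.2 (by linarith)
      simp [indicator, this]
  obtain ⟨fn, hfn, hfM, -, hlim⟩ := hG.exists_approx one_pos
  have hr0 : 0 < r := by linarith
  have hp0 : ENNReal.ofReal r ≠ 0 := by simpa using hr0
  have hlim0 : Tendsto (fun n => ∫⁻ q in strip N, ‖fn n q - Sᶜ.indicator F q‖ₑ ^ r) atTop (𝓝 0) := by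
    have e : ∀ n, ∫⁻ q in strip N, ‖fn n q - Sᶜ.indicator F q‖ₑ ^ r =
        ∫⁻ q in slab N (T + 1), ‖fn n q - Sᶜ.indicator F q‖ₑ ^ r := fun n =>
      setLIntegral_strip_eq_slab fun q hq => by
        rw [(hfn n).supp q hq, hG.supp q (by linarith), sub_zero, enorm_zero,
          ENNReal.zero_rpow_of_pos hr0]
    simp only [e]
    have := tendsto_lintegral_of_dominated_convergence
      (μ := (volume : Measure (XT N)).restrict (slab N (T + 1)))
      (F := fun n q => ‖fn n q - Sᶜ.indicator F q‖ₑ ^ r)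
      (f := fun _ => 0) (fun _ => ENNReal.ofReal (M + M) ^ r)
      (fun n => ((hfn n).smooth.continuous.measurable.sub hG.meas).enorm.pow_const _)
      (fun n => Eventually.of_forall fun q => by
        refine ENNReal.rpow_le_rpow ?_ hr0.le
        rw [Real.enorm_eq_ofReal_abs]
        exact ENNReal.ofReal_le_ofReal ((abs_sub _ _).trans (add_le_add (hfM n q) (hG.bdd q))))
      (by
        rw [lintegral_const]
        exact ENNReal.mul_ne_top (ENNReal.rpow_ne_top_of_nonneg hr0.le ENNReal.ofReal_ne_top)
          (measure_ne_top _ _))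
      (ae_restrict_of_ae (hlim.mono fun q hq => by
        have h1 := (hq.sub_const (Sᶜ.indicator F q)).enorm
        rw [sub_self, enorm_zero] at h1
        simpa [ENNReal.zero_rpow_of_pos hr0] using h1.ennrpow_const r))
    simpa using this
  have hlim1 : Tendsto (fun n => eLpNorm (fn n - Sᶜ.indicator F) (ENNReal.ofReal r)
      (volume.restrict (strip N))) atTop (𝓝 0) := by
    have h1 := hlim0.ennrpow_const (1 / r)
    rw [ENNReal.zero_rpow_of_pos (by positivity)] at h1
    refine h1.congr fun n => ?_
    rw [eLpNorm_eq_lintegral_rpow_enorm_toReal hp0 ENNReal.ofReal_ne_top, ENNReal.toReal_ofReal hr0.le]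
    rfl
  obtain ⟨n, hn⟩ := (hlim1.eventually_lt_const
    (show 0 < ENNReal.ofReal (ε / 2) by simpa using hε)).exists
  refine ⟨fn n, hfn n, ?_⟩
  have e : fn n - F = (fn n - Sᶜ.indicator F) - S.indicator F := by
    rw [sub_sub, indicator_compl_add_self S F]
  rw [e]
  refine (eLpNorm_sub_le ((hfn n).smooth.continuous.measurable.sub hG.meas).aestronglyMeasurable
    (hF.meas.indicator mS).aestronglyMeasurable (by
      rw [ENNReal.one_le_ofReal]; exact hr.le)).trans ((add_le_add hn.le hM).trans_eq ?_)
  rw [← ENNReal.ofReal_add (by positivity) (by positivity), add_halves]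

end

lemma heat_d2_sub {f g : XT N → ℝ} {R b : ℝ} (hf : SPc f R) (hg : SPc g R) (i j : Fin N)
    (q : XT N) : heat 0 b (d2 i j fun x => f x - g x) q =
      heat 0 b (d2 i j f) q - heat 0 b (d2 i j g) q := by
  have e1 : (fun y => fderiv ℝ (fun x => f x - g x) y (ei j)) = fun y =>
      fderiv ℝ f y (ei j) - fderiv ℝ g y (ei j) := funext fun y => by
    rw [fderiv_fun_sub (hf.smooth.differentiable (by simp) y)
      (hg.smooth.differentiable (by simp) y)]
    rfl
  have e2 : (d2 i j fun x => f x - g x) = fun x => d2 i j f x - d2 i j g x := funext fun x => by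
    unfold d2
    rw [e1, fderiv_fun_sub ((hf.dir (ei j)).smooth.differentiable (by simp) x)
      ((hg.dir (ei j)).smooth.differentiable (by simp) x)]
    rfl
  rw [e2]
  unfold heat Av
  exact integral_sub ((hf.spc_d2 i j).integrable_translate measurable_dh q)
    ((hg.spc_d2 i j).integrable_translate measurable_dh q)

section

variable {T r : ℝ}

lemma setIntegral_strip_eq_slab {R : ℝ} {g : XT N → ℝ} (h : ∀ q : XT N, R < |q.2| → g q = 0) :
    ∫ q in strip N, g q = ∫ q in slab N R, g q :=
  setIntegral_eq_of_subset_of_forall_sdiff_eq_zero measurableSet_strip inter_subset_left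
    fun q hq => h q (not_le.1 fun h' => hq.2 ⟨hq.1, h'⟩)

lemma eLpNorm_ofReal_eq {α : Type*} [MeasurableSpace α] {μ : Measure α} (hr : 0 < r) (f : α → ℝ) :
    eLpNorm f (ENNReal.ofReal r) μ = (∫⁻ q, ‖f q‖ₑ ^ r ∂μ) ^ (1 / r) := by
  rw [eLpNorm_eq_lintegral_rpow_enorm_toReal (by simpa using hr) ENNReal.ofReal_ne_top,
    ENNReal.toReal_ofReal hr.le]

lemma SPc.memLp_slab {f : XT N → ℝ} {R R' : ℝ} (hf : SPc f R) (p : ENNReal) :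
    MemLp f p (volume.restrict (slab N R')) := by
  obtain ⟨C, -, hC⟩ := hf.exists_bound
  exact MemLp.of_bound hf.smooth.continuous.aestronglyMeasurable C (Eventually.of_forall hC)

lemma exists_heat_d2_extension (N : ℕ) (hT : 0 < T) (hr : 1 < r) (i j : Fin N) :
    ∃ C : ENNReal, C ≠ ⊤ ∧ ∀ F : XT N → ℝ, TPc F T →
      MemLp F (ENNReal.ofReal r) (volume.restrict (strip N)) → ∃ g : XT N → ℝ,
        MemLp g (ENNReal.ofReal r) (volume.restrict (slab N T)) ∧
        eLpNorm g (ENNReal.ofReal r) (volume.restrict (slab N T)) ≤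
          C * eLpNorm F (ENNReal.ofReal r) (volume.restrict (strip N)) ∧
        ∀ Φ : XT N → ℝ, SPc Φ T →
          ∫ q in strip N, F q * heat 0 T (d2 i j fun x => Φ (-x)) (-q) =
            ∫ q in slab N T, g q * Φ q := by
  have hr0 : 0 < r := by linarith
  set p := ENNReal.ofReal r with hp
  have hp1 : 1 ≤ p := by rw [hp, ENNReal.one_le_ofReal]; exact hr.le
  obtain ⟨C₀, hC₀, h₀⟩ := exists_lintegral_heat_d2_le N hT hr (T + 1) T i j
  set C := C₀ ^ (1 / r) with hCdef
  have hC : C ≠ ⊤ := ENNReal.rpow_ne_top_of_nonneg (by positivity) hC₀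
  have hS : ∀ f : XT N → ℝ, SPc f (T + 1) →
      eLpNorm (heat 0 T (d2 i j f)) p (volume.restrict (slab N T)) ≤
        C * eLpNorm f p (volume.restrict (strip N)) := fun f hf => by
    rw [hp, eLpNorm_ofReal_eq hr0, eLpNorm_ofReal_eq hr0, hCdef,
      ← ENNReal.mul_rpow_of_nonneg _ _ (by positivity)]
    exact ENNReal.rpow_le_rpow (h₀ f hf) (by positivity)
  refine ⟨C, hC, fun F hF hFm => ?_⟩
  have hex : ∀ n : ℕ, ∃ f : XT N → ℝ, SPc f (T + 1) ∧
      eLpNorm (f - F) p (volume.restrict (strip N)) ≤ (2⁻¹ : ENNReal) ^ n := fun n => by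
    obtain ⟨f, h1, h2⟩ := hF.exists_SPc_close hr hFm (ε := (2⁻¹ : ℝ) ^ n) (by positivity)
    refine ⟨f, h1, h2.trans_eq ?_⟩
    rw [ENNReal.ofReal_pow (by norm_num), ENNReal.ofReal_inv_of_pos (by norm_num)]
    norm_num
  choose f hf hfF using hex
  have hSf : ∀ n, SPc (heat 0 T (d2 i j (f n))) (T + 1 + T) := fun n =>
    SPc.spc_heat le_rfl ((hf n).spc_d2 i j)
  have hfm : ∀ n, AEStronglyMeasurable (f n - F) (volume.restrict (strip N)) := fun n =>
    ((hf n).smooth.continuous.measurable.sub hF.meas).aestronglyMeasurable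
  have hx1 : ∀ n, (2⁻¹ : ENNReal) ^ n ≠ ⊤ := fun n => ENNReal.pow_ne_top (by simp)
  have hx0 : ∀ n, (2⁻¹ : ENNReal) ^ n ≠ 0 := fun n => pow_ne_zero _ (by simp)
  obtain ⟨g, hg, hlim⟩ := Lp.cauchy_complete_eLpNorm (p := p) (μ := volume.restrict (slab N T)) hp1
    (f := fun n => heat 0 T (d2 i j (f n))) (fun n => (hSf n).memLp_slab p)
    (B := fun n => (C * 2 + 1) * 2⁻¹ ^ n) (by
      rw [ENNReal.tsum_mul_left, ENNReal.tsum_geometric]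
      refine ENNReal.mul_ne_top (by finiteness) ?_
      norm_num) (fun k n m hn hm => by
      have e : heat 0 T (d2 i j (f n)) - heat 0 T (d2 i j (f m)) =
          heat 0 T (d2 i j fun x => f n x - f m x) := funext fun q => by
        rw [heat_d2_sub (hf n) (hf m)]; rfl
      rw [e]
      refine (hS _ ((hf n).sub (hf m))).trans_lt ?_
      have e2 : (fun x => f n x - f m x) = (f n - F) - (f m - F) := by
        ext x; simp
      have h1 : eLpNorm (fun x => f n x - f m x) p (volume.restrict (strip N)) ≤
          2 * 2⁻¹ ^ k := by
        rw [e2, two_mul]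
        refine (eLpNorm_sub_le (hfm n) (hfm m) hp1).trans (add_le_add ?_ ?_)
        · exact (hfF n).trans (pow_le_pow_of_le_one zero_le (by simp) hn)
        · exact (hfF m).trans (pow_le_pow_of_le_one zero_le (by simp) hm)
      calc _ ≤ C * (2 * 2⁻¹ ^ k) := by gcongr
        _ = C * 2 * 2⁻¹ ^ k := by ring
        _ < C * 2 * 2⁻¹ ^ k + 2⁻¹ ^ k :=
          ENNReal.lt_add_right (ENNReal.mul_ne_top (by finiteness) (hx1 k)) (hx0 k)
        _ = _ := by ring)
  refine ⟨g, hg, ?_, fun Φ hΦ => ?_⟩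
  · have h1 : ∀ n, eLpNorm g p (volume.restrict (slab N T)) ≤
        C * (eLpNorm F p (volume.restrict (strip N)) + 2⁻¹ ^ n) +
          eLpNorm (heat 0 T (d2 i j (f n)) - g) p (volume.restrict (slab N T)) := fun n => by
      have e : g = heat 0 T (d2 i j (f n)) - (heat 0 T (d2 i j (f n)) - g) := by simp
      have e' : f n = F + (f n - F) := by simp
      conv_lhs => rw [e]
      refine (eLpNorm_sub_le ((hSf n).memLp_slab p).1 (((hSf n).memLp_slab p).1.sub hg.1)
        hp1).trans (add_le_add_left ((hS _ (hf n)).trans ?_) _)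
      gcongr
      conv_lhs => rw [e']
      exact (eLpNorm_add_le hFm.1 (hfm n) hp1).trans (add_le_add_right (hfF n) _)
    refine ge_of_tendsto' (x := atTop) ?_ h1
    have h2 : Tendsto (fun n : ℕ => (2⁻¹ : ENNReal) ^ n) atTop (𝓝 0) :=
      ENNReal.tendsto_pow_atTop_nhds_zero_of_lt_one (by simp)
    have h3 := (ENNReal.Tendsto.const_mul (a := C) (h2.const_add
      (eLpNorm F p (volume.restrict (strip N)))) (Or.inr hC)).add hlim
    simpa using h3
  · set k : XT N → ℝ := fun q => heat 0 T (d2 i j fun x => Φ (-x)) (-q) with hk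
    have hkS : SPc k (T + T) := (SPc.spc_heat le_rfl (hΦ.comp_neg.spc_d2 i j)).comp_neg
    obtain ⟨B, -, hB⟩ := hkS.exists_bound
    obtain ⟨B', -, hB'⟩ := hΦ.exists_bound
    have hlimF : Tendsto (fun n => eLpNorm (f n - F) p (volume.restrict (slab N (T + 1)))) atTop
        (𝓝 0) := by
      refine tendsto_of_tendsto_of_tendsto_of_le_of_le tendsto_const_nhds
        (ENNReal.tendsto_pow_atTop_nhds_zero_of_lt_one (r := 2⁻¹) (by simp)) (fun _ => bot_le)
        fun n => ?_
      exact (eLpNorm_mono_measure _ (Measure.restrict_mono inter_subset_left le_rfl)).trans (hfF n)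
    have t1 := tendsto_integral_mul_of_tendsto_eLpNorm hp1
      (fun n => (hf n).memLp_slab (R' := T + 1) p)
      (hFm.mono_measure (Measure.restrict_mono inter_subset_left le_rfl)) hlimF
      hkS.smooth.continuous.aestronglyMeasurable hB
    have t2 := tendsto_integral_mul_of_tendsto_eLpNorm hp1
      (fun n => (hSf n).memLp_slab p) hg hlim hΦ.smooth.continuous.aestronglyMeasurable hB'
    have e : ∀ n, ∫ q in slab N (T + 1), f n q * k q =
        ∫ q in slab N T, heat 0 T (d2 i j (f n)) q * Φ q := fun n => by
      rw [← setIntegral_strip_eq_slab fun q hq => by rw [(hf n).supp q hq, zero_mul],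
        ← setIntegral_strip_eq_slab fun q hq => by rw [hΦ.supp q hq, mul_zero],
        (hf n).integral_heat_d2_mul hΦ hT]
    simp only [e] at t1
    rw [setIntegral_strip_eq_slab (R := T + 1) fun q hq => by
      rw [hF.supp q fun h => by rw [abs_of_pos h.1] at hq; linarith [h.2], zero_mul]]
    exact tendsto_nhds_unique t1 t2

end

section

variable {T r γ' K₀ : ℝ} {m₀ : RN N → ℝ} {m : RN N → ℝ → ℝ} {A : RN N → ℝ → RN N}
  {u e : XT N → ℝ} {W : Fin N → XT N → ℝ}

lemma fderiv_ei_eq_zero {Φ : XT N → ℝ} (hd : Differentiable ℝ Φ) {q : XT N}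
    (h : ∀ x, Φ (x, q.2) = 0) (j : Fin N) : fderiv ℝ Φ q (ei j) = 0 := by
  rw [← (hd q).lineDeriv_eq_fderiv, lineDeriv]
  have : (fun t : ℝ => Φ (q + t • ei j)) = fun _ => 0 := funext fun t => by
    have e : q + t • ei j = (q.1 + t • (ei j : XT N).1, q.2) := by
      ext <;> simp [ei]
    rw [e, h]
  rw [this, deriv_const]

lemma FPRep.exists_grad (N : ℕ) (hT : 0 < T) (hr : 1 < r) (hK₀ : 0 ≤ K₀) (γ' : ℝ)
    {c : ENNReal} (hc : c ≠ ⊤) :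
    ∃ C : ENNReal, C ≠ ⊤ ∧ ∀ (m₀ : RN N → ℝ) m A u e W, FPData N K₀ m₀ →
      FPRep N T γ' m₀ m A u e W → (∀ i, eLpNorm (FPflux T m₀ W i) (ENNReal.ofReal r)
        (volume.restrict (strip N)) ≤ c) → ∃ G : Fin N → XT N → ℝ,
      (∀ j, MemLp (G j) (ENNReal.ofReal r) (volume.restrict (QQ N T))) ∧
      (∀ j, eLpNorm (G j) (ENNReal.ofReal r) (volume.restrict (QQ N T)) ≤ C) ∧
      ∀ j Φ, SPc Φ T → (∀ q : XT N, q.2 ∉ Ioo 0 T → Φ q = 0) →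
        ∫ q in QQ N T, u q * fderiv ℝ Φ q (ei j) = -∫ q in QQ N T, G j q * Φ q := by
  set p := ENNReal.ofReal r with hp
  have hp1 : 1 ≤ p := by rw [hp, ENNReal.one_le_ofReal]; exact hr.le
  choose D hD hex using fun i j => exists_heat_d2_extension N hT hr i j
  set μ : Measure (XT N) := volume.restrict (slab N T) with hμ
  have hle : (volume.restrict (QQ N T) : Measure (XT N)) ≤ μ := by
    rw [restrict_QQ]
    refine Measure.restrict_mono (fun q hq => ?_) le_rfl
    have h2 : q.2 ∈ Ioo 0 T := hq.2
    have h3 : |q.2| ≤ T := by rw [abs_of_pos h2.1]; exact h2.2.le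
    exact ⟨hq.1, h3⟩
  have hslab : ∀ g : XT N → ℝ, (∀ q : XT N, q.2 ∉ Ioo 0 T → g q = 0) →
      ∫ q in slab N T, g q = ∫ q in QQ N T, g q := fun g hg => by
    rw [← setIntegral_strip_eq_QQ hg, setIntegral_strip_eq_slab (R := T) fun q hq => hg q fun h => by
      rw [abs_of_pos h.1] at hq; linarith [h.2]]
  refine ⟨μ univ ^ p.toReal⁻¹ * ENNReal.ofReal K₀ + ∑ j, ∑ i, D i j * c, ?_,
    fun m₀ m A u e W hd h hF => ?_⟩
  · refine ENNReal.add_ne_top.2 ⟨ENNReal.mul_ne_top (ENNReal.rpow_ne_top_of_nonneg (by positivity)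
      (measure_ne_top _ _)) ENNReal.ofReal_ne_top, ENNReal.sum_ne_top.2 fun j _ =>
      ENNReal.sum_ne_top.2 fun i _ => ENNReal.mul_ne_top (hD i j) hc⟩
  have hFm : ∀ i, MemLp (FPflux T m₀ W i) p (volume.restrict (strip N)) := fun i =>
    ⟨(h.TPc_flux hd i).meas.aestronglyMeasurable, (hF i).trans_lt hc.lt_top⟩
  choose g hg hgC hgI using fun i j => hex i j _ (h.TPc_flux hd i) (hFm i)
  have hcutm : ∀ j, MemLp (cut T (pd j m₀)) p μ := fun j =>
    MemLp.of_bound (hd.TPc_cut_pd j).meas.aestronglyMeasurable K₀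
      (Eventually.of_forall fun q => hd.abs_cut_pd_le hK₀ j q)
  have hsum : ∀ j, MemLp (∑ i, g i j) p μ := fun j => memLp_finsetSum' _ fun i _ => hg i j
  have hGm : ∀ j, MemLp (cut T (pd j m₀) - ∑ i, g i j) p μ := fun j => (hcutm j).sub (hsum j)
  refine ⟨fun j => cut T (pd j m₀) - ∑ i, g i j, fun j => (hGm j).mono_measure hle, fun j => ?_,
    fun j Φ hΦ h0 => ?_⟩
  · refine (eLpNorm_mono_measure _ hle).trans ((eLpNorm_sub_le (hcutm j).1 (hsum j).1 hp1).trans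
      (add_le_add ?_ ?_))
    · exact eLpNorm_le_of_ae_bound (Eventually.of_forall fun q => hd.abs_cut_pd_le hK₀ j q)
    · refine (eLpNorm_sum_le (fun i _ => (hg i j).1) hp1).trans ?_
      refine (Finset.sum_le_sum fun i _ => (hgC i j).trans (mul_le_mul_right (hF i) _)).trans ?_
      exact Finset.single_le_sum (f := fun j => ∑ i, D i j * c) (fun _ _ => zero_le)
        (Finset.mem_univ j)
  · have hdir := hΦ.dir (ei j)
    have h0' : ∀ q : XT N, q.2 ∉ Ioo 0 T → fderiv ℝ Φ q (ei j) = 0 := fun q hq =>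
      fderiv_ei_eq_zero (hΦ.smooth.differentiable (by simp)) (fun x => h0 _ hq) j
    have e1 := h.weak_bsol hd hK₀ hT.le hdir fun q hq => h0' q fun h' => not_lt.2 hq h'.2
    have ic := hd.TPc_cut.integrableOn (T := T) (hd.abs_cut_le hK₀)
    simp only [sub_mul] at e1
    rw [integral_sub (IntegrableOn.mul_SPc h.int_u hdir) (IntegrableOn.mul_SPc ic hdir),
      hd.integral_cut_mul_dir hK₀ hΦ] at e1
    simp only [hΦ.bsol_dir_dir, hgI _ j Φ hΦ] at e1
    have hi : ∀ {f : XT N → ℝ}, MemLp f p μ → Integrable (fun q => f q * Φ q) μ := fun {f} hf => by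
      obtain ⟨B, -, hB⟩ := hΦ.exists_bound
      exact (memLp_one_iff_integrable.1 (hf.mono_exponent hp1)).mul_bdd (c := B)
        hΦ.smooth.continuous.aestronglyMeasurable (Eventually.of_forall hB)
    rw [← setIntegral_strip_eq_QQ fun q hq => by rw [h0' q hq, mul_zero],
      ← hslab _ fun q hq => by rw [h0 q hq, mul_zero]]
    have e2 : ∫ q in slab N T, (cut T (pd j m₀) - ∑ i, g i j) q * Φ q =
        (∫ q in slab N T, cut T (pd j m₀) q * Φ q) - ∑ i, ∫ q in slab N T, g i j q * Φ q := by
      rw [← integral_finsetSum _ fun i _ => hi (hg i j),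
        ← integral_sub (hi (hcutm j)) (integrable_finsetSum _ fun i _ => hi (hg i j))]
      refine integral_congr_ae (Eventually.of_forall fun q => ?_)
      simp only [Pi.sub_apply, Finset.sum_apply, sub_mul, Finset.sum_mul]
    rw [e2, ← setIntegral_strip_eq_slab (R := T) fun q hq => by
      rw [(hd.TPc_cut_pd j).supp q fun h => by rw [abs_of_pos h.1] at hq; linarith [h.2], zero_mul]]
    linarith

lemma exists_abs_le_QQ {Φ : XT N → ℝ} (hΦ : Continuous Φ) (T : ℝ) :
    ∃ B, ∀ q ∈ (QQ N T : Set (XT N)), |Φ q| ≤ B := by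
  have hK : IsCompact (cube N ×ˢ Icc 0 T : Set (XT N)) := isCompact_Icc.prod isCompact_Icc
  obtain ⟨B, hB⟩ := hK.exists_bound_of_continuousOn hΦ.continuousOn
  exact ⟨B, fun q hq => hB q ⟨hq.1, Ioo_subset_Icc_self hq.2⟩⟩

/-- A smooth cutoff in time converging to one on `(0,T)`. -/
def timeCut (T : ℝ) (n : ℕ) (t : ℝ) : ℝ :=
  Real.smoothTransition (n * t - 1) * Real.smoothTransition (n * (T - t) - 1)

lemma contDiff_timeCut (n : ℕ) : ContDiff ℝ (⊤ : ℕ∞) (timeCut T n) :=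
  (Real.smoothTransition.contDiff.comp (by fun_prop)).mul
    (Real.smoothTransition.contDiff.comp (by fun_prop))

lemma abs_timeCut_le (n : ℕ) (t : ℝ) : |timeCut T n t| ≤ 1 := by
  unfold timeCut
  rw [abs_of_nonneg (mul_nonneg (Real.smoothTransition.nonneg _) (Real.smoothTransition.nonneg _))]
  exact mul_le_one₀ (Real.smoothTransition.le_one _) (Real.smoothTransition.nonneg _)
    (Real.smoothTransition.le_one _)

lemma timeCut_eq_zero {n : ℕ} {t : ℝ} (ht : t ∉ Ioo 0 T) : timeCut T n t = 0 := by
  unfold timeCut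
  rcases le_or_gt t 0 with h | h
  · rw [Real.smoothTransition.zero_of_nonpos, zero_mul]
    have : (n : ℝ) * t ≤ 0 := mul_nonpos_of_nonneg_of_nonpos (by positivity) h
    linarith
  · have hT : T ≤ t := not_lt.1 fun h' => ht ⟨h, h'⟩
    rw [Real.smoothTransition.zero_of_nonpos (x := n * (T - t) - 1), mul_zero]
    have : (n : ℝ) * (T - t) ≤ 0 := mul_nonpos_of_nonneg_of_nonpos (by positivity) (by linarith)
    linarith

lemma tendsto_timeCut {t : ℝ} (ht : t ∈ Ioo 0 T) :
    Tendsto (fun n => timeCut T n t) atTop (𝓝 1) := by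
  have h : ∀ {s : ℝ}, 0 < s → ∀ᶠ n : ℕ in atTop, Real.smoothTransition (n * s - 1) = 1 :=
    fun {s} hs => by
      have := (tendsto_natCast_atTop_atTop (R := ℝ)).atTop_mul_const hs
      filter_upwards [this.eventually_ge_atTop 2] with n hn
      exact Real.smoothTransition.one_of_one_le (by linarith)
  refine tendsto_const_nhds.congr' ?_
  filter_upwards [h ht.1, h (sub_pos.2 ht.2)] with n h1 h2
  rw [timeCut, h1, h2, mul_one]

lemma integral_mul_dir_of_SPc {u g : XT N → ℝ} {j : Fin N}
    (hu : IntegrableOn u (QQ N T)) (hg : IntegrableOn g (QQ N T))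
    (h : ∀ Φ, SPc Φ T → (∀ q : XT N, q.2 ∉ Ioo 0 T → Φ q = 0) →
      ∫ q in QQ N T, u q * fderiv ℝ Φ q (ei j) = -∫ q in QQ N T, g q * Φ q)
    {Φ : XT N → ℝ} (hΦ : ContDiff ℝ (⊤ : ℕ∞) Φ) (hp : PerQ Φ) :
    ∫ q in QQ N T, u q * fderiv ℝ Φ q (ei j) = -∫ q in QQ N T, g q * Φ q := by
  have hd : Differentiable ℝ Φ := hΦ.differentiable (by simp)
  have hcd : Continuous fun q => fderiv ℝ Φ q (ei j) := (differentiable_fderiv_apply hΦ _).continuous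
  set χ : ℕ → XT N → ℝ := fun n q => timeCut T n q.2 with hχ
  have cχ : ∀ n, ContDiff ℝ (⊤ : ℕ∞) (χ n) := fun n => (contDiff_timeCut n).comp contDiff_snd
  have hdχ : ∀ n q, fderiv ℝ (fun q => χ n q * Φ q) q (ei j) = χ n q * fderiv ℝ Φ q (ei j) :=
    fun n q => by
      have hχd := (cχ n).differentiable (by simp) q
      rw [fderiv_fun_mul hχd (hd q)]
      have : fderiv ℝ (χ n) q (ei j) = 0 := by
        rw [← hχd.lineDeriv_eq_fderiv, lineDeriv]
        simp [hχ, ei]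
      simp [this]
  have key : ∀ {f k : XT N → ℝ}, IntegrableOn f (QQ N T) → Continuous k →
      Tendsto (fun n => ∫ q in QQ N T, f q * (χ n q * k q)) atTop (𝓝 (∫ q in QQ N T, f q * k q)) :=
    fun {f k} hf hk => by
      obtain ⟨B, hB⟩ := exists_abs_le_QQ hk T
      have hmem : ∀ᵐ q ∂volume.restrict (QQ N T : Set (XT N)), q ∈ QQ N T :=
        ae_restrict_mem measurableSet_QQ
      refine tendsto_integral_of_dominated_convergence (fun q => ‖f q‖ * B)
        (fun n => hf.1.mul ((cχ n).continuous.mul hk).aestronglyMeasurable) (hf.norm.mul_const B)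
        (fun n => ?_) ?_
      · filter_upwards [hmem] with q hq
        rw [norm_mul]
        refine mul_le_mul_of_nonneg_left ?_ (norm_nonneg _)
        rw [norm_mul]
        exact (mul_le_of_le_one_left (norm_nonneg _) (abs_timeCut_le n q.2)).trans (hB q hq)
      · filter_upwards [hmem] with q hq
        simpa using ((tendsto_timeCut hq.2).mul_const (k q)).const_mul (f q)
  refine tendsto_nhds_unique (key hu hcd) (((key hg hΦ.continuous).neg).congr fun n => ?_)
  rw [← h (fun q => χ n q * Φ q) ⟨(cχ n).mul hΦ, fun q z => ?_, fun q hq => ?_⟩ fun q hq => ?_]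
  · simp only [hdχ]
  · simp only [hχ, hp q z, Prod.snd_add, latHom_snd, add_zero]
  · have : q.2 ∉ Ioo 0 T := fun h => by rw [abs_of_pos h.1] at hq; linarith [h.2]
    simp only [hχ, timeCut_eq_zero this, zero_mul]
  · simp only [hχ, timeCut_eq_zero hq, zero_mul]

end

section

variable {T r γ' K K₀ : ℝ}

lemma integrable_rpow_of_eLpNorm_le {α : Type*} [MeasurableSpace α] {μ : Measure α} {f : α → ℝ}
    (hr : 0 < r) (hf : AEStronglyMeasurable f μ) (h0 : ∀ x, 0 ≤ f x) {C : ENNReal} (hC : C ≠ ⊤)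
    (h : eLpNorm f (ENNReal.ofReal r) μ ≤ C) :
    Integrable (fun x => f x ^ r) μ ∧ (∫ x, f x ^ r ∂μ) ^ (1 / r) ≤ C.toReal := by
  have hm : MemLp f (ENNReal.ofReal r) μ := ⟨hf, h.trans_lt hC.lt_top⟩
  have hp0 : ENNReal.ofReal r ≠ 0 := by simpa using hr
  have h1 := hm.integrable_norm_rpow hp0 ENNReal.ofReal_ne_top
  rw [hm.eLpNorm_eq_integral_rpow_norm hp0 ENNReal.ofReal_ne_top,
    ENNReal.ofReal_le_iff_le_toReal hC] at h
  simp only [ENNReal.toReal_ofReal hr.le, Real.norm_of_nonneg (h0 _)] at h h1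
  exact ⟨h1, by rwa [one_div]⟩

lemma FPSol.exists_FPAll {m₀ : RN N → ℝ} {m : RN N → ℝ → ℝ} {A : RN N → ℝ → RN N}
    (h : FPSol N T γ' m₀ m A) (hd : FPData N K₀ m₀) (hT : 0 < T) (hγ' : 1 < γ')
    (hE : intQ N T (fun x t => euclNorm (A x t) ^ γ' * m x t) ≤ K) :
    ∃ u e W, FPAll N T γ' K K₀ m₀ m A u e W := by
  obtain ⟨u, e, W, hR⟩ := h.exists_FPRep hT hγ' hd.2.2.1 hd.2.2.2.1.continuous
  refine ⟨u, e, W, hd, hR, ?_⟩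
  rw [setIntegral_strip_eq_QQ hR.te.supp, integral_congr_ae hR.e_eq]
  exact hE

/-- The hypotheses on the solution used in the a priori estimates. -/
def FPBdd (N : ℕ) (T γ' K K₀ : ℝ) (m₀ : RN N → ℝ) (m : RN N → ℝ → ℝ) (A : RN N → ℝ → RN N) : Prop :=
  FPData N K₀ m₀ ∧ FPSol N T γ' m₀ m A ∧ intQ N T (fun x t => euclNorm (A x t) ^ γ' * m x t) ≤ K

lemma exists_density_bound (N : ℕ) {p : ℝ} (hT : 0 < T) (hγ' : 1 < γ') (hK₀ : 0 ≤ K₀) (K : ℝ)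
    (hp : 1 ≤ p) (hpγ : 1 - 1 / p < γ' / (N + 2)) :
    ∃ C : ℝ, ∀ m₀ m A, FPBdd N T γ' K K₀ m₀ m A →
      IntegrableOn (fun q : RN N × ℝ => m q.1 q.2 ^ p) (QQ N T) ∧
      (intQ N T (fun x t => m x t ^ p)) ^ (1 / p) ≤ C := by
  have hp0 : 0 < p := by linarith
  have hy0 : 0 ≤ 1 - 1 / p := by
    rw [sub_nonneg, div_le_one hp0]; exact hp
  obtain ⟨c, hc, h⟩ := DensBd.of_lt (K := K) hγ' hK₀ hT.le hy0
    (by linarith [show 0 < 1 / p by positivity]) hpγ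
  have hc' : c ^ (1 / p) ≠ ⊤ := ENNReal.rpow_ne_top_of_nonneg (by positivity) hc
  refine ⟨(c ^ (1 / p)).toReal, fun m₀ m A ⟨hd, hs, hE⟩ => ?_⟩
  obtain ⟨u, e, W, hA⟩ := hs.exists_FPAll hd hT hγ' hE
  have h1 := h m₀ m A u e W hA
  rw [sub_sub_cancel, one_div_one_div, setLIntegral_strip_eq_QQ fun q hq => by
    rw [hA.rep.tu.supp q hq, enorm_zero, ENNReal.zero_rpow_of_pos hp0]] at h1
  refine integrable_rpow_of_eLpNorm_le (f := fun q : XT N => m q.1 q.2) hp0 hs.int_m.1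
    (fun q => hs.nonneg _ _) hc' ?_
  rw [← eLpNorm_congr_ae hA.rep.u_eq, eLpNorm_ofReal_eq hp0]
  exact ENNReal.rpow_le_rpow h1 (by positivity)

lemma exists_flux_bound (N : ℕ) (hT : 0 < T) (hγ' : 1 < γ') (hK₀ : 0 ≤ K₀) (K : ℝ)
    (hr : 1 < r) (hrγ : r < γ') (hrN : 1 - 1 / r < (γ' - 1) / (N + 2)) :
    ∃ c : ENNReal, c ≠ ⊤ ∧ ∀ m₀ m A u e W, FPAll N T γ' K K₀ m₀ m A u e W → ∀ i,
      eLpNorm (FPflux T m₀ W i) (ENNReal.ofReal r) (volume.restrict (strip N)) ≤ c := by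
  have hr0 : 0 < r := by linarith
  have hγ0 : 0 < γ' := by linarith
  have hs0 : 0 < 1 - 1 / γ' := by rw [sub_pos, div_lt_one hγ0]; exact hγ'
  set x := (1 - 1 / r) / (1 - 1 / γ') with hx
  have hx0 : 0 ≤ x := div_nonneg (by rw [sub_nonneg, div_le_one hr0]; exact hr.le) hs0.le
  have hx1 : x < 1 := by
    rw [hx, div_lt_one hs0]
    linarith [one_div_lt_one_div_of_lt hr0 hrγ]
  have hxN : x < γ' / (N + 2) := by
    rw [hx, div_lt_iff₀ hs0]
    refine hrN.trans_eq ?_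
    field_simp
  obtain ⟨c, hc, h⟩ := (DensBd.of_lt (K := K) hγ' hK₀ hT.le hx0 hx1 hxN).flux hγ' hx0 hx1 hK₀
  refine ⟨c ^ (1 / r), ENNReal.rpow_ne_top_of_nonneg (by positivity) hc,
    fun m₀ m A u e W hA i => ?_⟩
  have h1 := h m₀ m A u e W hA i
  rw [hx, mul_div_cancel₀ _ hs0.ne', sub_sub_cancel, one_div_one_div] at h1
  rw [eLpNorm_ofReal_eq hr0]
  exact ENNReal.rpow_le_rpow h1 (by positivity)

lemma integrableOn_mul_continuous_QQ {f k : XT N → ℝ} (hf : IntegrableOn f (QQ N T))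
    (hk : Continuous k) : IntegrableOn (fun q => f q * k q) (QQ N T) := by
  obtain ⟨B, hB⟩ := exists_abs_le_QQ hk T
  exact hf.mul_bdd (c := B) hk.aestronglyMeasurable
    ((ae_restrict_mem measurableSet_QQ).mono fun q hq => hB q hq)

lemma memLp_continuous_QQ {k : XT N → ℝ} (hk : Continuous k) (p : ENNReal) :
    MemLp k p (volume.restrict (QQ N T)) := by
  obtain ⟨B, hB⟩ := exists_abs_le_QQ hk T
  exact MemLp.of_bound hk.aestronglyMeasurable B
    ((ae_restrict_mem measurableSet_QQ).mono fun q hq => hB q hq)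

lemma contDiff_fderiv_apply {φ : XT N → ℝ} (hφ : ContDiff ℝ (⊤ : ℕ∞) φ) (v : XT N) :
    ContDiff ℝ (⊤ : ℕ∞) fun q => fderiv ℝ φ q v :=
  (hφ.fderiv_right (m := (⊤ : ℕ∞)) (by norm_cast)).clm_apply contDiff_const

lemma PerQ.fderiv_apply {φ : XT N → ℝ} (hp : PerQ φ) (v : XT N) :
    PerQ fun q => fderiv ℝ φ q v := fun q z => by
  have : (fun x => φ (x + latHom N z)) = φ := funext fun x => hp x z
  simp only
  rw [← fderiv_comp_add_right, this]

lemma euclNorm_nonneg (p : RN N) : 0 ≤ euclNorm p := Real.sqrt_nonneg _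

lemma euclNorm_le_sum (p : RN N) : euclNorm p ≤ ∑ i, |p i| := by
  rw [euclNorm]
  refine Real.sqrt_le_iff.2 ⟨Finset.sum_nonneg fun i _ => abs_nonneg _, ?_⟩
  simp only [← sq_abs (p _)]
  exact Finset.sum_sq_le_sq_sum_of_nonneg fun i _ => abs_nonneg _

lemma continuous_euclNorm : Continuous (euclNorm : RN N → ℝ) := by
  unfold euclNorm; fun_prop

lemma hasWeakGradQ_of_components {m : RN N → ℝ → ℝ} {u : XT N → ℝ} {G : Fin N → XT N → ℝ}
    (hu : IntegrableOn u (QQ N T)) (hG : ∀ j, IntegrableOn (G j) (QQ N T))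
    (hum : u =ᵐ[volume.restrict (QQ N T)] fun q => m q.1 q.2)
    (h : ∀ j Φ, ContDiff ℝ (⊤ : ℕ∞) Φ → PerQ Φ →
      ∫ q in QQ N T, u q * fderiv ℝ Φ q (ei j) = -∫ q in QQ N T, G j q * Φ q) :
    HasWeakGradQ N T m fun x t j => G j (x, t) := by
  intro Φ hΦ hp
  have hΦj : ∀ j, ContDiff ℝ (⊤ : ℕ∞) fun q : XT N => Φ q.1 q.2 j := fun j => contDiff_pi.1 hΦ j
  have hpj : ∀ j, PerQ fun q : XT N => Φ q.1 q.2 j := fun j => perQ_iff.2 fun t x z => by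
    simpa using congrFun (hp t x z) j
  have e1 : intQ N T (fun x t => m x t * dive (fun y => Φ y t) x) =
      ∫ q in QQ N T, ∑ j, u q * fderiv ℝ (fun q : XT N => Φ q.1 q.2 j) q (ei j) := by
    rw [intQ]
    refine integral_congr_ae ?_
    filter_upwards [hum] with q hq
    rw [← Finset.mul_sum, hq, dive]
    congr 1
    exact Finset.sum_congr rfl fun j _ => pd_slice ((hΦj j).differentiable (by simp)) q.1 q.2 j
  rw [e1, integral_finsetSum _ fun j _ => integrableOn_mul_continuous_QQ hu
      (contDiff_fderiv_apply (hΦj j) _).continuous, intQ]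
  simp only [dotp]
  rw [integral_finsetSum _ fun j _ => integrableOn_mul_continuous_QQ (hG j) (hΦj j).continuous,
    ← Finset.sum_neg_distrib]
  exact Finset.sum_congr rfl fun j _ => h j _ (hΦj j) (hpj j)

lemma FPRep.integral_time_deriv {m₀ : RN N → ℝ} {m : RN N → ℝ → ℝ} {A : RN N → ℝ → RN N}
    {u e : XT N → ℝ} {W : Fin N → XT N → ℝ} (hR : FPRep N T γ' m₀ m A u e W)
    {G : Fin N → XT N → ℝ} (hG : ∀ j, IntegrableOn (G j) (QQ N T))
    (h : ∀ j Φ, ContDiff ℝ (⊤ : ℕ∞) Φ → PerQ Φ →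
      ∫ q in QQ N T, u q * fderiv ℝ Φ q (ei j) = -∫ q in QQ N T, G j q * Φ q)
    {φ : XT N → ℝ} (hφ : ContDiff ℝ (⊤ : ℕ∞) φ) (hp : PerQ φ) (h0 : ∀ x, φ (x, 0) = 0)
    (h1 : ∀ x, φ (x, T) = 0) :
    ∫ q in QQ N T, u q * fderiv ℝ φ q (et N) =
      ∑ j, ∫ q in QQ N T, (G j q - W j q) * fderiv ℝ φ q (ei j) := by
  have hu : IntegrableOn u (QQ N T) := (integrableOn_strip_iff_QQ hR.tu.supp).1 hR.int_u
  have hW : ∀ j, IntegrableOn (W j) (QQ N T) := fun j =>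
    (integrableOn_strip_iff_QQ (hR.tW j).supp).1 (hR.int_W j)
  have c1 : ∀ v, Continuous fun q => fderiv ℝ φ q v := fun v =>
    (contDiff_fderiv_apply hφ v).continuous
  have c2 : ∀ j, Continuous fun q => fderiv ℝ (fun x => fderiv ℝ φ x (ei j)) q (ei j) := fun j =>
    (contDiff_fderiv_apply (contDiff_fderiv_apply hφ _) _).continuous
  have h2 := hR.weak φ hφ hp h1
  simp only [h0, mul_zero, integral_zero, add_zero] at h2
  have it := integrableOn_mul_continuous_QQ hu (c1 (et N))
  have il : ∀ j, IntegrableOn (fun q => u q * fderiv ℝ (fun x => fderiv ℝ φ x (ei j)) q (ei j))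
      (QQ N T) := fun j => integrableOn_mul_continuous_QQ hu (c2 j)
  have iW : ∀ j, IntegrableOn (fun q => W j q * fderiv ℝ φ q (ei j)) (QQ N T) := fun j =>
    integrableOn_mul_continuous_QQ (hW j) (c1 _)
  have iG : ∀ j, IntegrableOn (fun q => G j q * fderiv ℝ φ q (ei j)) (QQ N T) := fun j =>
    integrableOn_mul_continuous_QQ (hG j) (c1 _)
  have e1 : ∫ q in QQ N T, (u q * (fderiv ℝ φ q (et N) + lapD φ q) +
      ∑ i, W i q * fderiv ℝ φ q (ei i)) = (∫ q in QQ N T, u q * fderiv ℝ φ q (et N)) +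
      (∑ j, ∫ q in QQ N T, u q * fderiv ℝ (fun x => fderiv ℝ φ x (ei j)) q (ei j)) +
      ∑ j, ∫ q in QQ N T, W j q * fderiv ℝ φ q (ei j) := by
    have is : IntegrableOn (fun q => u q * fderiv ℝ φ q (et N) +
        ∑ j, u q * fderiv ℝ (fun x => fderiv ℝ φ x (ei j)) q (ei j)) (QQ N T) :=
      it.add (integrable_finsetSum _ fun j _ => il j)
    rw [← integral_finsetSum _ fun j _ => il j, ← integral_finsetSum _ fun j _ => iW j,
      ← integral_add it (integrable_finsetSum _ fun j _ => il j),
      ← integral_add is (integrable_finsetSum _ fun j _ => iW j)]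
    refine integral_congr_ae (Eventually.of_forall fun q => ?_)
    simp only [lapD, mul_add, Finset.mul_sum]
  rw [e1] at h2
  simp only [h _ _ (contDiff_fderiv_apply hφ _) (hp.fderiv_apply _)] at h2
  simp only [sub_mul]
  simp only [integral_sub (iG _) (iW _), Finset.sum_sub_distrib]
  rw [Finset.sum_neg_distrib] at h2
  linarith

lemma abs_integral_mul_le_of_eLpNorm_le (hr : 1 < r) {H k : XT N → ℝ} {C : ENNReal} (hC : C ≠ ⊤)
    (hHm : AEStronglyMeasurable H (volume.restrict (QQ N T)))
    (hH : eLpNorm H (ENNReal.ofReal r) (volume.restrict (QQ N T)) ≤ C) {V : XT N → RN N}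
    (hV : Continuous V) (hk : Continuous k) (hkV : ∀ q, |k q| ≤ euclNorm (V q)) :
    |∫ q in QQ N T, H q * k q| ≤
      C.toReal * (∫ q in QQ N T, euclNorm (V q) ^ (r / (r - 1))) ^ ((r - 1) / r) := by
  have hr0 : 0 < r := by linarith
  have hpq : r.HolderConjugate (r / (r - 1)) := Real.HolderConjugate.conjExponent hr
  have cV : Continuous fun q => euclNorm (V q) := continuous_euclNorm.comp hV
  have hm : MemLp H (ENNReal.ofReal r) (volume.restrict (QQ N T)) := ⟨hHm, hH.trans_lt hC.lt_top⟩
  have iH : IntegrableOn H (QQ N T) := memLp_one_iff_integrable.1 (hm.mono_exponent (by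
    rw [ENNReal.one_le_ofReal]; exact hr.le))
  have h1 := integral_mul_norm_le_Lp_mul_Lq hpq hm
    (memLp_continuous_QQ (T := T) cV (ENNReal.ofReal (r / (r - 1))))
  have h2 := (integrable_rpow_of_eLpNorm_le (f := fun q => ‖H q‖) hr0 hHm.norm
    (fun q => norm_nonneg _) hC (by rwa [eLpNorm_norm])).2
  simp only [Real.norm_of_nonneg (euclNorm_nonneg _), one_div_div] at h1
  calc |∫ q in QQ N T, H q * k q| ≤ ∫ q in QQ N T, ‖H q‖ * euclNorm (V q) := by
        refine (norm_integral_le_integral_norm _).trans (integral_mono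
          (integrableOn_mul_continuous_QQ iH hk).norm
          (integrableOn_mul_continuous_QQ iH.norm cV) fun q => ?_)
        simp only [norm_mul]
        exact mul_le_mul_of_nonneg_left (hkV q) (norm_nonneg _)
    _ ≤ _ := h1.trans (mul_le_mul_of_nonneg_right h2 (Real.rpow_nonneg
        (integral_nonneg fun q => Real.rpow_nonneg (euclNorm_nonneg _) _) _))

end

section

variable {T r γ' K₀ : ℝ}

lemma exists_grad_bound (N : ℕ) (hT : 0 < T) (hγ' : 1 < γ') (hK₀ : 0 ≤ K₀) (K : ℝ)
    (hr : 1 < r) (hrγ : r < γ') (hrN : 1 - 1 / r < (γ' - 1) / (N + 2)) :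
    ∃ C : ENNReal, C ≠ ⊤ ∧ ∀ m₀ m A, FPBdd N T γ' K K₀ m₀ m A →
      ∃ (u e : XT N → ℝ) (W G : Fin N → XT N → ℝ), FPRep N T γ' m₀ m A u e W ∧
        (∀ j, MemLp (G j) (ENNReal.ofReal r) (volume.restrict (QQ N T))) ∧
        (∀ j, eLpNorm (G j) (ENNReal.ofReal r) (volume.restrict (QQ N T)) ≤ C) ∧
        (∀ j, eLpNorm (G j - W j) (ENNReal.ofReal r) (volume.restrict (QQ N T)) ≤ C) ∧
        ∀ j Φ, ContDiff ℝ (⊤ : ℕ∞) Φ → PerQ Φ →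
          ∫ q in QQ N T, u q * fderiv ℝ Φ q (ei j) = -∫ q in QQ N T, G j q * Φ q := by
  have hp1 : 1 ≤ ENNReal.ofReal r := by rw [ENNReal.one_le_ofReal]; exact hr.le
  obtain ⟨c, hc, hflux⟩ := exists_flux_bound N hT hγ' hK₀ K hr hrγ hrN
  obtain ⟨C, hC, hgrad⟩ := FPRep.exists_grad N hT hr hK₀ γ' hc
  set p := ENNReal.ofReal r with hp
  set μ : Measure (XT N) := volume.restrict (QQ N T) with hμ
  have hle : μ ≤ volume.restrict (strip N) := by
    rw [hμ, restrict_QQ]; exact Measure.restrict_mono inter_subset_left le_rfl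
  refine ⟨C + (c + μ univ ^ p.toReal⁻¹ * ENNReal.ofReal K₀), ?_, fun m₀ m A ⟨hd, hs, hE⟩ => ?_⟩
  · exact ENNReal.add_ne_top.2 ⟨hC, ENNReal.add_ne_top.2 ⟨hc, ENNReal.mul_ne_top
      (ENNReal.rpow_ne_top_of_nonneg (by positivity) (measure_ne_top _ _)) ENNReal.ofReal_ne_top⟩⟩
  obtain ⟨u, e, W, hA⟩ := hs.exists_FPAll hd hT hγ' hE
  obtain ⟨G, hGm, hGC, hGI⟩ := hgrad m₀ m A u e W hd hA.rep (hflux m₀ m A u e W hA)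
  have hu : IntegrableOn u (QQ N T) := (integrableOn_strip_iff_QQ hA.rep.tu.supp).1 hA.rep.int_u
  have hGi : ∀ j, IntegrableOn (G j) (QQ N T) := fun j =>
    memLp_one_iff_integrable.1 ((hGm j).mono_exponent hp1)
  refine ⟨u, e, W, G, hA.rep, hGm, fun j => (hGC j).trans le_self_add, fun j => ?_,
    fun j Φ hΦ hper => integral_mul_dir_of_SPc hu (hGi j) (hGI j) hΦ hper⟩
  refine (eLpNorm_sub_le (hGm j).1 (hA.rep.tW j).meas.aestronglyMeasurable hp1).trans
    (add_le_add (hGC j) ?_)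
  have e1 : W j = FPflux T m₀ W j + cut T (pd j m₀) := by
    ext q; simp [FPflux]
  rw [e1]
  refine (eLpNorm_add_le (hA.rep.TPc_flux hd j).meas.aestronglyMeasurable
    (hd.TPc_cut_pd j).meas.aestronglyMeasurable hp1).trans (add_le_add ?_ ?_)
  · exact (eLpNorm_mono_measure _ hle).trans (hflux m₀ m A u e W hA j)
  · exact eLpNorm_le_of_ae_bound (Eventually.of_forall fun q => hd.abs_cut_pd_le hK₀ j q)

lemma exists_weak_grad_bound (N : ℕ) (hT : 0 < T) (hγ' : 1 < γ') (hK₀ : 0 ≤ K₀) (K : ℝ)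
    (hr : 1 < r) (hrγ : r < γ') (hrN : 1 - 1 / r < (γ' - 1) / (N + 2)) :
    ∃ C : ℝ, ∀ m₀ m A, FPBdd N T γ' K K₀ m₀ m A →
      (∃ g : RN N → ℝ → RN N, HasWeakGradQ N T m g ∧
        IntegrableOn (fun q : RN N × ℝ => euclNorm (g q.1 q.2) ^ r) (QQ N T) ∧
        (intQ N T (fun x t => euclNorm (g x t) ^ r)) ^ (1 / r) ≤ C) ∧
      (∀ φ : RN N → ℝ → ℝ, IsTest N φ → (∀ x, φ x 0 = 0) → (∀ x, φ x T = 0) →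
        |intQ N T (fun x t => m x t * deriv (φ x) t)|
          ≤ C * (intQ N T (fun x t =>
              euclNorm (grad (fun y => φ y t) x) ^ (r / (r - 1)))) ^ ((r - 1) / r)) := by
  have hr0 : 0 < r := by linarith
  have hp1 : 1 ≤ ENNReal.ofReal r := by rw [ENNReal.one_le_ofReal]; exact hr.le
  obtain ⟨C, hC, h⟩ := exists_grad_bound N hT hγ' hK₀ K hr hrγ hrN
  have hNC : (N : ENNReal) * C ≠ ⊤ := ENNReal.mul_ne_top (ENNReal.natCast_ne_top N) hC
  refine ⟨((N : ENNReal) * C).toReal, fun m₀ m A hb => ?_⟩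
  obtain ⟨u, e, W, G, hR, hGm, hGC, hGW, hI⟩ := h m₀ m A hb
  have hu : IntegrableOn u (QQ N T) := (integrableOn_strip_iff_QQ hR.tu.supp).1 hR.int_u
  have hGi : ∀ j, IntegrableOn (G j) (QQ N T) := fun j =>
    memLp_one_iff_integrable.1 ((hGm j).mono_exponent hp1)
  refine ⟨⟨fun x t j => G j (x, t), hasWeakGradQ_of_components hu hGi hR.u_eq hI, ?_⟩,
    fun φ hφ h0 h1 => ?_⟩
  · have hGe : AEStronglyMeasurable (fun q j => G j q : XT N → RN N) (volume.restrict (QQ N T)) :=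
      (aemeasurable_pi_lambda _ fun j => (hGm j).1.aemeasurable).aestronglyMeasurable
    refine integrable_rpow_of_eLpNorm_le (f := fun q : XT N => euclNorm fun j => G j q) hr0
      (continuous_euclNorm.comp_aestronglyMeasurable hGe) (fun q => euclNorm_nonneg _) hNC ?_
    calc eLpNorm (fun q : XT N => euclNorm fun j => G j q) (ENNReal.ofReal r)
          (volume.restrict (QQ N T))
        ≤ eLpNorm (∑ j, fun q => ‖G j q‖) (ENNReal.ofReal r) (volume.restrict (QQ N T)) := by
          refine eLpNorm_mono_real fun q => ?_
          rw [Real.norm_of_nonneg (euclNorm_nonneg _), Finset.sum_apply]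
          exact euclNorm_le_sum _
      _ ≤ ∑ j, eLpNorm (fun q => ‖G j q‖) (ENNReal.ofReal r) (volume.restrict (QQ N T)) :=
          eLpNorm_sum_le (fun j _ => (hGm j).1.norm) hp1
      _ ≤ ∑ _j : Fin N, C := Finset.sum_le_sum fun j _ => by rw [eLpNorm_norm]; exact hGC j
      _ = N * C := by simp
  · set φ' : XT N → ℝ := fun q => φ q.1 q.2 with hφ'
    have hs : ContDiff ℝ (⊤ : ℕ∞) φ' := hφ.1
    have hd : Differentiable ℝ φ' := hs.differentiable (by simp)
    have hgr : ∀ q : XT N, grad (fun y => φ y q.2) q.1 = fun j => fderiv ℝ φ' q (ei j) := fun q =>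
      funext fun j => pd_slice hd q.1 q.2 j
    have e1 : intQ N T (fun x t => m x t * deriv (φ x) t) =
        ∫ q in QQ N T, u q * fderiv ℝ φ' q (et N) := by
      rw [intQ]
      refine integral_congr_ae ?_
      filter_upwards [hR.u_eq] with q hq
      rw [hq, ← (hasDerivAt_time_slice hd q.1 q.2).deriv]
    rw [e1, hR.integral_time_deriv hGi hI hs (perQ_iff.2 hφ.2) h0 h1, intQ]
    simp only [hgr]
    have cV : Continuous fun q => (fun j => fderiv ℝ φ' q (ei j) : RN N) :=
      continuous_pi fun j => (contDiff_fderiv_apply hs _).continuous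
    refine (Finset.abs_sum_le_sum_abs _ _).trans ((Finset.sum_le_sum fun j _ =>
      abs_integral_mul_le_of_eLpNorm_le hr hC
        ((hGm j).1.sub (hR.tW j).meas.aestronglyMeasurable) (hGW j) cV
        (contDiff_fderiv_apply hs _).continuous
        fun q => abs_le_euclNorm (fun j => fderiv ℝ φ' q (ei j)) j).trans_eq ?_)
    simp [mul_assoc]

end

end

/-- **Proposition 2.6**: a priori `H^{r,1}`-type estimates for the Fokker–Planck
equation under the bounds `E ≤ K`, `‖m‖_{p₀} ≤ K`; consequently `m` is bounded in
`L^p(Q)` for every admissible `p`. -/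
theorem fokker_planck_apriori (N : ℕ) (hN : 1 ≤ N) (T : ℝ) (hT : 0 < T) (γ' K K₀ r : ℝ)
    (hγ' : 1 < γ') (hK : 0 < K) (hK₀ : 0 ≤ K₀)
    (hr1 : 1 < r)
    (hr2 : γ' < (N : ℝ) + 2 → r < ((N : ℝ) + 2) / ((N : ℝ) + 3 - γ'))
    (hr3 : (N : ℝ) + 2 ≤ γ' → r < γ') :
    (∃ C > (0:ℝ),
      ∀ (p₀ : ℝ) (m₀ : RN N → ℝ) (m : RN N → ℝ → ℝ) (A : RN N → ℝ → RN N),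
        1 < p₀ → (γ' < (N : ℝ) + 2 → p₀ < ((N : ℝ) + 2) / ((N : ℝ) + 2 - γ')) →
        FPData N K₀ m₀ → FPSol N T γ' m₀ m A →
        intQ N T (fun x t => euclNorm (A x t) ^ γ' * m x t) ≤ K →
        IntegrableOn (fun q : RN N × ℝ => m q.1 q.2 ^ p₀) (QQ N T) →
        (intQ N T (fun x t => m x t ^ p₀)) ^ (1 / p₀) ≤ K →
        (IntegrableOn (fun q : RN N × ℝ => m q.1 q.2 ^ r) (QQ N T) ∧
          (intQ N T (fun x t => m x t ^ r)) ^ (1 / r) ≤ C) ∧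
        (∃ g : RN N → ℝ → RN N, HasWeakGradQ N T m g ∧
          IntegrableOn (fun q : RN N × ℝ => euclNorm (g q.1 q.2) ^ r) (QQ N T) ∧
          (intQ N T (fun x t => euclNorm (g x t) ^ r)) ^ (1 / r) ≤ C) ∧
        (∀ φ : RN N → ℝ → ℝ, IsTest N φ → (∀ x, φ x 0 = 0) → (∀ x, φ x T = 0) →
          |intQ N T (fun x t => m x t * deriv (φ x) t)|
            ≤ C * (intQ N T (fun x t =>
                euclNorm (grad (fun y => φ y t) x) ^ (r / (r - 1)))) ^ ((r - 1) / r))) ∧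
    (∀ p : ℝ, 1 ≤ p → (γ' < (N : ℝ) + 2 → p < ((N : ℝ) + 2) / ((N : ℝ) + 2 - γ')) →
      ∃ C' > (0:ℝ),
        ∀ (p₀ : ℝ) (m₀ : RN N → ℝ) (m : RN N → ℝ → ℝ) (A : RN N → ℝ → RN N),
          1 < p₀ → (γ' < (N : ℝ) + 2 → p₀ < ((N : ℝ) + 2) / ((N : ℝ) + 2 - γ')) →
          FPData N K₀ m₀ → FPSol N T γ' m₀ m A →
          intQ N T (fun x t => euclNorm (A x t) ^ γ' * m x t) ≤ K →
          IntegrableOn (fun q : RN N × ℝ => m q.1 q.2 ^ p₀) (QQ N T) →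
          (intQ N T (fun x t => m x t ^ p₀)) ^ (1 / p₀) ≤ K →
          IntegrableOn (fun q : RN N × ℝ => m q.1 q.2 ^ p) (QQ N T) ∧
          (intQ N T (fun x t => m x t ^ p)) ^ (1 / p) ≤ C') := by
  have hN0 : (0 : ℝ) < N + 2 := by positivity
  have hr0 : 0 < r := by linarith
  have hrr : 1 / r < 1 := by rw [div_lt_one hr0]; exact hr1
  have hri : 0 < 1 / r := by positivity
  have hrγ : r < γ' := by
    rcases lt_or_ge γ' ((N : ℝ) + 2) with h | h
    · refine (hr2 h).trans_le ?_
      rw [div_le_iff₀ (by linarith)]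
      nlinarith
    · exact hr3 h
  have hrN : 1 - 1 / r < (γ' - 1) / (N + 2) := by
    rw [lt_div_iff₀ hN0]
    rcases lt_or_ge γ' ((N : ℝ) + 2) with h | h
    · have h1 := hr2 h
      rw [lt_div_iff₀ (by linarith)] at h1
      have h2 : (N : ℝ) + 3 - γ' < 1 / r * (N + 2) := by
        rw [one_div_mul_eq_div, lt_div_iff₀ hr0]; linarith
      linarith
    · have h1 : 1 / γ' < 1 / r := one_div_lt_one_div_of_lt hr0 hrγ
      have h2 : 1 - 1 / γ' = (γ' - 1) / γ' := by field_simp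
      have h3 : (1 - 1 / r) * (N + 2) ≤ (1 - 1 / r) * γ' :=
        mul_le_mul_of_nonneg_left h (by linarith)
      have h4 : (1 - 1 / r) * γ' < (1 - 1 / γ') * γ' :=
        mul_lt_mul_of_pos_right (by linarith) (by linarith)
      have h5 : (1 - 1 / γ') * γ' = γ' - 1 := by field_simp
      linarith
  constructor
  · obtain ⟨C₁, h₁⟩ := exists_density_bound N hT hγ' hK₀ K hr1.le
      (hrN.trans (div_lt_div_of_pos_right (by linarith) hN0))
    obtain ⟨C₂, h₂⟩ := exists_weak_grad_bound N hT hγ' hK₀ K hr1 hrγ hrN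
    refine ⟨max 1 (max C₁ C₂), lt_max_of_lt_left one_pos,
      fun p₀ m₀ m A _ _ hd hs hE _ _ => ?_⟩
    have hC₁ : C₁ ≤ max 1 (max C₁ C₂) := (le_max_left _ _).trans (le_max_right _ _)
    have hC₂ : C₂ ≤ max 1 (max C₁ C₂) := (le_max_right _ _).trans (le_max_right _ _)
    obtain ⟨i1, b1⟩ := h₁ m₀ m A ⟨hd, hs, hE⟩
    obtain ⟨⟨g, hg, i2, b2⟩, h3⟩ := h₂ m₀ m A ⟨hd, hs, hE⟩
    refine ⟨⟨i1, b1.trans hC₁⟩, ⟨g, hg, i2, b2.trans hC₂⟩, fun φ hφ h0 hT0 =>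
      (h3 φ hφ h0 hT0).trans (mul_le_mul_of_nonneg_right hC₂ (Real.rpow_nonneg
        (integral_nonneg fun q => Real.rpow_nonneg (euclNorm_nonneg _) _) _))⟩
  · intro p hp hpN
    have hp0 : 0 < p := by linarith
    have hpγ : 1 - 1 / p < γ' / (N + 2) := by
      rw [lt_div_iff₀ hN0]
      rcases lt_or_ge γ' ((N : ℝ) + 2) with h | h
      · have h1 := hpN h
        rw [lt_div_iff₀ (by linarith)] at h1
        have h2 : (N : ℝ) + 2 - γ' < 1 / p * (N + 2) := by
          rw [one_div_mul_eq_div, lt_div_iff₀ hp0]; linarith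
        linarith
      · have : 0 < 1 / p * ((N : ℝ) + 2) := by positivity
        linarith
    obtain ⟨C, h⟩ := exists_density_bound N hT hγ' hK₀ K hp hpγ
    exact ⟨max 1 C, lt_max_of_lt_left one_pos, fun p₀ m₀ m A _ _ hd hs hE _ _ =>
      ⟨(h m₀ m A ⟨hd, hs, hE⟩).1, (h m₀ m A ⟨hd, hs, hE⟩).2.trans (le_max_right _ _)⟩⟩
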